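/- Fix R>1 and an integer p ≥ 1. There exists a density one subsequence S'⊆S and a constant C=C(p,R)>0 such that for every λ∈S' and every flat, L²-normalized toral eigenfunction f with eigenvalue λ: ∫_{𝕋²} L(F_x)^p dx ≤ C, where F_x(y) = f(x + Ry/√λ) for y∈[−1/2,1/2]² and L(F_x) = H¹({y∈[−1/2,1/2]²: F_x(y)=0}). -/

import Mathlib

open MeasureTheory Filter Topology Complex
open scoped ENNReal NNReal RealInnerProductSpace

noncomputable section

/-- The Euclidean plane `ℝ²`; the torus `𝕋² = ℝ²/ℤ²` is modeled by `ℤ²`-periodic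
functions on `E2` (toral eigenfunctions are automatically periodic), the fundamental
domain `Tdom`, and Euclidean balls of radius at most `1/2`. -/
abbrev E2 := EuclideanSpace ℝ (Fin 2)

/-- The point `(a, b) ∈ ℝ²`. -/
def pt (a b : ℝ) : E2 := (WithLp.equiv 2 (Fin 2 → ℝ)).symm ![a, b]

/-- `S`: the set of positive integers expressible as a sum of two squares. -/
def sumTwoSq : Set ℕ := {n | 0 < n ∧ ∃ a b : ℤ, (n : ℤ) = a ^ 2 + b ^ 2}

/-- `S' ⊆ S` is a density one subsequence of `S`. -/
def DensityOne (S' : Set ℕ) : Prop :=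
  S' ⊆ sumTwoSq ∧
    Tendsto
      (fun X : ℕ =>
        (Nat.card {n : ℕ | n ∈ S' ∧ n ≤ X} : ℝ) /
          (Nat.card {n : ℕ | n ∈ sumTwoSq ∧ n ≤ X} : ℝ))
      atTop (𝓝 1)

/-- The lattice points `ξ ∈ ℤ²` with `|ξ|² = lam`. -/
def latticePts (lam : ℕ) : Finset (ℤ × ℤ) :=
  ((Finset.Icc (-(lam : ℤ)) lam) ×ˢ (Finset.Icc (-(lam : ℤ)) lam)).filter
    fun ξ => ξ.1 ^ 2 + ξ.2 ^ 2 = (lam : ℤ)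

/-- `f` is a real-valued `L²`-normalized toral eigenfunction with eigenvalue `lam` and
Fourier coefficients `a`: `f(x) = Σ_{|ξ|²=lam} a_ξ e(⟨ξ,x⟩)`, `a_{-ξ} = conj a_ξ`,
`Σ |a_ξ|² = 1`. -/
def IsEigenfunction (lam : ℕ) (a : ℤ × ℤ → ℂ) (f : E2 → ℝ) : Prop :=
  (∀ ξ : ℤ × ℤ, ξ ∉ latticePts lam → a ξ = 0) ∧
    (∀ ξ : ℤ × ℤ, a (-ξ) = starRingEnd ℂ (a ξ)) ∧
    (∑ ξ ∈ latticePts lam, ‖a ξ‖ ^ 2 = 1) ∧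
    ∀ x : E2, (f x : ℂ) =
      ∑ ξ ∈ latticePts lam,
        a ξ * Complex.exp (2 * (Real.pi : ℂ) * Complex.I *
          ((((ξ.1 : ℝ) * x 0 + (ξ.2 : ℝ) * x 1 : ℝ)) : ℂ))

/-- Flatness: `|a_ξ|² ≤ 100 N^{-1+ε}` for every `ε > 0`. -/
def IsFlat (lam : ℕ) (a : ℤ × ℤ → ℂ) : Prop :=
  ∀ ε : ℝ, 0 < ε → ∀ ξ ∈ latticePts lam,
    ‖a ξ‖ ^ 2 ≤ 100 * ((latticePts lam).card : ℝ) ^ (-1 + ε : ℝ)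

/-- A fundamental domain `[0,1]²` for the torus `𝕋²`. -/
def Tdom : Set E2 := {x | x 0 ∈ Set.Icc (0 : ℝ) 1 ∧ x 1 ∈ Set.Icc (0 : ℝ) 1}

/-- The square `[-1/2,1/2]²`. -/
def Qdom : Set E2 := {y | y 0 ∈ Set.Icc (-(1/2) : ℝ) (1/2) ∧ y 1 ∈ Set.Icc (-(1/2) : ℝ) (1/2)}

/-- `L(f, B)`: the `1`-dimensional Hausdorff measure of the nodal set of `f` in `B`. -/
def nodalLen (f : E2 → ℝ) (B : Set E2) : ℝ := (μH[1] ({x : E2 | f x = 0} ∩ B)).toReal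

/-- `L(F_x)` where `F_x(y) = f(x + R y / √lam)` for `y ∈ [-1/2,1/2]²`, as an
extended nonnegative real. -/
def LF (lam : ℕ) (R : ℝ) (f : E2 → ℝ) (x : E2) : ℝ≥0∞ :=
  μH[1] {y : E2 | y ∈ Qdom ∧ f (x + (R / Real.sqrt lam) • y) = 0}

/-- The pseudo-spectral measure `µ_f = Σ_ξ |a_ξ|² δ_{ξ/√lam}` on `S¹ ⊂ ℝ²`. -/
def specMeasure (lam : ℕ) (a : ℤ × ℤ → ℂ) : Measure E2 :=
  ∑ ξ ∈ latticePts lam,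
    (ENNReal.ofReal (‖a ξ‖ ^ 2)) •
      Measure.dirac (pt ((ξ.1 : ℝ) / Real.sqrt lam) ((ξ.2 : ℝ) / Real.sqrt lam))

/-- Weak-star convergence of the pseudo-spectral measures of the sequence `a` to `mu`,
along `λ → ∞`, `λ ∈ S'`. -/
def SpecTendsto (S' : Set ℕ) (a : ℕ → ℤ × ℤ → ℂ) (mu : Measure E2) : Prop :=
  ∀ g : BoundedContinuousFunction E2 ℝ,
    Tendsto (fun lam => ∫ z, g z ∂(specMeasure lam (a lam))) (atTop ⊓ 𝓟 S')
      (𝓝 (∫ z, g z ∂mu))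

/-- The support of `mu` is not contained in a line. -/
def NotOnLine (mu : Measure E2) : Prop :=
  ∀ A B c : ℝ, ¬(A = 0 ∧ B = 0) → mu {x : E2 | A * x 0 + B * x 1 = c} < 1

/-- `µ̂(2) = ∫_{S¹} z² dµ(z)`, identifying `S¹ ⊂ ℂ`. -/
def muhat2 (mu : Measure E2) : ℂ := ∫ x, ((x 0 : ℂ) + (x 1 : ℂ) * Complex.I) ^ 2 ∂mu

/-- The constant `c₁ = (1-µ̂(2)²)/(2^{5/2}π) ∫₀^{2π} (1-µ̂(2)cos 2θ)^{-3/2} dθ`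
(for `µ̂(2)` real). -/
def c1const (mu : Measure E2) : ℝ :=
  ((1 - (muhat2 mu).re ^ 2) / (2 ^ ((5:ℝ)/2) * Real.pi)) *
    ∫ θ in (0:ℝ)..(2 * Real.pi), ((1 - (muhat2 mu).re * Real.cos (2 * θ)) ^ (-(3/2) : ℝ))

/-- A Jensen-type count of zeros of an entire function. -/
theorem two_pow_card_zeros_le (T : Finset ℂ) (r : ℝ) (hr : 0 < r) :
    ∀ (h : ℂ → ℂ) (M : ℝ), Differentiable ℂ h → h 0 ≠ 0 → (∀ w ∈ T, ‖w‖ ≤ r ∧ h w = 0) →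
      (∀ w : ℂ, ‖w‖ = 3 * r → ‖h w‖ ≤ M) → 2 ^ T.card * ‖h 0‖ ≤ M := by
  classical
  induction T using Finset.induction_on with
  | empty =>
    intro h M hd h0 _ hM
    have := Complex.norm_le_of_forall_mem_frontier_norm_le (f := h) (U := Metric.ball 0 (3 * r))
      (C := M) Metric.isBounded_ball hd.diffContOnCl
      (by
        intro z hz
        rw [frontier_ball _ (by positivity)] at hz
        exact hM z (by simpa using hz)) (z := 0)
      (subset_closure (by simp; positivity))
    simpa using this
  | insert a T ha ih =>
    intro h M hd h0 hT hM
    have haz := hT a (Finset.mem_insert_self a T)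
    have ha0 : a ≠ 0 := by rintro rfl; exact h0 haz.2
    have hpos : 0 < ‖a‖ := norm_pos_iff.mpr ha0
    have key : ∀ w, h w = (w - a) * dslope h a w := by
      intro w
      have := sub_smul_dslope h a w
      rw [haz.2, sub_zero, smul_eq_mul] at this
      exact this.symm
    have hgd : Differentiable ℂ (dslope h a) := by
      rw [← differentiableOn_univ]
      exact (Complex.differentiableOn_dslope (by simp)).2 hd.differentiableOn
    have hg0 : dslope h a 0 ≠ 0 := by
      intro hz; apply h0; rw [key 0, hz, mul_zero]
    have := ih (dslope h a) (M / (2 * r)) hgd hg0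
      (by
        intro w hw
        have h1 := hT w (Finset.mem_insert_of_mem hw)
        refine ⟨h1.1, ?_⟩
        have h2 := key w
        rw [h1.2] at h2
        rcases mul_eq_zero.mp h2.symm with h3 | h3
        · exact absurd (sub_eq_zero.mp h3 ▸ hw) ha
        · exact h3)
      (by
        intro w hw
        have h1 := hM w hw
        rw [key w, norm_mul] at h1
        have h2 : 2 * r ≤ ‖w - a‖ := by
          have := norm_sub_norm_le w a
          linarith [haz.1]
        rw [le_div_iff₀ (by positivity)]
        nlinarith [norm_nonneg (dslope h a w)])
    rw [le_div_iff₀ (by positivity)] at this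
    rw [Finset.card_insert_of_notMem ha, key 0, norm_mul, zero_sub, norm_neg]
    calc 2 ^ (T.card + 1) * (‖a‖ * ‖dslope h a 0‖)
        ≤ 2 ^ (T.card + 1) * (r * ‖dslope h a 0‖) := by gcongr; exact haz.1
      _ = 2 ^ T.card * ‖dslope h a 0‖ * (2 * r) := by ring
      _ ≤ M := this

theorem hausdorffMeasure_le_of_antilipschitzOn (P : Set E2) (φ : E2 → ℝ) (K : ℝ≥0)
    (h : ∀ y ∈ P, ∀ z ∈ P, dist y z ≤ K * |φ y - φ z|) :
    μH[1] P ≤ K * volume (φ '' P) := by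
  have hinj : Set.InjOn φ P := by
    intro y hy z hz hyz
    have := h y hy z hz
    rw [hyz, sub_self, abs_zero, mul_zero] at this
    exact dist_le_zero.mp this
  set g := Function.invFunOn φ P with hg
  have hleft : Set.LeftInvOn g φ P := hinj.leftInvOn_invFunOn
  have hL : LipschitzOnWith K g (φ '' P) := by
    apply LipschitzOnWith.of_dist_le_mul
    rintro _ ⟨y, hy, rfl⟩ _ ⟨z, hz, rfl⟩
    rw [hleft hy, hleft hz, Real.dist_eq]
    exact h y hy z hz
  have := hL.hausdorffMeasure_image_le (d := 1) zero_le_one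
  rw [hleft.image_image, hausdorffMeasure_real] at this
  simpa using this

theorem tsum_hausdorffMeasure_le (φ : E2 → ℝ) (K : ℝ≥0) (P : ℕ → Set E2) (Z : Set E2) (n : ℕ)
    (hm : ∀ k, MeasurableSet (P k)) (hd : Pairwise (Function.onFun Disjoint P))
    (hPZ : ∀ k, P k ⊆ Z) (hφ : ContinuousOn φ Z) (hφI : ∀ y ∈ Z, φ y ∈ Set.Icc (-1 : ℝ) 1)
    (h : ∀ k, ∀ y ∈ P k, ∀ z ∈ P k, dist y z ≤ K * |φ y - φ z|)
    (hn : ∀ s : ℝ, ∀ T : Finset E2, (∀ y ∈ T, y ∈ Z ∧ φ y = s) → T.card ≤ n) :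
    ∑' k, μH[1] (P k) ≤ K * (2 * n) := by
  classical
  have hinj : ∀ k, Set.InjOn φ (P k) := by
    intro k y hy z hz hyz
    have := h k y hy z hz
    rw [hyz, sub_self, abs_zero, mul_zero] at this
    exact dist_le_zero.mp this
  have hmeas : ∀ k, MeasurableSet (φ '' P k) := fun k =>
    (hm k).image_of_continuousOn_injOn (hφ.mono (hPZ k)) (hinj k)
  calc ∑' k, μH[1] (P k) ≤ ∑' k, K * volume (φ '' P k) :=
        ENNReal.tsum_le_tsum fun k => hausdorffMeasure_le_of_antilipschitzOn _ _ _ (h k)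
    _ = K * ∑' k, volume (φ '' P k) := ENNReal.tsum_mul_left
    _ = K * ∑' k, ∫⁻ s, (φ '' P k).indicator 1 s := by
        congr 2; ext k; rw [lintegral_indicator_one (hmeas k)]
    _ = K * ∫⁻ s, ∑' k, (φ '' P k).indicator 1 s := by
        rw [lintegral_tsum]
        intro k
        exact (measurable_one.indicator (hmeas k)).aemeasurable
    _ ≤ K * ∫⁻ s, (Set.Icc (-1 : ℝ) 1).indicator (fun _ => (n : ℝ≥0∞)) s := by
        gcongr with s
        by_cases hs : s ∈ Set.Icc (-1 : ℝ) 1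
        · rw [Set.indicator_of_mem hs]
          rw [ENNReal.tsum_eq_iSup_sum]
          apply iSup_le
          intro F
          set F' := F.filter (fun k => s ∈ φ '' P k) with hF'
          have e1 : ∑ k ∈ F, (φ '' P k).indicator (1 : ℝ → ℝ≥0∞) s = (F'.card : ℝ≥0∞) := by
            simp only [Set.indicator_apply, Pi.one_apply, hF']
            rw [Finset.sum_boole]
          rw [e1]
          have hex : ∀ k ∈ F', ∃ y ∈ P k, φ y = s := by
            intro k hk
            exact (Finset.mem_filter.mp hk).2
          choose! y hy hys using hex
          have hyinj : Set.InjOn y F' := by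
            intro k hk l hl hkl
            by_contra hne
            exact Set.disjoint_left.mp (hd hne) (hy k hk) (hkl ▸ hy l hl)
          have := hn s (F'.image y) (by
            intro z hz
            obtain ⟨k, hk, rfl⟩ := Finset.mem_image.mp hz
            exact ⟨hPZ k (hy k hk), hys k hk⟩)
          rw [Finset.card_image_of_injOn hyinj] at this
          exact_mod_cast this
        · rw [Set.indicator_of_notMem hs]
          simp only [nonpos_iff_eq_zero, ENNReal.tsum_eq_zero]
          intro k
          rw [Set.indicator_of_notMem]
          rintro ⟨y, hy, rfl⟩
          exact hs (hφI y (hPZ k hy))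
    _ = K * (2 * n) := by
        rw [lintegral_indicator_const measurableSet_Icc, Real.volume_Icc]
        norm_num
        ring_nf

section

/-- The exponential sum `∑ c_i exp(i(α_i z + β_i w))` as a function of two complex variables. -/
def expSum {ι : Type*} (s : Finset ι) (α β : ι → ℝ) (c : ι → ℂ) (z w : ℂ) : ℂ :=
  ∑ i ∈ s, c i * Complex.exp (I * (α i * z + β i * w))

variable {ι : Type*} (s : Finset ι) (α β : ι → ℝ)

theorem expSum_strict (c : ι → ℂ) (y : E2) (ε : ℝ) (hε : 0 < ε) :
    ∃ U : Set E2, IsOpen U ∧ y ∈ U ∧ ∀ z ∈ U, ∀ z' ∈ U,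
      |(expSum s α β c (z 0) (z 1)).re - (expSum s α β c (z' 0) (z' 1)).re
        - ((expSum s α β (fun i => c i * (I * α i)) (y 0) (y 1)).re * (z 0 - z' 0)
          + (expSum s α β (fun i => c i * (I * β i)) (y 0) (y 1)).re * (z 1 - z' 1))|
      ≤ ε * ‖z - z'‖ := by
  let ℓ : ι → E2 →L[ℝ] ℂ := fun i =>
    Complex.ofRealCLM ∘L (α i • EuclideanSpace.proj 0 + β i • EuclideanSpace.proj 1)
  have hℓ : ∀ i x, ℓ i x = ((α i * x 0 + β i * x 1 : ℝ) : ℂ) := by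
    intro i x; simp [ℓ]
  have h1 : ∀ i, HasStrictFDerivAt (fun x : E2 => c i * Complex.exp (I * ℓ i x))
      (c i • Complex.exp (I * ℓ i y) • I • ℓ i) y := by
    intro i
    have := (((ℓ i).hasStrictFDerivAt (x := y)).const_mul I).cexp.const_mul (c i)
    exact this
  have h2 : HasStrictFDerivAt (fun x : E2 => ∑ i ∈ s, c i * Complex.exp (I * ℓ i x))
      (∑ i ∈ s, c i • Complex.exp (I * ℓ i y) • I • ℓ i) y :=
    HasStrictFDerivAt.fun_sum fun i _ => h1 i
  have h3 := (Complex.reCLM.hasStrictFDerivAt).comp y h2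
  have h4 := h3.isLittleO.def hε
  rw [nhds_prod_eq] at h4
  obtain ⟨t, ht, ht'⟩ := Filter.eventually_prod_self_iff'.mp h4
  obtain ⟨U, hUt, hU, hyU⟩ := mem_nhds_iff.mp ht
  refine ⟨U, hU, hyU, fun z hz z' hz' => ?_⟩
  have := ht' z (hUt hz) z' (hUt hz')
  have e1 : ∀ x : E2, expSum s α β c (x 0) (x 1) = ∑ i ∈ s, c i * Complex.exp (I * ℓ i x) := by
    intro x
    simp only [expSum, hℓ]
    push_cast
    rfl
  rw [e1, e1]
  refine le_trans (le_of_eq ?_) this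
  rw [Real.norm_eq_abs]
  congr 1
  simp only [Complex.reCLM_apply, ContinuousLinearMap.comp_apply,
    _root_.sum_apply, _root_.smul_apply]
  congr 1
  rw [expSum, expSum]
  have e2 : ∀ (u : ℂ) (a : ℝ), u.re * a = (u * a).re := by intro u a; simp
  rw [e2, e2, ← Complex.add_re, Finset.sum_mul, Finset.sum_mul, ← Finset.sum_add_distrib]
  congr 1
  refine Finset.sum_congr rfl fun i _ => ?_
  rw [hℓ, hℓ]
  simp only [smul_eq_mul]
  push_cast [PiLp.sub_apply]
  ring

theorem abs_slope_sub_ge {q u v : E2} (hq : dist q (pt 4 0) ≤ 1) (hu : u ∈ Qdom) (hv : v ∈ Qdom)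
    (h : |u 0 - v 0| ≤ 11 / 9 * |u 1 - v 1|) :
    ‖u - v‖ ≤ 120 * |(u 1 - q 1) / (u 0 - q 0) - (v 1 - q 1) / (v 0 - q 0)| := by
  have hq' : ‖q - pt 4 0‖ ≤ 1 := by rwa [← dist_eq_norm]
  have hc0 : |q 0 - 4| ≤ 1 := by
    have := (PiLp.norm_apply_le (q - pt 4 0) 0).trans hq'
    simpa [pt] using this
  have hc1 : |q 1| ≤ 1 := by
    have := (PiLp.norm_apply_le (q - pt 4 0) 1).trans hq'
    simpa [pt] using this
  rw [abs_le] at hc0 hc1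
  obtain ⟨⟨hu0, hu0'⟩, ⟨hu1, hu1'⟩⟩ := hu
  obtain ⟨⟨hv0, hv0'⟩, ⟨hv1, hv1'⟩⟩ := hv
  set d0 := u 0 - v 0 with hd0
  set d1 := u 1 - v 1 with hd1
  have hn : ‖u - v‖ ≤ |d0| + |d1| := by
    rw [EuclideanSpace.norm_eq]
    apply Real.sqrt_le_iff.mpr
    refine ⟨by positivity, ?_⟩
    simp only [Fin.sum_univ_two, PiLp.sub_apply, Real.norm_eq_abs]
    nlinarith [abs_nonneg d0, abs_nonneg d1, mul_nonneg (abs_nonneg d0) (abs_nonneg d1)]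
  have hw : 5 / 2 ≤ q 0 - u 0 := by linarith
  have hw' : 5 / 2 ≤ q 0 - v 0 := by linarith
  have e : (u 1 - q 1) / (u 0 - q 0) - (v 1 - q 1) / (v 0 - q 0)
      = ((v 0 - q 0) * d1 - (v 1 - q 1) * d0) / ((q 0 - u 0) * (q 0 - v 0)) := by
    have h1 : u 0 - q 0 ≠ 0 := by linarith
    have h2 : v 0 - q 0 ≠ 0 := by linarith
    have h3 : q 0 - u 0 ≠ 0 := by linarith
    have h4 : q 0 - v 0 ≠ 0 := by linarith
    rw [div_sub_div _ _ h1 h2, div_eq_div_iff (mul_ne_zero h1 h2) (mul_ne_zero h3 h4)]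
    rw [hd0, hd1]; ring
  rw [e, abs_div, abs_of_pos (by positivity : 0 < (q 0 - u 0) * (q 0 - v 0)), ← mul_div_assoc,
    le_div_iff₀ (by positivity)]
  have h5 : (q 0 - u 0) * (q 0 - v 0) ≤ 31 := by nlinarith
  have h6 : 5 / 2 * |d1| - 3 / 2 * |d0| ≤ |(v 0 - q 0) * d1 - (v 1 - q 1) * d0| := by
    have h7 := abs_sub_abs_le_abs_sub ((v 0 - q 0) * d1) ((v 1 - q 1) * d0)
    rw [abs_mul, abs_mul] at h7
    have h8 : 5 / 2 ≤ |v 0 - q 0| := by rw [abs_sub_comm]; exact le_trans hw' (le_abs_self _)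
    have h9 : |v 1 - q 1| ≤ 3 / 2 := by rw [abs_le]; constructor <;> linarith
    nlinarith [abs_nonneg d0, abs_nonneg d1]
  have h10 : ‖u - v‖ * ((q 0 - u 0) * (q 0 - v 0)) ≤ ‖u - v‖ * 31 := by gcongr
  nlinarith [abs_nonneg d0, abs_nonneg d1, norm_nonneg (u - v)]

/-- Swap of the coordinates. -/
def swp (y : E2) : E2 := pt (y 1) (y 0)

theorem swp_zero (y : E2) : swp y 0 = y 1 := by simp [swp, pt]
theorem swp_one (y : E2) : swp y 1 = y 0 := by simp [swp, pt]

theorem norm_swp_sub (u v : E2) : ‖swp u - swp v‖ = ‖u - v‖ := by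
  rw [EuclideanSpace.norm_eq, EuclideanSpace.norm_eq]
  simp only [Fin.sum_univ_two, PiLp.sub_apply, swp_zero, swp_one]
  rw [add_comm]

theorem local_antilipschitz (c : ι → ℂ) {q p : E2} (hq : dist q (pt 4 0) ≤ 1)
    (hp : dist p (pt 0 4) ≤ 1) (y : E2)
    (hg : (expSum s α β (fun i => c i * (I * α i)) (y 0) (y 1)).re ≠ 0 ∨
      (expSum s α β (fun i => c i * (I * β i)) (y 0) (y 1)).re ≠ 0) :
    ∃ U : Set E2, IsOpen U ∧ y ∈ U ∧
      ((∀ u ∈ U ∩ Qdom, ∀ v ∈ U ∩ Qdom, (expSum s α β c (u 0) (u 1)).re = 0 →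
          (expSum s α β c (v 0) (v 1)).re = 0 →
          dist u v ≤ 120 * |(u 1 - q 1) / (u 0 - q 0) - (v 1 - q 1) / (v 0 - q 0)|) ∨
       (∀ u ∈ U ∩ Qdom, ∀ v ∈ U ∩ Qdom, (expSum s α β c (u 0) (u 1)).re = 0 →
          (expSum s α β c (v 0) (v 1)).re = 0 →
          dist u v ≤ 120 * |(u 0 - p 0) / (u 1 - p 1) - (v 0 - p 0) / (v 1 - p 1)|)) := by
  set g0 := (expSum s α β (fun i => c i * (I * α i)) (y 0) (y 1)).re
  set g1 := (expSum s α β (fun i => c i * (I * β i)) (y 0) (y 1)).re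
  have hn : ∀ u v : E2, ‖u - v‖ ≤ |u 0 - v 0| + |u 1 - v 1| := by
    intro u v
    rw [EuclideanSpace.norm_eq]
    apply Real.sqrt_le_iff.mpr
    refine ⟨by positivity, ?_⟩
    simp only [Fin.sum_univ_two, PiLp.sub_apply, Real.norm_eq_abs]
    nlinarith [mul_nonneg (abs_nonneg (u 0 - v 0)) (abs_nonneg (u 1 - v 1))]
  have aux : ∀ a b x y : ℝ, |b| ≤ |a| → a ≠ 0 → |a * x + b * y| ≤ |a| / 10 * (|x| + |y|) →
      |x| ≤ 11 / 9 * |y| := by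
    intro a b x y hab ha h
    have hpos : 0 < |a| := abs_pos.mpr ha
    have h1 := abs_sub_abs_le_abs_sub (a * x) (-(b * y))
    rw [abs_neg, sub_neg_eq_add, abs_mul, abs_mul] at h1
    have h2 : |b| * |y| ≤ |a| * |y| := by gcongr
    have h3 : |a| * |x| ≤ |a| * (|y| + 1 / 10 * (|x| + |y|)) := by nlinarith
    have := le_of_mul_le_mul_left h3 hpos
    linarith
  rcases le_total |g1| |g0| with hle | hle
  · have h0 : g0 ≠ 0 := by
      rcases hg with h | h
      · exact h
      · intro h'; rw [h', abs_zero] at hle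
        exact h (abs_eq_zero.mp (le_antisymm hle (abs_nonneg _)))
    obtain ⟨U, hU, hy, H⟩ := expSum_strict s α β c y (|g0| / 10) (by positivity)
    refine ⟨U, hU, hy, Or.inl fun u hu v hv hu0 hv0 => ?_⟩
    rw [dist_eq_norm]
    refine abs_slope_sub_ge hq hu.2 hv.2 (aux g0 g1 _ _ hle h0 ?_)
    have := H u hu.1 v hv.1
    rw [hu0, hv0, sub_self, zero_sub, abs_neg] at this
    refine this.trans ?_
    gcongr
    exact hn u v
  · have h0 : g1 ≠ 0 := by
      rcases hg with h | h
      · intro h'; rw [h', abs_zero] at hle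
        exact h (abs_eq_zero.mp (le_antisymm hle (abs_nonneg _)))
      · exact h
    obtain ⟨U, hU, hy, H⟩ := expSum_strict s α β c y (|g1| / 10) (by positivity)
    refine ⟨U, hU, hy, Or.inr fun u hu v hv hu0 hv0 => ?_⟩
    have hp' : dist (swp p) (pt 4 0) ≤ 1 := by
      have : pt 4 0 = swp (pt 0 4) := by simp [swp, pt]
      rw [this, dist_eq_norm, norm_swp_sub, ← dist_eq_norm]; exact hp
    have := abs_slope_sub_ge (q := swp p) (u := swp u) (v := swp v) hp'
      ⟨by rw [swp_zero]; exact hu.2.2, by rw [swp_one]; exact hu.2.1⟩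
      ⟨by rw [swp_zero]; exact hv.2.2, by rw [swp_one]; exact hv.2.1⟩ ?_
    · rw [norm_swp_sub] at this
      simpa only [swp_zero, swp_one, dist_eq_norm] using this
    · simp only [swp_zero, swp_one]
      refine aux g1 g0 _ _ hle h0 ?_
      have := H u hu.1 v hv.1
      rw [hu0, hv0, sub_self, zero_sub, abs_neg, add_comm] at this
      refine this.trans ?_
      gcongr
      rw [add_comm]
      exact hn u v

end

section

variable {ι : Type*} (s : Finset ι) (α β : ι → ℝ)

theorem hasSum_cexp (x : ℂ) : HasSum (fun n : ℕ => x ^ n / (n.factorial : ℂ)) (Complex.exp x) := by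
  rw [Complex.exp_eq_exp_ℂ]
  exact NormedSpace.expSeries_div_hasSum_exp x

theorem summable_norm_cexp (x : ℂ) : Summable (fun n : ℕ => ‖x ^ n / (n.factorial : ℂ)‖) :=
  NormedSpace.norm_expSeries_div_summable x

theorem hasSum_mul_prod (f g : ℕ → ℂ) (u v : ℂ) (h1 : HasSum f u) (h2 : HasSum g v)
    (h3 : Summable fun n => ‖f n‖) (h4 : Summable fun n => ‖g n‖) :
    HasSum (fun ab : ℕ × ℕ => f ab.1 * g ab.2) (u * v) :=
  h1.mul h2 (summable_mul_of_summable_norm h3 h4)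

theorem hasSum_cexp_mul (x y : ℂ) :
    HasSum (fun ab : ℕ × ℕ => x ^ ab.1 / (ab.1.factorial : ℂ) * (y ^ ab.2 / (ab.2.factorial : ℂ)))
      (Complex.exp x * Complex.exp y) :=
  hasSum_mul_prod (fun n => x ^ n / (n.factorial : ℂ)) (fun n => y ^ n / (n.factorial : ℂ)) _ _
    (hasSum_cexp x) (hasSum_cexp y) (summable_norm_cexp x) (summable_norm_cexp y)

theorem hasSum_expSum (c : ι → ℂ) (z w : ℂ) :
    HasSum (fun ab : ℕ × ℕ => z ^ ab.1 / (ab.1.factorial : ℂ) * (w ^ ab.2 / (ab.2.factorial : ℂ)) *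
      ∑ i ∈ s, c i * (I * α i) ^ ab.1 * (I * β i) ^ ab.2) (expSum s α β c z w) := by
  have h1 : ∀ i, HasSum (fun ab : ℕ × ℕ => c i * (((I * α i * z) ^ ab.1 / (ab.1.factorial : ℂ)) *
      ((I * β i * w) ^ ab.2 / (ab.2.factorial : ℂ))))
      (c i * Complex.exp (I * (α i * z + β i * w))) := by
    intro i
    apply HasSum.mul_left
    have e : Complex.exp (I * (α i * z + β i * w))
        = Complex.exp (I * α i * z) * Complex.exp (I * β i * w) := by
      rw [← Complex.exp_add]; ring_nf
    rw [e]
    exact hasSum_cexp_mul (I * α i * z) (I * β i * w)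
  have h2 := hasSum_sum (s := s) fun i _ => h1 i
  refine h2.congr_fun ?_ |> fun h => h
  intro ab
  rw [Finset.mul_sum]
  refine Finset.sum_congr rfl fun i _ => ?_
  rw [mul_pow, mul_pow (I * (β i : ℂ))]
  ring

theorem expSum_add (c : ι → ℂ) (z w z' w' : ℂ) :
    expSum s α β c (z + z') (w + w')
      = expSum s α β (fun i => c i * Complex.exp (I * (α i * z + β i * w))) z' w' := by
  simp only [expSum]
  refine Finset.sum_congr rfl fun i _ => ?_
  rw [mul_assoc, ← Complex.exp_add]; ring_nf

theorem differentiable_expSum_line (c : ι → ℂ) (z w u v : ℂ) :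
    Differentiable ℂ fun t : ℂ => expSum s α β c (z + t * u) (w + t * v) := by
  unfold expSum
  fun_prop

theorem exists_deriv_ne_zero (c : ι → ℂ) (y q : E2)
    (hq : (expSum s α β c (q 0) (q 1)).re ≠ 0) :
    ∃ a b : ℕ, (expSum s α β (fun i => c i * (I * α i) ^ a * (I * β i) ^ b) (y 0) (y 1)).re ≠ 0 := by
  by_contra! hcon
  apply hq
  have h := hasSum_expSum s α β
    (fun i => c i * Complex.exp (I * (α i * (y 0 : ℂ) + β i * (y 1 : ℂ)))) ((q 0 - y 0 : ℝ) : ℂ)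
    ((q 1 - y 1 : ℝ) : ℂ)
  rw [← expSum_add] at h
  have h' := Complex.hasSum_re h
  have e0 : ((y 0 : ℂ) + ((q 0 - y 0 : ℝ) : ℂ)) = q 0 := by push_cast; ring
  have e1 : ((y 1 : ℂ) + ((q 1 - y 1 : ℝ) : ℂ)) = q 1 := by push_cast; ring
  rw [e0, e1] at h'
  refine h'.unique ?_
  convert hasSum_zero with ab
  have e2 : ((q 0 - y 0 : ℝ) : ℂ) ^ ab.1 / (ab.1.factorial : ℂ) *
      (((q 1 - y 1 : ℝ) : ℂ) ^ ab.2 / (ab.2.factorial : ℂ))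
      = (((q 0 - y 0) ^ ab.1 / ab.1.factorial * ((q 1 - y 1) ^ ab.2 / ab.2.factorial) : ℝ) : ℂ) := by
    push_cast; ring
  rw [e2, Complex.re_ofReal_mul]
  have e3 := hcon ab.1 ab.2
  simp only [expSum] at e3
  rw [mul_eq_zero]; right
  rw [← e3]
  congr 1
  refine Finset.sum_congr rfl fun i _ => ?_
  ring

theorem exists_derivs_re_eq_zero (c : ι → ℂ) (y q : E2)
    (hq : (expSum s α β c (q 0) (q 1)).re ≠ 0) (hy : (expSum s α β c (y 0) (y 1)).re = 0) :
    ∃ a b : ℕ, (expSum s α β (fun i => c i * (I * α i) ^ a * (I * β i) ^ b) (y 0) (y 1)).re = 0 ∧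
      ((expSum s α β (fun i => c i * (I * α i) ^ a * (I * β i) ^ b * (I * α i)) (y 0) (y 1)).re ≠ 0 ∨
      (expSum s α β (fun i => c i * (I * α i) ^ a * (I * β i) ^ b * (I * β i)) (y 0) (y 1)).re ≠ 0) := by
  by_contra! hcon
  obtain ⟨a, b, hab⟩ := exists_deriv_ne_zero s α β c y q hq
  apply hab
  have key : ∀ n a b, a + b = n →
      (expSum s α β (fun i => c i * (I * α i) ^ a * (I * β i) ^ b) (y 0) (y 1)).re = 0 := by
    intro n
    induction n with
    | zero =>
      intro a b h
      obtain ⟨rfl, rfl⟩ : a = 0 ∧ b = 0 := by omega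
      simpa using hy
    | succ n ih =>
      intro a b h
      rcases Nat.eq_zero_or_pos a with rfl | ha
      · obtain ⟨b, rfl⟩ : ∃ b', b = b' + 1 := ⟨b - 1, by omega⟩
        have := (hcon 0 b (ih 0 b (by omega))).2
        simp only [pow_succ, ← mul_assoc] at this ⊢
        exact this
      · obtain ⟨a, rfl⟩ : ∃ a', a = a' + 1 := ⟨a - 1, by omega⟩
        have := (hcon a b (ih a b (by omega))).1
        rw [← this]
        congr 2; ext i; ring
  exact key _ a b rfl

theorem continuous_expSum_re (c : ι → ℂ) :
    Continuous fun y : E2 => (expSum s α β c (y 0) (y 1)).re := by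
  unfold expSum
  fun_prop

theorem measurableSet_Qdom : MeasurableSet Qdom := by
  have : Qdom = (fun y : E2 => y 0) ⁻¹' Set.Icc (-(1/2)) (1/2) ∩
      (fun y : E2 => y 1) ⁻¹' Set.Icc (-(1/2)) (1/2) := rfl
  rw [this]
  exact (measurableSet_Icc.preimage (by fun_prop)).inter (measurableSet_Icc.preimage (by fun_prop))

theorem coord_of_dist_le {q : E2} {a b : ℝ} (h : dist q (pt a b) ≤ 1) :
    (a - 1 ≤ q 0 ∧ q 0 ≤ a + 1) ∧ (b - 1 ≤ q 1 ∧ q 1 ≤ b + 1) := by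
  rw [dist_eq_norm] at h
  have hc0 : |q 0 - a| ≤ 1 := by
    have := (PiLp.norm_apply_le (q - pt a b) 0).trans h
    simpa [pt] using this
  have hc1 : |q 1 - b| ≤ 1 := by
    have := (PiLp.norm_apply_le (q - pt a b) 1).trans h
    simpa [pt] using this
  rw [abs_le] at hc0 hc1
  constructor <;> constructor <;> linarith

/-- Zeros on a line through `q`. -/
theorem card_zeros_line_le (c : ι → ℂ) (M : ℝ) (n : ℕ) (q0 q1 u v : ℝ)
    (hq0 : |q0| ≤ 5) (hq1 : |q1| ≤ 5) (hu : |u| ≤ 1) (hv : |v| ≤ 1)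
    (hM : ∀ z w : ℂ, ‖z‖ ≤ 23 → ‖w‖ ≤ 23 → ‖expSum s α β c z w‖ ≤ M)
    (hn : M < 2 ^ (n + 1) * ‖expSum s α β c q0 q1‖) (h0 : expSum s α β c q0 q1 ≠ 0)
    (T : Finset ℝ) (hT : ∀ t ∈ T, |t| ≤ 6 ∧
      expSum s α β c ((q0 : ℂ) + t * u) ((q1 : ℂ) + t * v) = 0) : T.card ≤ n := by
  classical
  have := two_pow_card_zeros_le (T.image (fun t : ℝ => (t : ℂ))) 6 (by norm_num)
    (fun t : ℂ => expSum s α β c ((q0 : ℂ) + t * u) ((q1 : ℂ) + t * v)) M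
    (differentiable_expSum_line s α β c _ _ _ _) (by simpa using h0)
    (by
      intro w hw
      obtain ⟨t, ht, rfl⟩ := Finset.mem_image.mp hw
      refine ⟨?_, (hT t ht).2⟩
      rw [Complex.norm_real]; exact (hT t ht).1)
    (by
      intro w hw
      have aux : ∀ a b : ℝ, |a| ≤ 5 → |b| ≤ 1 → ‖(a : ℂ) + w * b‖ ≤ 23 := by
        intro a b ha hb
        refine (norm_add_le _ _).trans ?_
        rw [norm_mul, Complex.norm_real, Complex.norm_real, Real.norm_eq_abs, Real.norm_eq_abs, hw]
        nlinarith [abs_nonneg b]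
      exact hM _ _ (aux _ _ hq0 hu) (aux _ _ hq1 hv))
  rw [Finset.card_image_of_injective _ Complex.ofReal_injective] at this
  simp only [zero_mul, add_zero] at this
  by_contra hlt
  push Not at hlt
  have h2 : (2 : ℝ) ^ (n + 1) ≤ 2 ^ T.card := pow_le_pow_right₀ (by norm_num) hlt
  have := mul_le_mul_of_nonneg_right h2 (norm_nonneg (expSum s α β c q0 q1))
  linarith

theorem nodal_le (c : ι → ℂ) (M : ℝ) (n m : ℕ) (q p : E2)
    (hq : dist q (pt 4 0) ≤ 1) (hp : dist p (pt 0 4) ≤ 1)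
    (hreal : ∀ y : E2, (expSum s α β c (y 0) (y 1)).im = 0)
    (hM : ∀ z w : ℂ, ‖z‖ ≤ 23 → ‖w‖ ≤ 23 → ‖expSum s α β c z w‖ ≤ M)
    (hq0 : expSum s α β c (q 0) (q 1) ≠ 0) (hp0 : expSum s α β c (p 0) (p 1) ≠ 0)
    (hn : M < 2 ^ (n + 1) * ‖expSum s α β c (q 0) (q 1)‖)
    (hm : M < 2 ^ (m + 1) * ‖expSum s α β c (p 0) (p 1)‖) :
    μH[1] {y : E2 | y ∈ Qdom ∧ (expSum s α β c (y 0) (y 1)).re = 0} ≤ 240 * (n + m) := by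
  classical
  set Z : Set E2 := {y : E2 | y ∈ Qdom ∧ (expSum s α β c (y 0) (y 1)).re = 0} with hZ
  have hqc := coord_of_dist_le hq
  have hpc := coord_of_dist_le hp
  have hZm : MeasurableSet Z :=
    measurableSet_Qdom.inter ((isClosed_singleton.preimage
      (continuous_expSum_re s α β c)).measurableSet)
  let φ : Bool → E2 → ℝ := fun b => if b then fun y => (y 1 - q 1) / (y 0 - q 0)
    else fun y => (y 0 - p 0) / (y 1 - p 1)
  have hq0' : (expSum s α β c (q 0) (q 1)).re ≠ 0 := by
    intro h; exact hq0 (Complex.ext h (hreal q))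
  -- the pieces
  let G : ℕ × ℕ → E2 → ℝ := fun ab y =>
    (expSum s α β (fun i => c i * (I * α i) ^ ab.1 * (I * β i) ^ ab.2) (y 0) (y 1)).re
  let good : Bool → Set E2 → Prop := fun b A => ∀ u ∈ A, ∀ v ∈ A,
    dist u v ≤ ((120 : ℝ≥0) : ℝ) * |φ b u - φ b v|
  let BB := TopologicalSpace.countableBasis E2
  have : Countable BB := (TopologicalSpace.countable_countableBasis E2).to_subtype
  let J := (ℕ × ℕ) × BB
  let A : J → Set E2 := fun j => Z ∩ ({y | G j.1 y = 0} ∩ (j.2 : Set E2))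
  have hAm : ∀ j, MeasurableSet (A j) := by
    intro j
    refine hZm.inter (MeasurableSet.inter ?_ ?_)
    · exact (isClosed_singleton.preimage (continuous_expSum_re s α β _)).measurableSet
    · exact (TopologicalSpace.isOpen_of_mem_countableBasis j.2.2).measurableSet
  let P0 : Bool → J → Set E2 := fun b j => if good b (A j) then A j else ∅
  have hP0m : ∀ b j, MeasurableSet (P0 b j) := by
    intro b j; simp only [P0]; split_ifs
    · exact hAm j
    · exact MeasurableSet.empty
  have hP0g : ∀ b j, good b (P0 b j) := by
    intro b j; simp only [P0]; split_ifs with h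
    · exact h
    · intro u hu; exact absurd hu (Set.notMem_empty u)
  have hP0Z : ∀ b j, P0 b j ⊆ Z := by
    intro b j; simp only [P0]; split_ifs
    · exact Set.inter_subset_left
    · exact Set.empty_subset _
  have hcover : ∀ y ∈ Z, ∃ b j, y ∈ P0 b j := by
    intro y hy
    obtain ⟨a, b, hab, hab'⟩ := exists_derivs_re_eq_zero s α β c y q hq0' hy.2
    obtain ⟨U, hU, hyU, H⟩ := local_antilipschitz s α β
      (fun i => c i * (I * α i) ^ a * (I * β i) ^ b) hq hp y hab'
    obtain ⟨V, hV, hyV, hVU⟩ :=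
      (TopologicalSpace.isBasis_countableBasis E2).exists_subset_of_mem_open hyU hU
    have hyA : y ∈ A ((a, b), ⟨V, hV⟩) := ⟨hy, hab, hyV⟩
    rcases H with H | H
    · refine ⟨true, ((a, b), ⟨V, hV⟩), ?_⟩
      have : good true (A ((a, b), ⟨V, hV⟩)) := by
        intro u hu v hv
        exact H u ⟨hVU hu.2.2, hu.1.1⟩ v ⟨hVU hv.2.2, hv.1.1⟩ hu.2.1 hv.2.1
      simp only [P0, if_pos this]; exact hyA
    · refine ⟨false, ((a, b), ⟨V, hV⟩), ?_⟩
      have : good false (A ((a, b), ⟨V, hV⟩)) := by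
        intro u hu v hv
        exact H u ⟨hVU hu.2.2, hu.1.1⟩ v ⟨hVU hv.2.2, hv.1.1⟩ hu.2.1 hv.2.1
      simp only [P0, if_pos this]; exact hyA
  have : Encodable J := Encodable.ofCountable J
  let P1 : Bool → ℕ → Set E2 := fun b k => match Encodable.decode (α := J) k with
    | some j => P0 b j
    | none => ∅
  have hP1m : ∀ b k, MeasurableSet (P1 b k) := by
    intro b k; simp only [P1]; split
    · exact hP0m _ _
    · exact MeasurableSet.empty
  have hP1g : ∀ b k, good b (P1 b k) := by
    intro b k; simp only [P1]; split
    · exact hP0g _ _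
    · intro u hu; exact absurd hu (Set.notMem_empty u)
  have hP1Z : ∀ b k, P1 b k ⊆ Z := by
    intro b k; simp only [P1]; split
    · exact hP0Z _ _
    · exact Set.empty_subset _
  have hcover1 : Z ⊆ ⋃ b : Bool, ⋃ k, P1 b k := by
    intro y hy
    obtain ⟨b, j, hj⟩ := hcover y hy
    refine Set.mem_iUnion.mpr ⟨b, Set.mem_iUnion.mpr ⟨Encodable.encode j, ?_⟩⟩
    simp only [P1, Encodable.encodek]; exact hj
  have hden : ∀ y ∈ Qdom, 5 / 2 ≤ q 0 - y 0 ∧ q 0 - y 0 ≤ 6 ∧ |y 1 - q 1| ≤ 5 / 2 ∧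
      5 / 2 ≤ p 1 - y 1 ∧ p 1 - y 1 ≤ 6 ∧ |y 0 - p 0| ≤ 5 / 2 := by
    rintro y ⟨⟨h1, h2⟩, h3, h4⟩
    obtain ⟨⟨h5, h6⟩, h7, h8⟩ := hqc
    obtain ⟨⟨h9, h10⟩, h11, h12⟩ := hpc
    refine ⟨by linarith, by linarith, ?_, by linarith, by linarith, ?_⟩ <;>
    rw [abs_le] <;> constructor <;> linarith
  have hslope : ∀ d w : ℝ, |d| ≤ 5 / 2 → 5 / 2 ≤ -w → d / w ∈ Set.Icc (-1 : ℝ) 1 := by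
    intro d w hd hw
    rw [abs_le] at hd
    have hw' : w < 0 := by linarith
    constructor
    · rw [le_div_iff_of_neg hw']; linarith
    · rw [div_le_iff_of_neg hw']; linarith
  have hmain : ∀ b : Bool, ∑' k, μH[1] (disjointed (P1 b) k) ≤
      ((120 : ℝ≥0) : ℝ≥0∞) * (2 * ((if b then n else m : ℕ) : ℝ≥0∞)) := by
    intro b
    apply tsum_hausdorffMeasure_le (φ b) 120 (disjointed (P1 b)) Z
    · intro k; exact MeasurableSet.disjointed (hP1m b) k
    · exact disjoint_disjointed _
    · intro k; exact (disjointed_subset (P1 b) k).trans (hP1Z b k)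
    · cases b
      · simp only [φ]
        refine ContinuousOn.div (by fun_prop) (by fun_prop) ?_
        intro y hy
        have := hden y hy.1
        linarith
      · simp only [φ]
        refine ContinuousOn.div (by fun_prop) (by fun_prop) ?_
        intro y hy
        have := hden y hy.1
        linarith
    · intro y hy
      have h := hden y hy.1
      cases b
      · exact hslope _ _ h.2.2.2.2.2 (by linarith)
      · exact hslope _ _ h.2.2.1 (by linarith)
    · intro k y hy z hz
      exact hP1g b k y (disjointed_subset (P1 b) k hy) z (disjointed_subset (P1 b) k hz)
    · intro σ T hT
      rcases T.eq_empty_or_nonempty with rfl | ⟨y0, hy0⟩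
      · simp
      have hσ : |σ| ≤ 1 := by
        have h := hden y0 (hT y0 hy0).1.1
        rw [← (hT y0 hy0).2, abs_le]
        cases b
        · exact hslope _ _ h.2.2.2.2.2 (by linarith)
        · exact hslope _ _ h.2.2.1 (by linarith)
      have hz : ∀ y ∈ T, expSum s α β c (y 0) (y 1) = 0 := by
        intro y hy
        exact Complex.ext (hT y hy).1.2 (hreal y)
      cases b
      · have hy : ∀ y ∈ T, y 0 = p 0 + (y 1 - p 1) * σ := by
          intro y hy
          have h := hden y (hT y hy).1.1
          have h1 := (hT y hy).2
          simp only [φ] at h1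
          have h2 : y 1 - p 1 ≠ 0 := by linarith
          simp only [Bool.false_eq_true, if_false] at h1
          rw [← h1, mul_div_cancel₀ _ h2]; ring
        have hinj : Set.InjOn (fun y : E2 => y 1 - p 1) T := by
          intro y hy' z hz' hyz
          have h1 : y 1 = z 1 := by simpa using hyz
          ext i
          fin_cases i
          · simp only [Fin.zero_eta]; rw [hy y hy', hy z hz', h1]
          · exact h1
        rw [← Finset.card_image_of_injOn hinj]
        refine card_zeros_line_le s α β c M m (p 0) (p 1) σ 1 ?_ ?_ hσ (by norm_num) hM hm hp0 _ ?_
        · rw [abs_le]; constructor <;> linarith [hpc.1.1, hpc.1.2]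
        · rw [abs_le]; constructor <;> linarith [hpc.2.1, hpc.2.2]
        · intro t ht
          obtain ⟨y, hyT, rfl⟩ := Finset.mem_image.mp ht
          have h := hden y (hT y hyT).1.1
          refine ⟨by rw [abs_le]; constructor <;> linarith, ?_⟩
          rw [← hz y hyT]
          congr 1
          · rw [hy y hyT]; push_cast; ring
          · push_cast; ring
      · have hy : ∀ y ∈ T, y 1 = q 1 + (y 0 - q 0) * σ := by
          intro y hy
          have h := hden y (hT y hy).1.1
          have h1 := (hT y hy).2
          simp only [φ] at h1
          have h2 : y 0 - q 0 ≠ 0 := by linarith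
          simp only [if_true] at h1
          rw [← h1, mul_div_cancel₀ _ h2]; ring
        have hinj : Set.InjOn (fun y : E2 => y 0 - q 0) T := by
          intro y hy' z hz' hyz
          have h1 : y 0 = z 0 := by simpa using hyz
          ext i
          fin_cases i
          · exact h1
          · simp only [Fin.mk_one]; rw [hy y hy', hy z hz', h1]
        rw [← Finset.card_image_of_injOn hinj]
        refine card_zeros_line_le s α β c M n (q 0) (q 1) 1 σ ?_ ?_ (by norm_num) hσ hM hn hq0 _ ?_
        · rw [abs_le]; constructor <;> linarith [hqc.1.1, hqc.1.2]
        · rw [abs_le]; constructor <;> linarith [hqc.2.1, hqc.2.2]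
        · intro t ht
          obtain ⟨y, hyT, rfl⟩ := Finset.mem_image.mp ht
          have h := hden y (hT y hyT).1.1
          refine ⟨by rw [abs_le]; constructor <;> linarith, ?_⟩
          rw [← hz y hyT]
          congr 1
          · push_cast; ring
          · rw [hy y hyT]; push_cast; ring
  calc μH[1] Z ≤ μH[1] (⋃ b : Bool, ⋃ k, disjointed (P1 b) k) := by
        refine measure_mono ?_
        simp only [iUnion_disjointed]
        exact hcover1
    _ ≤ ∑' b : Bool, μH[1] (⋃ k, disjointed (P1 b) k) := measure_iUnion_le _
    _ ≤ ∑' b : Bool, ∑' k, μH[1] (disjointed (P1 b) k) :=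
        ENNReal.tsum_le_tsum fun b => measure_iUnion_le _
    _ ≤ ∑' b : Bool, ((120 : ℝ≥0) : ℝ≥0∞) * (2 * ((if b then n else m : ℕ) : ℝ≥0∞)) :=
        ENNReal.tsum_le_tsum hmain
    _ = 240 * (n + m) := by
        rw [tsum_bool]
        simp only [Bool.false_eq_true, if_false, if_true]
        push_cast
        ring

end

theorem mem_latticePts {lam : ℕ} {ξ : ℤ × ℤ} :
    ξ ∈ latticePts lam ↔ ξ.1 ^ 2 + ξ.2 ^ 2 = (lam : ℤ) := by
  simp only [latticePts, Finset.mem_filter, Finset.mem_product, Finset.mem_Icc, and_iff_right_iff_imp]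
  intro h
  refine ⟨⟨?_, ?_⟩, ?_, ?_⟩ <;> nlinarith [sq_nonneg ξ.1, sq_nonneg ξ.2, sq_nonneg (ξ.1 + 1),
    sq_nonneg (ξ.2 + 1), sq_nonneg (ξ.1 - 1), sq_nonneg (ξ.2 - 1), abs_nonneg ξ.1, abs_nonneg ξ.2,
    Int.le_self_sq ξ.1, Int.le_self_sq ξ.2, Int.le_self_sq (-ξ.1), Int.le_self_sq (-ξ.2)]

theorem neg_mem_latticePts {lam : ℕ} {ξ : ℤ × ℤ} : -ξ ∈ latticePts lam ↔ ξ ∈ latticePts lam := by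
  simp [mem_latticePts]

/-- The character `e(⟨ξ, x⟩)`. -/
def ch (ξ : ℤ × ℤ) (x : E2) : ℂ :=
  Complex.exp (2 * (Real.pi : ℂ) * Complex.I * ((((ξ.1 : ℝ) * x 0 + (ξ.2 : ℝ) * x 1 : ℝ)) : ℂ))

theorem ch_add_left (ξ η : ℤ × ℤ) (x : E2) : ch (ξ + η) x = ch ξ x * ch η x := by
  simp only [ch, ← Complex.exp_add]
  congr 1; push_cast [Prod.fst_add, Prod.snd_add]; ring

theorem ch_zero (x : E2) : ch 0 x = 1 := by simp [ch]

theorem ch_add_right (ξ : ℤ × ℤ) (x y : E2) : ch ξ (x + y) = ch ξ x * ch ξ y := by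
  simp only [ch, ← Complex.exp_add]
  congr 1; push_cast [PiLp.add_apply]; ring

theorem norm_ch (ξ : ℤ × ℤ) (x : E2) : ‖ch ξ x‖ = 1 := by
  have : ch ξ x = Complex.exp (((2 * Real.pi * ((ξ.1 : ℝ) * x 0 + (ξ.2 : ℝ) * x 1) : ℝ) : ℂ) * I) := by
    simp only [ch]; congr 1; push_cast; ring
  rw [this, Complex.norm_exp_ofReal_mul_I]

theorem ch_neg (ξ : ℤ × ℤ) (x : E2) : ch (-ξ) x = starRingEnd ℂ (ch ξ x) := by
  simp only [ch]
  rw [← Complex.exp_conj]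
  congr 1
  simp only [map_mul, Complex.conj_ofReal, Complex.conj_I, map_ofNat]
  push_cast [Prod.fst_neg, Prod.snd_neg]; ring

theorem continuous_ch (ξ : ℤ × ℤ) : Continuous (ch ξ) := by
  unfold ch; fun_prop

theorem ch_sum {κ : Type*} (t : Finset κ) (v : κ → ℤ × ℤ) (x : E2) :
    ch (∑ i ∈ t, v i) x = ∏ i ∈ t, ch (v i) x := by
  classical
  induction t using Finset.induction_on with
  | empty => simp [ch_zero]
  | insert a t ha ih => rw [Finset.sum_insert ha, Finset.prod_insert ha, ch_add_left, ih]

theorem integral_exp_Icc (n : ℤ) :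
    ∫ t in Set.Icc (0 : ℝ) 1, Complex.exp (2 * (Real.pi : ℂ) * Complex.I * ((n * t : ℝ) : ℂ))
      = if n = 0 then 1 else 0 := by
  rw [integral_Icc_eq_integral_Ioc, ← intervalIntegral.integral_of_le zero_le_one]
  split_ifs with h
  · subst h; simp
  · have hc : (2 * (Real.pi : ℂ) * Complex.I * n) ≠ 0 := by
      simp [Real.pi_ne_zero, h]
    have := integral_exp_mul_complex (a := 0) (b := 1) hc
    have e : ∀ t : ℝ, (2 * (Real.pi : ℂ) * Complex.I * ((n * t : ℝ) : ℂ))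
        = 2 * (Real.pi : ℂ) * Complex.I * n * t := by intro t; push_cast; ring
    simp only [e]
    rw [this]
    have e2 : Complex.exp (2 * (Real.pi : ℂ) * Complex.I * n * ((1 : ℝ) : ℂ)) = 1 := by
      rw [Complex.exp_eq_one_iff]; exact ⟨n, by push_cast; ring⟩
    rw [e2]; simp

theorem Tdom_eq_preimage : Tdom = (MeasurableEquiv.toLp 2 (Fin 2 → ℝ)).symm ⁻¹'
    (Set.univ.pi fun _ => Set.Icc (0 : ℝ) 1) := by
  ext x
  simp [Tdom, Set.mem_pi, Fin.forall_fin_two, -Set.pi_univ_Icc]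

theorem volume_Tdom : volume Tdom = 1 := by
  rw [Tdom_eq_preimage, (EuclideanSpace.volume_preserving_symm_measurableEquiv_toLp (Fin 2)).measure_preimage
    (MeasurableSet.univ_pi fun _ => measurableSet_Icc).nullMeasurableSet, volume_pi_pi]
  simp

theorem integral_ch (ξ : ℤ × ℤ) : ∫ x in Tdom, ch ξ x = if ξ = 0 then 1 else 0 := by
  have hp := EuclideanSpace.volume_preserving_symm_measurableEquiv_toLp (Fin 2)
  have h1 : ∫ x in Tdom, ch ξ x = ∫ y in (Set.univ.pi fun _ : Fin 2 => Set.Icc (0 : ℝ) 1),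
      ∏ i : Fin 2, Complex.exp (2 * (Real.pi : ℂ) * Complex.I * (((![ξ.1, ξ.2] i : ℤ) * y i : ℝ) : ℂ)) := by
    rw [Tdom_eq_preimage, ← hp.setIntegral_preimage_emb (MeasurableEquiv.measurableEmbedding _)]
    congr 1
    ext x
    rw [Fin.prod_univ_two, ← Complex.exp_add, ch]
    congr 1
    simp
    ring
  rw [h1, volume_pi, Measure.restrict_pi_pi]
  have h2 := integral_fintype_prod_eq_prod (ι := Fin 2)
    (μ := fun _ : Fin 2 => (volume : Measure ℝ).restrict (Set.Icc 0 1))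
    (fun i (t : ℝ) => Complex.exp (2 * (Real.pi : ℂ) * Complex.I * (((![ξ.1, ξ.2] i : ℤ) * t : ℝ) : ℂ)))
  rw [h2, Fin.prod_univ_two]
  simp only [integral_exp_Icc]
  rcases ξ with ⟨a, b⟩
  simp only [Matrix.cons_val_zero, Matrix.cons_val_one, Prod.mk_eq_zero]
  by_cases ha : a = 0 <;> by_cases hb : b = 0 <;> simp [ha, hb]

/-- Haar probability measure on the fundamental domain. -/
def μT : Measure E2 := volume.restrict Tdom

instance : IsProbabilityMeasure μT := ⟨by rw [μT, Measure.restrict_apply_univ, volume_Tdom]⟩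

theorem integral_ch_μT (ξ : ℤ × ℤ) : ∫ x, ch ξ x ∂μT = if ξ = 0 then 1 else 0 := integral_ch ξ

theorem integrable_of_bounded {g : E2 → ℂ} (hg : Continuous g) (C : ℝ) (h : ∀ x, ‖g x‖ ≤ C) :
    Integrable g μT :=
  Integrable.of_bound hg.aestronglyMeasurable C (Eventually.of_forall h)

/-- A general trigonometric sum integral. -/
theorem integral_sum_ch {κ : Type*} (t : Finset κ) (c : κ → ℂ) (v : κ → ℤ × ℤ) :
    ∫ x, ∑ i ∈ t, c i * ch (v i) x ∂μT = ∑ i ∈ t, if v i = 0 then c i else 0 := by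
  rw [integral_finsetSum]
  · refine Finset.sum_congr rfl fun i _ => ?_
    rw [integral_const_mul, integral_ch_μT]; simp
  · intro i _
    exact integrable_of_bounded (continuous_const.mul (continuous_ch _)) ‖c i‖
      (fun x => by rw [norm_mul, norm_ch, mul_one])

/-- Parseval. -/
theorem integral_normSq_sum_ch (t : Finset (ℤ × ℤ)) (c : ℤ × ℤ → ℂ) :
    ∫ x, ‖∑ ξ ∈ t, c ξ * ch ξ x‖ ^ 2 ∂μT = ∑ ξ ∈ t, ‖c ξ‖ ^ 2 := by
  have h1 : ∀ x, ((‖∑ ξ ∈ t, c ξ * ch ξ x‖ ^ 2 : ℝ) : ℂ)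
      = ∑ z ∈ t ×ˢ t, (c z.1 * starRingEnd ℂ (c z.2)) * ch (z.1 - z.2) x := by
    intro x
    push_cast
    rw [← Complex.mul_conj', map_sum, Finset.sum_mul_sum, Finset.sum_product]
    refine Finset.sum_congr rfl fun ξ _ => Finset.sum_congr rfl fun η _ => ?_
    rw [map_mul, sub_eq_add_neg, ch_add_left, ch_neg]; ring
  have h2 := integral_sum_ch (t ×ˢ t) (fun z => c z.1 * starRingEnd ℂ (c z.2)) (fun z => z.1 - z.2)
  simp only [← h1] at h2
  rw [integral_complex_ofReal] at h2
  have h3 : (∑ z ∈ t ×ˢ t, if z.1 - z.2 = 0 then c z.1 * starRingEnd ℂ (c z.2) else 0)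
      = ((∑ ξ ∈ t, ‖c ξ‖ ^ 2 : ℝ) : ℂ) := by
    rw [Finset.sum_product]
    push_cast
    refine Finset.sum_congr rfl fun ξ hξ => ?_
    simp only [sub_eq_zero]
    rw [Finset.sum_ite_eq, if_pos hξ, Complex.mul_conj']
  rw [h3] at h2
  exact_mod_cast h2

/-- Translates of an eigenfunction are eigenfunctions. -/
theorem IsEigenfunction.translate {lam : ℕ} {a : ℤ × ℤ → ℂ} {f : E2 → ℝ}
    (h : IsEigenfunction lam a f) (v : E2) :
    IsEigenfunction lam (fun ξ => a ξ * ch ξ v) (fun x => f (x + v)) := by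
  obtain ⟨h1, h2, h3, h4⟩ := h
  refine ⟨fun ξ hξ => by simp only [h1 ξ hξ, zero_mul], fun ξ => ?_, ?_, fun x => ?_⟩
  · simp only [h2, ch_neg, map_mul]
  · simpa only [norm_mul, norm_ch, mul_one] using h3
  · rw [h4]
    refine Finset.sum_congr rfl fun ξ _ => ?_
    have := ch_add_right ξ x v
    simp only [ch] at this ⊢
    rw [this]; ring

theorem IsFlat.translate {lam : ℕ} {a : ℤ × ℤ → ℂ} (h : IsFlat lam a) (v : E2) :
    IsFlat lam (fun ξ => a ξ * ch ξ v) := by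
  intro ε hε ξ hξ
  simpa only [norm_mul, norm_ch, mul_one] using h ε hε ξ hξ

theorem IsFlat.le {lam : ℕ} {a : ℤ × ℤ → ℂ} (h : IsFlat lam a) (ξ : ℤ × ℤ)
    (hξ : ξ ∈ latticePts lam) : ‖a ξ‖ ^ 2 ≤ 100 / ((latticePts lam).card : ℝ) := by
  have hN : 0 < ((latticePts lam).card : ℝ) := by
    exact_mod_cast Finset.card_pos.mpr ⟨ξ, hξ⟩
  have ht : Tendsto (fun ε : ℝ => 100 * ((latticePts lam).card : ℝ) ^ (-1 + ε : ℝ)) (𝓝[>] 0)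
      (𝓝 (100 / ((latticePts lam).card : ℝ))) := by
    have : Continuous fun ε : ℝ => 100 * ((latticePts lam).card : ℝ) ^ (-1 + ε : ℝ) := by
      refine continuous_const.mul ?_
      exact Continuous.rpow continuous_const (by fun_prop) (fun _ => Or.inl hN.ne')
    have h0 := this.tendsto 0
    rw [add_zero, Real.rpow_neg_one, ← div_eq_mul_inv] at h0
    exact h0.mono_left nhdsWithin_le_nhds
  refine ge_of_tendsto ht ?_
  filter_upwards [self_mem_nhdsWithin] with ε hε
  exact h ε hε ξ hξ

/-- Points around which `f` is uniformly at most `exp (-l)` on the unit ball of radius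
`R / √lam`. -/
def smallSet (lam : ℕ) (R : ℝ) (f : E2 → ℝ) (l : ℕ) : Set E2 :=
  {x | ∀ y : E2, ‖y‖ ≤ 1 → |f (x + (R / Real.sqrt lam) • y)| ≤ Real.exp (-(l : ℝ))}

theorem IsEigenfunction.eq_sum {lam : ℕ} {a : ℤ × ℤ → ℂ} {f : E2 → ℝ}
    (h : IsEigenfunction lam a f) (x : E2) : (f x : ℂ) = ∑ ξ ∈ latticePts lam, a ξ * ch ξ x :=
  h.2.2.2 x

theorem IsEigenfunction.continuous {lam : ℕ} {a : ℤ × ℤ → ℂ} {f : E2 → ℝ}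
    (h : IsEigenfunction lam a f) : Continuous f := by
  have : f = fun x => (∑ ξ ∈ latticePts lam, a ξ * ch ξ x).re := by
    ext x; rw [← h.eq_sum]; simp
  rw [this]
  exact Complex.continuous_re.comp (continuous_finsetSum _ fun ξ _ =>
    continuous_const.mul (continuous_ch ξ))

theorem measurableSet_smallSet {lam : ℕ} {a : ℤ × ℤ → ℂ} {f : E2 → ℝ}
    (h : IsEigenfunction lam a f) (R : ℝ) (l : ℕ) : MeasurableSet (smallSet lam R f l) := by
  apply IsClosed.measurableSet
  have : smallSet lam R f l = ⋂ y : E2, ⋂ _ : ‖y‖ ≤ 1,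
      {x | |f (x + (R / Real.sqrt lam) • y)| ≤ Real.exp (-(l : ℝ))} := by
    ext x; simp [smallSet]
  rw [this]
  refine isClosed_iInter fun y => isClosed_iInter fun _ => ?_
  have := h.continuous
  exact isClosed_le (by fun_prop) continuous_const

/-- Frequencies of the rescaled eigenfunction. -/
def frq1 (lam : ℕ) (R : ℝ) (ξ : ℤ × ℤ) : ℝ := 2 * Real.pi * R * ((ξ.1 : ℝ) / Real.sqrt lam)
def frq2 (lam : ℕ) (R : ℝ) (ξ : ℤ × ℤ) : ℝ := 2 * Real.pi * R * ((ξ.2 : ℝ) / Real.sqrt lam)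

theorem expSum_eq_rescaled {lam : ℕ} {a : ℤ × ℤ → ℂ} {f : E2 → ℝ} (h : IsEigenfunction lam a f)
    (R : ℝ) (x y : E2) :
    expSum (latticePts lam) (frq1 lam R) (frq2 lam R) (fun ξ => a ξ * ch ξ x) (y 0) (y 1)
      = (f (x + (R / Real.sqrt lam) • y) : ℂ) := by
  rw [h.eq_sum, expSum]
  refine Finset.sum_congr rfl fun ξ _ => ?_
  rw [ch_add_right, mul_assoc]
  congr 2
  simp only [ch, frq1, frq2]
  congr 1
  push_cast [PiLp.smul_apply, smul_eq_mul]
  ring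

theorem abs_coord_div_le {lam : ℕ} (hl : 0 < lam) {ξ : ℤ × ℤ} (hξ : ξ ∈ latticePts lam) :
    |(ξ.1 : ℝ) / Real.sqrt lam| ≤ 1 ∧ |(ξ.2 : ℝ) / Real.sqrt lam| ≤ 1 := by
  rw [mem_latticePts] at hξ
  have h : (ξ.1 : ℝ) ^ 2 + (ξ.2 : ℝ) ^ 2 = lam := by exact_mod_cast hξ
  have hs : 0 < Real.sqrt lam := Real.sqrt_pos.mpr (by exact_mod_cast hl)
  constructor <;> rw [abs_div, abs_of_pos hs, div_le_one hs] <;> apply Real.abs_le_sqrt <;>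
  nlinarith [sq_nonneg (ξ.1 : ℝ), sq_nonneg (ξ.2 : ℝ)]

/-- Normalized mixed derivatives. -/
def gder (lam : ℕ) (a : ℤ × ℤ → ℂ) (ab : ℕ × ℕ) (x : E2) : ℂ :=
  ∑ ξ ∈ latticePts lam, (a ξ * (((ξ.1 : ℝ) / Real.sqrt lam) ^ ab.1 *
    ((ξ.2 : ℝ) / Real.sqrt lam) ^ ab.2 : ℝ)) * ch ξ x

theorem continuous_gder (lam : ℕ) (a : ℤ × ℤ → ℂ) (ab : ℕ × ℕ) : Continuous (gder lam a ab) := by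
  unfold gder
  exact continuous_finsetSum _ fun ξ _ => continuous_const.mul (continuous_ch ξ)

theorem lintegral_gder_le {lam : ℕ} (hl : 0 < lam) {a : ℤ × ℤ → ℂ} {f : E2 → ℝ}
    (h : IsEigenfunction lam a f) (ab : ℕ × ℕ) : ∫⁻ x, ‖gder lam a ab x‖ₑ ∂μT ≤ 1 := by
  have hc := continuous_gder lam a ab
  have h1 : ∫ x, ‖gder lam a ab x‖ ^ 2 ∂μT ≤ 1 := by
    unfold gder
    rw [integral_normSq_sum_ch, ← h.2.2.1]
    refine Finset.sum_le_sum fun ξ hξ => ?_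
    rw [norm_mul, mul_pow, Complex.norm_real]
    have h2 := abs_coord_div_le hl hξ
    have h3 : ‖((ξ.1 : ℝ) / Real.sqrt lam) ^ ab.1 * ((ξ.2 : ℝ) / Real.sqrt lam) ^ ab.2‖ ≤ 1 := by
      rw [norm_mul, norm_pow, norm_pow, Real.norm_eq_abs, Real.norm_eq_abs]
      exact mul_le_one₀ (pow_le_one₀ (abs_nonneg _) h2.1) (by positivity)
        (pow_le_one₀ (abs_nonneg _) h2.2)
    exact mul_le_of_le_one_right (by positivity) (pow_le_one₀ (norm_nonneg _) h3)
  have hb : ∃ C, ∀ x, ‖gder lam a ab x‖ ≤ C := by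
    refine ⟨∑ ξ ∈ latticePts lam, ‖(a ξ * (((ξ.1 : ℝ) / Real.sqrt lam) ^ ab.1 *
      ((ξ.2 : ℝ) / Real.sqrt lam) ^ ab.2 : ℝ))‖, fun x => ?_⟩
    unfold gder
    refine (norm_sum_le _ _).trans (Finset.sum_le_sum fun ξ _ => ?_)
    rw [norm_mul, norm_ch, mul_one]
  obtain ⟨C, hC⟩ := hb
  have hi : Integrable (gder lam a ab) μT := integrable_of_bounded hc C hC
  have hi2 : Integrable (fun x => ‖gder lam a ab x‖ ^ 2) μT := by
    refine Integrable.of_bound (by fun_prop) (C ^ 2) (Eventually.of_forall fun x => ?_)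
    rw [norm_pow, norm_norm]
    exact pow_le_pow_left₀ (norm_nonneg _) (hC x) 2
  have h4 : ∫ x, ‖gder lam a ab x‖ ∂μT ≤ 1 := by
    have : ∫ x, ‖gder lam a ab x‖ ∂μT ≤ ∫ x, (1 / 2 + 1 / 2 * ‖gder lam a ab x‖ ^ 2) ∂μT := by
      refine integral_mono hi.norm ((integrable_const _).add (hi2.const_mul _)) fun x => ?_
      simp only
      nlinarith [sq_nonneg (‖gder lam a ab x‖ - 1)]
    rw [integral_add (integrable_const _) (hi2.const_mul _), integral_const_mul] at this
    simp at this
    linarith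
  rw [← ofReal_integral_norm_eq_lintegral_enorm hi]
  exact ENNReal.ofReal_le_one.mpr h4

/-- Weights in the Taylor majorant. -/
def tw (R : ℝ) (ab : ℕ × ℕ) : ℝ :=
  (46 * Real.pi * R) ^ ab.1 / ab.1.factorial * ((46 * Real.pi * R) ^ ab.2 / ab.2.factorial)

theorem tw_nonneg {R : ℝ} (hR : 1 < R) (ab : ℕ × ℕ) : 0 ≤ tw R ab := by
  have := Real.pi_pos
  unfold tw; positivity

theorem summable_tw (R : ℝ) : Summable (tw R) := by
  have h := (hasSum_cexp_mul ((46 * Real.pi * R : ℝ) : ℂ) ((46 * Real.pi * R : ℝ) : ℂ)).summable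
  have h2 := (Complex.hasSum_re h.hasSum).summable
  refine h2.congr fun ab => ?_
  rw [tw]
  have : (((46 * Real.pi * R : ℝ) : ℂ) ^ ab.1 / (ab.1.factorial : ℂ) *
      (((46 * Real.pi * R : ℝ) : ℂ) ^ ab.2 / (ab.2.factorial : ℂ)))
      = (((46 * Real.pi * R) ^ ab.1 / ab.1.factorial * ((46 * Real.pi * R) ^ ab.2 / ab.2.factorial) : ℝ) : ℂ) := by
    push_cast; ring
  rw [this, Complex.ofReal_re]

/-- Taylor majorant of the complexified rescaled eigenfunction. -/
def maj (lam : ℕ) (R : ℝ) (a : ℤ × ℤ → ℂ) (x : E2) : ℝ≥0∞ :=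
  ∑' ab : ℕ × ℕ, ENNReal.ofReal (tw R ab) * ‖gder lam a ab x‖ₑ

theorem lintegral_maj_le {lam : ℕ} (hl : 0 < lam) {a : ℤ × ℤ → ℂ} {f : E2 → ℝ} (R : ℝ)
    (h : IsEigenfunction lam a f) :
    ∫⁻ x, maj lam R a x ∂μT ≤ ∑' ab, ENNReal.ofReal (tw R ab) := by
  unfold maj
  rw [lintegral_tsum]
  · refine ENNReal.tsum_le_tsum fun ab => ?_
    rw [lintegral_const_mul _ (continuous_gder lam a ab).enorm.measurable]
    exact mul_le_of_le_one_right (by simp) (lintegral_gder_le hl h ab)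
  · intro ab
    exact ((continuous_gder lam a ab).enorm.measurable.const_mul _).aemeasurable

theorem norm_expSum_le_maj {lam : ℕ} {R : ℝ} (hR : 1 < R) (a : ℤ × ℤ → ℂ) (x : E2) (z w : ℂ)
    (hz : ‖z‖ ≤ 23) (hw : ‖w‖ ≤ 23) (hM : maj lam R a x ≠ ⊤) :
    ‖expSum (latticePts lam) (frq1 lam R) (frq2 lam R) (fun ξ => a ξ * ch ξ x) z w‖
      ≤ (maj lam R a x).toReal := by
  have hpi := Real.pi_pos
  have hs := hasSum_expSum (latticePts lam) (frq1 lam R) (frq2 lam R) (fun ξ => a ξ * ch ξ x) z w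
  have hterm : ∀ ab : ℕ × ℕ, ‖z ^ ab.1 / (ab.1.factorial : ℂ) * (w ^ ab.2 / (ab.2.factorial : ℂ)) *
      ∑ ξ ∈ latticePts lam, (a ξ * ch ξ x) * (I * frq1 lam R ξ) ^ ab.1 * (I * frq2 lam R ξ) ^ ab.2‖
      ≤ tw R ab * ‖gder lam a ab x‖ := by
    intro ab
    have e : ∑ ξ ∈ latticePts lam, (a ξ * ch ξ x) * (I * frq1 lam R ξ) ^ ab.1 *
        (I * frq2 lam R ξ) ^ ab.2
        = (I * (2 * Real.pi * R)) ^ ab.1 * (I * (2 * Real.pi * R)) ^ ab.2 * gder lam a ab x := by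
      rw [gder, Finset.mul_sum]
      refine Finset.sum_congr rfl fun ξ _ => ?_
      simp only [frq1, frq2]
      push_cast
      simp only [mul_pow]
      ring
    rw [e, norm_mul, norm_mul, norm_mul, norm_mul, ← mul_assoc]
    gcongr
    rw [norm_div, norm_div, norm_pow, norm_pow, norm_pow, norm_pow, tw]
    have e2 : ‖I * (2 * (Real.pi : ℂ) * (R : ℂ))‖ = 2 * Real.pi * R := by
      simp [abs_of_pos hpi, abs_of_pos (by linarith : (0 : ℝ) < R)]
    rw [e2, Complex.norm_natCast, Complex.norm_natCast]
    have h46 : (46 * Real.pi * R : ℝ) = 23 * (2 * Real.pi * R) := by ring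
    rw [h46, mul_pow 23, mul_pow 23]
    calc ‖z‖ ^ ab.1 / (ab.1.factorial : ℝ) * (‖w‖ ^ ab.2 / (ab.2.factorial : ℝ)) *
          ((2 * Real.pi * R) ^ ab.1 * (2 * Real.pi * R) ^ ab.2)
        ≤ 23 ^ ab.1 / (ab.1.factorial : ℝ) * (23 ^ ab.2 / (ab.2.factorial : ℝ)) *
          ((2 * Real.pi * R) ^ ab.1 * (2 * Real.pi * R) ^ ab.2) := by gcongr
      _ = _ := by ring
  have e1 : ∀ ab, ENNReal.ofReal (tw R ab) * ‖gder lam a ab x‖ₑ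
      = ENNReal.ofReal (tw R ab * ‖gder lam a ab x‖) := by
    intro ab
    rw [ENNReal.ofReal_mul (tw_nonneg hR ab), ofReal_norm]
  have hnn : ∀ ab, 0 ≤ tw R ab * ‖gder lam a ab x‖ := fun ab =>
    mul_nonneg (tw_nonneg hR ab) (norm_nonneg _)
  have hsum : Summable fun ab => tw R ab * ‖gder lam a ab x‖ := by
    have := ENNReal.summable_toReal (f := fun ab => ENNReal.ofReal (tw R ab) * ‖gder lam a ab x‖ₑ) hM
    refine this.congr fun ab => ?_
    rw [e1, ENNReal.toReal_ofReal (hnn ab)]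
  have e3 : (maj lam R a x).toReal = ∑' ab, tw R ab * ‖gder lam a ab x‖ := by
    unfold maj
    simp only [e1]
    rw [← ENNReal.ofReal_tsum_of_nonneg hnn hsum, ENNReal.toReal_ofReal (tsum_nonneg hnn)]
  rw [e3, ← hs.tsum_eq]
  exact tsum_of_norm_bounded hsum.hasSum hterm

theorem exists_pow_le_two_pow (p : ℕ) : ∃ C : ℕ, ∀ j : ℕ, j ^ p ≤ C * 2 ^ j := by
  have h := tendsto_pow_const_div_const_pow_of_one_lt p (by norm_num : (1 : ℝ) < 2)
  obtain ⟨B, hB⟩ := h.bddAbove_range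
  obtain ⟨C, hC⟩ := exists_nat_ge B
  refine ⟨C, fun j => ?_⟩
  have h1 : (j : ℝ) ^ p / 2 ^ j ≤ C := (hB ⟨j, rfl⟩).trans hC
  rw [div_le_iff₀ (by positivity)] at h1
  exact_mod_cast h1

/-- Sum measuring how small `f` is near a point. -/
def smallSum (lam : ℕ) (R : ℝ) (f : E2 → ℝ) (p : ℕ) (x : E2) : ℝ≥0∞ :=
  ∑' l : ℕ, ((l : ℝ≥0∞) + 1) ^ p * (smallSet lam R f l).indicator 1 x

theorem smallSum_eq_top {lam : ℕ} {R : ℝ} {f : E2 → ℝ} {p : ℕ} {x : E2}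
    (h : ∀ l, x ∈ smallSet lam R f l) : smallSum lam R f p x = ⊤ := by
  rw [eq_top_iff, ← ENNReal.tsum_const_eq_top_of_ne_zero (α := ℕ) (c := 1) one_ne_zero]
  refine ENNReal.tsum_le_tsum fun l => ?_
  rw [Set.indicator_of_mem (h l), Pi.one_apply, mul_one]
  exact one_le_pow₀ (by simp)

theorem pow_le_smallSum {lam : ℕ} {R : ℝ} {f : E2 → ℝ} {p : ℕ} (hp : 1 ≤ p) {x : E2} {l : ℕ}
    (h : ∀ m < l, x ∈ smallSet lam R f m) : (l : ℝ≥0∞) ^ p ≤ smallSum lam R f p x := by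
  rcases Nat.eq_zero_or_pos l with rfl | hl
  · simp [show p ≠ 0 by omega]
  · refine le_trans ?_ (ENNReal.le_tsum (l - 1))
    rw [Set.indicator_of_mem (h (l - 1) (by omega)), Pi.one_apply, mul_one]
    have : ((l - 1 : ℕ) : ℝ≥0∞) + 1 = l := by
      rw [← Nat.cast_add_one]; congr 1; omega
    rw [this]

theorem LF_pow_le {lam : ℕ} {R : ℝ} (hR : 1 < R) {p : ℕ} (hp : 1 ≤ p) {a : ℤ × ℤ → ℂ} {f : E2 → ℝ}
    (h : IsEigenfunction lam a f) (C : ℕ) (hC : ∀ j : ℕ, j ^ p ≤ C * 2 ^ j) (x : E2) :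
    LF lam R f x ^ p ≤ (1440 ^ p : ℝ≥0∞) * ((1 + 2 * C) * (1 + maj lam R a x) +
      smallSum lam R (fun x => f (x + (R / Real.sqrt lam) • pt 4 0)) p x +
      smallSum lam R (fun x => f (x + (R / Real.sqrt lam) • pt 0 4)) p x) := by
  classical
  set f1 : E2 → ℝ := fun x => f (x + (R / Real.sqrt lam) • pt 4 0) with hf1
  set f2 : E2 → ℝ := fun x => f (x + (R / Real.sqrt lam) • pt 0 4) with hf2
  have hpos : (1440 ^ p : ℝ≥0∞) ≠ 0 := by positivity
  by_cases hM : maj lam R a x = ⊤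
  · rw [hM]
    simp [hpos, ENNReal.mul_top]
  by_cases h1 : ∀ l, x ∈ smallSet lam R f1 l
  · rw [smallSum_eq_top h1]
    simp [hpos, ENNReal.mul_top]
  by_cases h2 : ∀ l, x ∈ smallSet lam R f2 l
  · rw [smallSum_eq_top h2]
    simp [hpos, ENNReal.mul_top]
  push Not at h1 h2
  set l1 := Nat.find h1 with hl1
  set l2 := Nat.find h2 with hl2
  have hl1' : ∀ m < l1, x ∈ smallSet lam R f1 m := fun m hm => by
    simpa using Nat.find_min h1 hm
  have hl2' : ∀ m < l2, x ∈ smallSet lam R f2 m := fun m hm => by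
    simpa using Nat.find_min h2 hm
  have hx1 := Nat.find_spec h1
  have hx2 := Nat.find_spec h2
  rw [← hl1] at hx1
  rw [← hl2] at hx2
  simp only [smallSet, Set.mem_ofPred_eq, not_forall, not_le, exists_prop] at hx1 hx2
  obtain ⟨y1, hy1, hq⟩ := hx1
  obtain ⟨y2, hy2, hp'⟩ := hx2
  set M := (maj lam R a x).toReal with hMdef
  have hexj : ∃ j : ℕ, M < 2 ^ j := pow_unbounded_of_one_lt M (by norm_num)
  set j := Nat.find hexj with hj
  have hMj : M < 2 ^ j := Nat.find_spec hexj
  have hMj' : ∀ m < j, (2 : ℝ) ^ m ≤ M := fun m hm => by simpa using Nat.find_min hexj hm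
  set F := fun y : E2 => expSum (latticePts lam) (frq1 lam R) (frq2 lam R) (fun ξ => a ξ * ch ξ x) (y 0) (y 1)
  have hF : ∀ y, F y = (f (x + (R / Real.sqrt lam) • y) : ℂ) := fun y => expSum_eq_rescaled h R x y
  set q := pt 4 0 + y1 with hqdef
  set p' := pt 0 4 + y2 with hpdef
  have eq1 : f1 (x + (R / Real.sqrt lam) • y1) = f (x + (R / Real.sqrt lam) • q) := by
    simp only [hf1, hqdef]; congr 1; rw [smul_add]; abel
  have eq2 : f2 (x + (R / Real.sqrt lam) • y2) = f (x + (R / Real.sqrt lam) • p') := by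
    simp only [hf2, hpdef]; congr 1; rw [smul_add]; abel
  rw [eq1] at hq
  rw [eq2] at hp'
  have hbig : ∀ (y : E2) (l : ℕ), Real.exp (-(l : ℝ)) < |f (x + (R / Real.sqrt lam) • y)| →
      F y ≠ 0 ∧ M < 2 ^ (j + 2 * l + 1) * ‖F y‖ := by
    intro y l hy
    rw [hF, Complex.norm_real, Real.norm_eq_abs]
    refine ⟨?_, ?_⟩
    · have : 0 < |f (x + (R / Real.sqrt lam) • y)| := (Real.exp_pos _).trans hy
      exact_mod_cast abs_pos.mp this
    · have h3 : Real.exp l ≤ 2 ^ (2 * l) := by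
        rw [pow_mul, ← Real.exp_one_pow]
        apply pow_le_pow_left₀ (Real.exp_pos _).le
        have := Real.exp_one_lt_d9
        linarith
      have h4 : 1 ≤ 2 ^ (2 * l) * |f (x + (R / Real.sqrt lam) • y)| := by
        calc (1 : ℝ) = Real.exp l * Real.exp (-(l : ℝ)) := by rw [← Real.exp_add]; simp
          _ ≤ 2 ^ (2 * l) * |f (x + (R / Real.sqrt lam) • y)| := by gcongr
      have h5 : (2 : ℝ) ^ (j + 2 * l + 1) = 2 * 2 ^ j * 2 ^ (2 * l) := by ring
      rw [h5]
      nlinarith [pow_pos (by norm_num : (0 : ℝ) < 2) j]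
  have hnod := nodal_le (latticePts lam) (frq1 lam R) (frq2 lam R) (fun ξ => a ξ * ch ξ x) M
    (j + 2 * l1) (j + 2 * l2) q p' (by simpa [hqdef, dist_eq_norm] using hy1)
    (by simpa [hpdef, dist_eq_norm] using hy2)
    (fun y => by
      have := hF y
      simp only [F] at this
      rw [this, Complex.ofReal_im])
    (fun z w hz hw => norm_expSum_le_maj hR a x z w hz hw hM)
    (hbig q l1 hq).1 (hbig p' l2 hp').1 (hbig q l1 hq).2 (hbig p' l2 hp').2
  have hset : {y : E2 | y ∈ Qdom ∧ (expSum (latticePts lam) (frq1 lam R) (frq2 lam R)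
      (fun ξ => a ξ * ch ξ x) (y 0) (y 1)).re = 0}
      = {y : E2 | y ∈ Qdom ∧ f (x + (R / Real.sqrt lam) • y) = 0} := by
    ext y
    have := hF y
    simp only [F] at this
    simp only [Set.mem_ofPred_eq, this, Complex.ofReal_re]
  rw [hset] at hnod
  have hLF : LF lam R f x ≤ ((480 * (j + l1 + l2) : ℕ) : ℝ≥0∞) := by
    refine le_trans hnod (le_of_eq ?_)
    push_cast; ring
  have hcomb : (480 * (j + l1 + l2)) ^ p ≤ 1440 ^ p * (j ^ p + l1 ^ p + l2 ^ p) := by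
    have h6 : (j + l1 + l2) ≤ 3 * max j (max l1 l2) := by
      have := le_max_left j (max l1 l2)
      have := le_max_right j (max l1 l2)
      have := le_max_left l1 l2
      have := le_max_right l1 l2
      omega
    have h7 : (max j (max l1 l2)) ^ p ≤ j ^ p + l1 ^ p + l2 ^ p := by
      rcases max_choice j (max l1 l2) with h | h <;> rw [h]
      · omega
      · rcases max_choice l1 l2 with h | h <;> rw [h] <;> omega
    calc (480 * (j + l1 + l2)) ^ p ≤ (480 * (3 * max j (max l1 l2))) ^ p := by gcongr
      _ = 1440 ^ p * (max j (max l1 l2)) ^ p := by rw [← mul_pow]; ring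
      _ ≤ _ := by gcongr
  have hjp : ((j ^ p : ℕ) : ℝ≥0∞) ≤ (1 + 2 * C) * (1 + maj lam R a x) := by
    rcases Nat.eq_zero_or_pos j with hj0 | hj0
    · rw [hj0, zero_pow (by omega)]; simp
    · have h8 : (2 : ℝ) ^ (j - 1) ≤ M := hMj' _ (by omega)
      have h9 : ((2 ^ (j - 1) : ℕ) : ℝ≥0∞) ≤ maj lam R a x := by
        rw [← ENNReal.ofReal_toReal hM, ← hMdef, ← ENNReal.ofReal_natCast]
        apply ENNReal.ofReal_le_ofReal
        exact_mod_cast h8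
      have h10 : j ^ p ≤ 2 * C * 2 ^ (j - 1) := by
        refine (hC j).trans (le_of_eq ?_)
        obtain ⟨i, hi⟩ : ∃ i, j = i + 1 := ⟨j - 1, by omega⟩
        rw [hi, Nat.add_sub_cancel]; ring
      calc ((j ^ p : ℕ) : ℝ≥0∞) ≤ ((2 * C * 2 ^ (j - 1) : ℕ) : ℝ≥0∞) := by exact_mod_cast h10
        _ = (2 * C) * ((2 ^ (j - 1) : ℕ) : ℝ≥0∞) := by push_cast; ring
        _ ≤ (1 + 2 * C) * (1 + maj lam R a x) := by
            gcongr
            · exact le_add_self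
            · exact h9.trans le_add_self
  calc LF lam R f x ^ p ≤ ((480 * (j + l1 + l2) : ℕ) : ℝ≥0∞) ^ p := by gcongr
    _ = (((480 * (j + l1 + l2)) ^ p : ℕ) : ℝ≥0∞) := by rw [← Nat.cast_pow]
    _ ≤ ((1440 ^ p * (j ^ p + l1 ^ p + l2 ^ p) : ℕ) : ℝ≥0∞) := by exact_mod_cast hcomb
    _ = 1440 ^ p * (((j ^ p : ℕ) : ℝ≥0∞) + (l1 : ℝ≥0∞) ^ p + (l2 : ℝ≥0∞) ^ p) := by
        push_cast; ring
    _ ≤ _ := by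
        gcongr
        · exact pow_le_smallSum hp hl1'
        · exact pow_le_smallSum hp hl2'

theorem lintegral_smallSum {lam : ℕ} {a : ℤ × ℤ → ℂ} {f : E2 → ℝ} (h : IsEigenfunction lam a f)
    (R : ℝ) (p : ℕ) : ∫⁻ x, smallSum lam R f p x ∂μT
      = ∑' l : ℕ, ((l : ℝ≥0∞) + 1) ^ p * μT (smallSet lam R f l) := by
  unfold smallSum
  have hm := measurableSet_smallSet h R
  rw [lintegral_tsum]
  · congr 1; ext l
    rw [lintegral_const_mul _ (measurable_one.indicator (hm l)), lintegral_indicator_one (hm l)]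
  · intro l
    exact ((measurable_one.indicator (hm l)).const_mul _).aemeasurable

theorem measurable_smallSum {lam : ℕ} {a : ℤ × ℤ → ℂ} {f : E2 → ℝ} (h : IsEigenfunction lam a f)
    (R : ℝ) (p : ℕ) : Measurable (smallSum lam R f p) := by
  have hm := measurableSet_smallSet h R
  unfold smallSum
  exact Measurable.tsum fun l => (measurable_one.indicator (hm l)).const_mul _

theorem measurable_maj (lam : ℕ) (R : ℝ) (a : ℤ × ℤ → ℂ) : Measurable (maj lam R a) := by
  unfold maj
  exact Measurable.tsum fun ab => (continuous_gder lam a ab).enorm.measurable.const_mul _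

/-- Reduction of the moments of the nodal length to small ball estimates. -/
theorem lintegral_LF_pow_le {R : ℝ} (hR : 1 < R) {p : ℕ} (hp : 1 ≤ p) (K : ℝ≥0) :
    ∃ C : ℝ, 0 < C ∧ ∀ lam : ℕ, 0 < lam →
      (∀ (a : ℤ × ℤ → ℂ) (f : E2 → ℝ), IsEigenfunction lam a f → IsFlat lam a →
        ∑' l : ℕ, ((l : ℝ≥0∞) + 1) ^ p * μT (smallSet lam R f l) ≤ K) →
      ∀ (a : ℤ × ℤ → ℂ) (f : E2 → ℝ), IsEigenfunction lam a f → IsFlat lam a →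
        ∫⁻ x in Tdom, (LF lam R f x) ^ p ≤ ENNReal.ofReal C := by
  obtain ⟨C0, hC0⟩ := exists_pow_le_two_pow p
  set W : ℝ≥0∞ := ∑' ab, ENNReal.ofReal (tw R ab) with hW
  have hWtop : W ≠ ⊤ := by
    rw [hW, ← ENNReal.ofReal_tsum_of_nonneg (tw_nonneg hR) (summable_tw R)]
    exact ENNReal.ofReal_ne_top
  set B : ℝ≥0∞ := (1440 ^ p : ℝ≥0∞) * ((1 + 2 * C0) * (1 + W) + K + K) with hB
  have hBtop : B ≠ ⊤ := by
    rw [hB]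
    finiteness
  refine ⟨B.toReal + 1, by positivity, fun lam hl hsb a f h hflat => ?_⟩
  have hs : ∀ v : E2, ∫⁻ x, smallSum lam R (fun x => f (x + v)) p x ∂μT ≤ K := fun v => by
    rw [lintegral_smallSum (h.translate v)]
    exact hsb _ _ (h.translate v) (hflat.translate v)
  have hms := fun v : E2 => measurable_smallSum (h.translate v) R p
  have hmm := measurable_maj lam R a
  calc ∫⁻ x in Tdom, (LF lam R f x) ^ p
      ≤ ∫⁻ x, (1440 ^ p : ℝ≥0∞) * ((1 + 2 * C0) * (1 + maj lam R a x) +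
      smallSum lam R (fun x => f (x + (R / Real.sqrt lam) • pt 4 0)) p x +
      smallSum lam R (fun x => f (x + (R / Real.sqrt lam) • pt 0 4)) p x) ∂μT :=
        lintegral_mono fun x => LF_pow_le hR hp h C0 hC0 x
    _ = (1440 ^ p : ℝ≥0∞) * ((1 + 2 * C0) * (1 + ∫⁻ x, maj lam R a x ∂μT) +
      ∫⁻ x, smallSum lam R (fun x => f (x + (R / Real.sqrt lam) • pt 4 0)) p x ∂μT +
      ∫⁻ x, smallSum lam R (fun x => f (x + (R / Real.sqrt lam) • pt 0 4)) p x ∂μT) := by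
        have m1 : Measurable fun x => (1 + 2 * (C0 : ℝ≥0∞)) * (1 + maj lam R a x) :=
          (hmm.const_add 1).const_mul _
        have i1 : ∫⁻ x, (1 + 2 * (C0 : ℝ≥0∞)) * (1 + maj lam R a x) ∂μT
            = (1 + 2 * C0) * (1 + ∫⁻ x, maj lam R a x ∂μT) := by
          rw [lintegral_const_mul _ (hmm.const_add 1), lintegral_add_right _ hmm]
          simp
        set s1 := smallSum lam R (fun x => f (x + (R / Real.sqrt lam) • pt 4 0)) p with hs1
        set s2 := smallSum lam R (fun x => f (x + (R / Real.sqrt lam) • pt 0 4)) p with hs2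
        have k1 : Measurable s1 := hms _
        have k2 : Measurable s2 := hms _
        have m2 : Measurable fun x => (1 + 2 * (C0 : ℝ≥0∞)) * (1 + maj lam R a x) + s1 x + s2 x :=
          (m1.add k1).add k2
        rw [lintegral_const_mul _ m2, lintegral_add_right _ k2, lintegral_add_right _ k1, i1]
    _ ≤ B := by
        rw [hB]
        gcongr
        · exact lintegral_maj_le hl R h
        · exact hs _
        · exact hs _
    _ ≤ ENNReal.ofReal (B.toReal + 1) := by
        rw [← ENNReal.ofReal_toReal hBtop]
        apply ENNReal.ofReal_le_ofReal
        rw [ENNReal.toReal_ofReal ENNReal.toReal_nonneg]; linarith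

/-- The finite family `v` restricted to `b` is a minimal vanishing sum. -/
def ZeroMin {ι : Type} (v : ι → ℤ × ℤ) (b : Finset ι) : Prop :=
  b.Nonempty ∧ ∑ i ∈ b, v i = 0 ∧ ∀ t ⊆ b, t ≠ b → t.Nonempty → ∑ i ∈ t, v i ≠ 0

open Classical in
/-- The families in `A`, supported on `b`, forming a minimal vanishing sum. -/
def relSet {ι : Type} [Fintype ι] (A : Finset (ℤ × ℤ)) (b : Finset ι) : Finset (ι → ℤ × ℤ) :=
  (Fintype.piFinset fun i => if i ∈ b then A else {0}).filter fun v => ZeroMin v b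

open Classical in
/-- Each minimal vanishing sum in `A` indexed by a part of `ι` is determined by each of its
terms, up to at most `D` choices. -/
def RelBound (ι : Type) [Fintype ι] (A : Finset (ℤ × ℤ)) (D : ℕ) : Prop :=
  ∀ b : Finset ι, ∀ i ∈ b, ∀ ξ, ((relSet A b).filter fun v => v i = ξ).card ≤ D

theorem mem_relSet {ι : Type} [Fintype ι] {A : Finset (ℤ × ℤ)} {b : Finset ι}
    {v : ι → ℤ × ℤ} :
    v ∈ relSet A b ↔ (∀ i ∈ b, v i ∈ A) ∧ (∀ i ∉ b, v i = 0) ∧ ZeroMin v b := by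
  classical
  simp only [relSet, Finset.mem_filter, Fintype.mem_piFinset]
  constructor
  · rintro ⟨h, hz⟩
    refine ⟨fun i hi => ?_, fun i hi => ?_, hz⟩
    · simpa [hi] using h i
    · simpa [hi] using h i
  · rintro ⟨h1, h2, hz⟩
    refine ⟨fun i => ?_, hz⟩
    by_cases hi : i ∈ b
    · simpa [hi] using h1 i hi
    · simpa [hi] using h2 i hi

theorem ZeroMin.congr {ι : Type} {v w : ι → ℤ × ℤ} {b : Finset ι} (h : ZeroMin v b)
    (hvw : ∀ i ∈ b, v i = w i) : ZeroMin w b := by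
  refine ⟨h.1, ?_, fun t ht hne htn => ?_⟩
  · rw [← Finset.sum_congr rfl hvw]; exact h.2.1
  · rw [← Finset.sum_congr rfl fun i hi => hvw i (ht hi)]; exact h.2.2 t ht hne htn

theorem exists_zeroMin {ι : Type} (v : ι → ℤ × ℤ) (s : Finset ι) (hs : s.Nonempty)
    (h : ∑ i ∈ s, v i = 0) : ∃ b ⊆ s, ZeroMin v b := by
  induction s using Finset.strongInduction with
  | H s ih =>
    by_cases hm : ∀ t ⊆ s, t ≠ s → t.Nonempty → ∑ i ∈ t, v i ≠ 0
    · exact ⟨s, subset_rfl, hs, h, hm⟩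
    · push Not at hm
      obtain ⟨t, hts, hne, htn, ht⟩ := hm
      obtain ⟨b, hb, hz⟩ := ih t (hts.ssubset_of_ne hne) htn ht
      exact ⟨b, hb.trans hts, hz⟩

theorem exists_blocks_aux {ι : Type} (v : ι → ℤ × ℤ) (s : Finset ι) [DecidableEq ι]
    (h : ∑ i ∈ s, v i = 0) :
    ∃ (n : ℕ) (c : ι → ℕ), (∀ i ∈ s, c i < n) ∧ ∀ b < n, ZeroMin v (s.filter fun i => c i = b) := by
  induction s using Finset.strongInduction with
  | H s ih =>
    rcases s.eq_empty_or_nonempty with rfl | hs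
    · exact ⟨0, fun _ => 0, by simp, by simp⟩
    · obtain ⟨t, hts, ht⟩ := exists_zeroMin v s hs h
      have hlt : s \ t ⊂ s := Finset.sdiff_ssubset hts ht.1
      have hsum : ∑ i ∈ s \ t, v i = 0 := by
        have := Finset.sum_sdiff (f := v) hts
        rw [ht.2.1, h, add_zero] at this
        exact this
      obtain ⟨n, c, hc, hb⟩ := ih _ hlt hsum
      refine ⟨n + 1, fun i => if i ∈ t then n else c i, fun i hi => ?_, fun b hbn => ?_⟩
      · by_cases hit : i ∈ t
        · simp [hit]
        · have := hc i (by simp [hi, hit])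
          simp only [hit, if_false]; omega
      · rcases Nat.lt_succ_iff_lt_or_eq.1 hbn with hlt | rfl
        · have h1 : s.filter (fun i => (if i ∈ t then n else c i) = b)
              = (s \ t).filter fun i => c i = b := by
            ext i
            simp only [Finset.mem_filter, Finset.mem_sdiff]
            by_cases hit : i ∈ t
            · simp [hit]; omega
            · simp [hit]
          rw [h1]; exact hb b hlt
        · have h1 : s.filter (fun i => (if i ∈ t then b else c i) = b) = t := by
            ext i
            simp only [Finset.mem_filter]
            by_cases hit : i ∈ t
            · simp [hit, hts hit]
            · simp only [hit, if_false, iff_false, not_and]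
              intro hi
              have := hc i (by simp [hi, hit])
              omega
          rw [h1]; exact ht

/-- A vanishing sum decomposes into minimal ones. -/
theorem exists_blocks {ι : Type} [Fintype ι] [DecidableEq ι] (v : ι → ℤ × ℤ)
    (h : ∑ i, v i = 0) :
    ∃ (n : ℕ) (c : ι → Fin n), Function.Surjective c ∧
      ∀ b, ZeroMin v (Finset.univ.filter fun i => c i = b) := by
  obtain ⟨n, c, hc, hb⟩ := exists_blocks_aux v Finset.univ h
  have hb' : ∀ b : Fin n, ZeroMin v (Finset.univ.filter fun i =>
      (⟨c i, hc i (Finset.mem_univ i)⟩ : Fin n) = b) := fun b => by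
    have : (Finset.univ.filter fun i => (⟨c i, hc i (Finset.mem_univ i)⟩ : Fin n) = b)
        = Finset.univ.filter fun i => c i = b := by
      ext i; simp [Fin.ext_iff]
    rw [this]; exact hb b b.2
  refine ⟨n, fun i => ⟨c i, hc i (Finset.mem_univ i)⟩, fun b => ?_, hb'⟩
  obtain ⟨i, hi⟩ := (hb' b).1
  exact ⟨i, (Finset.mem_filter.1 hi).2⟩

/-- A Cauchy–Schwarz inequality for at least two factors. -/
theorem sum_prod_le_prod_sqrt {X E : Type*} (T : Finset X) (F : Finset E) (hF : 2 ≤ F.card)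
    (g : E → X → ℝ) (hg : ∀ e t, 0 ≤ g e t) :
    ∑ t ∈ T, ∏ e ∈ F, g e t ≤ ∏ e ∈ F, √(∑ t ∈ T, g e t ^ 2) := by
  classical
  obtain ⟨e₁, e₂, F', h1, h2, rfl⟩ : ∃ e₁ e₂ F', e₁ ∉ insert e₂ F' ∧ e₂ ∉ F' ∧
      F = insert e₁ (insert e₂ F') := by
    obtain ⟨e₁, he₁, e₂, he₂, hne⟩ := Finset.one_lt_card.1 hF
    refine ⟨e₁, e₂, (F.erase e₁).erase e₂, by simp [hne], by simp, ?_⟩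
    ext e; simp only [Finset.mem_insert, Finset.mem_erase]
    by_cases h1 : e = e₁
    · simp [h1, he₁]
    · by_cases h2 : e = e₂ <;> simp [h1, h2, he₂]
  have hle : ∀ e, ∀ t ∈ T, g e t ≤ √(∑ t ∈ T, g e t ^ 2) := fun e t ht => by
    apply Real.le_sqrt_of_sq_le
    exact Finset.single_le_sum (f := fun t => g e t ^ 2) (fun t _ => sq_nonneg _) ht
  simp only [Finset.prod_insert h1, Finset.prod_insert h2]
  set P := ∏ e ∈ F', √(∑ t ∈ T, g e t ^ 2) with hP
  calc ∑ t ∈ T, g e₁ t * (g e₂ t * ∏ e ∈ F', g e t)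
      ≤ ∑ t ∈ T, (g e₁ t * g e₂ t) * P := by
        refine Finset.sum_le_sum fun t ht => ?_
        rw [← mul_assoc]
        refine mul_le_mul_of_nonneg_left ?_ (mul_nonneg (hg _ _) (hg _ _))
        exact Finset.prod_le_prod (fun e _ => hg _ _) fun e _ => hle e t ht
    _ = (∑ t ∈ T, g e₁ t * g e₂ t) * P := by rw [Finset.sum_mul]
    _ ≤ (√(∑ t ∈ T, g e₁ t ^ 2) * √(∑ t ∈ T, g e₂ t ^ 2)) * P := by
        refine mul_le_mul_of_nonneg_right ?_ (Finset.prod_nonneg fun e _ => Real.sqrt_nonneg _)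
        exact Real.sum_mul_le_sqrt_mul_sqrt _ _ _
    _ = _ := by ring

open Classical in
/-- A Cauchy–Schwarz inequality for products of functions each depending on some of the
variables, every variable occurring in at least two of the functions. -/
theorem sum_prod_le_prod_sqrt_pi {X : Type*} [Fintype X] {E : Type*} [Fintype E] (x₀ : X)
    (n : ℕ) (A : E → Finset (Fin n)) (hA : ∀ i, 2 ≤ (Finset.univ.filter fun e => i ∈ A e).card)
    (g : E → (Fin n → X) → ℝ) (hg : ∀ e x, 0 ≤ g e x)
    (hdep : ∀ e x y, (∀ i ∈ A e, x i = y i) → g e x = g e y) :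
    ∑ x : Fin n → X, ∏ e, g e x
      ≤ ∏ e, √(∑ x : Fin n → X, if ∀ i ∉ A e, x i = x₀ then g e x ^ 2 else 0) := by
  induction n with
  | zero =>
    simp only [Finset.univ_unique, Finset.sum_singleton]
    refine le_of_eq (Finset.prod_congr rfl fun e _ => ?_)
    rw [if_pos (fun i => i.elim0), Real.sqrt_sq (hg _ _)]
  | succ n ih =>
    set g' : E → (Fin n → X) → ℝ := fun e x =>
      if 0 ∈ A e then √(∑ t, g e (Fin.cons t x) ^ 2) else g e (Fin.cons x₀ x) with hg'
    set A' : E → Finset (Fin n) := fun e => Finset.univ.filter fun i => i.succ ∈ A e with hA'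
    have hsum : ∀ φ : (Fin (n + 1) → X) → ℝ,
        ∑ x, φ x = ∑ x : Fin n → X, ∑ t, φ (Fin.cons t x) := fun φ => by
      rw [← (Fin.consEquiv fun _ => X).sum_comp, Fintype.sum_prod_type_right]
      rfl
    have h1 : ∀ x : Fin n → X, ∑ t, ∏ e, g e (Fin.cons t x) ≤ ∏ e, g' e x := fun x => by
      have hspl : ∀ t, ∏ e, g e (Fin.cons t x) =
          (∏ e ∈ Finset.univ.filter fun e => 0 ∈ A e, g e (Fin.cons t x)) *
          ∏ e ∈ Finset.univ.filter fun e => ¬ 0 ∈ A e, g e (Fin.cons x₀ x) := fun t => by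
        rw [← Finset.prod_filter_mul_prod_filter_not Finset.univ (fun e => 0 ∈ A e)]
        congr 1
        refine Finset.prod_congr rfl fun e he => hdep e _ _ fun i hi => ?_
        have h0 := (Finset.mem_filter.1 he).2
        rcases Fin.eq_zero_or_eq_succ i with rfl | ⟨j, rfl⟩
        · exact absurd hi h0
        · simp
      simp only [hspl]
      rw [← Finset.sum_mul, ← Finset.prod_filter_mul_prod_filter_not Finset.univ (fun e => 0 ∈ A e)
        (fun e => g' e x)]
      refine mul_le_mul ?_ (le_of_eq ?_) (Finset.prod_nonneg fun e _ => hg _ _)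
        (Finset.prod_nonneg fun e _ => ?_)
      · refine (sum_prod_le_prod_sqrt Finset.univ _ (hA 0) (fun e t => g e (Fin.cons t x))
          fun e t => hg _ _).trans (le_of_eq ?_)
        refine Finset.prod_congr rfl fun e he => ?_
        simp only [hg', (Finset.mem_filter.1 he).2, if_true]
      · refine Finset.prod_congr rfl fun e he => ?_
        simp only [hg', (Finset.mem_filter.1 he).2, if_false]
      · simp only [hg']; split_ifs
        · exact Real.sqrt_nonneg _
        · exact hg _ _
    rw [hsum]
    refine (Finset.sum_le_sum fun x _ => h1 x).trans ?_
    refine (ih A' (fun i => ?_) g' (fun e x => ?_) (fun e x y hxy => ?_)).trans (le_of_eq ?_)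
    · have := hA i.succ
      simpa [hA'] using this
    · simp only [hg']; split_ifs
      · exact Real.sqrt_nonneg _
      · exact hg _ _
    · have key : ∀ t, g e (Fin.cons t x) = g e (Fin.cons t y) := fun t => by
        refine hdep e _ _ fun i hi => ?_
        rcases Fin.eq_zero_or_eq_succ i with rfl | ⟨j, rfl⟩
        · simp
        · simpa using hxy j (by simpa [hA'] using hi)
      simp only [hg', key]
    · refine Finset.prod_congr rfl fun e _ => ?_
      congr 1
      rw [hsum]
      refine Finset.sum_congr rfl fun x _ => ?_
      have hiff : ∀ t, (∀ i ∉ A e, (Fin.cons t x : Fin (n + 1) → X) i = x₀) ↔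
          ((0 ∉ A e → t = x₀) ∧ ∀ i ∉ A' e, x i = x₀) := fun t => by
        rw [Fin.forall_fin_succ]
        simp [hA']
      simp only [hiff]
      by_cases hx : ∀ i ∉ A' e, x i = x₀
      · rw [if_pos hx]
        by_cases h0 : 0 ∈ A e
        · simp only [hg', h0, if_true]
          rw [Real.sq_sqrt (Finset.sum_nonneg fun _ _ => sq_nonneg _)]
          refine Finset.sum_congr rfl fun t _ => ?_
          rw [if_pos ⟨fun h => absurd trivial h, hx⟩]
        · simp only [hg', h0, if_false]
          rw [Finset.sum_eq_single x₀]
          · rw [if_pos ⟨fun _ => rfl, hx⟩]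
          · intro t _ ht
            rw [if_neg fun h => ht (h.1 (fun h => h))]
          · simp
      · rw [if_neg hx]
        refine (Finset.sum_eq_zero fun t _ => ?_).symm
        rw [if_neg fun h => hx h.2]

open Classical in
theorem exists_edge_eq_zero {m n : ℕ} {A : Finset (ℤ × ℤ)} (h0 : (0 : ℤ × ℤ) ∉ A)
    {f : Fin m → ℤ × ℤ → ℤ × ℤ → ℝ} (hfd : ∀ e ξ η, ξ + η = 0 → f e ξ η = 0)
    (c : Fin m × Bool → Fin n) (hc : Function.Surjective c)
    (hdeg : ¬ ∀ b, 2 ≤ (Finset.univ.filter fun e => b ∈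
      ({c (e, false), c (e, true)} : Finset (Fin n))).card)
    (u : Fin m × Bool → ℤ × ℤ) (hA : ∀ i, u i ∈ A)
    (hz : ∀ b, ZeroMin u (Finset.univ.filter fun i => c i = b)) :
    ∏ e, f e (u (e, false)) (u (e, true)) = 0 := by
  push Not at hdeg
  obtain ⟨b, hb⟩ := hdeg
  set fib : Fin n → Finset (Fin m × Bool) := fun b => Finset.univ.filter fun i => c i = b with hfib
  obtain ⟨⟨e, j⟩, hej⟩ := hc b
  have hcard : (Finset.univ.filter fun e => b ∈ ({c (e, false), c (e, true)} : Finset (Fin n))).card ≤ 1 := by omega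
  have hsame : ∀ i ∈ fib b, i.1 = e := fun i hi => by
    have hi' : c i = b := (Finset.mem_filter.1 hi).2
    refine Finset.card_le_one.1 hcard _ ?_ _ ?_
    · simp only [Finset.mem_filter, Finset.mem_univ, true_and, Finset.mem_insert,
        Finset.mem_singleton]
      rcases i with ⟨i, _ | _⟩
      · left; exact hi'.symm
      · right; exact hi'.symm
    · simp only [Finset.mem_filter, Finset.mem_univ, true_and, Finset.mem_insert,
        Finset.mem_singleton]
      cases j
      · left; exact hej.symm
      · right; exact hej.symm
  have hsum : ∑ i ∈ fib b, u i = 0 := (hz b).2.1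
  have hsub : fib b ⊆ {(e, false), (e, true)} := fun i hi => by
    have := hsame i hi
    rcases i with ⟨i, _ | _⟩ <;> simp_all
  have hmem : (e, j) ∈ fib b := by simp [hfib, hej]
  by_cases hother : (e, !j) ∈ fib b
  · have : fib b = {(e, false), (e, true)} := by
      refine hsub.antisymm fun i hi => ?_
      cases j <;> simp only [Finset.mem_insert, Finset.mem_singleton] at hi <;>
        rcases hi with rfl | rfl <;> simpa using by assumption
    rw [this, Finset.sum_pair (by simp)] at hsum
    exact Finset.prod_eq_zero (Finset.mem_univ e) (hfd _ _ _ hsum)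
  · exfalso
    have : fib b = {(e, j)} := by
      ext i
      constructor
      · intro hi
        have h1 := hsame i hi
        rcases i with ⟨i, j'⟩
        simp only at h1; subst h1
        by_cases hjj : j' = j
        · simp [hjj]
        · have : j' = !j := by cases j <;> cases j' <;> simp_all
          rw [this] at hi; exact absurd hi hother
      · intro hi; rw [Finset.mem_singleton.1 hi]; exact hmem
    rw [this, Finset.sum_singleton] at hsum
    exact h0 (hsum ▸ hA _)

open Classical in
theorem sum_blocks_le {m n : ℕ} {A : Finset (ℤ × ℤ)} (h0 : (0 : ℤ × ℤ) ∉ A) {D : ℕ}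
    (hD : RelBound (Fin m × Bool) A D) (f : Fin m → ℤ × ℤ → ℤ × ℤ → ℝ)
    (hf : ∀ e ξ η, 0 ≤ f e ξ η) (hfd : ∀ e ξ η, ξ + η = 0 → f e ξ η = 0)
    (c : Fin m × Bool → Fin n) (hc : Function.Surjective c) :
    ∑ u ∈ Fintype.piFinset fun _ : Fin m × Bool => A,
      (if ∀ b, ZeroMin u (Finset.univ.filter fun i => c i = b) then
        ∏ e, f e (u (e, false)) (u (e, true)) else 0)
      ≤ (D : ℝ) ^ m * ∏ e, √(∑ ξ ∈ A, ∑ η ∈ A, f e ξ η ^ 2) := by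
  set fib : Fin n → Finset (Fin m × Bool) := fun b => Finset.univ.filter fun i => c i = b with hfib
  set Ae : Fin m → Finset (Fin n) := fun e => {c (e, false), c (e, true)} with hAe
  have hprodnn : (0 : ℝ) ≤ ∏ e, √(∑ ξ ∈ A, ∑ η ∈ A, f e ξ η ^ 2) :=
    Finset.prod_nonneg fun e _ => Real.sqrt_nonneg _
  by_cases hdeg : ∀ b, 2 ≤ (Finset.univ.filter fun e => b ∈ Ae e).card
  swap
  · refine le_trans (le_of_eq (Finset.sum_eq_zero fun u hu => ?_)) (by positivity)
    split_ifs with hz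
    · exact exists_edge_eq_zero h0 hfd c hc hdeg u (Fintype.mem_piFinset.1 hu) hz
    · rfl
  set P : Finset (Fin m × Bool → ℤ × ℤ) := Fintype.piFinset fun _ => insert 0 A with hP
  set x₀ : P := ⟨0, by simp [hP]⟩ with hx₀
  set π : Fin m → (Fin n → P) → (ℤ × ℤ) × (ℤ × ℤ) := fun e x =>
    ((x (c (e, false))).1 (e, false), (x (c (e, true))).1 (e, true)) with hπ
  set g : Fin m → (Fin n → P) → ℝ := fun e x =>
    if ∀ b ∈ Ae e, (x b).1 ∈ relSet A (fib b) then f e (π e x).1 (π e x).2 else 0 with hg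
  have hgn : ∀ e x, 0 ≤ g e x := fun e x => by
    simp only [hg]; split_ifs
    · exact hf _ _ _
    · exact le_rfl
  have hgd : ∀ e x y, (∀ i ∈ Ae e, x i = y i) → g e x = g e y := fun e x y hxy => by
    have e1 := hxy (c (e, false)) (by simp [hAe])
    have e2 := hxy (c (e, true)) (by simp [hAe])
    have h1 : (∀ b ∈ Ae e, (x b).1 ∈ relSet A (fib b)) ↔
        (∀ b ∈ Ae e, (y b).1 ∈ relSet A (fib b)) :=
      forall₂_congr fun b hb => by rw [hxy b hb]
    simp only [hg, hπ, h1, e1, e2]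
  have key := sum_prod_le_prod_sqrt_pi x₀ n Ae hdeg g hgn hgd
  have hB : ∀ e, (∑ x : Fin n → P, if ∀ i ∉ Ae e, x i = x₀ then g e x ^ 2 else 0)
      ≤ (D : ℝ) ^ 2 * ∑ ξ ∈ A, ∑ η ∈ A, f e ξ η ^ 2 := fun e => by
    set Good : Finset (Fin n → P) := Finset.univ.filter fun x =>
      (∀ i ∉ Ae e, x i = x₀) ∧ ∀ b ∈ Ae e, (x b).1 ∈ relSet A (fib b) with hGood
    have h1 : (∑ x : Fin n → P, if ∀ i ∉ Ae e, x i = x₀ then g e x ^ 2 else 0)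
        = ∑ x ∈ Good, f e (π e x).1 (π e x).2 ^ 2 := by
      rw [hGood, Finset.sum_filter]
      refine Finset.sum_congr rfl fun x _ => ?_
      simp only [hg]
      by_cases ha : ∀ i ∉ Ae e, x i = x₀
      · rw [if_pos ha]
        by_cases hb : ∀ b ∈ Ae e, (x b).1 ∈ relSet A (fib b)
        · rw [if_pos hb, if_pos ⟨ha, hb⟩]
        · rw [if_neg hb, if_neg fun h => hb h.2]; norm_num
      · rw [if_neg ha, if_neg fun h => ha h.1]
    have hmemfib : ∀ i, i ∈ fib (c i) := fun i => by simp [hfib]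
    have hmaps : ∀ x ∈ Good, π e x ∈ A ×ˢ A := fun x hx => by
      have h2 := (Finset.mem_filter.1 hx).2.2
      rw [Finset.mem_product]
      exact ⟨(mem_relSet.1 (h2 _ (by simp [hAe]))).1 _ (hmemfib _),
        (mem_relSet.1 (h2 _ (by simp [hAe]))).1 _ (hmemfib _)⟩
    rw [h1, ← Finset.sum_fiberwise_of_maps_to hmaps, ← Finset.sum_product', Finset.mul_sum]
    refine Finset.sum_le_sum fun p _ => ?_
    have h2 : ∑ x ∈ Good with π e x = p, f e (π e x).1 (π e x).2 ^ 2
        = ((Good.filter fun x => π e x = p).card : ℝ) * f e p.1 p.2 ^ 2 := by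
      rw [← nsmul_eq_mul, ← Finset.sum_const]
      refine Finset.sum_congr rfl fun x hx => ?_
      rw [(Finset.mem_filter.1 hx).2]
    rw [h2]
    refine mul_le_mul_of_nonneg_right ?_ (sq_nonneg _)
    have h3 : (Good.filter fun x => π e x = p).card ≤ D * D := by
      refine le_trans ?_ (Nat.mul_le_mul
        (hD (fib (c (e, false))) (e, false) (hmemfib _) p.1)
        (hD (fib (c (e, true))) (e, true) (hmemfib _) p.2))
      rw [← Finset.card_product]
      refine Finset.card_le_card_of_injOn
        (fun x => ((x (c (e, false))).1, (x (c (e, true))).1)) ?_ ?_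
      · intro x hx
        have hx' := Finset.mem_filter.1 (Finset.mem_coe.1 hx)
        have h4 := (Finset.mem_filter.1 hx'.1).2.2
        simp only [Finset.coe_product, Set.mem_prod, Finset.mem_coe, Finset.mem_filter]
        refine ⟨⟨h4 _ (by simp [hAe]), ?_⟩, h4 _ (by simp [hAe]), ?_⟩
        · rw [← hx'.2]
        · rw [← hx'.2]
      · intro x hx y hy hxy
        have hx' := (Finset.mem_filter.1 (Finset.mem_filter.1 (Finset.mem_coe.1 hx)).1).2.1
        have hy' := (Finset.mem_filter.1 (Finset.mem_filter.1 (Finset.mem_coe.1 hy)).1).2.1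
        simp only [Prod.mk.injEq] at hxy
        funext b
        by_cases hb : b ∈ Ae e
        · simp only [hAe, Finset.mem_insert, Finset.mem_singleton] at hb
          rcases hb with rfl | rfl
          · exact Subtype.ext hxy.1
          · exact Subtype.ext hxy.2
        · rw [hx' b hb, hy' b hb]
    rw [sq]; exact_mod_cast h3
  set φ : (Fin m × Bool → ℤ × ℤ) → Fin n → P := fun u b =>
    ⟨fun i => if c i = b then (if u i ∈ A then u i else 0) else 0, by
      simp only [hP, Fintype.mem_piFinset, Finset.mem_insert]
      intro i
      split_ifs with h1 h2
      · exact Or.inr h2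
      · exact Or.inl rfl
      · exact Or.inl rfl⟩ with hφ
  set U := (Fintype.piFinset fun _ : Fin m × Bool => A).filter
    fun u => ∀ b, ZeroMin u (fib b) with hU
  have hφi : ∀ u ∈ U, ∀ i, (φ u (c i)).1 i = u i := fun u hu i => by
    have hA := Fintype.mem_piFinset.1 (Finset.mem_filter.1 hu).1 i
    simp [hφ, hA]
  have hφrel : ∀ u ∈ U, ∀ b, (φ u b).1 ∈ relSet A (fib b) := fun u hu b => by
    have hA := Fintype.mem_piFinset.1 (Finset.mem_filter.1 hu).1
    have hz := (Finset.mem_filter.1 hu).2 b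
    have hval : ∀ i ∈ fib b, u i = (φ u b).1 i := fun i hi => by
      have : c i = b := (Finset.mem_filter.1 hi).2
      rw [← this, hφi u hu]
    refine mem_relSet.2 ⟨fun i hi => ?_, fun i hi => ?_, hz.congr hval⟩
    · rw [← hval i hi]; exact hA i
    · have : c i ≠ b := fun h => hi (by simp [hfib, h])
      simp [hφ, this]
  calc ∑ u ∈ Fintype.piFinset fun _ : Fin m × Bool => A,
      (if ∀ b, ZeroMin u (fib b) then ∏ e, f e (u (e, false)) (u (e, true)) else 0)
      = ∑ u ∈ U, ∏ e, f e (u (e, false)) (u (e, true)) := by rw [hU, Finset.sum_filter]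
    _ = ∑ u ∈ U, ∏ e, g e (φ u) := by
        refine Finset.sum_congr rfl fun u hu => Finset.prod_congr rfl fun e _ => ?_
        simp only [hg, hπ]
        rw [if_pos fun b _ => hφrel u hu b, hφi u hu, hφi u hu]
    _ = ∑ x ∈ U.image φ, ∏ e, g e x := by
        rw [Finset.sum_image]
        intro u hu w hw huw
        funext i
        rw [← hφi u hu, ← hφi w hw, huw]
    _ ≤ ∑ x, ∏ e, g e x :=
        Finset.sum_le_sum_of_subset_of_nonneg (Finset.subset_univ _) fun x _ _ =>
          Finset.prod_nonneg fun e _ => hgn _ _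
    _ ≤ _ := key
    _ ≤ ∏ e, ((D : ℝ) * √(∑ ξ ∈ A, ∑ η ∈ A, f e ξ η ^ 2)) := by
        refine Finset.prod_le_prod (fun e _ => Real.sqrt_nonneg _) fun e _ => ?_
        refine (Real.sqrt_le_sqrt (le_trans (le_of_eq ?_) (hB e))).trans (le_of_eq ?_)
        · refine Finset.sum_congr rfl fun x _ => ?_
          congr
        rw [Real.sqrt_mul (by positivity), Real.sqrt_sq (Nat.cast_nonneg _)]
    _ = _ := by rw [Finset.prod_mul_distrib]; simp

open Classical in
theorem sum_zeroSum_le {m : ℕ} {A : Finset (ℤ × ℤ)} (h0 : (0 : ℤ × ℤ) ∉ A) {D : ℕ}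
    (hD : RelBound (Fin m × Bool) A D) (f : Fin m → ℤ × ℤ → ℤ × ℤ → ℝ)
    (hf : ∀ e ξ η, 0 ≤ f e ξ η) (hfd : ∀ e ξ η, ξ + η = 0 → f e ξ η = 0) :
    ∑ u ∈ Fintype.piFinset fun _ : Fin m × Bool => A,
      (if ∑ i, u i = 0 then ∏ e, f e (u (e, false)) (u (e, true)) else 0)
      ≤ ((2 * m + 1) * (2 * m) ^ (2 * m) : ℕ) *
        ((D : ℝ) ^ m * ∏ e, √(∑ ξ ∈ A, ∑ η ∈ A, f e ξ η ^ 2)) := by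
  have hpn : ∀ u : Fin m × Bool → ℤ × ℤ, 0 ≤ ∏ e, f e (u (e, false)) (u (e, true)) :=
    fun u => Finset.prod_nonneg fun e _ => hf _ _ _
  set B := (D : ℝ) ^ m * ∏ e, √(∑ ξ ∈ A, ∑ η ∈ A, f e ξ η ^ 2) with hB
  have hBn : 0 ≤ B := mul_nonneg (by positivity) (Finset.prod_nonneg fun e _ => Real.sqrt_nonneg _)
  set V : (Fin m × Bool → ℤ × ℤ) → (n : ℕ) → (Fin m × Bool → Fin n) → ℝ := fun u n c =>
    if Function.Surjective c then
      (if ∀ b, ZeroMin u (Finset.univ.filter fun i => c i = b) then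
        ∏ e, f e (u (e, false)) (u (e, true)) else 0) else 0 with hV
  have hVn : ∀ u n c, 0 ≤ V u n c := fun u n c => by
    simp only [hV]; split_ifs
    · exact hpn u
    · exact le_rfl
    · exact le_rfl
  have h1 : ∀ u : Fin m × Bool → ℤ × ℤ,
      (if ∑ i, u i = 0 then ∏ e, f e (u (e, false)) (u (e, true)) else 0)
      ≤ ∑ n ∈ Finset.range (2 * m + 1), ∑ c : Fin m × Bool → Fin n, V u n c := fun u => by
    split_ifs with hu
    · obtain ⟨n, c, hc, hz⟩ := exists_blocks u hu
      have hn : n ≤ 2 * m := by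
        have := Fintype.card_le_of_surjective c hc
        simp at this; omega
      refine le_trans (b := V u n c) (le_of_eq ?_) ?_
      · simp only [hV]
        rw [if_pos hc, if_pos hz]
      · refine le_trans (Finset.single_le_sum (f := fun c => V u n c) (fun c _ => hVn u n c)
          (Finset.mem_univ c)) ?_
        exact Finset.single_le_sum (f := fun n => ∑ c : Fin m × Bool → Fin n, V u n c)
          (fun n _ => Finset.sum_nonneg fun c _ => hVn u n c)
          (Finset.mem_range.2 (by omega))
    · exact Finset.sum_nonneg fun n _ => Finset.sum_nonneg fun c _ => hVn u n c
  have h2 : ∀ n (c : Fin m × Bool → Fin n),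
      ∑ u ∈ Fintype.piFinset fun _ : Fin m × Bool => A, V u n c ≤ B := fun n c => by
    by_cases hc : Function.Surjective c
    · simp only [hV, if_pos hc]
      exact sum_blocks_le h0 hD f hf hfd c hc
    · simp only [hV, if_neg hc]; simpa using hBn
  calc _ ≤ ∑ u ∈ Fintype.piFinset fun _ : Fin m × Bool => A,
        ∑ n ∈ Finset.range (2 * m + 1), ∑ c : Fin m × Bool → Fin n, V u n c :=
        Finset.sum_le_sum fun u _ => h1 u
    _ = ∑ n ∈ Finset.range (2 * m + 1), ∑ c : Fin m × Bool → Fin n,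
        ∑ u ∈ Fintype.piFinset fun _ : Fin m × Bool => A, V u n c := by
        rw [Finset.sum_comm]
        exact Finset.sum_congr rfl fun n _ => Finset.sum_comm
    _ ≤ ∑ n ∈ Finset.range (2 * m + 1), ∑ c : Fin m × Bool → Fin n, B :=
        Finset.sum_le_sum fun n _ => Finset.sum_le_sum fun c _ => h2 n c
    _ ≤ ∑ n ∈ Finset.range (2 * m + 1), ((2 * m) ^ (2 * m) : ℕ) * B := by
        refine Finset.sum_le_sum fun n hn => ?_
        rw [Finset.sum_const, nsmul_eq_mul]
        refine mul_le_mul_of_nonneg_right ?_ hBn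
        have : n ≤ 2 * m := by have := Finset.mem_range.1 hn; omega
        simp only [Finset.card_univ, Fintype.card_fun, Fintype.card_fin,
          Fintype.card_prod, Fintype.card_bool]
        rw [mul_comm m 2]
        exact_mod_cast Nat.pow_le_pow_left this _
    _ = _ := by
        rw [Finset.sum_const, Finset.card_range, nsmul_eq_mul]; push_cast; ring

/-- A combinatorial constant in the moment estimate for quadratic chaoses. -/
def chaosConst (m : ℕ) : ℕ := (2 * m + 1) * (2 * m) ^ (2 * m)

theorem norm_integral_chaos_le {m : ℕ} {A : Finset (ℤ × ℤ)} (h0 : (0 : ℤ × ℤ) ∉ A)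
    (hneg : ∀ ξ ∈ A, -ξ ∈ A) {D : ℕ} (hD : RelBound (Fin m × Bool) A D)
    (B : ℤ × ℤ → ℤ × ℤ → ℂ) :
    ‖∫ x, (∑ p ∈ A ×ˢ A, (if p.1 = p.2 then 0 else B p.1 p.2) * ch (p.1 - p.2) x) ^ m ∂μT‖
      ≤ chaosConst m * ((D : ℝ) ^ m * √(∑ ξ ∈ A, ∑ η ∈ A, ‖B ξ η‖ ^ 2) ^ m) := by
  classical
  set B' : ℤ × ℤ → ℤ × ℤ → ℂ := fun ξ η => if ξ = η then 0 else B ξ η with hB'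
  have hexp : ∀ x, (∑ p ∈ A ×ˢ A, (if p.1 = p.2 then 0 else B p.1 p.2) * ch (p.1 - p.2) x) ^ m
      = ∑ w ∈ Fintype.piFinset fun _ : Fin m => A ×ˢ A,
        (∏ e, B' (w e).1 (w e).2) * ch (∑ e, ((w e).1 - (w e).2)) x := fun x => by
    have : (∑ p ∈ A ×ˢ A, (if p.1 = p.2 then 0 else B p.1 p.2) * ch (p.1 - p.2) x) ^ m
      = ∏ _e : Fin m, ∑ p ∈ A ×ˢ A, B' p.1 p.2 * ch (p.1 - p.2) x := by simp [hB']
    rw [this, Finset.prod_univ_sum]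
    refine Finset.sum_congr rfl fun w _ => ?_
    rw [Finset.prod_mul_distrib, ch_sum]
  simp only [hexp]
  rw [integral_sum_ch]
  set f : Fin m → ℤ × ℤ → ℤ × ℤ → ℝ := fun _ ξ η => ‖B' ξ (-η)‖ with hf
  have hmain := sum_zeroSum_le h0 hD f (fun _ _ _ => norm_nonneg _) (fun e ξ η h => by
    have : ξ = -η := eq_neg_of_add_eq_zero_left h
    simp [hf, hB', this])
  have hsq : ∀ e : Fin m, ∑ ξ ∈ A, ∑ η ∈ A, f e ξ η ^ 2 ≤ ∑ ξ ∈ A, ∑ η ∈ A, ‖B ξ η‖ ^ 2 := fun e => by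
    refine Finset.sum_le_sum fun ξ _ => ?_
    have : ∑ η ∈ A, f e ξ η ^ 2 = ∑ η ∈ A, ‖B' ξ η‖ ^ 2 :=
      Finset.sum_nbij' (fun η => -η) (fun η => -η) (fun η h => hneg η h) (fun η h => hneg η h)
        (fun η _ => neg_neg η) (fun η _ => neg_neg η) fun η _ => rfl
    rw [this]
    refine Finset.sum_le_sum fun η _ => ?_
    simp only [hB']
    split_ifs
    · simp
    · exact le_rfl
  refine (norm_sum_le _ _).trans (le_trans ?_ (hmain.trans ?_))
  · refine le_of_eq (Finset.sum_nbij'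
      (fun w i => if i.2 then -(w i.1).2 else (w i.1).1)
      (fun u e => (u (e, false), -u (e, true))) ?_ ?_ ?_ ?_ ?_)
    · intro w hw
      rw [Fintype.mem_piFinset] at hw ⊢
      rintro ⟨e, _ | _⟩
      · simpa using (Finset.mem_product.1 (hw e)).1
      · simpa using hneg _ (Finset.mem_product.1 (hw e)).2
    · intro u hu
      rw [Fintype.mem_piFinset] at hu ⊢
      intro e
      exact Finset.mem_product.2 ⟨hu _, hneg _ (hu _)⟩
    · intro w _; funext e; simp
    · intro u _; funext ⟨e, j⟩; cases j <;> simp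
    · intro w _
      have h1 : ∑ i : Fin m × Bool, (if i.2 then -(w i.1).2 else (w i.1).1)
          = ∑ e, ((w e).1 - (w e).2) := by
        rw [Fintype.sum_prod_type]
        refine Finset.sum_congr rfl fun e _ => ?_
        rw [Fintype.sum_bool]; simp; abel
      rw [h1]
      split_ifs <;> simp [hf, norm_prod]
  · rw [chaosConst]
    refine mul_le_mul_of_nonneg_left ?_ (Nat.cast_nonneg _)
    refine mul_le_mul_of_nonneg_left ?_ (by positivity)
    calc ∏ e : Fin m, √(∑ ξ ∈ A, ∑ η ∈ A, f e ξ η ^ 2)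
        ≤ ∏ _e : Fin m, √(∑ ξ ∈ A, ∑ η ∈ A, ‖B ξ η‖ ^ 2) :=
          Finset.prod_le_prod (fun e _ => Real.sqrt_nonneg _) fun e _ =>
            Real.sqrt_le_sqrt (hsq e)
      _ = _ := by simp

/-- The set where an orthonormal system of exponential sums is uniformly small has small measure. -/
theorem measureReal_small_le {A : Finset (ℤ × ℤ)} (h0 : (0 : ℤ × ℤ) ∉ A)
    (hneg : ∀ ξ ∈ A, -ξ ∈ A) {k D : ℕ} (hD : RelBound (Fin (2 * k) × Bool) A D)
    {n : ℕ} (hn : 0 < n) (b : Fin n → ℤ × ℤ → ℂ)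
    (hb : ∀ i j, ∑ ξ ∈ A, b i ξ * starRingEnd ℂ (b j ξ) = if i = j then 1 else 0)
    (s : Set E2) (hs : ∀ x ∈ s, ∀ i, ‖∑ ξ ∈ A, b i ξ * ch ξ x‖ ^ 2 ≤ 1 / 2) :
    μT.real s ≤ chaosConst (2 * k) * (4 * (D : ℝ) ^ 2 / n) ^ k := by
  classical
  set B : ℤ × ℤ → ℤ × ℤ → ℂ := fun ξ η => ∑ i, b i ξ * starRingEnd ℂ (b i η) with hB
  have hBsum : ∑ ξ ∈ A, ∑ η ∈ A, ‖B ξ η‖ ^ 2 = n := by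
    have h1 : ((∑ ξ ∈ A, ∑ η ∈ A, ‖B ξ η‖ ^ 2 : ℝ) : ℂ) = ∑ i, ∑ j,
        (∑ ξ ∈ A, b i ξ * starRingEnd ℂ (b j ξ)) *
          (∑ η ∈ A, b j η * starRingEnd ℂ (b i η)) := by
      push_cast
      have h2 : ∀ ξ η, ((‖B ξ η‖ : ℂ)) ^ 2 = ∑ i, ∑ j, (b i ξ * starRingEnd ℂ (b j ξ)) *
          (b j η * starRingEnd ℂ (b i η)) := fun ξ η => by
        rw [← Complex.mul_conj', hB, map_sum, Finset.sum_mul_sum]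
        refine Finset.sum_congr rfl fun i _ => Finset.sum_congr rfl fun j _ => ?_
        simp only [map_mul, Complex.conj_conj]; ring
      simp only [h2, Finset.sum_mul_sum]
      calc _ = ∑ ξ ∈ A, ∑ i, ∑ η ∈ A, ∑ j, (b i ξ * starRingEnd ℂ (b j ξ)) *
          (b j η * starRingEnd ℂ (b i η)) := Finset.sum_congr rfl fun ξ _ => Finset.sum_comm
        _ = ∑ i, ∑ ξ ∈ A, ∑ η ∈ A, ∑ j, (b i ξ * starRingEnd ℂ (b j ξ)) *
          (b j η * starRingEnd ℂ (b i η)) := Finset.sum_comm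
        _ = ∑ i, ∑ ξ ∈ A, ∑ j, ∑ η ∈ A, (b i ξ * starRingEnd ℂ (b j ξ)) *
          (b j η * starRingEnd ℂ (b i η)) := Finset.sum_congr rfl fun i _ =>
            Finset.sum_congr rfl fun ξ _ => Finset.sum_comm
        _ = _ := Finset.sum_congr rfl fun i _ => Finset.sum_comm
    have h3 : (∑ i, ∑ j, (∑ ξ ∈ A, b i ξ * starRingEnd ℂ (b j ξ)) *
          (∑ η ∈ A, b j η * starRingEnd ℂ (b i η)) : ℂ) = n := by
      simp only [hb]; simp
    rw [h3] at h1
    exact_mod_cast h1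
  set G : Fin n → E2 → ℂ := fun i x => ∑ ξ ∈ A, b i ξ * ch ξ x with hG
  set Q : E2 → ℝ := fun x => ∑ i, ‖G i x‖ ^ 2 - n with hQ
  have hGc : ∀ i, Continuous (G i) := fun i =>
    continuous_finsetSum _ fun ξ _ => continuous_const.mul (continuous_ch ξ)
  have hQc : Continuous Q :=
    (continuous_finsetSum _ fun i _ => (hGc i).norm.pow 2).sub continuous_const
  have hGb : ∀ i x, ‖G i x‖ ≤ ∑ ξ ∈ A, ‖b i ξ‖ := fun i x =>
    (norm_sum_le _ _).trans (le_of_eq (Finset.sum_congr rfl fun ξ _ => by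
      rw [norm_mul, norm_ch, mul_one]))
  have hQb : ∀ x, |Q x| ≤ ∑ i, (∑ ξ ∈ A, ‖b i ξ‖) ^ 2 + n := fun x => by
    refine (abs_sub _ _).trans (add_le_add ?_ (by simp))
    rw [abs_of_nonneg (Finset.sum_nonneg fun i _ => sq_nonneg _)]
    exact Finset.sum_le_sum fun i _ => pow_le_pow_left₀ (norm_nonneg _) (hGb i x) 2
  have hQe : ∀ x, (Q x : ℂ) = ∑ p ∈ A ×ˢ A,
      (if p.1 = p.2 then 0 else B p.1 p.2) * ch (p.1 - p.2) x := fun x => by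
    have h1 : (∑ i, (‖G i x‖ : ℂ) ^ 2) = ∑ p ∈ A ×ˢ A, B p.1 p.2 * ch (p.1 - p.2) x := by
      have : ∀ i, (‖G i x‖ : ℂ) ^ 2 = ∑ p ∈ A ×ˢ A,
          (b i p.1 * starRingEnd ℂ (b i p.2)) * ch (p.1 - p.2) x := fun i => by
        rw [← Complex.mul_conj', hG, map_sum, Finset.sum_mul_sum, ← Finset.sum_product']
        refine Finset.sum_congr rfl fun p _ => ?_
        rw [sub_eq_add_neg, ch_add_left, ch_neg, map_mul]; ring
      simp only [this]
      rw [Finset.sum_comm]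
      refine Finset.sum_congr rfl fun p _ => ?_
      rw [← Finset.sum_mul]
    have h2 : ∑ p ∈ A ×ˢ A, (if p.1 = p.2 then B p.1 p.2 else 0) * ch (p.1 - p.2) x = n := by
      rw [Finset.sum_product]
      have : ∀ ξ ∈ A, ∑ η ∈ A, (if ξ = η then B ξ η else 0) * ch (ξ - η) x = B ξ ξ :=
        fun ξ hξ => by
          rw [Finset.sum_eq_single ξ]
          · simp [ch_zero]
          · intro η _ hne; simp [Ne.symm hne]
          · intro h; exact absurd hξ h
      rw [Finset.sum_congr rfl this, hB, Finset.sum_comm]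
      simp [hb]
    have h3 : (Q x : ℂ) = ∑ i, (‖G i x‖ : ℂ) ^ 2 - n := by simp [hQ]
    rw [h3, h1, ← h2, ← Finset.sum_sub_distrib]
    refine Finset.sum_congr rfl fun p _ => ?_
    split_ifs <;> ring
  have hIe : ∫ x, Q x ^ (2 * k) ∂μT ≤ chaosConst (2 * k) * ((D : ℝ) ^ (2 * k) * (n : ℝ) ^ k) := by
    have h1 := norm_integral_chaos_le h0 hneg hD B
    simp only [← hQe, ← Complex.ofReal_pow] at h1
    have h2 : ∫ x, ((Q x ^ (2 * k) : ℝ) : ℂ) ∂μT = ((∫ x, Q x ^ (2 * k) ∂μT : ℝ) : ℂ) :=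
      integral_ofReal
    rw [h2, hBsum, pow_mul √_, Real.sq_sqrt (Nat.cast_nonneg _)] at h1
    refine (le_abs_self _).trans ?_
    rwa [Complex.norm_real, Real.norm_eq_abs] at h1
  have hnn : ∀ x, 0 ≤ Q x ^ (2 * k) := fun x => by rw [pow_mul]; positivity
  have hQi : Integrable (fun x => Q x ^ (2 * k)) μT := by
    refine Integrable.of_bound (hQc.pow _).aestronglyMeasurable
      ((∑ i, (∑ ξ ∈ A, ‖b i ξ‖) ^ 2 + n) ^ (2 * k)) (Eventually.of_forall fun x => ?_)
    rw [norm_pow, Real.norm_eq_abs]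
    exact pow_le_pow_left₀ (abs_nonneg _) (hQb x) _
  have hcheb := mul_meas_ge_le_integral_of_nonneg (Eventually.of_forall hnn) hQi
    (((n : ℝ) / 2) ^ (2 * k))
  have hsub : s ⊆ {x | ((n : ℝ) / 2) ^ (2 * k) ≤ Q x ^ (2 * k)} := fun x hx => by
    have h1 : ∑ i, ‖G i x‖ ^ 2 ≤ n * (1 / 2) := by
      refine (Finset.sum_le_sum fun i _ => hs x hx i).trans (le_of_eq ?_)
      simp
    have h2 : (n : ℝ) / 2 ≤ |Q x| := by
      rw [abs_of_nonpos]
      · simp only [hQ]; linarith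
      · simp only [hQ]
        have : (0 : ℝ) ≤ n := Nat.cast_nonneg _
        linarith
    rw [Set.mem_ofPred_eq, pow_mul (Q x), ← sq_abs, ← pow_mul]
    exact pow_le_pow_left₀ (by positivity) h2 _
  have hn' : (0 : ℝ) < n := by exact_mod_cast hn
  have h4 : ((n : ℝ) / 2) ^ (2 * k) * μT.real s ≤
      chaosConst (2 * k) * ((D : ℝ) ^ (2 * k) * (n : ℝ) ^ k) :=
    le_trans (mul_le_mul_of_nonneg_left (measureReal_mono hsub) (by positivity))
      (hcheb.trans hIe)
  have h5 : μT.real s ≤ chaosConst (2 * k) * ((D : ℝ) ^ (2 * k) * (n : ℝ) ^ k) /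
      ((n : ℝ) / 2) ^ (2 * k) := by
    rw [le_div_iff₀ (by positivity)]; linarith
  refine h5.trans (le_of_eq ?_)
  rw [pow_mul, pow_mul, ← mul_pow, mul_div_assoc, ← div_pow]
  congr 2
  field_simp
  ring

/-- A complex parameter separating the frequencies, realized by translations of size `t`. -/
def freqShift (lam : ℕ) (t : ℝ) (ξ : ℤ × ℤ) : ℂ :=
  (Complex.exp (((t * (ξ.1 / √lam) : ℝ) : ℂ) * I) - 1) +
    I * (Complex.exp (((t * (ξ.2 / √lam) : ℝ) : ℂ) * I) - 1)

theorem norm_exp_sub_exp_sub_le {α β t : ℝ} (hα : |α| ≤ t) (hβ : |β| ≤ t) :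
    ‖Complex.exp (α * I) - Complex.exp (β * I) - ((α - β : ℝ) : ℂ) * I‖ ≤ t * |α - β| := by
  have h := Convex.norm_image_sub_le_of_norm_hasDerivWithin_le (𝕜 := ℝ) (s := Set.Icc (-t) t)
    (f := fun u : ℝ => Complex.exp (u * I) - u * I)
    (f' := fun u : ℝ => Complex.exp (u * I) * I - I) (C := t) (x := β) (y := α)
    (fun u _ => by
      have h1 : HasDerivAt (fun u : ℝ => (u : ℂ) * I) I u := by
        simpa using (Complex.ofRealCLM.hasDerivAt (x := u)).mul_const I
      exact ((h1.cexp).sub h1).hasDerivWithinAt) (fun u hu => by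
      have : Complex.exp (u * I) * I - I = (Complex.exp (u * I) - 1) * I := by ring
      rw [this, norm_mul, Complex.norm_I, mul_one, mul_comm (u : ℂ)]
      refine (Real.norm_exp_I_mul_ofReal_sub_one_le).trans ?_
      rw [Real.norm_eq_abs]; exact abs_le.2 hu) (convex_Icc _ _) (abs_le.1 hβ) (abs_le.1 hα)
  refine le_trans (le_of_eq ?_) h
  congr 1; push_cast; ring

theorem coord_div_sqrt_sq {lam : ℕ} (hl : 0 < lam) {ξ : ℤ × ℤ} (hξ : ξ ∈ latticePts lam) :
    ((ξ.1 : ℝ) / √lam) ^ 2 + ((ξ.2 : ℝ) / √lam) ^ 2 = 1 := by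
  have h : ((ξ.1 : ℝ)) ^ 2 + (ξ.2 : ℝ) ^ 2 = lam := by exact_mod_cast mem_latticePts.1 hξ
  have hl' : (0 : ℝ) < lam := by exact_mod_cast hl
  rw [div_pow, div_pow, Real.sq_sqrt hl'.le, ← add_div, h, div_self hl'.ne']

theorem norm_freqShift_le {lam : ℕ} (hl : 0 < lam) {t : ℝ} (ht : 0 ≤ t) {ξ : ℤ × ℤ}
    (hξ : ξ ∈ latticePts lam) : ‖freqShift lam t ξ‖ ≤ 2 * t := by
  have h := coord_div_sqrt_sq hl hξ
  have h1 : |(ξ.1 : ℝ) / √lam| ≤ 1 := by rw [← sq_le_one_iff_abs_le_one]; nlinarith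
  have h2 : |(ξ.2 : ℝ) / √lam| ≤ 1 := by rw [← sq_le_one_iff_abs_le_one]; nlinarith
  have key : ∀ u : ℝ, |u| ≤ 1 → ‖Complex.exp (((t * u : ℝ) : ℂ) * I) - 1‖ ≤ t := fun u hu => by
    rw [mul_comm]
    refine (Real.norm_exp_I_mul_ofReal_sub_one_le).trans ?_
    rw [Real.norm_eq_abs, abs_mul, abs_of_nonneg ht]
    exact mul_le_of_le_one_right ht hu
  unfold freqShift
  refine (norm_add_le _ _).trans ?_
  rw [norm_mul, Complex.norm_I, one_mul]
  linarith [key _ h1, key _ h2]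

theorem le_norm_freqShift_sub {lam : ℕ} (hl : 0 < lam) {t : ℝ} (ht : 0 ≤ t) (ht' : t ≤ 1 / 4)
    {ξ η : ℤ × ℤ} (hξ : ξ ∈ latticePts lam) (hη : η ∈ latticePts lam) {Y : ℕ}
    (hY : 0 < Y) (h : (lam : ℤ) ≤ ((ξ.1 - η.1) ^ 2 + (ξ.2 - η.2) ^ 2) * Y) :
    t / (2 * √Y) ≤ ‖freqShift lam t ξ - freqShift lam t η‖ := by
  have hl' : (0 : ℝ) < lam := by exact_mod_cast hl
  have hY' : (0 : ℝ) < Y := by exact_mod_cast hY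
  have bd : ∀ ζ ∈ latticePts lam, |t * ((ζ.1 : ℝ) / √lam)| ≤ t ∧ |t * ((ζ.2 : ℝ) / √lam)| ≤ t := by
    intro ζ hζ
    have h := coord_div_sqrt_sq hl hζ
    have h1 : |(ζ.1 : ℝ) / √lam| ≤ 1 := by rw [← sq_le_one_iff_abs_le_one]; nlinarith
    have h2 : |(ζ.2 : ℝ) / √lam| ≤ 1 := by rw [← sq_le_one_iff_abs_le_one]; nlinarith
    rw [abs_mul, abs_mul, abs_of_nonneg ht]
    exact ⟨mul_le_of_le_one_right ht h1, mul_le_of_le_one_right ht h2⟩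
  set p := t * ((ξ.1 : ℝ) / √lam) - t * ((η.1 : ℝ) / √lam) with hp
  set q := t * ((ξ.2 : ℝ) / √lam) - t * ((η.2 : ℝ) / √lam) with hq
  have e1 := norm_exp_sub_exp_sub_le (bd ξ hξ).1 (bd η hη).1
  have e2 := norm_exp_sub_exp_sub_le (bd ξ hξ).2 (bd η hη).2
  rw [← hp] at e1
  rw [← hq] at e2
  have hpq : t ^ 2 / Y ≤ p ^ 2 + q ^ 2 := by
    have h3 : (lam : ℝ) ≤ (((ξ.1 : ℝ) - η.1) ^ 2 + ((ξ.2 : ℝ) - η.2) ^ 2) * Y := by exact_mod_cast h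
    have h4 : p ^ 2 + q ^ 2 = t ^ 2 * ((((ξ.1 : ℝ) - η.1) ^ 2 + ((ξ.2 : ℝ) - η.2) ^ 2) / lam) := by
      have hs := Real.sq_sqrt hl'.le
      have hs0 := (Real.sqrt_pos.2 hl').ne'
      rw [hp, hq]
      nth_rewrite 5 [← hs]
      field_simp
    rw [h4, div_eq_mul_one_div]
    refine mul_le_mul_of_nonneg_left ?_ (sq_nonneg _)
    rw [div_le_div_iff₀ hY' hl']; linarith
  have hr : √(p ^ 2 + q ^ 2) ≥ t / √Y := by
    rw [← Real.sqrt_sq ht, ← Real.sqrt_div (sq_nonneg t)]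
    exact Real.sqrt_le_sqrt hpq
  have hmain : ‖(p : ℂ) * I + I * ((q : ℂ) * I)‖ = √(p ^ 2 + q ^ 2) := by
    have : (p : ℂ) * I + I * ((q : ℂ) * I) = ((-q : ℝ) : ℂ) + (p : ℝ) * I := by
      push_cast; ring_nf; rw [Complex.I_sq]; ring
    rw [this, Complex.norm_add_mul_I]; congr 1; ring
  have hsplit : (p : ℂ) * I + I * ((q : ℂ) * I) = (freqShift lam t ξ - freqShift lam t η)
      - ((Complex.exp (((t * (ξ.1 / √lam) : ℝ) : ℂ) * I) -
          Complex.exp (((t * (η.1 / √lam) : ℝ) : ℂ) * I) - (p : ℂ) * I)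
        + I * (Complex.exp (((t * (ξ.2 / √lam) : ℝ) : ℂ) * I) -
          Complex.exp (((t * (η.2 / √lam) : ℝ) : ℂ) * I) - (q : ℂ) * I)) := by
    unfold freqShift; ring
  have hn : √(p ^ 2 + q ^ 2) ≤ ‖freqShift lam t ξ - freqShift lam t η‖ + (t * |p| + t * |q|) := by
    rw [← hmain, hsplit]
    refine (norm_sub_le _ _).trans ?_
    refine add_le_add le_rfl ((norm_add_le _ _).trans ?_)
    rw [norm_mul, Complex.norm_I, one_mul]
    exact add_le_add e1 e2
  have hpq2 : |p| + |q| ≤ 2 * √(p ^ 2 + q ^ 2) := by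
    have h5 : |p| ≤ √(p ^ 2 + q ^ 2) := Real.abs_le_sqrt (by nlinarith [sq_nonneg q])
    have h6 : |q| ≤ √(p ^ 2 + q ^ 2) := Real.abs_le_sqrt (by nlinarith [sq_nonneg p])
    linarith
  have h7 : t / (2 * √Y) = (t / √Y) / 2 := by field_simp
  rw [h7]
  nlinarith [abs_nonneg p, abs_nonneg q, Real.sqrt_nonneg (p ^ 2 + q ^ 2)]

/-- Finite difference operators applied to an eigenfunction stay small on `smallSet`. -/
theorem norm_sum_prod_freqShift_le {lam : ℕ} {R : ℝ} (hR : 1 < R) {a : ℤ × ℤ → ℂ} {f : E2 → ℝ}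
    (h : IsEigenfunction lam a f) {t : ℝ} (ht : 0 ≤ t) {κ : Type*} (T : Finset κ) (c : κ → ℂ)
    (hc : ∀ i ∈ T, ‖c i‖ ≤ 1) {l : ℕ} {x : E2} (hx : x ∈ smallSet lam R f l) (y : E2)
    (hy : ‖y‖ + T.card * t ≤ 1) :
    ‖∑ ξ ∈ latticePts lam, a ξ * (∏ i ∈ T, (freqShift lam t ξ - c i)) *
      ch ξ (x + (R / Real.sqrt lam) • y)‖ ≤ 5 ^ T.card * Real.exp (-(l : ℝ)) := by
  classical
  induction T using Finset.induction_on generalizing y with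
  | empty =>
    have h1 := hx y (by simpa using hy)
    have h2 := h.eq_sum (x + (R / Real.sqrt lam) • y)
    simp only [Finset.prod_empty, mul_one, Finset.card_empty, pow_zero, one_mul]
    rw [← h2, Complex.norm_real]
    exact h1
  | insert j T hj ih =>
    rw [Finset.card_insert_of_notMem hj] at hy ⊢
    push_cast at hy
    have hc' : ∀ i ∈ T, ‖c i‖ ≤ 1 := fun i hi => hc i (Finset.mem_insert_of_mem hi)
    set τ := t / (2 * Real.pi * R) with hτ
    have hpi := Real.pi_gt_three
    have hR0 : 0 < R := by linarith
    have hτ0 : 0 ≤ τ := by rw [hτ]; positivity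
    have hτt : τ ≤ t := by
      rw [hτ]; apply div_le_self ht; nlinarith
    set g : E2 → ℂ := fun y => ∑ ξ ∈ latticePts lam, a ξ * (∏ i ∈ T, (freqShift lam t ξ - c i)) *
      ch ξ (x + (R / Real.sqrt lam) • y) with hg
    have hn1 : ‖pt τ 0‖ = τ := by
      simp [pt, EuclideanSpace.norm_eq, Fin.sum_univ_two, Real.sqrt_sq hτ0]
    have hn2 : ‖pt 0 τ‖ = τ := by
      simp [pt, EuclideanSpace.norm_eq, Fin.sum_univ_two, Real.sqrt_sq hτ0]
    have hid : ∑ ξ ∈ latticePts lam, a ξ * (∏ i ∈ insert j T, (freqShift lam t ξ - c i)) *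
      ch ξ (x + (R / Real.sqrt lam) • y) =
        (g (y + pt τ 0) - g y) + I * (g (y + pt 0 τ) - g y) - c j * g y := by
      simp only [hg, ← Finset.sum_sub_distrib, Finset.mul_sum, ← Finset.sum_add_distrib]
      refine Finset.sum_congr rfl fun ξ _ => ?_
      have e1 : ch ξ (x + (R / Real.sqrt lam) • (y + pt τ 0)) =
          ch ξ (x + (R / Real.sqrt lam) • y) *
            Complex.exp (((t * (ξ.1 / √lam) : ℝ) : ℂ) * I) := by
        rw [smul_add, ← add_assoc, ch_add_right]
        congr 1
        simp only [ch]; congr 1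
        have : (ξ.1 : ℝ) * ((R / √lam) • pt τ 0) 0 + (ξ.2 : ℝ) * ((R / √lam) • pt τ 0) 1
            = t * (ξ.1 / √lam) / (2 * Real.pi) := by
          simp only [pt, hτ, PiLp.smul_apply, smul_eq_mul, WithLp.equiv_symm_apply,
            Matrix.cons_val_zero, Matrix.cons_val_one]
          field_simp
          ring
        rw [this]
        have hpi0 : (Real.pi : ℂ) ≠ 0 := by exact_mod_cast Real.pi_ne_zero
        push_cast
        field_simp
      have e2 : ch ξ (x + (R / Real.sqrt lam) • (y + pt 0 τ)) =
          ch ξ (x + (R / Real.sqrt lam) • y) *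
            Complex.exp (((t * (ξ.2 / √lam) : ℝ) : ℂ) * I) := by
        rw [smul_add, ← add_assoc, ch_add_right]
        congr 1
        simp only [ch]; congr 1
        have : (ξ.1 : ℝ) * ((R / √lam) • pt 0 τ) 0 + (ξ.2 : ℝ) * ((R / √lam) • pt 0 τ) 1
            = t * (ξ.2 / √lam) / (2 * Real.pi) := by
          simp only [pt, hτ, PiLp.smul_apply, smul_eq_mul, WithLp.equiv_symm_apply,
            Matrix.cons_val_zero, Matrix.cons_val_one]
          field_simp
          ring
        rw [this]
        have hpi0 : (Real.pi : ℂ) ≠ 0 := by exact_mod_cast Real.pi_ne_zero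
        push_cast
        field_simp
      rw [e1, e2, Finset.prod_insert hj]
      unfold freqShift
      ring
    have b0 := ih hc' y (by nlinarith)
    have b1 := ih hc' (y + pt τ 0) (by linarith [norm_add_le y (pt τ 0)])
    have b2 := ih hc' (y + pt 0 τ) (by linarith [norm_add_le y (pt 0 τ)])
    rw [hid]
    have b3 : ‖c j * g y‖ ≤ 5 ^ T.card * Real.exp (-(l : ℝ)) := by
      rw [norm_mul]
      exact (mul_le_of_le_one_left (norm_nonneg _) (hc j (Finset.mem_insert_self _ _))).trans b0
    have b4 : ‖(g (y + pt τ 0) - g y) + I * (g (y + pt 0 τ) - g y) - c j * g y‖ ≤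
        (‖g (y + pt τ 0)‖ + ‖g y‖) + (‖g (y + pt 0 τ)‖ + ‖g y‖) + ‖c j * g y‖ := by
      refine (norm_sub_le _ _).trans (add_le_add ((norm_add_le _ _).trans ?_) le_rfl)
      rw [norm_mul, Complex.norm_I, one_mul]
      exact add_le_add (norm_sub_le _ _) (norm_sub_le _ _)
    rw [pow_succ]
    linarith

/-- Every sizeable set of lattice points contains `n` well-separated points. -/
def SepProp (lam n Y : ℕ) : Prop :=
  ∀ G ⊆ latticePts lam, 3 * (latticePts lam).card ≤ 400 * G.card →
    ∃ T ⊆ G, T.card = n ∧ ∀ z ∈ T, ∀ z' ∈ T, z ≠ z' →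
      (lam : ℤ) ≤ ((z.1 - z'.1) ^ 2 + (z.2 - z'.2) ^ 2) * Y

theorem norm_sum_eval_freqShift_le {lam : ℕ} (hl : 0 < lam) {R : ℝ} (hR : 1 < R)
    {a : ℤ × ℤ → ℂ} {f : E2 → ℝ} (h : IsEigenfunction lam a f) {n Y : ℕ} (hn : 0 < n)
    (hY : 0 < Y) {T : Finset (ℤ × ℤ)} (hT : T ⊆ latticePts lam) (hTn : T.card = n)
    (hsep : ∀ z ∈ T, ∀ z' ∈ T, z ≠ z' →
      (lam : ℤ) ≤ ((z.1 - z'.1) ^ 2 + (z.2 - z'.2) ^ 2) * Y)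
    {P : Polynomial ℂ} (hP : P.degree < n)
    (hPT : ∀ z ∈ T, ‖P.eval (freqShift lam (1 / (4 * n)) z)‖ ≤ 2) {l : ℕ} {x : E2}
    (hx : x ∈ smallSet lam R f l) :
    ‖∑ ξ ∈ latticePts lam, a ξ * P.eval (freqShift lam (1 / (4 * n)) ξ) * ch ξ x‖ ≤
      n * (2 * ((40 * n * √Y) ^ (n - 1) * Real.exp (-(l : ℝ)))) := by
  classical
  have hn' : (0 : ℝ) < n := by exact_mod_cast hn
  have hn1 : (1 : ℝ) ≤ n := by exact_mod_cast hn
  have hY' : (0 : ℝ) < Y := by exact_mod_cast hY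
  set t : ℝ := 1 / (4 * n) with ht
  have ht0 : 0 < t := by positivity
  have ht4 : t ≤ 1 / 4 := by
    rw [ht]; apply div_le_div_of_nonneg_left <;> linarith
  set v := freqShift lam t with hv
  have hsep' : ∀ z ∈ T, ∀ z' ∈ T, z ≠ z' → t / (2 * √Y) ≤ ‖v z - v z'‖ := fun z hz z' hz' hne =>
    le_norm_freqShift_sub hl ht0.le ht4 (hT hz) (hT hz') hY (hsep z hz z' hz' hne)
  have hpos : 0 < t / (2 * √Y) := by positivity
  have hinj : Set.InjOn v T := by
    intro z hz z' hz' he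
    by_contra hne
    have := hsep' z hz z' hz' hne
    rw [he, sub_self, norm_zero] at this
    linarith
  have hPe := Lagrange.eq_interpolate hinj (f := P) (by rw [hTn]; exact hP)
  have hid : ∑ ξ ∈ latticePts lam, a ξ * P.eval (v ξ) * ch ξ x =
      ∑ z ∈ T, P.eval (v z) * ((∏ j ∈ T.erase z, (v z - v j)⁻¹) *
        ∑ ξ ∈ latticePts lam, a ξ * (∏ j ∈ T.erase z, (v ξ - v j)) * ch ξ x) := by
    simp only [Finset.mul_sum]
    rw [Finset.sum_comm]
    refine Finset.sum_congr rfl fun ξ _ => ?_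
    conv_lhs => rw [hPe]
    rw [Lagrange.interpolate_apply, Polynomial.eval_finsetSum, Finset.mul_sum, Finset.sum_mul]
    refine Finset.sum_congr rfl fun z _ => ?_
    simp only [Lagrange.basis, Lagrange.basisDivisor, Polynomial.eval_mul, Polynomial.eval_C,
      Polynomial.eval_prod, Polynomial.eval_sub, Polynomial.eval_X, Finset.prod_mul_distrib]
    ring
  rw [hid]
  refine (norm_sum_le _ _).trans ?_
  rw [← nsmul_eq_mul, ← hTn]
  refine Finset.sum_le_card_nsmul _ _ _ fun z hz => ?_
  have hc : (T.erase z).card = n - 1 := by rw [Finset.card_erase_of_mem hz, hTn]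
  rw [norm_mul, norm_mul, norm_prod]
  have h1 : ∏ j ∈ T.erase z, ‖(v z - v j)⁻¹‖ ≤ (8 * n * √Y) ^ (n - 1) := by
    rw [← hc, ← Finset.prod_const]
    refine Finset.prod_le_prod (fun _ _ => norm_nonneg _) fun j hj => ?_
    rw [norm_inv]
    refine (inv_anti₀ hpos (hsep' z hz j (Finset.mem_of_mem_erase hj)
      (Finset.ne_of_mem_erase hj).symm)).trans (le_of_eq ?_)
    rw [ht]; field_simp; norm_num
  have h2 := norm_sum_prod_freqShift_le hR h ht0.le (T.erase z) v (fun j hj =>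
    (norm_freqShift_le hl ht0.le (hT (Finset.mem_of_mem_erase hj))).trans (by linarith)) hx 0
    (by
      rw [norm_zero, zero_add, hc, ht]
      have : ((n - 1 : ℕ) : ℝ) ≤ n := by exact_mod_cast Nat.sub_le n 1
      rw [mul_one_div, div_le_one (by positivity)]
      linarith)
  simp only [smul_zero, add_zero] at h2
  rw [hc] at h2
  rw [hTn]
  refine mul_le_mul (hPT z hz) ?_ (by positivity) (by norm_num)
  refine (mul_le_mul h1 h2 (norm_nonneg _) (by positivity)).trans (le_of_eq ?_)
  rw [← mul_assoc, ← mul_pow]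
  congr 2; ring

theorem three_mul_card_le {lam : ℕ} {a : ℤ × ℤ → ℂ} (hf : IsFlat lam a) {G : Finset (ℤ × ℤ)}
    (hG : G ⊆ latticePts lam) (hm : 3 / 4 ≤ ∑ ξ ∈ G, ‖a ξ‖ ^ 2) :
    3 * (latticePts lam).card ≤ 400 * G.card := by
  have hGne : G.Nonempty := by
    rw [Finset.nonempty_iff_ne_empty]
    rintro rfl
    norm_num at hm
  have hN : 0 < ((latticePts lam).card : ℝ) := by
    exact_mod_cast Finset.card_pos.mpr (hGne.mono hG)
  have h1 : ∑ ξ ∈ G, ‖a ξ‖ ^ 2 ≤ G.card • (100 / ((latticePts lam).card : ℝ)) :=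
    Finset.sum_le_card_nsmul _ _ _ fun ξ hξ => hf.le ξ (hG hξ)
  rw [nsmul_eq_mul] at h1
  have h2 := hm.trans h1
  rw [mul_div_assoc', le_div_iff₀ hN] at h2
  have : (3 * (latticePts lam).card : ℝ) ≤ 400 * G.card := by linarith
  exact_mod_cast this

theorem measureReal_smallSet_le {lam : ℕ} (hl : 0 < lam) {R : ℝ} (hR : 1 < R) {k D : ℕ}
    (hD : RelBound (Fin (2 * k) × Bool) (latticePts lam) D) {n Y : ℕ} (hn : 0 < n)
    (hY : 0 < Y) (hS : SepProp lam n Y) {a : ℤ × ℤ → ℂ} {f : E2 → ℝ}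
    (h : IsEigenfunction lam a f) (hf : IsFlat lam a) {l : ℕ}
    (hlarge : (40 * n * Y : ℝ) ^ n ≤ Real.exp l) :
    μT.real (smallSet lam R f l) ≤ chaosConst (2 * k) * (4 * (D : ℝ) ^ 2 / n) ^ k := by
  classical
  have hn' : (0 : ℝ) < n := by exact_mod_cast hn
  have hn1 : (1 : ℝ) ≤ n := by exact_mod_cast hn
  have hY' : (1 : ℝ) ≤ Y := by exact_mod_cast hY
  set Λ := latticePts lam with hΛ
  set t : ℝ := 1 / (4 * n) with ht
  have ht0 : 0 < t := by positivity
  have ht4 : t ≤ 1 / 4 := by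
    rw [ht]; apply div_le_div_of_nonneg_left <;> linarith
  set v := freqShift lam t with hv
  have hmass : ∑ ξ ∈ Λ, ‖a ξ‖ ^ 2 = 1 := h.2.2.1
  let E := EuclideanSpace ℂ Λ
  let Φ : Polynomial.degreeLT ℂ n →ₗ[ℂ] E :=
    { toFun := fun P => WithLp.toLp 2 fun ξ : Λ => a ξ * (P : Polynomial ℂ).eval (v ξ)
      map_add' := fun P Q => by
        ext ξ; exact (congrArg _ Polynomial.eval_add).trans (mul_add _ _ _)
      map_smul' := fun c P => by
        ext ξ
        refine (congrArg (a ξ * ·) (Polynomial.eval_smul ..)).trans ?_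
        exact mul_left_comm (a ξ) c _ }
  have hΦ : ∀ P ξ, Φ P ξ = a ξ * (P : Polynomial ℂ).eval (v ξ) := fun P ξ => rfl
  have hker : LinearMap.ker Φ = ⊥ := by
    rw [LinearMap.ker_eq_bot']
    intro P hP
    have hz : ∀ ξ ∈ Λ, a ξ * (P : Polynomial ℂ).eval (v ξ) = 0 := fun ξ hξ => by
      have := congrArg (fun u : E => u ⟨ξ, hξ⟩) hP
      simpa [hΦ] using this
    set G := Λ.filter fun ξ => (P : Polynomial ℂ).eval (v ξ) = 0 with hG
    have hGm : ∑ ξ ∈ G, ‖a ξ‖ ^ 2 = 1 := by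
      rw [← hmass, hG, Finset.sum_filter]
      refine Finset.sum_congr rfl fun ξ hξ => ?_
      split_ifs with h0
      · rfl
      · rw [(mul_eq_zero.1 (hz ξ hξ)).resolve_right h0]; simp
    obtain ⟨T, hTG, hTn, hsep⟩ := hS G (Finset.filter_subset _ _)
      (three_mul_card_le hf (Finset.filter_subset _ _) (by rw [hGm]; norm_num))
    have hTΛ : T ⊆ Λ := hTG.trans (Finset.filter_subset _ _)
    have hinj : Set.InjOn v T := by
      intro z hz z' hz' he
      by_contra hne
      have h1 := le_norm_freqShift_sub hl ht0.le ht4 (hTΛ hz) (hTΛ hz') hY (hsep z hz z' hz' hne)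
      rw [← hv, he, sub_self, norm_zero] at h1
      have : 0 < t / (2 * √(Y : ℝ)) := by positivity
      linarith
    have hdeg := Polynomial.mem_degreeLT.1 P.2
    have := Polynomial.eq_zero_of_degree_lt_of_eval_index_eq_zero (v := v) T hinj
      (by rw [hTn]; exact hdeg) (fun z hz => (Finset.mem_filter.1 (hTG hz)).2)
    exact Subtype.ext this
  have hrank : Module.finrank ℂ (LinearMap.range Φ) = n := by
    rw [LinearMap.finrank_range_of_inj (LinearMap.ker_eq_bot.1 hker),
      (Polynomial.degreeLTEquiv ℂ n).finrank_eq, Module.finrank_fin_fun]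
  let B := (stdOrthonormalBasis ℂ (LinearMap.range Φ)).reindex (finCongr hrank)
  have hex : ∀ i, ∃ P, Φ P = (B i : E) := fun i => (B i).2
  choose P hPB using hex
  refine measureReal_small_le (A := Λ) ?_ (fun ξ hξ => neg_mem_latticePts.2 hξ) hD hn
    (fun i ξ => a ξ * (P i : Polynomial ℂ).eval (v ξ)) ?_ _ ?_
  · rw [hΛ, mem_latticePts]
    simp only [Prod.fst_zero, Prod.snd_zero]
    intro h0
    have : (lam : ℤ) ≠ 0 := by exact_mod_cast hl.ne'
    exact this (by rw [← h0]; ring)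
  · intro i j
    have h1 : inner ℂ (B j : E) (B i : E) = if j = i then (1 : ℂ) else 0 := by
      have := orthonormal_iff_ite.1 B.orthonormal j i
      simpa using this
    rw [← hPB, ← hPB, PiLp.inner_apply] at h1
    rw [← Finset.sum_coe_sort]
    simp only [eq_comm (a := i)]
    rw [← h1]
    refine Finset.sum_congr rfl fun ξ _ => ?_
    simp [hΦ]
  · intro x hx i
    have hnorm : ∑ ξ ∈ Λ, ‖a ξ‖ ^ 2 * ‖(P i : Polynomial ℂ).eval (v ξ)‖ ^ 2 = 1 := by
      have h1 : ‖(B i : E)‖ = 1 := B.orthonormal.1 i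
      rw [← hPB, EuclideanSpace.norm_eq, Real.sqrt_eq_one] at h1
      rw [← h1, ← Finset.sum_coe_sort]
      exact Finset.sum_congr rfl fun ξ _ => by rw [hΦ, norm_mul, mul_pow]
    set G := Λ.filter fun ξ => ‖(P i : Polynomial ℂ).eval (v ξ)‖ ≤ 2 with hG
    have hGm : 3 / 4 ≤ ∑ ξ ∈ G, ‖a ξ‖ ^ 2 := by
      have h2 := Finset.sum_filter_add_sum_filter_not Λ
        (fun ξ => ‖(P i : Polynomial ℂ).eval (v ξ)‖ ≤ 2) (fun ξ => ‖a ξ‖ ^ 2)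
      have h3 : ∑ ξ ∈ Λ.filter (fun ξ => ¬ ‖(P i : Polynomial ℂ).eval (v ξ)‖ ≤ 2),
          4 * ‖a ξ‖ ^ 2 ≤ 1 := by
        rw [← hnorm]
        refine (Finset.sum_le_sum fun ξ hξ => ?_).trans (Finset.sum_le_sum_of_subset_of_nonneg
          (Finset.filter_subset _ Λ) fun _ _ _ => by positivity)
        have h4 := not_le.1 (Finset.mem_filter.1 hξ).2
        rw [mul_comm]
        exact mul_le_mul_of_nonneg_left (by nlinarith) (sq_nonneg _)
      rw [← Finset.mul_sum] at h3
      rw [hmass] at h2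
      linarith
    obtain ⟨T, hTG, hTn, hsep⟩ := hS G (Finset.filter_subset _ _)
      (three_mul_card_le hf (Finset.filter_subset _ _) hGm)
    have hb := norm_sum_eval_freqShift_le hl hR h hn hY (hTG.trans (Finset.filter_subset _ _)) hTn
      hsep (Polynomial.mem_degreeLT.1 (P i).2) (fun z hz => (Finset.mem_filter.1 (hTG hz)).2) hx
    have hsq : √(Y : ℝ) ≤ Y := by
      rw [Real.sqrt_le_left (by linarith)]; nlinarith
    have h5 : (40 * n * √(Y : ℝ)) ^ (n - 1) ≤ (40 * n * Y : ℝ) ^ (n - 1) := by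
      refine pow_le_pow_left₀ (by positivity) ?_ _
      exact mul_le_mul_of_nonneg_left hsq (by positivity)
    have h6 : (40 * n : ℝ) * (40 * n * Y : ℝ) ^ (n - 1) ≤ (40 * n * Y : ℝ) ^ n := by
      obtain ⟨m, rfl⟩ := Nat.exists_eq_succ_of_ne_zero hn.ne'
      rw [Nat.succ_eq_add_one, Nat.add_sub_cancel, pow_succ', mul_assoc (40 * _ : ℝ) (Y : ℝ)]
      refine mul_le_mul_of_nonneg_left ?_ (by positivity)
      exact le_mul_of_one_le_left (by positivity) hY'
    have h7 : Real.exp (-(l : ℝ)) * Real.exp l = 1 := by rw [← Real.exp_add]; simp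
    have h8 : n * (2 * ((40 * n * √(Y : ℝ)) ^ (n - 1) * Real.exp (-(l : ℝ)))) ≤ 1 / 20 := by
      have h9 : 40 * n * (40 * n * √(Y : ℝ)) ^ (n - 1) ≤ Real.exp l :=
        ((mul_le_mul_of_nonneg_left h5 (by positivity)).trans h6).trans hlarge
      have h10 := mul_le_mul_of_nonneg_left h9 (Real.exp_pos (-(l : ℝ))).le
      rw [h7] at h10
      linarith
    have h11 := hb.trans h8
    calc _ ≤ (1 / 20 : ℝ) ^ 2 := pow_le_pow_left₀ (norm_nonneg _) h11 2
      _ ≤ 1 / 2 := by norm_num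

theorem smallSet_eq_empty {lam : ℕ} (hl : 0 < lam) {R : ℝ} (hR : 1 < R) {a : ℤ × ℤ → ℂ}
    {f : E2 → ℝ} (h : IsEigenfunction lam a f) {l : ℕ}
    (hlarge : (40 * (latticePts lam).card * lam : ℝ) ^ (latticePts lam).card < Real.exp l) :
    smallSet lam R f l = ∅ := by
  classical
  rw [Set.eq_empty_iff_forall_notMem]
  intro x hx
  set Λ := latticePts lam with hΛ
  have hmass : ∑ ξ ∈ Λ, ‖a ξ‖ ^ 2 = 1 := h.2.2.1
  have hne : Λ.Nonempty := by
    rw [Finset.nonempty_iff_ne_empty]; intro h0; rw [h0] at hmass; simp at hmass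
  have hN : 0 < Λ.card := Finset.card_pos.2 hne
  set N := Λ.card with hNdef
  have hN' : (1 : ℝ) ≤ N := by exact_mod_cast hN
  have hl' : (1 : ℝ) ≤ lam := by exact_mod_cast hl
  obtain ⟨ξ₀, hξ₀, hbig⟩ : ∃ ξ₀ ∈ Λ, 1 / (N : ℝ) ≤ ‖a ξ₀‖ ^ 2 := by
    by_contra hcon
    push Not at hcon
    have := Finset.sum_lt_sum_of_nonempty hne hcon
    rw [hmass, Finset.sum_const, nsmul_eq_mul, ← hNdef] at this
    field_simp at this
    exact lt_irrefl _ this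
  set t : ℝ := 1 / (4 * N) with ht
  have ht0 : 0 < t := by positivity
  have ht4 : t ≤ 1 / 4 := by
    rw [ht]; apply div_le_div_of_nonneg_left <;> linarith
  set v := freqShift lam t with hv
  have hc : (Λ.erase ξ₀).card = N - 1 := by rw [Finset.card_erase_of_mem hξ₀]
  have h2 := norm_sum_prod_freqShift_le hR h ht0.le (Λ.erase ξ₀) v (fun j hj =>
    (norm_freqShift_le hl ht0.le (Finset.mem_of_mem_erase hj)).trans (by linarith)) hx 0
    (by
      rw [norm_zero, zero_add, hc, ht]
      have : ((N - 1 : ℕ) : ℝ) ≤ N := by exact_mod_cast Nat.sub_le N 1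
      rw [mul_one_div, div_le_one (by positivity)]
      linarith)
  rw [← hΛ, hc, Finset.sum_eq_single_of_mem ξ₀ hξ₀ (fun ξ hξ hne => by
    rw [Finset.prod_eq_zero (Finset.mem_erase.2 ⟨hne, hξ⟩) (by rw [← hv, sub_self])]; simp), norm_mul,
    norm_ch, mul_one, norm_mul, norm_prod] at h2
  have h3 : (t / (2 * √(lam : ℝ))) ^ (N - 1) ≤ ∏ i ∈ Λ.erase ξ₀, ‖v ξ₀ - v i‖ := by
    rw [← hc, ← Finset.prod_const]
    refine Finset.prod_le_prod (fun _ _ => by positivity) fun i hi => ?_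
    refine le_norm_freqShift_sub hl ht0.le ht4 hξ₀ (Finset.mem_of_mem_erase hi) hl ?_
    have hne : ξ₀ ≠ i := (Finset.ne_of_mem_erase hi).symm
    have h1 : 1 ≤ (ξ₀.1 - i.1) ^ 2 + (ξ₀.2 - i.2) ^ 2 := by
      by_contra hlt
      have hs1 := sq_nonneg (ξ₀.1 - i.1)
      have hs2 := sq_nonneg (ξ₀.2 - i.2)
      have e1 : (ξ₀.1 - i.1) ^ 2 = 0 := by omega
      have e2 : (ξ₀.2 - i.2) ^ 2 = 0 := by omega
      exact hne (Prod.ext (sub_eq_zero.1 (by simpa using e1)) (sub_eq_zero.1 (by simpa using e2)))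
    have : (0 : ℤ) ≤ lam := by positivity
    nlinarith
  have ha : 1 / (N : ℝ) ≤ ‖a ξ₀‖ := by
    have h1 : ‖a ξ₀‖ ≤ 1 := by
      have : ‖a ξ₀‖ ^ 2 ≤ 1 := by
        rw [← hmass]
        exact Finset.single_le_sum (f := fun ξ => ‖a ξ‖ ^ 2) (fun _ _ => by positivity) hξ₀
      exact (sq_le_one_iff₀ (norm_nonneg _)).1 this
    nlinarith [norm_nonneg (a ξ₀)]
  have h4 : 1 / (N : ℝ) * (t / (2 * √(lam : ℝ))) ^ (N - 1) ≤ 5 ^ (N - 1) * Real.exp (-(l : ℝ)) :=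
    (mul_le_mul ha h3 (by positivity) (norm_nonneg _)).trans h2
  have hsq : √(lam : ℝ) ≤ lam := by
    rw [Real.sqrt_le_left (by linarith)]; nlinarith
  have h5 : Real.exp l ≤ N * (40 * N * √(lam : ℝ)) ^ (N - 1) := by
    have e1 : (40 * N * √(lam : ℝ)) ^ (N - 1) * (t / (2 * √(lam : ℝ))) ^ (N - 1) = 5 ^ (N - 1) := by
      rw [← mul_pow]; congr 1; rw [ht]; field_simp; norm_num
    have h7 : Real.exp (-(l : ℝ)) * Real.exp l = 1 := by rw [← Real.exp_add]; simp
    have hp : 0 < (t / (2 * √(lam : ℝ))) ^ (N - 1) := by positivity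
    refine le_of_mul_le_mul_right (a := (t / (2 * √(lam : ℝ))) ^ (N - 1)) ?_ hp
    rw [mul_assoc, e1]
    have h8 := mul_le_mul_of_nonneg_left h4 (show (0 : ℝ) ≤ N * Real.exp l by positivity)
    calc _ = N * Real.exp l * (1 / N * (t / (2 * √(lam : ℝ))) ^ (N - 1)) := by field_simp
      _ ≤ _ := h8
      _ = N * 5 ^ (N - 1) * (Real.exp (-(l : ℝ)) * Real.exp l) := by ring
      _ = _ := by rw [h7, mul_one]
  have h6 : (N : ℝ) * (40 * N * √(lam : ℝ)) ^ (N - 1) ≤ (40 * N * lam : ℝ) ^ N := by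
    have e1 : (40 * N * lam : ℝ) ^ N = (40 * N * lam : ℝ) ^ (N - 1) * (40 * N * lam) := by
      rw [← pow_succ, Nat.sub_add_cancel hN]
    rw [e1, mul_comm (N : ℝ)]
    refine mul_le_mul (pow_le_pow_left₀ (by positivity)
      (mul_le_mul_of_nonneg_left hsq (by positivity)) _) ?_ (by positivity) (by positivity)
    nlinarith
  linarith

theorem RelBound.card_relSet_le {ι : Type} [Fintype ι] {A : Finset (ℤ × ℤ)} {D : ℕ}
    (hD : RelBound ι A D) (b : Finset ι) : (relSet A b).card ≤ A.card * D := by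
  classical
  rcases b.eq_empty_or_nonempty with rfl | ⟨i, hi⟩
  · have : relSet A (∅ : Finset ι) = ∅ := by
      rw [Finset.eq_empty_iff_forall_notMem]
      intro v hv
      exact Finset.not_nonempty_empty (mem_relSet.1 hv).2.2.1
    rw [this]; simp
  · rw [Finset.card_eq_sum_card_fiberwise (f := fun v => v i) (t := A)
      (fun v hv => (mem_relSet.1 hv).1 i hi)]
    rw [← smul_eq_mul]
    refine Finset.sum_le_card_nsmul _ _ _ fun ξ _ => ?_
    convert hD b i hi ξ

/-- The number of ways to label `n` objects by an initial segment of at most `n` labels. -/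
def labelCount (n : ℕ) : ℕ := ∑ m ∈ Finset.range (n + 1), m ^ n

theorem card_zeroSum_le {ι : Type} [Fintype ι] [DecidableEq ι] {A : Finset (ℤ × ℤ)}
    (hA : A.Nonempty) {D : ℕ} (hD : RelBound ι A D) (V : Finset (ι → ℤ × ℤ))
    (hV : ∀ v ∈ V, (∀ i, v i ∈ A) ∧ ∑ i, v i = 0) (m : ℕ)
    (hm : ∀ v ∈ V, ∀ (n : ℕ) (c : ι → Fin n), Function.Surjective c →
      (∀ b, ZeroMin v (Finset.univ.filter fun i => c i = b)) → n ≤ m) :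
    V.card ≤ labelCount (Fintype.card ι) * (A.card * (D + 1)) ^ m := by
  classical
  let S : ∀ n, (ι → Fin n) → Finset (ι → ℤ × ℤ) := fun n c => V.filter fun v =>
    Function.Surjective c ∧ ∀ b, ZeroMin v (Finset.univ.filter fun i => c i = b)
  have hsub : V ⊆ (Finset.range (Fintype.card ι + 1)).biUnion fun n =>
      (Finset.univ : Finset (ι → Fin n)).biUnion fun c => S n c := by
    intro v hv
    obtain ⟨n, c, hc, hb⟩ := exists_blocks v (hV v hv).2
    have hn : n ≤ Fintype.card ι := by simpa using Fintype.card_le_of_surjective c hc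
    simp only [Finset.mem_biUnion, Finset.mem_range, Finset.mem_univ, true_and]
    refine ⟨n, by omega, c, Finset.mem_filter.2 ⟨hv, hc, fun b => ?_⟩⟩
    convert hb b
  have hS : ∀ n c, (S n c).card ≤ (A.card * (D + 1)) ^ m := by
    intro n c
    rcases (S n c).eq_empty_or_nonempty with h0 | ⟨v0, hv0⟩
    · rw [h0]; simp
    obtain ⟨hv0, hc, hb0⟩ := Finset.mem_filter.1 hv0
    have hnm := hm v0 hv0 n c hc hb0
    have h1 : (S n c).card ≤ (Fintype.piFinset fun b : Fin n =>
        relSet A (Finset.univ.filter fun i => c i = b)).card := by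
      refine Finset.card_le_card_of_injOn (fun v b i => if c i = b then v i else 0) ?_ ?_
      · intro v hv
        obtain ⟨hv, -, hb⟩ := Finset.mem_filter.1 hv
        refine Fintype.mem_piFinset.2 fun b => mem_relSet.2 ⟨fun i hi => ?_, fun i hi => ?_, ?_⟩
        · simp only [Finset.mem_filter, Finset.mem_univ, true_and] at hi
          simp only [hi, if_true]
          exact (hV v hv).1 i
        · simp only [Finset.mem_filter, Finset.mem_univ, true_and] at hi
          simp [hi]
        · refine (hb b).congr fun i hi => ?_
          simp only [Finset.mem_filter, Finset.mem_univ, true_and] at hi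
          simp [hi]
      · intro v _ w _ h
        funext i
        have := congrFun (congrFun h (c i)) i
        simpa using this
    refine h1.trans ?_
    rw [Fintype.card_piFinset]
    refine (Finset.prod_le_prod' fun b _ => (hD.card_relSet_le _).trans
      (Nat.mul_le_mul_left _ (Nat.le_succ D))).trans ?_
    rw [Finset.prod_const, Finset.card_univ, Fintype.card_fin]
    exact Nat.pow_le_pow_right (Nat.mul_pos hA.card_pos (Nat.succ_pos _)) hnm
  refine (Finset.card_le_card hsub).trans (Finset.card_biUnion_le.trans ?_)
  rw [labelCount, Finset.sum_mul]
  refine Finset.sum_le_sum fun n _ => Finset.card_biUnion_le.trans ?_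
  refine (Finset.sum_le_card_nsmul _ _ _ fun c _ => hS n c).trans (le_of_eq ?_)
  simp [smul_eq_mul]

/-- With `2 * r` terms there are at most `r` blocks. -/
theorem two_mul_blocks_le {ι : Type} [Fintype ι] [DecidableEq ι] {v : ι → ℤ × ℤ}
    (hv0 : ∀ i, v i ≠ 0) {n : ℕ} (c : ι → Fin n)
    (hb : ∀ b, ZeroMin v (Finset.univ.filter fun i => c i = b)) :
    2 * n ≤ Fintype.card ι := by
  rw [← Finset.card_univ, Finset.card_eq_sum_card_fiberwise (f := c) (t := Finset.univ)
    (fun _ _ => Finset.mem_univ _)]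
  have : ∑ _b : Fin n, 2 = 2 * n := by simp [mul_comm]
  rw [← this]
  refine Finset.sum_le_sum fun b _ => ?_
  by_contra hlt
  obtain ⟨hne, hs, -⟩ := hb b
  have h1 : (Finset.univ.filter fun i => c i = b).card = 1 := by
    have := hne.card_pos; omega
  obtain ⟨i, hi⟩ := Finset.card_eq_one.1 h1
  rw [hi, Finset.sum_singleton] at hs
  exact hv0 i hs

/-- If some term has no opposite partner, there are fewer blocks. -/
theorem two_mul_blocks_lt {ι : Type} [Fintype ι] [DecidableEq ι] {v : ι → ℤ × ℤ}
    (hv0 : ∀ i, v i ≠ 0) (i₀ : ι) (hp : ∀ i, i ≠ i₀ → v i ≠ -v i₀) {n : ℕ} (c : ι → Fin n)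
    (hb : ∀ b, ZeroMin v (Finset.univ.filter fun i => c i = b)) :
    2 * n < Fintype.card ι := by
  rw [← Finset.card_univ, Finset.card_eq_sum_card_fiberwise (f := c) (t := Finset.univ)
    (fun _ _ => Finset.mem_univ _)]
  have : ∑ _b : Fin n, 2 = 2 * n := by simp [mul_comm]
  rw [← this]
  have key : ∀ b, 2 ≤ (Finset.univ.filter fun i => c i = b).card := by
    intro b
    by_contra hlt
    obtain ⟨hne, hs, -⟩ := hb b
    have h1 : (Finset.univ.filter fun i => c i = b).card = 1 := by
      have := hne.card_pos; omega
    obtain ⟨i, hi⟩ := Finset.card_eq_one.1 h1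
    rw [hi, Finset.sum_singleton] at hs
    exact hv0 i hs
  refine Finset.sum_lt_sum (fun b _ => key b) ⟨c i₀, Finset.mem_univ _, ?_⟩
  by_contra hlt
  have h2 : (Finset.univ.filter fun i => c i = c i₀).card = 2 := by
    have := key (c i₀); omega
  obtain ⟨-, hs, -⟩ := hb (c i₀)
  have hmem : i₀ ∈ Finset.univ.filter fun i => c i = c i₀ := by simp
  rw [← Finset.add_sum_erase _ _ hmem] at hs
  have h3 : ((Finset.univ.filter fun i => c i = c i₀).erase i₀).card = 1 := by
    rw [Finset.card_erase_of_mem hmem, h2]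
  obtain ⟨i, hi⟩ := Finset.card_eq_one.1 h3
  rw [hi, Finset.sum_singleton] at hs
  have hne : i ≠ i₀ := by
    have : i ∈ (Finset.univ.filter fun i => c i = c i₀).erase i₀ := by rw [hi]; simp
    exact Finset.ne_of_mem_erase this
  exact hp i hne (eq_neg_of_add_eq_zero_right hs)

open Classical in
/-- The `j`-th moment of `∑ a ξ e(ξ·x)`, expanded over vanishing sums. -/
def momSum (A : Finset (ℤ × ℤ)) (a : ℤ × ℤ → ℂ) (j : ℕ) : ℂ :=
  ∑ v : Fin j → A, if ∑ i, (v i : ℤ × ℤ) = 0 then ∏ i, a (v i) else 0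

theorem ch_sum' {κ : Type*} (t : Finset κ) (v : κ → ℤ × ℤ) (x : E2) :
    ch (∑ i ∈ t, v i) x = ∏ i ∈ t, ch (v i) x := by
  classical
  induction t using Finset.induction_on with
  | empty => simp [ch_zero]
  | insert j t hj ih => rw [Finset.sum_insert hj, Finset.prod_insert hj, ch_add_left, ih]

theorem integral_pow_eq_momSum (A : Finset (ℤ × ℤ)) (a : ℤ × ℤ → ℂ) (j : ℕ) :
    ∫ x, (∑ ξ ∈ A, a ξ * ch ξ x) ^ j ∂μT = momSum A a j := by
  have h : ∀ x, (∑ ξ ∈ A, a ξ * ch ξ x) ^ j =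
      ∑ v : Fin j → A, (∏ i, a (v i)) * ch (∑ i, (v i : ℤ × ℤ)) x := by
    intro x
    rw [← Finset.sum_coe_sort, Fintype.sum_pow]
    refine Finset.sum_congr rfl fun v _ => ?_
    rw [Finset.prod_mul_distrib, ch_sum']
  simp only [h]
  rw [integral_sum_ch]
  unfold momSum
  refine Finset.sum_congr rfl fun v _ => ?_
  congr

section pairing
variable {A : Finset (ℤ × ℤ)} (hneg : ∀ ξ ∈ A, -ξ ∈ A)

/-- Insert the pair `x, -x` at the positions `0` and `i + 1`. -/
def insertPair (m : ℕ) (i : Fin (m + 1)) (x : A) (w : Fin m → A) : Fin (m + 2) → A :=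
  Fin.cons x (Fin.insertNth i ⟨-(x : ℤ × ℤ), hneg _ x.2⟩ w)

theorem sum_paired {E : Type*} [AddCommMonoid E] [DecidableEq (ℤ × ℤ)] (m : ℕ)
    (i : Fin (m + 1)) (F : (Fin (m + 2) → A) → E) :
    ∑ v : Fin (m + 2) → A, (if (v i.succ : ℤ × ℤ) = -(v 0 : ℤ × ℤ) then F v else 0) =
      ∑ x : A, ∑ w : Fin m → A, F (insertPair hneg m i x w) := by
  rw [← (Fin.consEquiv fun _ => A).sum_comp, Fintype.sum_prod_type]
  refine Finset.sum_congr rfl fun x _ => ?_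
  rw [← (Fin.insertNthEquiv (fun _ => A) i).sum_comp, Fintype.sum_prod_type]
  rw [Finset.sum_eq_single (⟨-(x : ℤ × ℤ), hneg _ x.2⟩ : A)]
  · refine Finset.sum_congr rfl fun w _ => ?_
    simp [Fin.consEquiv, Fin.insertNthEquiv, insertPair]
  · intro y _ hy
    refine Finset.sum_eq_zero fun w _ => ?_
    rw [if_neg]
    simp only [Fin.consEquiv, Fin.insertNthEquiv, Equiv.coe_fn_mk, Fin.cons_succ, Fin.cons_zero,
      Fin.insertNth_apply_same]
    exact fun h => hy (Subtype.ext h)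
  · simp

theorem sum_insertPair (m : ℕ) (i : Fin (m + 1)) (x : A) (w : Fin m → A) :
    ∑ k, (insertPair hneg m i x w k : ℤ × ℤ) = ∑ k, (w k : ℤ × ℤ) := by
  rw [Fin.sum_univ_succ, Fin.sum_univ_succAbove _ i]
  simp [insertPair]

theorem prod_insertPair {M : Type*} [CommMonoid M] (g : ℤ × ℤ → M) (m : ℕ) (i : Fin (m + 1))
    (x : A) (w : Fin m → A) :
    ∏ k, g (insertPair hneg m i x w k) = g x * (g (-x) * ∏ k, g (w k)) := by
  rw [Fin.prod_univ_succ, Fin.prod_univ_succAbove _ i]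
  simp [insertPair]

open Classical in
/-- The number of terms opposite to the first one. -/
def partners {m : ℕ} (v : Fin (m + 2) → A) : ℝ :=
  ∑ i : Fin (m + 1), if (v i.succ : ℤ × ℤ) = -(v 0 : ℤ × ℤ) then 1 else 0

open Classical in
theorem partners_insertPair (m : ℕ) (i : Fin (m + 1)) (x : A) (w : Fin m → A) :
    partners (insertPair hneg m i x w) =
      1 + ∑ k, if (w k : ℤ × ℤ) = -(x : ℤ × ℤ) then (1 : ℝ) else 0 := by
  unfold partners
  rw [Fin.sum_univ_succAbove _ i]
  simp [insertPair]

open Classical in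
theorem momSum_step (hneg : ∀ ξ ∈ A, -ξ ∈ A) {a : ℤ × ℤ → ℂ}
    (ha : ∑ ξ ∈ A, a ξ * a (-ξ) = 1) (m : ℕ) :
    momSum A a (m + 2) - (m + 1) * momSum A a m =
      ∑ v : Fin (m + 2) → A, ((1 - partners v : ℝ) : ℂ) *
        if ∑ i, (v i : ℤ × ℤ) = 0 then ∏ i, a (v i) else 0 := by
  have h1 : ∀ i : Fin (m + 1), ∑ v : Fin (m + 2) → A,
      (if (v i.succ : ℤ × ℤ) = -(v 0 : ℤ × ℤ) then
        (if ∑ i, (v i : ℤ × ℤ) = 0 then ∏ i, a (v i) else 0) else 0) = momSum A a m := by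
    intro i
    rw [sum_paired hneg]
    simp only [sum_insertPair, prod_insertPair hneg a]
    rw [momSum]
    refine Eq.trans ?_ (one_mul _)
    rw [← ha, ← Finset.sum_coe_sort A, Finset.sum_mul]
    refine Finset.sum_congr rfl fun x _ => ?_
    rw [Finset.mul_sum]
    refine Finset.sum_congr rfl fun w _ => ?_
    split_ifs <;> ring
  have h2 : ((m : ℂ) + 1) * momSum A a m = ∑ i : Fin (m + 1), ∑ v : Fin (m + 2) → A,
      (if (v i.succ : ℤ × ℤ) = -(v 0 : ℤ × ℤ) then
        (if ∑ i, (v i : ℤ × ℤ) = 0 then ∏ i, a (v i) else 0) else 0) := by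
    simp only [h1]; simp
  rw [h2, Finset.sum_comm, momSum, ← Finset.sum_sub_distrib]
  refine Finset.sum_congr rfl fun v _ => ?_
  unfold partners
  push_cast
  rw [sub_mul, one_mul, Finset.sum_mul]
  congr 1
  refine Finset.sum_congr rfl fun i _ => ?_
  split_ifs <;> simp

open Classical in
/-- The moments of the absolute values. -/
def absSum (A : Finset (ℤ × ℤ)) (a : ℤ × ℤ → ℂ) (j : ℕ) : ℝ :=
  ∑ v : Fin j → A, if ∑ i, (v i : ℤ × ℤ) = 0 then ∏ i, ‖a (v i)‖ else 0

theorem prod_norm_le {a : ℤ × ℤ → ℂ} {B : ℝ} (hB : ∀ ξ ∈ A, ‖a ξ‖ ^ 2 ≤ B) (r : ℕ)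
    (v : Fin (2 * r) → A) : ∏ i, ‖a (v i)‖ ≤ B ^ r := by
  have hB0 : ∀ i : Fin (2 * r), 0 ≤ B := fun i => (sq_nonneg _).trans (hB _ (v i).2)
  rcases Nat.eq_zero_or_pos r with rfl | hr
  · simp
  have hB0 := hB0 ⟨0, by omega⟩
  calc ∏ i, ‖a (v i)‖ ≤ ∏ _i : Fin (2 * r), √B :=
        Finset.prod_le_prod (fun _ _ => norm_nonneg _) fun i _ => Real.le_sqrt_of_sq_le (hB _ (v i).2)
    _ = B ^ r := by
        rw [Finset.prod_const, Finset.card_univ, Fintype.card_fin, pow_mul, Real.sq_sqrt hB0]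

theorem sum_filter_zeroSum_le (hA : A.Nonempty) {D r s : ℕ}
    (hD : RelBound (Fin (2 * r)) A D) {a : ℤ × ℤ → ℂ}
    (hB : ∀ ξ ∈ A, ‖a ξ‖ ^ 2 ≤ 100 / A.card) (V : Finset (Fin (2 * r) → A))
    (hV : ∀ v ∈ V, ∑ i, (v i : ℤ × ℤ) = 0)
    (hs : ∀ v ∈ V, ∀ (n : ℕ) (c : Fin (2 * r) → Fin n),
      (∀ b, ZeroMin (fun i => (v i : ℤ × ℤ)) (Finset.univ.filter fun i => c i = b)) → n ≤ s) :
    ∑ v ∈ V, ∏ i, ‖a (v i)‖ ≤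
      labelCount (2 * r) * (A.card * (D + 1) : ℝ) ^ s * (100 / A.card : ℝ) ^ r := by
  classical
  have hinj : Function.Injective fun (v : Fin (2 * r) → A) i => (v i : ℤ × ℤ) :=
    fun v w h => funext fun i => Subtype.ext (congrFun h i)
  have hc := card_zeroSum_le hA hD (V.image fun v i => (v i : ℤ × ℤ)) (by
    intro u hu
    obtain ⟨v, hv, rfl⟩ := Finset.mem_image.1 hu
    exact ⟨fun i => (v i).2, hV v hv⟩) s (by
    intro u hu n c _ hb
    obtain ⟨v, hv, rfl⟩ := Finset.mem_image.1 hu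
    exact hs v hv n c hb)
  rw [Finset.card_image_of_injective _ hinj, Fintype.card_fin] at hc
  refine (Finset.sum_le_card_nsmul _ _ _ fun v _ => prod_norm_le hB r v).trans ?_
  rw [nsmul_eq_mul]
  refine mul_le_mul_of_nonneg_right ?_ (by positivity)
  exact_mod_cast hc

theorem absSum_le (h0 : (0 : ℤ × ℤ) ∉ A) (hA : A.Nonempty) {D r : ℕ}
    (hD : RelBound (Fin (2 * r)) A D) {a : ℤ × ℤ → ℂ}
    (hB : ∀ ξ ∈ A, ‖a ξ‖ ^ 2 ≤ 100 / A.card) :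
    absSum A a (2 * r) ≤ labelCount (2 * r) * (100 * (D + 1) : ℝ) ^ r := by
  classical
  unfold absSum
  rw [← Finset.sum_filter]
  have hN : (A.card : ℝ) ≠ 0 := by exact_mod_cast hA.card_pos.ne'
  refine (sum_filter_zeroSum_le hA hD hB _ (fun v hv => (Finset.mem_filter.1 hv).2)
    (s := r) ?_).trans (le_of_eq ?_)
  · intro v _ n c hb
    have := two_mul_blocks_le (fun i => fun h => h0 (by have := (v i).2; rwa [h] at this)) c hb
    rw [Fintype.card_fin] at this
    omega
  · rw [mul_assoc, ← mul_pow]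
    congr 2; field_simp

/-- The constant in the moment recursion. -/
def momConst (r D : ℕ) : ℝ :=
  labelCount (2 * (r + 1)) * (D + 1) ^ r * 100 ^ (r + 1) +
    (2 * r + 1) * (2 * r) * 100 * (labelCount (2 * r) * (100 * (D + 1)) ^ r)

theorem norm_momSum_step_le (hneg : ∀ ξ ∈ A, -ξ ∈ A) (h0 : (0 : ℤ × ℤ) ∉ A) (hA : A.Nonempty) {D r : ℕ}
    (hD : RelBound (Fin (2 * r)) A D) (hD' : RelBound (Fin (2 * (r + 1))) A D)
    {a : ℤ × ℤ → ℂ} (hB : ∀ ξ ∈ A, ‖a ξ‖ ^ 2 ≤ 100 / A.card)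
    (hconj : ∀ ξ, a (-ξ) = starRingEnd ℂ (a ξ)) (hmass : ∑ ξ ∈ A, ‖a ξ‖ ^ 2 = 1) :
    ‖momSum A a (2 * (r + 1)) - (2 * r + 1) * momSum A a (2 * r)‖ ≤ momConst r D / A.card := by
  classical
  have hN : (0 : ℝ) < A.card := by exact_mod_cast hA.card_pos
  have hpn : ∀ j (v : Fin j → A), 0 ≤ ∏ i, ‖a (v i)‖ := fun j v =>
    Finset.prod_nonneg fun _ _ => norm_nonneg _
  have ha : ∑ ξ ∈ A, a ξ * a (-ξ) = 1 := by
    have : ((∑ ξ ∈ A, ‖a ξ‖ ^ 2 : ℝ) : ℂ) = 1 := by rw [hmass]; simp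
    rw [← this]
    push_cast
    exact Finset.sum_congr rfl fun ξ _ => by rw [hconj, Complex.mul_conj']
  have hstep := momSum_step hneg ha (2 * r)
  push_cast at hstep
  change momSum A a (2 * r + 2) - _ = _ at hstep
  rw [show 2 * (r + 1) = 2 * r + 2 by ring, hstep]
  set W : (Fin (2 * r + 2) → A) → ℝ := fun v =>
    if ∑ i, (v i : ℤ × ℤ) = 0 then ∏ i, ‖a (v i)‖ else 0 with hW
  have hW0 : ∀ v, 0 ≤ W v := fun v => by
    simp only [hW]; split_ifs
    · exact hpn _ _
    · exact le_rfl
  have hP : ∀ v : Fin (2 * r + 2) → A, |1 - partners v| ≤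
      (if partners v = 0 then 1 else 0) + partners v * (partners v - 1) := by
    intro v
    have hnat : ∃ k : ℕ, partners v = k := by
      refine ⟨∑ i : Fin (2 * r + 1), if (v i.succ : ℤ × ℤ) = -(v 0 : ℤ × ℤ) then 1 else 0, ?_⟩
      unfold partners; push_cast; rfl
    obtain ⟨k, hk⟩ := hnat
    rw [hk]
    rcases k with _ | k
    · simp
    · have h1 : ((k + 1 : ℕ) : ℝ) ≠ 0 := by positivity
      rw [if_neg h1]
      push_cast
      rw [abs_of_nonpos (by linarith [k.cast_nonneg (α := ℝ)])]
      nlinarith [k.cast_nonneg (α := ℝ)]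
  have hfirst : ‖∑ v : Fin (2 * r + 2) → A, ((1 : ℂ) - (partners v : ℂ)) *
        (if ∑ i, (v i : ℤ × ℤ) = 0 then ∏ i, a (v i) else 0)‖ ≤
      ∑ v : Fin (2 * r + 2) → A, (if partners v = 0 then W v else 0) +
        ∑ v : Fin (2 * r + 2) → A, partners v * ((partners v - 1) * W v) := by
    rw [← Finset.sum_add_distrib]
    refine (norm_sum_le _ _).trans (Finset.sum_le_sum fun v _ => ?_)
    rw [norm_mul]
    have e1 : ‖(1 : ℂ) - (partners v : ℂ)‖ = |1 - partners v| := by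
      rw [← Complex.ofReal_one, ← Complex.ofReal_sub, Complex.norm_real, Real.norm_eq_abs]
    have e2 : ‖(if ∑ i, (v i : ℤ × ℤ) = 0 then ∏ i, a (v i) else 0 : ℂ)‖ = W v := by
      simp only [hW]
      split_ifs
      · rw [norm_prod]
      · simp
    rw [e1, e2]
    refine (mul_le_mul_of_nonneg_right (hP v) (hW0 v)).trans (le_of_eq ?_)
    split_ifs <;> ring
  refine hfirst.trans ?_
  have hbad1 : ∑ v : Fin (2 * r + 2) → A, (if partners v = 0 then W v else 0) ≤
      labelCount (2 * (r + 1)) * (D + 1) ^ r * 100 ^ (r + 1) / A.card := by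
    have e : ∑ v : Fin (2 * r + 2) → A, (if partners v = 0 then W v else 0) =
        ∑ v ∈ Finset.univ.filter (fun v : Fin (2 * r + 2) → A =>
          partners v = 0 ∧ ∑ i, (v i : ℤ × ℤ) = 0), ∏ i, ‖a (v i)‖ := by
      rw [Finset.sum_filter]
      refine Finset.sum_congr rfl fun v _ => ?_
      simp only [hW]
      by_cases h1 : partners v = 0 <;> by_cases h2 : ∑ i, (v i : ℤ × ℤ) = 0 <;> simp [h1, h2]
    rw [e]
    refine (sum_filter_zeroSum_le (r := r + 1) (s := r) hA hD' hB _
      (fun v hv => (Finset.mem_filter.1 hv).2.2) ?_).trans (le_of_eq ?_)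
    · intro v hv n c hb
      have hp0 := (Finset.mem_filter.1 hv).2.1
      have := two_mul_blocks_lt (fun i => fun h => h0 (by have := (v i).2; rwa [h] at this))
        (0 : Fin (2 * r + 2)) (fun i hi heq => by
          obtain ⟨k, rfl⟩ := Fin.exists_succ_eq_of_ne_zero hi
          have h3 : (1 : ℝ) ≤ partners v := by
            unfold partners
            refine le_trans (le_of_eq ?_) (Finset.single_le_sum (f := fun i : Fin (2 * r + 1) =>
              if (v i.succ : ℤ × ℤ) = -(v 0 : ℤ × ℤ) then (1 : ℝ) else 0)
              (fun i _ => by split_ifs <;> norm_num) (Finset.mem_univ k))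
            simp [heq]
          linarith) c hb
      rw [Fintype.card_fin] at this
      omega
    · rw [div_pow, pow_succ (A.card : ℝ), mul_pow]
      field_simp
  have hbad2 : ∑ v : Fin (2 * r + 2) → A, partners v * ((partners v - 1) * W v) ≤
      (2 * r + 1) * (2 * r) * 100 * (labelCount (2 * r) * (100 * (D + 1)) ^ r) / A.card := by
    have e1 : ∑ v : Fin (2 * r + 2) → A, partners v * ((partners v - 1) * W v) =
        ∑ i : Fin (2 * r + 1), ∑ v : Fin (2 * r + 2) → A,
          if (v i.succ : ℤ × ℤ) = -(v 0 : ℤ × ℤ) then (partners v - 1) * W v else 0 := by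
      rw [Finset.sum_comm]
      refine Finset.sum_congr rfl fun v _ => ?_
      nth_rewrite 1 [partners]
      rw [Finset.sum_mul]
      refine Finset.sum_congr rfl fun i _ => ?_
      split_ifs <;> simp
    have e2 : ∀ i : Fin (2 * r + 1), ∑ v : Fin (2 * r + 2) → A,
          (if (v i.succ : ℤ × ℤ) = -(v 0 : ℤ × ℤ) then (partners v - 1) * W v else 0) ≤
        (2 * r) * (100 / A.card) * absSum A a (2 * r) := by
      intro i
      rw [sum_paired hneg, Finset.sum_comm, absSum, Finset.mul_sum]
      refine Finset.sum_le_sum fun w _ => ?_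
      simp only [hW, partners_insertPair, sum_insertPair, prod_insertPair hneg fun ξ => ‖a ξ‖,
        add_sub_cancel_left]
      split_ifs with hw
      · have e3 : ∀ x : A, (∑ k, if (w k : ℤ × ℤ) = -(x : ℤ × ℤ) then (1 : ℝ) else 0) *
            (‖a x‖ * (‖a (-x)‖ * ∏ k, ‖a (w k)‖)) =
            (∑ k, if (w k : ℤ × ℤ) = -(x : ℤ × ℤ) then ‖a x‖ ^ 2 else 0) * ∏ k, ‖a (w k)‖ := by
          intro x
          rw [hconj, RCLike.norm_conj]
          have : ∀ k, (if (w k : ℤ × ℤ) = -(x : ℤ × ℤ) then ‖a x‖ ^ 2 else 0) =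
              (if (w k : ℤ × ℤ) = -(x : ℤ × ℤ) then (1 : ℝ) else 0) * ‖a x‖ ^ 2 := fun k => by
            split_ifs <;> simp
          simp only [this]
          rw [← Finset.sum_mul]; ring
        simp only [e3]
        rw [← Finset.sum_mul]
        refine mul_le_mul_of_nonneg_right ?_ (hpn _ _)
        rw [Finset.sum_comm]
        have e4 : ∀ k : Fin (2 * r), ∑ x : A,
            (if (w k : ℤ × ℤ) = -(x : ℤ × ℤ) then ‖a x‖ ^ 2 else 0) ≤ 100 / A.card := by
          intro k
          rw [Finset.sum_eq_single (⟨-(w k : ℤ × ℤ), hneg _ (w k).2⟩ : A)]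
          · simp only [neg_neg, if_true]
            exact hB _ (hneg _ (w k).2)
          · intro x _ hx
            rw [if_neg]
            intro h
            exact hx (Subtype.ext (neg_eq_iff_eq_neg.2 h).symm)
          · simp
        refine (Finset.sum_le_card_nsmul _ _ _ fun k _ => e4 k).trans (le_of_eq ?_)
        simp
      · simp
    rw [e1]
    refine (Finset.sum_le_card_nsmul _ _ _ fun i _ => e2 i).trans ?_
    have e5 := absSum_le h0 hA hD hB
    rw [Finset.card_univ, Fintype.card_fin, nsmul_eq_mul]
    push_cast
    calc _ ≤ (2 * r + 1 : ℝ) * ((2 * r) * (100 / A.card) *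
          (labelCount (2 * r) * (100 * (D + 1)) ^ r)) := by gcongr
      _ = _ := by ring
  refine (add_le_add hbad1 hbad2).trans (le_of_eq ?_)
  rw [momConst]; ring
end pairing

theorem nonneg_of_deriv_nonneg {g g' : ℝ → ℝ} (hg : ∀ y, HasDerivAt g (g' y) y) (h0 : 0 ≤ g 0)
    (h : ∀ y, 0 ≤ y → 0 ≤ g' y) (y : ℝ) (hy : 0 ≤ y) : 0 ≤ g y := by
  have hm : MonotoneOn g (Set.Ici 0) := by
    refine monotoneOn_of_deriv_nonneg (convex_Ici 0)
      (fun x _ => (hg x).continuousAt.continuousWithinAt)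
      (fun x _ => (hg x).differentiableAt.differentiableWithinAt) fun x hx => ?_
    rw [interior_Ici] at hx
    rw [(hg x).deriv]
    exact h x (le_of_lt hx)
  exact h0.trans (hm Set.self_mem_Ici hy hy)

/-- Taylor polynomial of the cosine. -/
def cosT (n : ℕ) (y : ℝ) : ℝ := ∑ j ∈ Finset.range n, (-1) ^ j * y ^ (2 * j) / (2 * j).factorial

/-- Taylor polynomial of the sine. -/
def sinT (n : ℕ) (y : ℝ) : ℝ :=
  ∑ j ∈ Finset.range n, (-1) ^ j * y ^ (2 * j + 1) / (2 * j + 1).factorial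

theorem hasDerivAt_pow_div_factorial (n : ℕ) (y : ℝ) :
    HasDerivAt (fun y : ℝ => y ^ (n + 1) / (n + 1).factorial) (y ^ n / n.factorial) y := by
  have h := (hasDerivAt_pow (n + 1) y).div_const ((n + 1).factorial : ℝ)
  have e : y ^ n / n.factorial = ((n + 1 : ℕ) : ℝ) * y ^ (n + 1 - 1) / (n + 1).factorial := by
    rw [Nat.factorial_succ]
    push_cast
    have : (n.factorial : ℝ) ≠ 0 := by positivity
    have : (n : ℝ) + 1 ≠ 0 := by positivity
    field_simp
  rw [e]
  exact h

theorem hasDerivAt_sinT (n : ℕ) (y : ℝ) : HasDerivAt (sinT n) (cosT n y) y := by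
  unfold sinT cosT
  refine HasDerivAt.fun_sum fun j _ => ?_
  simp only [mul_div_assoc]
  exact (hasDerivAt_pow_div_factorial (2 * j) y).const_mul _

theorem hasDerivAt_cosT (n : ℕ) (y : ℝ) : HasDerivAt (cosT (n + 1)) (-sinT n y) y := by
  have e : cosT (n + 1) = fun y => (∑ j ∈ Finset.range n,
      (-1 : ℝ) ^ (j + 1) * (y ^ (2 * j + 1 + 1) / (2 * j + 1 + 1).factorial)) + 1 := by
    funext y
    rw [cosT, Finset.sum_range_succ']
    simp [mul_add, mul_div_assoc]
  rw [e, sinT, ← Finset.sum_neg_distrib]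
  refine HasDerivAt.add_const _ (HasDerivAt.fun_sum fun j _ => ?_)
  have := (hasDerivAt_pow_div_factorial (2 * j + 1) y).const_mul ((-1 : ℝ) ^ (j + 1))
  have e2 : -((-1) ^ j * y ^ (2 * j + 1) / (2 * j + 1).factorial) =
      (-1 : ℝ) ^ (j + 1) * (y ^ (2 * j + 1) / (2 * j + 1).factorial) := by
    rw [pow_succ]; ring
  rw [e2]
  exact this

theorem cosT_sinT_alternating (n : ℕ) : (∀ y : ℝ, 0 ≤ y → 0 ≤ (-1) ^ (n + 1) * (Real.cos y - cosT (n + 1) y)) ∧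
    ∀ y : ℝ, 0 ≤ y → 0 ≤ (-1) ^ (n + 1) * (Real.sin y - sinT (n + 1) y) := by
  have key : ∀ n, (∀ y : ℝ, 0 ≤ y → 0 ≤ (-1) ^ (n + 1) * (Real.cos y - cosT (n + 1) y)) →
      ∀ y : ℝ, 0 ≤ y → 0 ≤ (-1) ^ (n + 1) * (Real.sin y - sinT (n + 1) y) := fun n h =>
    nonneg_of_deriv_nonneg (g' := fun y => (-1) ^ (n + 1) * (Real.cos y - cosT (n + 1) y))
      (fun y => ((Real.hasDerivAt_sin y).sub (hasDerivAt_sinT _ y)).const_mul _)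
      (by simp [sinT]) h
  induction n with
  | zero =>
    have h : ∀ y : ℝ, 0 ≤ y → 0 ≤ (-1) ^ (0 + 1) * (Real.cos y - cosT (0 + 1) y) := by
      intro y _
      simp [cosT, Real.cos_le_one]
    exact ⟨h, key 0 h⟩
  | succ n ih =>
    have h := nonneg_of_deriv_nonneg
      (g := fun y => (-1) ^ (n + 1 + 1) * (Real.cos y - cosT (n + 1 + 1) y))
      (fun y => ((Real.hasDerivAt_cos y).sub (hasDerivAt_cosT (n + 1) y)).const_mul _)
      (by rw [cosT, Finset.sum_range_succ']; simp) (fun y hy => by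
        have := ih.2 y hy
        rw [pow_succ]; linarith)
    exact ⟨h, key _ h⟩

theorem exp_neg_alternating (n : ℕ) : ∀ y : ℝ, 0 ≤ y →
    0 ≤ (-1) ^ n * (Real.exp (-y) - ∑ j ∈ Finset.range n, (-1) ^ j * (y ^ j / j.factorial)) := by
  induction n with
  | zero => intro y _; simp [Real.exp_nonneg]
  | succ n ih =>
    refine nonneg_of_deriv_nonneg (g' := fun y => (-1) ^ (n + 1) * (Real.exp (-y) * (-1) -
      ∑ j ∈ Finset.range n, (-1) ^ (j + 1) * (y ^ j / j.factorial))) (fun y => ?_) ?_ fun y hy => ?_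
    · have e : (fun y : ℝ => ∑ j ∈ Finset.range (n + 1), (-1) ^ j * (y ^ j / j.factorial)) =
          fun y => (∑ j ∈ Finset.range n, (-1 : ℝ) ^ (j + 1) * (y ^ (j + 1) / (j + 1).factorial)) + 1 := by
        funext y
        rw [Finset.sum_range_succ']
        simp
      have h1 : HasDerivAt (fun y : ℝ => ∑ j ∈ Finset.range (n + 1), (-1) ^ j * (y ^ j / j.factorial))
          (∑ j ∈ Finset.range n, (-1) ^ (j + 1) * (y ^ j / j.factorial)) y := by
        rw [e]
        exact HasDerivAt.add_const _ (HasDerivAt.fun_sum fun j _ =>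
          (hasDerivAt_pow_div_factorial j y).const_mul _)
      exact ((hasDerivAt_neg y).exp.sub h1).const_mul _
    · rw [Finset.sum_range_succ']; simp
    · refine (ih y hy).trans (le_of_eq ?_)
      have : ∑ j ∈ Finset.range n, (-1 : ℝ) ^ (j + 1) * (y ^ j / j.factorial) =
          -∑ j ∈ Finset.range n, (-1) ^ j * (y ^ j / j.factorial) := by
        rw [← Finset.sum_neg_distrib]
        exact Finset.sum_congr rfl fun j _ => by rw [pow_succ]; ring
      rw [this, pow_succ]; ring

/-- A polynomial majorant of a multiple of the indicator of `[-1,1]`. -/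
def kerT (q : ℕ) (y : ℝ) : ℝ :=
  ∑ j ∈ Finset.range (2 * q + 1), (-1) ^ j * y ^ (2 * j) / (2 * j + 2).factorial

theorem kerT_abs (q : ℕ) (y : ℝ) : kerT q |y| = kerT q y := by
  unfold kerT
  refine Finset.sum_congr rfl fun j _ => ?_
  rw [pow_mul, sq_abs, ← pow_mul]

theorem one_sub_cos_le_sq_mul_kerT (q : ℕ) {y : ℝ} (hy : 0 ≤ y) :
    1 - Real.cos y ≤ y ^ 2 * kerT q y := by
  have h1 := (cosT_sinT_alternating (2 * q + 1)).1 y hy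
  have h2 : cosT (2 * q + 1 + 1) y = 1 - y ^ 2 * kerT q y := by
    rw [cosT, Finset.sum_range_succ', kerT, Finset.mul_sum]
    simp only [mul_zero, pow_zero, Nat.factorial_zero, Nat.cast_one, mul_one, div_one]
    rw [add_comm, sub_eq_add_neg, ← Finset.sum_neg_distrib]
    congr 1
    refine Finset.sum_congr rfl fun j _ => ?_
    rw [mul_add, pow_succ, pow_add]; ring
  have h3 : (-1 : ℝ) ^ (2 * q + 1 + 1) = 1 := by
    rw [show 2 * q + 1 + 1 = 2 * (q + 1) by ring, pow_mul]; simp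
  rw [h3, h2] at h1
  linarith

theorem kerT_nonneg (q : ℕ) (y : ℝ) : 0 ≤ kerT q y := by
  rw [← kerT_abs]
  rcases (abs_nonneg y).eq_or_lt with h | h
  · rw [← h, kerT, Finset.sum_range_succ', Finset.sum_eq_zero]
    · simp
    · intro j _; simp
  · have h1 := one_sub_cos_le_sq_mul_kerT q h.le
    have h2 := Real.cos_le_one |y|
    have h3 : 0 < |y| ^ 2 := by positivity
    by_contra hlt
    push Not at hlt
    nlinarith

theorem one_third_le_kerT (q : ℕ) {y : ℝ} (hy : |y| ≤ 1) : 1 / 3 ≤ kerT q y := by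
  rw [← kerT_abs]
  rcases (abs_nonneg y).eq_or_lt with h | h
  · rw [← h, kerT, Finset.sum_range_succ', Finset.sum_eq_zero]
    · norm_num [Nat.factorial]
    · intro j _; simp
  · have h1 := one_sub_cos_le_sq_mul_kerT q h.le
    have h2 := (cosT_sinT_alternating 2).1 |y| h.le
    have h4 : cosT 3 |y| = 1 - |y| ^ 2 / 2 + |y| ^ 4 / 24 := by
      simp [cosT, Finset.sum_range_succ, Nat.factorial]; ring
    norm_num at h2
    rw [h4] at h2
    rw [Real.cos_abs] at h1
    have h3 : 0 < |y| ^ 2 := by positivity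
    have h5 : |y| ^ 2 ≤ 1 := by nlinarith
    have h6 : |y| ^ 4 = |y| ^ 2 * |y| ^ 2 := by ring
    by_contra hlt
    push Not at hlt
    nlinarith

/-- The even moments of the standard Gaussian. -/
def gMom : ℕ → ℝ
  | 0 => 1
  | r + 1 => (2 * r + 1) * gMom r

theorem gMom_div (r : ℕ) : gMom r / (2 * r + 2).factorial =
    1 / (2 ^ r * r.factorial) * (1 / ((2 * r + 1) * (2 * r + 2))) := by
  have h : gMom r * (2 ^ r * r.factorial) = (2 * r).factorial := by
    induction r with
    | zero => simp [gMom]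
    | succ r ih =>
      rw [gMom, Nat.factorial_succ, show 2 * (r + 1) = 2 * r + 1 + 1 by ring, Nat.factorial_succ,
        Nat.factorial_succ, pow_succ]
      push_cast
      rw [← ih]; ring
  rw [Nat.factorial_succ, Nat.factorial_succ]
  push_cast
  rw [← h]
  have : (r.factorial : ℝ) ≠ 0 := by positivity
  have : gMom r ≠ 0 := by
    intro h0; rw [h0, zero_mul] at h
    have : ((2 * r).factorial : ℝ) ≠ 0 := by positivity
    exact this h.symm
  field_simp
  ring

theorem integral_one_sub_mul_pow (j : ℕ) :
    ∫ s in (0 : ℝ)..1, (1 - s) * s ^ (2 * j) = 1 / ((2 * j + 1) * (2 * j + 2)) := by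
  have : ∀ s : ℝ, (1 - s) * s ^ (2 * j) = s ^ (2 * j) - s ^ (2 * j + 1) := fun s => by ring
  simp only [this]
  rw [intervalIntegral.integral_sub (by simp) (by simp), integral_pow, integral_pow]
  push_cast
  have h1 : (2 * (j : ℝ) + 1) ≠ 0 := by positivity
  have h2 : (2 * (j : ℝ) + 1 + 1) ≠ 0 := by positivity
  have h3 : (2 * (j : ℝ) + 2) ≠ 0 := by positivity
  simp
  field_simp
  ring

theorem gMom_sum_le (q : ℕ) {U : ℝ} (hU : 0 < U) :
    ∑ j ∈ Finset.range (2 * q + 1), (-1) ^ j * (gMom j * U ^ (2 * j)) / (2 * j + 2).factorial ≤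
      2 / U + (U ^ 2 / 2) ^ (2 * q) / (2 * q).factorial := by
  have e : ∀ j, (-1) ^ j * (gMom j * U ^ (2 * j)) / (2 * j + 2).factorial =
      ∫ s in (0 : ℝ)..1, (1 - s) * ((-1) ^ j * ((U ^ 2 * s ^ 2 / 2) ^ j / j.factorial)) := by
    intro j
    have h1 : ∀ s : ℝ, (1 - s) * ((-1) ^ j * ((U ^ 2 * s ^ 2 / 2) ^ j / j.factorial)) =
        ((-1) ^ j * U ^ (2 * j) * (1 / (2 ^ j * j.factorial))) * ((1 - s) * s ^ (2 * j)) := by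
      intro s
      rw [div_pow, mul_pow, ← pow_mul, ← pow_mul]
      have : (j.factorial : ℝ) ≠ 0 := by positivity
      field_simp
    simp only [h1]
    rw [intervalIntegral.integral_const_mul, integral_one_sub_mul_pow, mul_assoc _ (1 / _) (1 / _),
      ← gMom_div]
    ring
  simp only [e]
  rw [← intervalIntegral.integral_finsetSum (fun j _ => by
    apply Continuous.intervalIntegrable; fun_prop)]
  set τ : ℝ := (U ^ 2 / 2) ^ (2 * q) / (2 * q).factorial with hτ
  have hτ0 : 0 ≤ τ := by positivity
  have hg : ∫ s in (0 : ℝ)..1, Real.exp (-(U ^ 2 / 2) * s ^ 2) ≤ 2 / U := by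
    have hb : 0 < U ^ 2 / 2 := by positivity
    rw [intervalIntegral.integral_of_le zero_le_one]
    have h1 : ∫ s in Set.Ioc (0 : ℝ) 1, Real.exp (-(U ^ 2 / 2) * s ^ 2) ≤
        ∫ s in Set.Ioi (0 : ℝ), Real.exp (-(U ^ 2 / 2) * s ^ 2) :=
      setIntegral_mono_set (integrable_exp_neg_mul_sq hb).integrableOn
        (Eventually.of_forall fun _ => (Real.exp_pos _).le)
        (Set.Ioc_subset_Ioi_self.eventuallyLE)
    refine h1.trans ?_
    rw [integral_gaussian_Ioi]
    have h2 : √(Real.pi / (U ^ 2 / 2)) ≤ 4 / U := by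
      rw [Real.sqrt_le_left (by positivity), div_pow, div_le_div_iff₀ hb (by positivity)]
      nlinarith [Real.pi_lt_four, Real.pi_pos, sq_pos_of_pos hU]
    linarith [show (4 : ℝ) / U = 2 * (2 / U) by ring]
  calc _ ≤ ∫ s in (0 : ℝ)..1, (Real.exp (-(U ^ 2 / 2) * s ^ 2) + τ) := by
        refine intervalIntegral.integral_mono_on zero_le_one ?_ ?_ fun s hs => ?_
        · apply Continuous.intervalIntegrable; fun_prop
        · apply Continuous.intervalIntegrable; fun_prop
        · rw [← Finset.mul_sum]
          have hz : 0 ≤ U ^ 2 * s ^ 2 / 2 := by positivity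
          have h1 := exp_neg_alternating (2 * q) (U ^ 2 * s ^ 2 / 2) hz
          have h3 : (-1 : ℝ) ^ (2 * q) = 1 := by rw [pow_mul]; simp
          rw [h3, one_mul] at h1
          rw [Finset.sum_range_succ, h3, one_mul]
          have h4 : (U ^ 2 * s ^ 2 / 2) ^ (2 * q) / (2 * q).factorial ≤ τ := by
            rw [hτ]
            gcongr
            have : s ^ 2 ≤ 1 := by nlinarith [hs.1, hs.2]
            nlinarith [sq_nonneg U]
          have h5 : -(U ^ 2 / 2) * s ^ 2 = -(U ^ 2 * s ^ 2 / 2) := by ring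
          rw [h5]
          have h6 : 0 ≤ Real.exp (-(U ^ 2 * s ^ 2 / 2)) + τ := by positivity
          calc _ ≤ (1 - s) * (Real.exp (-(U ^ 2 * s ^ 2 / 2)) + τ) :=
                mul_le_mul_of_nonneg_left (by linarith) (by linarith [hs.2])
            _ ≤ _ := mul_le_of_le_one_left h6 (by linarith [hs.1])
    _ ≤ 2 / U + τ := by
        rw [intervalIntegral.integral_add (by apply Continuous.intervalIntegrable; fun_prop) (by simp)]
        simp only [intervalIntegral.integral_const, sub_zero, one_smul]
        linarith

theorem exists_kerT_bound (L : ℕ) : ∃ (q : ℕ) (δ : ℝ), 0 < δ ∧ ∀ m : ℕ → ℝ,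
    (∀ r ≤ 2 * q, |m r - gMom r| ≤ δ) → ∀ l ≤ L,
    3 * ∑ j ∈ Finset.range (2 * q + 1),
      (-1) ^ j * (m j * Real.exp l ^ (2 * j)) / (2 * j + 2).factorial ≤ 12 * Real.exp (-(l : ℝ)) := by
  have ht := (FloorSemiring.tendsto_pow_div_factorial_atTop (Real.exp L ^ 2 / 2)).comp
    (tendsto_id.const_mul_atTop' (show 0 < 2 by norm_num) : Tendsto (fun n : ℕ => 2 * n) atTop atTop)
  obtain ⟨q, hq⟩ := (ht.eventually (eventually_le_nhds (Real.exp_pos (-(L : ℝ))))).exists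
  simp only [Function.comp] at hq
  set B : ℝ := ∑ j ∈ Finset.range (2 * q + 1), Real.exp L ^ (2 * j) with hB
  have hB0 : 0 < B := Finset.sum_pos (fun j _ => by positivity) ⟨0, by simp⟩
  refine ⟨q, Real.exp (-(L : ℝ)) / B, by positivity, fun m hm l hl => ?_⟩
  have hl' : (l : ℝ) ≤ L := by exact_mod_cast hl
  have hel : Real.exp l ≤ Real.exp L := Real.exp_le_exp.2 hl'
  have hLl : Real.exp (-(L : ℝ)) ≤ Real.exp (-(l : ℝ)) := Real.exp_le_exp.2 (by linarith)
  have h1 := gMom_sum_le q (Real.exp_pos l)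
  have h2 : (Real.exp l ^ 2 / 2) ^ (2 * q) / (2 * q).factorial ≤ Real.exp (-(L : ℝ)) := by
    refine le_trans ?_ hq
    gcongr
  have h3 : ∑ j ∈ Finset.range (2 * q + 1),
      (-1) ^ j * (m j * Real.exp l ^ (2 * j)) / (2 * j + 2).factorial ≤
      ∑ j ∈ Finset.range (2 * q + 1),
      (-1) ^ j * (gMom j * Real.exp l ^ (2 * j)) / (2 * j + 2).factorial + Real.exp (-(L : ℝ)) := by
    rw [← sub_le_iff_le_add', ← Finset.sum_sub_distrib]
    calc _ ≤ ∑ j ∈ Finset.range (2 * q + 1), Real.exp (-(L : ℝ)) / B * Real.exp L ^ (2 * j) := by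
          refine Finset.sum_le_sum fun j hj => ?_
          have hj' : j ≤ 2 * q := by have := Finset.mem_range.1 hj; omega
          rw [← sub_div, ← mul_sub, ← sub_mul]
          refine (le_abs_self _).trans ?_
          rw [abs_div, abs_mul, abs_pow, abs_neg, abs_one, one_pow, one_mul, abs_mul, Nat.abs_cast]
          refine (div_le_self (by positivity) ?_).trans ?_
          · exact_mod_cast Nat.one_le_iff_ne_zero.2 (Nat.factorial_ne_zero _)
          · rw [abs_of_nonneg (by positivity : (0 : ℝ) ≤ Real.exp l ^ (2 * j))]
            exact mul_le_mul (hm j hj') (pow_le_pow_left₀ (by positivity) hel _) (by positivity)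
              (by positivity)
      _ = Real.exp (-(L : ℝ)) := by
          rw [← Finset.mul_sum, ← hB, div_mul_cancel₀ _ hB0.ne']
  have h4 : 2 / Real.exp l = 2 * Real.exp (-(l : ℝ)) := by rw [Real.exp_neg]; rfl
  linarith

/-- Error amplification in the moment recursion. -/
def momErr : ℕ → ℝ
  | 0 => 0
  | r + 1 => (2 * r + 1) * momErr r + 1

theorem momErr_nonneg (r : ℕ) : 0 ≤ momErr r := by
  induction r with
  | zero => simp [momErr]
  | succ r ih => rw [momErr]; positivity

theorem abs_sub_gMom_le {m : ℕ → ℝ} {ε : ℝ} {K : ℕ} (h0 : m 0 = 1)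
    (h : ∀ r < K, |m (r + 1) - (2 * r + 1) * m r| ≤ ε) :
    ∀ r ≤ K, |m r - gMom r| ≤ momErr r * ε := by
  intro r
  induction r with
  | zero => intro _; simp [h0, gMom, momErr]
  | succ r ih =>
    intro hr
    have h1 := ih (by omega)
    have h2 := h r (by omega)
    rw [gMom, momErr]
    have e : m (r + 1) - (2 * r + 1) * gMom r =
        (m (r + 1) - (2 * r + 1) * m r) + (2 * r + 1) * (m r - gMom r) := by ring
    rw [e]
    refine (abs_add_le _ _).trans ?_
    rw [abs_mul, abs_of_nonneg (by positivity : (0 : ℝ) ≤ 2 * r + 1)]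
    nlinarith [mul_le_mul_of_nonneg_left h1 (by positivity : (0 : ℝ) ≤ 2 * r + 1)]

theorem IsEigenfunction.exists_bound {lam : ℕ} {a : ℤ × ℤ → ℂ} {f : E2 → ℝ}
    (h : IsEigenfunction lam a f) : ∃ C : ℝ, ∀ x, |f x| ≤ C := by
  refine ⟨∑ ξ ∈ latticePts lam, ‖a ξ‖, fun x => ?_⟩
  have : |f x| = ‖(f x : ℂ)‖ := by simp
  rw [this, h.eq_sum]
  refine (norm_sum_le _ _).trans (Finset.sum_le_sum fun ξ _ => ?_)
  rw [norm_mul, norm_ch, mul_one]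

theorem IsEigenfunction.integrable_pow {lam : ℕ} {a : ℤ × ℤ → ℂ} {f : E2 → ℝ}
    (h : IsEigenfunction lam a f) (j : ℕ) : Integrable (fun x => f x ^ j) μT := by
  obtain ⟨C, hC⟩ := h.exists_bound
  refine Integrable.of_bound (h.continuous.pow j).aestronglyMeasurable (C ^ j)
    (Eventually.of_forall fun x => ?_)
  rw [norm_pow, Real.norm_eq_abs]
  exact pow_le_pow_left₀ (abs_nonneg _) (hC x) _

theorem IsEigenfunction.momSum_eq {lam : ℕ} {a : ℤ × ℤ → ℂ} {f : E2 → ℝ}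
    (h : IsEigenfunction lam a f) (j : ℕ) :
    momSum (latticePts lam) a j = ((∫ x, f x ^ j ∂μT : ℝ) : ℂ) := by
  rw [← integral_pow_eq_momSum, ← integral_complex_ofReal]
  simp only [← h.eq_sum, Complex.ofReal_pow]

theorem measureReal_abs_le_le {lam : ℕ} {a : ℤ × ℤ → ℂ} {f : E2 → ℝ}
    (h : IsEigenfunction lam a f) (q l : ℕ) :
    μT.real {x | |f x| ≤ Real.exp (-(l : ℝ))} ≤ 3 * ∑ j ∈ Finset.range (2 * q + 1),
      (-1) ^ j * ((∫ x, f x ^ (2 * j) ∂μT) * Real.exp l ^ (2 * j)) / (2 * j + 2).factorial := by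
  have hm : MeasurableSet {x | |f x| ≤ Real.exp (-(l : ℝ))} :=
    (isClosed_le h.continuous.abs continuous_const).measurableSet
  have e : ∀ x, 3 * kerT q (f x * Real.exp l) = ∑ j ∈ Finset.range (2 * q + 1),
      (3 * ((-1) ^ j * Real.exp l ^ (2 * j) / (2 * j + 2).factorial)) * f x ^ (2 * j) := by
    intro x
    rw [kerT, Finset.mul_sum]
    refine Finset.sum_congr rfl fun j _ => ?_
    rw [mul_pow]; ring
  have hi : ∀ j ∈ Finset.range (2 * q + 1), Integrable (fun x =>
      (3 * ((-1) ^ j * Real.exp l ^ (2 * j) / (2 * j + 2).factorial)) * f x ^ (2 * j)) μT :=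
    fun j _ => (h.integrable_pow _).const_mul _
  calc μT.real {x | |f x| ≤ Real.exp (-(l : ℝ))}
      = ∫ x, Set.indicator {x | |f x| ≤ Real.exp (-(l : ℝ))} (fun _ => (1 : ℝ)) x ∂μT := by
        rw [integral_indicator hm]; simp
    _ ≤ ∫ x, 3 * kerT q (f x * Real.exp l) ∂μT := by
        refine integral_mono ((integrable_const 1).indicator hm) ?_ fun x => ?_
        · simp only [e]
          exact integrable_finsetSum _ hi
        · by_cases hx : |f x| ≤ Real.exp (-(l : ℝ))
          · have hx' : x ∈ {x | |f x| ≤ Real.exp (-(l : ℝ))} := hx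
            simp only [Set.indicator_of_mem hx']
            have : |f x * Real.exp l| ≤ 1 := by
              rw [abs_mul, abs_of_pos (Real.exp_pos _)]
              calc _ ≤ Real.exp (-(l : ℝ)) * Real.exp l := by gcongr
                _ = 1 := by rw [← Real.exp_add]; simp
            linarith [one_third_le_kerT q this]
          · have hx' : x ∉ {x | |f x| ≤ Real.exp (-(l : ℝ))} := hx
            simp only [Set.indicator_of_notMem hx']
            linarith [kerT_nonneg q (f x * Real.exp l)]
    _ = _ := by
        simp only [e]
        rw [integral_finsetSum _ hi, Finset.mul_sum]
        refine Finset.sum_congr rfl fun j _ => ?_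
        rw [integral_const_mul]; ring

theorem exists_small_ball (L : ℕ) : ∃ J : ℕ, ∀ D : ℕ, ∃ N0 : ℕ, ∀ lam : ℕ, 0 < lam →
    N0 ≤ (latticePts lam).card → (∀ j ≤ J, RelBound (Fin j) (latticePts lam) D) →
    ∀ (R : ℝ) (a : ℤ × ℤ → ℂ) (f : E2 → ℝ), IsEigenfunction lam a f → IsFlat lam a →
    ∀ l ≤ L, μT.real (smallSet lam R f l) ≤ 12 * Real.exp (-(l : ℝ)) := by
  obtain ⟨q, δ, hδ, hq⟩ := exists_kerT_bound L
  refine ⟨2 * (2 * q + 1), fun D => ?_⟩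
  set E : ℝ := ∑ r ∈ Finset.range (2 * q + 1), momErr r + 1 with hE
  have hE0 : 0 < E := by
    have := Finset.sum_nonneg fun r (_ : r ∈ Finset.range (2 * q + 1)) => momErr_nonneg r
    linarith
  have hEr : ∀ r ≤ 2 * q, momErr r ≤ E := fun r hr => by
    have := Finset.single_le_sum (f := momErr) (fun r _ => momErr_nonneg r)
      (Finset.mem_range.2 (by omega : r < 2 * q + 1))
    linarith
  set M : ℝ := ∑ r ∈ Finset.range (2 * q + 1), momConst r D with hM
  have hMn : ∀ r, 0 ≤ momConst r D := fun r => by unfold momConst; positivity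
  have hMr : ∀ r ≤ 2 * q, momConst r D ≤ M := fun r hr =>
    Finset.single_le_sum (f := fun r => momConst r D) (fun r _ => hMn r)
      (Finset.mem_range.2 (by omega : r < 2 * q + 1))
  obtain ⟨N0, hN0⟩ := exists_nat_gt (M * E / δ)
  refine ⟨N0 + 1, fun lam hlam hN hrel R a f h hf l hl => ?_⟩
  have hA : (latticePts lam).Nonempty := Finset.card_pos.1 (by omega)
  have hNr : (N0 : ℝ) ≤ (latticePts lam).card := by exact_mod_cast (by omega : N0 ≤ _)
  have hNp : (0 : ℝ) < (latticePts lam).card := by exact_mod_cast Finset.card_pos.2 hA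
  have h0 : (0 : ℤ × ℤ) ∉ latticePts lam := by
    rw [mem_latticePts]; simp; omega
  set m : ℕ → ℝ := fun r => ∫ x, f x ^ (2 * r) ∂μT with hm
  have hstep : ∀ r < 2 * q, |m (r + 1) - (2 * r + 1) * m r| ≤ δ / E := by
    intro r hr
    have h1 := norm_momSum_step_le (hneg := fun ξ hξ => neg_mem_latticePts.2 hξ) h0 hA (r := r)
      (hrel _ (by omega)) (hrel _ (by omega)) (fun ξ hξ => hf.le ξ hξ) h.2.1 h.2.2.1
    rw [h.momSum_eq, h.momSum_eq] at h1
    have h2 : ((∫ x, f x ^ (2 * (r + 1)) ∂μT : ℝ) : ℂ) - (2 * r + 1) * ((∫ x, f x ^ (2 * r) ∂μT : ℝ) : ℂ)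
        = ((m (r + 1) - (2 * r + 1) * m r : ℝ) : ℂ) := by
      simp only [hm]; push_cast; rfl
    rw [h2, Complex.norm_real, Real.norm_eq_abs] at h1
    refine h1.trans ?_
    rw [div_le_div_iff₀ hNp hE0]
    have h3 : M * E < δ * N0 := by
      rw [div_lt_iff₀ hδ] at hN0; linarith
    have h4 : momConst r D * E ≤ M * E := by gcongr; exact hMr r hr.le
    nlinarith
  have hclose : ∀ r ≤ 2 * q, |m r - gMom r| ≤ δ := by
    intro r hr
    refine (abs_sub_gMom_le (m := m) (ε := δ / E) (K := 2 * q) (by simp [hm]) hstep r hr).trans ?_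
    rw [mul_div_assoc', div_le_iff₀ hE0]
    nlinarith [hEr r hr]
  refine le_trans ?_ ((measureReal_abs_le_le h q l).trans (hq m hclose l hl))
  refine measureReal_mono (fun x hx => ?_)
  have := hx 0 (by simp)
  simpa using this

theorem sum_Ioc_sum_divisors {M : Type*} [AddCommMonoid M] (F : ℕ → ℕ → M) (N : ℕ) :
    ∑ n ∈ Finset.Ioc 0 N, ∑ d ∈ n.divisors, F d (n / d) =
      ∑ d ∈ Finset.Ioc 0 N, ∑ m ∈ Finset.Ioc 0 (N / d), F d m := by
  rw [Finset.sum_sigma', Finset.sum_sigma']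
  refine Finset.sum_bij' (fun x _ => ⟨x.2, x.1 / x.2⟩) (fun x _ => ⟨x.1 * x.2, x.1⟩) ?_ ?_ ?_ ?_ ?_
  · rintro ⟨n, d⟩ h
    simp only [Finset.mem_sigma, Finset.mem_Ioc, Nat.mem_divisors] at h ⊢
    obtain ⟨⟨hn, hnN⟩, hd, hn0⟩ := h
    have hd0 := Nat.pos_of_dvd_of_pos hd hn
    exact ⟨⟨hd0, (Nat.le_of_dvd hn hd).trans hnN⟩, Nat.div_pos (Nat.le_of_dvd hn hd) hd0,
      Nat.div_le_div_right hnN⟩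
  · rintro ⟨d, m⟩ h
    simp only [Finset.mem_sigma, Finset.mem_Ioc, Nat.mem_divisors] at h ⊢
    obtain ⟨⟨hd, hdN⟩, hm, hmN⟩ := h
    have h1 : d * m ≤ N := by
      rw [mul_comm]; exact (Nat.le_div_iff_mul_le hd).1 hmN
    exact ⟨⟨Nat.mul_pos hd hm, h1⟩, Dvd.intro _ rfl, (Nat.mul_pos hd hm).ne'⟩
  · rintro ⟨n, d⟩ h
    simp only [Finset.mem_sigma, Nat.mem_divisors] at h
    simp only [Sigma.mk.injEq, heq_eq_eq, and_true]
    exact Nat.mul_div_cancel' h.2.1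
  · rintro ⟨d, m⟩ h
    simp only [Finset.mem_sigma, Finset.mem_Ioc] at h
    simp only [Sigma.mk.injEq, heq_eq_eq, true_and]
    exact Nat.mul_div_cancel_left _ h.1.1
  · rintro ⟨n, d⟩ _
    rfl

/-- The nontrivial character modulo four, with real values. -/
def chi (n : ℕ) : ℝ := ((ZMod.χ₄ (n : ZMod 4) : ℤ) : ℝ)

theorem chi_mul (m n : ℕ) : chi (m * n) = chi m * chi n := by
  rw [chi, chi, chi, ← Int.cast_mul, ← map_mul, Nat.cast_mul]

theorem chi_even {n : ℕ} (h : n % 2 = 0) : chi n = 0 := by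
  rw [chi, ZMod.χ₄_nat_eq_if_mod_four, if_pos h]; simp

theorem chi_one {n : ℕ} (h : n % 4 = 1) : chi n = 1 := by
  rw [chi, ZMod.χ₄_nat_one_mod_four h]; simp

theorem chi_three {n : ℕ} (h : n % 4 = 3) : chi n = -1 := by
  rw [chi, ZMod.χ₄_nat_three_mod_four h]; simp

theorem abs_chi_le (n : ℕ) : |chi n| ≤ 1 := by
  rcases Nat.even_or_odd n with h | h
  · rw [chi_even (Nat.even_iff.1 h)]; simp
  · have : n % 4 = 1 ∨ n % 4 = 3 := by have := Nat.odd_iff.1 h; omega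
    rcases this with h | h
    · rw [chi_one h]; simp
    · rw [chi_three h]; simp

/-- Alternating sums against the character modulo four. -/
theorem sum_chi_mul_bounds {f : ℕ → ℝ} (hf0 : ∀ n, 0 ≤ f n) (k : ℕ) : ∀ a : ℕ,
    (∀ m n, a ≤ m → m ≤ n → f n ≤ f m) →
    ((a % 4 = 0 ∨ a % 4 = 1) → 0 ≤ ∑ m ∈ Finset.Ico a (a + k), chi m * f m ∧
      ∑ m ∈ Finset.Ico a (a + k), chi m * f m ≤ f a) ∧
    ((a % 4 = 2 ∨ a % 4 = 3) → -f a ≤ ∑ m ∈ Finset.Ico a (a + k), chi m * f m ∧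
      ∑ m ∈ Finset.Ico a (a + k), chi m * f m ≤ 0) := by
  induction k with
  | zero => intro a _; simp [hf0 a]
  | succ k ih =>
    intro a hf
    have h := ih (a + 1) fun m n hm hn => hf m n (by omega) hn
    have h1 := hf a (a + 1) le_rfl (by omega)
    have e : ∑ m ∈ Finset.Ico a (a + (k + 1)), chi m * f m =
        chi a * f a + ∑ m ∈ Finset.Ico (a + 1) (a + 1 + k), chi m * f m := by
      rw [Finset.sum_eq_sum_Ico_succ_bot (by omega), show a + (k + 1) = a + 1 + k by ring]
    rw [e]
    have h4 : a % 4 = 0 ∨ a % 4 = 1 ∨ a % 4 = 2 ∨ a % 4 = 3 := by omega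
    rcases h4 with h4 | h4 | h4 | h4
    · have := h.1 (by omega)
      rw [chi_even (by omega)]
      refine ⟨fun _ => ⟨by linarith [this.1], by linarith [this.2]⟩, fun h => by omega⟩
    · have := h.2 (by omega)
      rw [chi_one h4]
      refine ⟨fun _ => ⟨by linarith [this.1], by linarith [this.2]⟩, fun h => by omega⟩
    · have := h.2 (by omega)
      rw [chi_even (by omega)]
      refine ⟨fun h => by omega, fun _ => ⟨by linarith [this.1], by linarith [this.2]⟩⟩
    · have := h.1 (by omega)
      rw [chi_three h4]
      refine ⟨fun h => by omega, fun _ => ⟨by linarith [this.1], by linarith [this.2]⟩⟩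

theorem abs_sum_chi_mul_le {f : ℕ → ℝ} (hf0 : ∀ n, 0 ≤ f n) {a : ℕ} (b : ℕ)
    (hf : ∀ m n, a ≤ m → m ≤ n → f n ≤ f m) :
    |∑ m ∈ Finset.Ioc a b, chi m * f m| ≤ f a := by
  rcases le_or_gt b a with hb | hb
  · rw [Finset.Ioc_eq_empty (by omega)]; simpa using hf0 a
  · have h := sum_chi_mul_bounds hf0 (b - a) (a + 1) fun m n hm hn => hf m n (by omega) hn
    have h1 := hf a (a + 1) le_rfl (by omega)
    have e : Finset.Ico (a + 1) (a + 1 + (b - a)) = Finset.Ioc a b := by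
      ext x; simp; omega
    rw [e] at h
    have h0 := hf0 (a + 1)
    have h4 : ((a + 1) % 4 = 0 ∨ (a + 1) % 4 = 1) ∨ ((a + 1) % 4 = 2 ∨ (a + 1) % 4 = 3) := by omega
    rw [abs_le]
    rcases h4 with h4 | h4
    · have := h.1 h4
      constructor <;> linarith [this.1, this.2]
    · have := h.2 h4
      constructor <;> linarith [this.1, this.2]

open ArithmeticFunction in
theorem sum_vonMangoldt_div_ge {N : ℕ} (hN : 0 < N) :
    Real.log N - 1 ≤ ∑ n ∈ Finset.Ioc 0 N, vonMangoldt n / n := by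
  have hN' : (0 : ℝ) < N := by exact_mod_cast hN
  have h1 : ∑ n ∈ Finset.Ioc 0 N, Real.log n =
      ∑ d ∈ Finset.Ioc 0 N, (N / d : ℕ) * vonMangoldt d := by
    have := sum_Ioc_sum_divisors (fun d _ => (vonMangoldt d : ℝ)) N
    simp only [vonMangoldt_sum, Finset.sum_const, Nat.card_Ioc, Nat.sub_zero, nsmul_eq_mul] at this
    exact this
  have h2 : ∑ n ∈ Finset.Ioc 0 N, Real.log n = Real.log N.factorial := by
    rw [← Finset.prod_Ico_id_eq_factorial, Nat.cast_prod, Real.log_prod]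
    · rfl
    · intro i hi
      have := (Finset.mem_Ico.1 hi).1
      positivity
  have h3 : N * Real.log N - N ≤ Real.log N.factorial := by
    have h4 : (N : ℝ) ^ N / N.factorial ≤ Real.exp N := Real.pow_div_factorial_le_exp _ hN'.le N
    have hf : (0 : ℝ) < N.factorial := by positivity
    have h5 := Real.log_le_log (by positivity) h4
    rw [Real.log_exp, Real.log_div (by positivity) hf.ne', Real.log_pow] at h5
    linarith
  have h4 : ∑ d ∈ Finset.Ioc 0 N, (N / d : ℕ) * vonMangoldt d ≤
      N * ∑ n ∈ Finset.Ioc 0 N, vonMangoldt n / n := by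
    rw [Finset.mul_sum]
    refine Finset.sum_le_sum fun d _ => ?_
    calc ((N / d : ℕ) : ℝ) * vonMangoldt d ≤ (N / d) * vonMangoldt d := by
          gcongr
          exact Nat.cast_div_le
      _ = _ := by ring
  have h5 : N * (Real.log N - 1) ≤ N * ∑ n ∈ Finset.Ioc 0 N, vonMangoldt n / n := by
    rw [mul_sub, mul_one]; linarith
  exact le_of_mul_le_mul_left h5 hN'

open ArithmeticFunction in
theorem sum_vonMangoldt_le (N : ℕ) :
    ∑ n ∈ Finset.Ioc 0 N, vonMangoldt n ≤ 6 * N := by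
  have h := Chebyshev.psi_le_const_mul_self (x := N) (by positivity)
  rw [Chebyshev.psi, Nat.floor_natCast] at h
  have h4 : Real.log 4 ≤ 2 := by
    have : Real.log 4 = 2 * Real.log 2 := by
      rw [show (4 : ℝ) = 2 ^ 2 by norm_num, Real.log_pow]; norm_num
    linarith [Real.log_two_lt_d9]
  refine h.trans ?_
  gcongr
  linarith

open ArithmeticFunction in
theorem sum_vonMangoldt_div_le {N : ℕ} (hN : 0 < N) :
    ∑ n ∈ Finset.Ioc 0 N, vonMangoldt n / n ≤ Real.log N + 6 := by
  have hN' : (0 : ℝ) < N := by exact_mod_cast hN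
  have h1 : ∑ n ∈ Finset.Ioc 0 N, Real.log n =
      ∑ d ∈ Finset.Ioc 0 N, (N / d : ℕ) * vonMangoldt d := by
    have := sum_Ioc_sum_divisors (fun d _ => (vonMangoldt d : ℝ)) N
    simp only [vonMangoldt_sum, Finset.sum_const, Nat.card_Ioc, Nat.sub_zero, nsmul_eq_mul] at this
    exact this
  have h2 : ∑ n ∈ Finset.Ioc 0 N, Real.log n ≤ N * Real.log N := by
    calc _ ≤ ∑ n ∈ Finset.Ioc 0 N, Real.log N := by
          refine Finset.sum_le_sum fun n hn => ?_
          have := Finset.mem_Ioc.1 hn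
          have h0 : (0 : ℝ) < n := by exact_mod_cast this.1
          exact Real.log_le_log h0 (by exact_mod_cast this.2)
      _ = _ := by simp
  have h4 : N * ∑ n ∈ Finset.Ioc 0 N, vonMangoldt n / n ≤
      ∑ d ∈ Finset.Ioc 0 N, (N / d : ℕ) * vonMangoldt d + ∑ n ∈ Finset.Ioc 0 N, vonMangoldt n := by
    rw [Finset.mul_sum, ← Finset.sum_add_distrib]
    refine Finset.sum_le_sum fun d hd => ?_
    have hd0 : (0 : ℝ) < d := by exact_mod_cast (Finset.mem_Ioc.1 hd).1
    calc (N : ℝ) * (vonMangoldt d / d) = (N / d) * vonMangoldt d := by ring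
      _ ≤ ((N / d : ℕ) + 1) * vonMangoldt d := by
          gcongr
          rw [← Nat.floor_div_eq_div (K := ℝ)]
          exact (Nat.lt_floor_add_one _).le
      _ = _ := by ring
  have h5 := sum_vonMangoldt_le N
  have h6 : N * ∑ n ∈ Finset.Ioc 0 N, vonMangoldt n / n ≤ N * (Real.log N + 6) := by
    rw [mul_add]; linarith
  exact le_of_mul_le_mul_left h6 hN'

/-- Partial sums of the series `L(1, χ₄)`. -/
def chiL (M : ℕ) : ℝ := ∑ m ∈ Finset.Ioc 0 M, chi m * (1 / m)

theorem abs_sum_chi_inv_le {a : ℕ} (ha : 0 < a) (b : ℕ) :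
    |∑ m ∈ Finset.Ioc a b, chi m * (1 / m)| ≤ 1 / a := by
  refine abs_sum_chi_mul_le (f := fun m : ℕ => 1 / (m : ℝ)) (fun n => by positivity) b ?_
  intro m n hm hmn
  have h0 : (0 : ℝ) < m := by exact_mod_cast (by omega : 0 < m)
  have h1 : (m : ℝ) ≤ n := by exact_mod_cast hmn
  exact one_div_le_one_div_of_le h0 h1

theorem chiL_eq_add {M N : ℕ} (h : M ≤ N) :
    chiL N = chiL M + ∑ m ∈ Finset.Ioc M N, chi m * (1 / m) := by
  rw [chiL, chiL, Finset.sum_Ioc_consecutive _ (Nat.zero_le _) h]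

theorem half_le_chiL {M : ℕ} (hM : 0 < M) : 1 / 2 ≤ chiL M := by
  have h1 : chiL 1 = 1 := by
    rw [chiL, show Finset.Ioc 0 1 = {1} by rfl, Finset.sum_singleton, chi_one (by norm_num)]
    norm_num
  have h2 : chiL 2 = 1 := by
    rw [chiL_eq_add one_le_two, h1, show Finset.Ioc 1 2 = {2} by rfl, Finset.sum_singleton,
      chi_even (by norm_num)]
    norm_num
  rcases Nat.lt_or_ge M 2 with h | h
  · rw [show M = 1 by omega, h1]; norm_num
  · rw [chiL_eq_add h, h2]
    have := (abs_le.1 (abs_sum_chi_inv_le (a := 2) (by norm_num) M)).1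
    push_cast at this
    linarith

theorem abs_chiL_sub_le {M N : ℕ} (hM : 0 < M) (h : M ≤ N) : |chiL M - chiL N| ≤ 1 / M := by
  rw [chiL_eq_add h, sub_add_cancel_left, abs_neg]
  exact abs_sum_chi_inv_le hM N

theorem abs_sum_chi_log_le (N : ℕ) :
    |∑ n ∈ Finset.Ioc 0 N, chi n * (Real.log n / n)| ≤ 1 := by
  rcases Nat.lt_or_ge N 3 with h | h
  · have : ∑ n ∈ Finset.Ioc 0 N, chi n * (Real.log n / n) = 0 := by
      refine Finset.sum_eq_zero fun n hn => ?_
      have := Finset.mem_Ioc.1 hn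
      obtain rfl | rfl : n = 1 ∨ n = 2 := by omega
      · simp
      · rw [chi_even (by norm_num), zero_mul]
    rw [this]; simp
  · have e : ∑ n ∈ Finset.Ioc 0 N, chi n * (Real.log n / n) =
        ∑ n ∈ Finset.Ioc 3 N, chi n * (Real.log n / n) - Real.log 3 / 3 := by
      rw [← Finset.sum_Ioc_consecutive _ (Nat.zero_le 3) h,
        show Finset.Ioc 0 3 = {1, 2, 3} by rfl]
      simp only [Finset.mem_insert, Finset.mem_singleton, OfNat.one_ne_ofNat, or_self,
        not_false_eq_true, Finset.sum_insert, Nat.cast_one, Real.log_one, zero_div, mul_zero,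
        Finset.sum_singleton, zero_add, Nat.cast_ofNat, Nat.reduceEqDiff]
      rw [chi_even (by norm_num), chi_three (by norm_num)]
      ring
    have h1 := abs_sum_chi_mul_le (f := fun n : ℕ => Real.log n / n)
      (fun n => div_nonneg (Real.log_natCast_nonneg n) (by positivity)) (a := 3) N (by
        intro m n hm hmn
        have h3 : (3 : ℝ) ≤ m := by exact_mod_cast hm
        have h4 : (m : ℝ) ≤ n := by exact_mod_cast hmn
        have he : Real.exp 1 ≤ 3 := by linarith [Real.exp_one_lt_d9]
        exact Real.log_div_self_antitoneOn (he.trans h3) (he.trans (h3.trans h4)) h4)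
    have h3 : Real.log 3 ≤ 3 / 2 := by
      have : Real.log 3 ≤ Real.log 4 := Real.log_le_log (by norm_num) (by norm_num)
      rw [show (4 : ℝ) = 2 ^ 2 by norm_num, Real.log_pow] at this
      have h2 := Real.log_two_lt_d9
      push_cast at this
      linarith
    have h30 : 0 ≤ Real.log 3 := Real.log_nonneg (by norm_num)
    rw [e]
    push_cast at h1
    rw [abs_le] at h1 ⊢
    constructor <;> linarith [h1.1, h1.2]

open ArithmeticFunction in
theorem abs_sum_chi_vonMangoldt_le (N : ℕ) :
    |∑ n ∈ Finset.Ioc 0 N, chi n * (vonMangoldt n / n)| ≤ 26 := by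
  rcases Nat.eq_zero_or_pos N with rfl | hN
  · simp
  have hN' : (0 : ℝ) < N := by exact_mod_cast hN
  have h1 : ∑ n ∈ Finset.Ioc 0 N, chi n * (Real.log n / n) =
      ∑ d ∈ Finset.Ioc 0 N, chi d * (vonMangoldt d / d) * chiL (N / d) := by
    have := sum_Ioc_sum_divisors
      (fun d m => chi d * (vonMangoldt d / d) * (chi m * (1 / m))) N
    simp only [← Finset.mul_sum] at this
    rw [show (∑ d ∈ Finset.Ioc 0 N, chi d * (vonMangoldt d / d) * chiL (N / d)) = _ from
      this.symm]
    refine Finset.sum_congr rfl fun n hn => ?_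
    have hn0 : 0 < n := (Finset.mem_Ioc.1 hn).1
    rw [← vonMangoldt_sum, Finset.sum_div, Finset.mul_sum]
    refine Finset.sum_congr rfl fun d hd => ?_
    have hdn := (Nat.mem_divisors.1 hd).1
    have hd0 := Nat.pos_of_dvd_of_pos hdn hn0
    obtain ⟨m, rfl⟩ := hdn
    have hm0 : m ≠ 0 := by rintro rfl; simp at hn0
    rw [Nat.mul_div_cancel_left _ hd0, chi_mul]
    have : (d : ℝ) ≠ 0 := by exact_mod_cast hd0.ne'
    have : (m : ℝ) ≠ 0 := by exact_mod_cast hm0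
    push_cast
    field_simp
  have h2 : |∑ d ∈ Finset.Ioc 0 N, chi d * (vonMangoldt d / d) * (chiL (N / d) - chiL N)| ≤ 12 := by
    calc _ ≤ ∑ d ∈ Finset.Ioc 0 N, |chi d * (vonMangoldt d / d) * (chiL (N / d) - chiL N)| :=
          Finset.abs_sum_le_sum_abs _ _
      _ ≤ ∑ d ∈ Finset.Ioc 0 N, (2 / N) * vonMangoldt d := by
          refine Finset.sum_le_sum fun d hd => ?_
          obtain ⟨hd0, hdN⟩ := Finset.mem_Ioc.1 hd
          have hd0' : (0 : ℝ) < d := by exact_mod_cast hd0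
          have hq : 0 < N / d := Nat.div_pos hdN hd0
          have hq' : (0 : ℝ) < (N / d : ℕ) := by exact_mod_cast hq
          have h3 : (N : ℝ) ≤ 2 * d * (N / d : ℕ) := by
            have h5 : N < d * (N / d + 1) := by
              have := Nat.lt_div_mul_add hd0 (a := N)
              nlinarith
            have h6 : N ≤ 2 * d * (N / d) := by nlinarith
            exact_mod_cast h6
          have h4 := abs_chiL_sub_le hq (Nat.div_le_self N d)
          have hL : (0 : ℝ) ≤ vonMangoldt d := vonMangoldt_nonneg
          rw [abs_mul, abs_mul, abs_of_nonneg (div_nonneg hL hd0'.le)]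
          calc _ ≤ 1 * (vonMangoldt d / d) * (1 / (N / d : ℕ)) := by
                gcongr
                exact abs_chi_le d
            _ = vonMangoldt d * (1 / (d * (N / d : ℕ))) := by field_simp
            _ ≤ vonMangoldt d * (2 / N) := by
                gcongr ?_ * ?_
                rw [div_le_div_iff₀ (by positivity) hN']
                linarith
            _ = _ := by ring
      _ = (2 / N) * ∑ d ∈ Finset.Ioc 0 N, vonMangoldt d := by rw [Finset.mul_sum]
      _ ≤ (2 / N) * (6 * N) := by gcongr; exact sum_vonMangoldt_le N
      _ = 12 := by field_simp; norm_num
  have h3 := abs_sum_chi_log_le N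
  have h4 : (∑ n ∈ Finset.Ioc 0 N, chi n * (vonMangoldt n / n)) * chiL N =
      ∑ n ∈ Finset.Ioc 0 N, chi n * (Real.log n / n) -
      ∑ d ∈ Finset.Ioc 0 N, chi d * (vonMangoldt d / d) * (chiL (N / d) - chiL N) := by
    rw [h1, ← Finset.sum_sub_distrib, Finset.sum_mul]
    exact Finset.sum_congr rfl fun d _ => by ring
  have h5 : |∑ n ∈ Finset.Ioc 0 N, chi n * (vonMangoldt n / n)| * (1 / 2) ≤ 13 := by
    calc _ ≤ |∑ n ∈ Finset.Ioc 0 N, chi n * (vonMangoldt n / n)| * |chiL N| := by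
          gcongr
          exact (half_le_chiL hN).trans (le_abs_self _)
      _ = _ := (abs_mul _ _).symm
      _ ≤ _ := by
          rw [h4]
          refine (abs_sub _ _).trans ?_
          linarith
  linarith

/-- Primes congruent to one modulo four in the interval `(a, b]`. -/
def primesOne (a b : ℕ) : Finset ℕ := (Finset.Ioc a b).filter fun p => p.Prime ∧ p % 4 = 1

theorem mem_primesOne {a b p : ℕ} : p ∈ primesOne a b ↔ (a < p ∧ p ≤ b) ∧ p.Prime ∧ p % 4 = 1 := by
  rw [primesOne, Finset.mem_filter, Finset.mem_Ioc]

open ArithmeticFunction in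
theorem exists_window : ∃ A : ℕ, 2 ≤ A ∧ ∃ M0 : ℕ, 2 ≤ M0 ∧ ∀ M, M0 ≤ M →
    1 ≤ ∑ p ∈ primesOne M (A * M), Real.log p / p := by
  obtain ⟨C, hC⟩ := Chebyshev.psi_sub_theta_le_mul_sqrt
  obtain ⟨A, hA⟩ := exists_nat_gt (Real.exp 62)
  have hA1 : (1 : ℝ) < A := (Real.one_lt_exp_iff.2 (by norm_num)).trans hA
  have hlogA : 62 ≤ Real.log A := by
    rw [← Real.log_exp 62]; exact Real.log_le_log (Real.exp_pos _) hA.le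
  obtain ⟨M0, hM0⟩ := exists_nat_gt (A * (2 * |C|) ^ 2)
  refine ⟨A, by exact_mod_cast hA1, M0 + 2, by omega, fun M hM => ?_⟩
  have hMpos : (0 : ℝ) < M := by exact_mod_cast (by omega : 0 < M)
  have hA0 : 0 < A := by exact_mod_cast (zero_lt_one.trans hA1)
  have hAM : 0 < A * M := Nat.mul_pos hA0 (by omega)
  have hMA : M ≤ A * M := Nat.le_mul_of_pos_left _ hA0
  have h1 : Real.log A - 59 ≤ ∑ n ∈ Finset.Ioc M (A * M), (1 + chi n) * (vonMangoldt n / n) := by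
    have a1 := sum_vonMangoldt_div_ge hAM
    have a2 := sum_vonMangoldt_div_le (N := M) (by omega)
    have a3 := abs_le.1 (abs_sum_chi_vonMangoldt_le (A * M))
    have a4 := abs_le.1 (abs_sum_chi_vonMangoldt_le M)
    rw [← Finset.sum_Ioc_consecutive _ (Nat.zero_le M) hMA] at a1 a3
    push_cast at a1
    rw [Real.log_mul (by positivity) hMpos.ne'] at a1
    simp only [add_mul, one_mul, Finset.sum_add_distrib]
    linarith [a3.1, a3.2, a4.1, a4.2]
  have h2 : ∑ n ∈ Finset.Ioc M (A * M), (1 + chi n) * (vonMangoldt n / n) ≤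
      ∑ n ∈ Finset.Ioc M (A * M), ((if n.Prime ∧ n % 4 = 1 then 2 * (Real.log n / n) else 0) +
        (if ¬ n.Prime then (2 / M) * vonMangoldt n else 0)) := by
    refine Finset.sum_le_sum fun n hn => ?_
    obtain ⟨hn1, hn2⟩ := Finset.mem_Ioc.1 hn
    have hL : (0 : ℝ) ≤ vonMangoldt n := vonMangoldt_nonneg
    have hMn : (M : ℝ) ≤ n := by exact_mod_cast hn1.le
    by_cases hp : n.Prime
    · rw [if_neg (not_not.2 hp), add_zero, vonMangoldt_apply_prime hp]
      have : n % 4 = 1 ∨ n % 4 = 3 := by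
        have := hp.eq_two_or_odd
        omega
      rcases this with h | h
      · rw [if_pos ⟨hp, h⟩, chi_one h]; norm_num
      · rw [if_neg (by omega), chi_three h]; norm_num
    · rw [if_neg (fun h => hp h.1), if_pos hp, zero_add]
      have hc := (abs_le.1 (abs_chi_le n)).2
      calc _ ≤ 2 * (vonMangoldt n / M) := by
            gcongr
            linarith
        _ = _ := by ring
  have h3 : ∑ n ∈ Finset.Ioc M (A * M), (if ¬ n.Prime then (2 / M) * vonMangoldt n else 0) ≤ 1 := by
    have a1 := Chebyshev.psi_sub_theta_eq_sum_not_prime ((A * M : ℕ) : ℝ)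
    rw [Nat.floor_natCast] at a1
    have a2 := hC ((A * M : ℕ) : ℝ)
    rw [a1] at a2
    rw [← Finset.sum_filter, ← Finset.mul_sum]
    have a3 : ∑ n ∈ (Finset.Ioc M (A * M)).filter (fun n => ¬ n.Prime), vonMangoldt n ≤
        ∑ n ∈ (Finset.Ioc 0 (A * M)).filter (fun n => ¬ n.Prime), vonMangoldt n := by
      refine Finset.sum_le_sum_of_subset_of_nonneg ?_ fun _ _ _ => vonMangoldt_nonneg
      exact Finset.filter_subset_filter _ (Finset.Ioc_subset_Ioc_left (Nat.zero_le _))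
    have a4 : C * √((A * M : ℕ) : ℝ) ≤ M / 2 := by
      have b1 : √((A * M : ℕ) : ℝ) * (2 * |C|) ≤ M := by
        rw [← Real.sqrt_sq (by positivity : 0 ≤ 2 * |C|), ← Real.sqrt_mul (by positivity)]
        apply Real.sqrt_le_iff.2 ⟨hMpos.le, ?_⟩
        push_cast
        have : (M0 : ℝ) ≤ M := by exact_mod_cast (by omega : M0 ≤ M)
        calc (A : ℝ) * M * (2 * |C|) ^ 2 = (A * (2 * |C|) ^ 2) * M := by ring
          _ ≤ (M : ℝ) * M := by gcongr; linarith
          _ = _ := by ring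
      have b2 : C * √((A * M : ℕ) : ℝ) ≤ |C| * √((A * M : ℕ) : ℝ) := by
        gcongr; exact le_abs_self C
      linarith
    calc _ ≤ (2 / M) * ((M : ℝ) / 2) := by
          gcongr
          exact a3.trans (a2.trans a4)
      _ = 1 := by field_simp
  rw [Finset.sum_add_distrib] at h2
  rw [primesOne, Finset.sum_filter]
  have h4 : ∑ n ∈ Finset.Ioc M (A * M), (if n.Prime ∧ n % 4 = 1 then 2 * (Real.log n / n) else 0) =
      2 * ∑ n ∈ Finset.Ioc M (A * M), (if n.Prime ∧ n % 4 = 1 then Real.log n / n else 0) := by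
    rw [Finset.mul_sum]
    exact Finset.sum_congr rfl fun n _ => by split_ifs <;> simp
  linarith

/-- A Chebyshev bound for primes congruent to one modulo four. -/
theorem exists_theta_one_ge : ∃ c : ℝ, 0 < c ∧ ∃ K0 : ℕ, 0 < K0 ∧ ∀ N : ℕ, K0 ≤ N →
    c * N ≤ ∑ p ∈ primesOne 0 N, Real.log p := by
  obtain ⟨A, hA, M0, hM0, h⟩ := exists_window
  have hA0 : (0 : ℝ) < A := by positivity
  refine ⟨1 / (2 * A), by positivity, A * M0, by positivity, fun N hN => ?_⟩
  set M := N / A with hM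
  have hM0M : M0 ≤ M := (Nat.le_div_iff_mul_le (by omega)).2 (by rw [mul_comm]; exact hN)
  have hAM : A * M ≤ N := Nat.mul_div_le N A
  have hMpos : (0 : ℝ) < M := by exact_mod_cast (by omega : 0 < M)
  have h1 : N ≤ 2 * A * M := by
    have h5 : N < A * (M + 1) := by
      have := Nat.lt_div_mul_add (by omega : 0 < A) (a := N)
      nlinarith
    nlinarith
  have h2 : (M : ℝ) ≤ ∑ p ∈ primesOne 0 N, Real.log p := by
    calc (M : ℝ) ≤ M * ∑ p ∈ primesOne M (A * M), Real.log p / p :=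
          le_mul_of_one_le_right hMpos.le (h M hM0M)
      _ ≤ ∑ p ∈ primesOne M (A * M), Real.log p := by
          rw [Finset.mul_sum]
          refine Finset.sum_le_sum fun p hp => ?_
          obtain ⟨⟨hp1, _⟩, hp2, _⟩ := mem_primesOne.1 hp
          have hp0 : (0 : ℝ) < p := by exact_mod_cast hp2.pos
          have : (M : ℝ) ≤ p := by exact_mod_cast hp1.le
          calc (M : ℝ) * (Real.log p / p) ≤ p * (Real.log p / p) := by
                have := Real.log_natCast_nonneg p
                gcongr
            _ = _ := by field_simp
      _ ≤ _ := by
          refine Finset.sum_le_sum_of_subset_of_nonneg ?_ fun p _ _ => Real.log_natCast_nonneg p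
          intro p hp
          have := mem_primesOne.1 hp
          exact mem_primesOne.2 ⟨⟨by omega, by omega⟩, this.2⟩
  refine le_trans ?_ h2
  rw [div_mul_eq_mul_div, one_mul, div_le_iff₀ (by positivity)]
  have : (N : ℝ) ≤ 2 * A * M := by exact_mod_cast h1
  linarith

theorem exists_sum_inv_ge : ∃ A : ℕ, 2 ≤ A ∧ ∃ c : ℝ, 0 < c ∧ ∃ J : ℕ, ∀ j, J ≤ j →
    c / (j + 1) ≤ ∑ p ∈ primesOne (A ^ j) (A ^ (j + 1)), 1 / (p : ℝ) := by
  obtain ⟨A, hA, M0, hM0, h⟩ := exists_window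
  have hA1 : (1 : ℝ) < A := by exact_mod_cast hA
  have hl : 0 < Real.log A := Real.log_pos hA1
  refine ⟨A, hA, 1 / Real.log A, by positivity, M0, fun j hj => ?_⟩
  have h1 := h (A ^ j) (hj.trans (Nat.lt_pow_self (by omega)).le)
  rw [← pow_succ'] at h1
  have h2 : ∑ p ∈ primesOne (A ^ j) (A ^ (j + 1)), Real.log p / p ≤
      ((j + 1) * Real.log A) * ∑ p ∈ primesOne (A ^ j) (A ^ (j + 1)), 1 / (p : ℝ) := by
    rw [Finset.mul_sum]
    refine Finset.sum_le_sum fun p hp => ?_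
    obtain ⟨⟨_, hp1⟩, hp2, _⟩ := mem_primesOne.1 hp
    have hp0 : (0 : ℝ) < p := by exact_mod_cast hp2.pos
    have : Real.log p ≤ (j + 1) * Real.log A := by
      have := Real.log_le_log hp0 (by exact_mod_cast hp1 : (p : ℝ) ≤ (A : ℝ) ^ (j + 1))
      rw [Real.log_pow] at this
      exact_mod_cast this
    rw [mul_one_div]
    gcongr
  have hj0 : (0 : ℝ) < j + 1 := by positivity
  rw [div_div, div_le_iff₀ (by positivity)]
  linarith

open ArithmeticFunction in
/-- The sum of `log q` over prime powers `q ≤ Y` is `O(Y)`. -/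
theorem exists_sum_log_primePow_le : ∃ C : ℝ, 0 < C ∧ ∀ Y : ℕ,
    ∑ q ∈ (Finset.Ioc 0 Y).filter IsPrimePow, Real.log q ≤ C * Y := by
  obtain ⟨C, hC⟩ := Chebyshev.psi_sub_theta_le_mul_sqrt
  refine ⟨2 + 4 * |C|, by positivity, fun Y => ?_⟩
  rcases Nat.eq_zero_or_pos Y with rfl | hY
  · simp
  have hY' : (0 : ℝ) < Y := by exact_mod_cast hY
  have hl2 : 1 / 2 < Real.log 2 := by linarith [Real.log_two_gt_d9]
  have h4 : Real.log 4 ≤ 2 := by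
    rw [show (4 : ℝ) = 2 ^ 2 by norm_num, Real.log_pow]
    push_cast
    linarith [Real.log_two_lt_d9]
  have hth : ∑ q ∈ (Finset.Ioc 0 Y).filter Nat.Prime, Real.log q ≤ 2 * Y := by
    have := Chebyshev.theta_le_log4_mul_x (x := Y) hY'.le
    rw [Chebyshev.theta, Nat.floor_natCast] at this
    exact this.trans (by gcongr)
  have hlY : 0 ≤ Real.log Y := Real.log_natCast_nonneg Y
  have hps : ∑ n ∈ (Finset.Ioc 0 Y).filter (fun n => ¬ n.Prime), vonMangoldt n ≤ |C| * √Y := by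
    have a1 := Chebyshev.psi_sub_theta_eq_sum_not_prime (Y : ℝ)
    rw [Nat.floor_natCast] at a1
    rw [← a1]
    refine (hC Y).trans ?_
    gcongr
    exact le_abs_self C
  have h1 : ∑ q ∈ (Finset.Ioc 0 Y).filter IsPrimePow, Real.log q ≤
      ∑ q ∈ Finset.Ioc 0 Y, ((if q.Prime then Real.log q else 0) +
        (if ¬ q.Prime then 2 * Real.log Y * vonMangoldt q else 0)) := by
    rw [Finset.sum_filter]
    refine Finset.sum_le_sum fun q hq => ?_
    obtain ⟨hq0, hqY⟩ := Finset.mem_Ioc.1 hq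
    have hq0' : (0 : ℝ) < q := by exact_mod_cast hq0
    by_cases hp : q.Prime
    · rw [if_pos hp.prime.isPrimePow, if_pos hp, if_neg (not_not.2 hp), add_zero]
    · rw [if_neg hp, if_pos hp, zero_add]
      split_ifs with hpp
      · rw [vonMangoldt_apply, if_pos hpp]
        have hmf : 2 ≤ q.minFac := (Nat.minFac_prime hpp.ne_one).two_le
        have : Real.log 2 ≤ Real.log q.minFac :=
          Real.log_le_log (by norm_num) (by exact_mod_cast hmf)
        have h5 : Real.log q ≤ Real.log Y := Real.log_le_log hq0' (by exact_mod_cast hqY)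
        nlinarith
      · have : (0 : ℝ) ≤ vonMangoldt q := vonMangoldt_nonneg
        positivity
  have hlog : √Y * Real.log Y ≤ 2 * Y := by
    have h5 : Real.log Y = 2 * Real.log (√Y) := by
      rw [Real.log_sqrt hY'.le]; ring
    have h6 : Real.log (√Y) ≤ √Y := (Real.log_le_sub_one_of_pos (Real.sqrt_pos.2 hY')).trans (by linarith)
    have h7 := Real.mul_self_sqrt hY'.le
    rw [h5]
    nlinarith [Real.sqrt_nonneg (Y : ℝ)]
  refine h1.trans ?_
  rw [Finset.sum_add_distrib, ← Finset.sum_filter, ← Finset.sum_filter, ← Finset.mul_sum]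
  calc _ ≤ 2 * (Y : ℝ) + 2 * Real.log Y * (|C| * √Y) := by gcongr
    _ = 2 * (Y : ℝ) + 2 * |C| * (√Y * Real.log Y) := by ring
    _ ≤ 2 * (Y : ℝ) + 2 * |C| * (2 * Y) := by gcongr
    _ = _ := by ring

theorem mem_sumTwoSq_iff {n : ℕ} :
    n ∈ sumTwoSq ↔ 0 < n ∧ ∀ q : ℕ, q.Prime → q % 4 = 3 → Even (n.factorization q) := by
  have h1 : (∃ a b : ℤ, (n : ℤ) = a ^ 2 + b ^ 2) ↔ ∃ x y : ℕ, n = x ^ 2 + y ^ 2 := by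
    constructor
    · rintro ⟨a, b, h⟩
      refine ⟨a.natAbs, b.natAbs, ?_⟩
      zify
      rw [sq_abs, sq_abs, h]
    · rintro ⟨x, y, h⟩
      exact ⟨x, y, by exact_mod_cast h⟩
  rw [sumTwoSq, Set.mem_ofPred_eq, h1, Nat.eq_sq_add_sq_iff]
  refine and_congr_right fun hn => ?_
  constructor
  · intro h q hq h3
    by_cases hqn : q ∣ n
    · rw [Nat.factorization_def _ hq]
      exact h q (Nat.mem_primeFactors.2 ⟨hq, hqn, hn.ne'⟩) h3
    · rw [Nat.factorization_eq_zero_of_not_dvd hqn]; exact Even.zero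
  · intro h q hq h3
    have hq' := Nat.prime_of_mem_primeFactors hq
    rw [← Nat.factorization_def _ hq']
    exact h q hq' h3

theorem sumTwoSq_pos {n : ℕ} (h : n ∈ sumTwoSq) : 0 < n := h.1

theorem one_mem_sumTwoSq : 1 ∈ sumTwoSq := ⟨one_pos, 1, 0, by norm_num⟩

theorem sumTwoSq_div_mem {n d : ℕ} (hn : n ∈ sumTwoSq) (hd : d ∈ sumTwoSq) (h : d ∣ n) :
    n / d ∈ sumTwoSq := by
  rw [mem_sumTwoSq_iff] at *
  refine ⟨Nat.div_pos (Nat.le_of_dvd hn.1 h) hd.1, fun q hq h3 => ?_⟩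
  rw [Nat.factorization_div h, Finsupp.tsub_apply]
  have h1 := hn.2 q hq h3
  have h2 := hd.2 q hq h3
  rw [Nat.even_iff] at *
  omega

theorem sumTwoSq_mul_mem {n d : ℕ} (hn : n ∈ sumTwoSq) (hd : d ∈ sumTwoSq) :
    n * d ∈ sumTwoSq := by
  rw [mem_sumTwoSq_iff] at *
  refine ⟨Nat.mul_pos hn.1 hd.1, fun q hq h3 => ?_⟩
  rw [Nat.factorization_mul hn.1.ne' hd.1.ne', Finsupp.add_apply]
  exact (hn.2 q hq h3).add (hd.2 q hq h3)

theorem sumTwoSq_of_mul_coprime {q m : ℕ} (h : q * m ∈ sumTwoSq) (hc : q.Coprime m) :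
    m ∈ sumTwoSq := by
  rw [mem_sumTwoSq_iff] at *
  have hq0 : q ≠ 0 := by rintro rfl; simp at h
  have hm0 : m ≠ 0 := by rintro rfl; simp at h
  refine ⟨Nat.pos_of_ne_zero hm0, fun r hr h3 => ?_⟩
  have h1 := h.2 r hr h3
  rw [Nat.factorization_mul hq0 hm0, Finsupp.add_apply] at h1
  by_cases hrm : r ∣ m
  · have : ¬ r ∣ q := fun hrq => hr.one_lt.ne' (Nat.dvd_one.1 (hc ▸ Nat.dvd_gcd hrq hrm))
    rwa [Nat.factorization_eq_zero_of_not_dvd this, zero_add] at h1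
  · rw [Nat.factorization_eq_zero_of_not_dvd hrm]; exact Even.zero

theorem prime_one_mem_sumTwoSq {p : ℕ} (hp : p.Prime) (h : p % 4 = 1) : p ∈ sumTwoSq := by
  rw [mem_sumTwoSq_iff]
  refine ⟨hp.pos, fun q hq h3 => ?_⟩
  have : q ≠ p := by rintro rfl; omega
  rw [hp.factorization, Finsupp.single_apply, if_neg this.symm]; exact Even.zero

theorem sq_mem_sumTwoSq {p : ℕ} (hp : 0 < p) : p ^ 2 ∈ sumTwoSq :=
  ⟨by positivity, p, 0, by push_cast; ring⟩

/-- The logarithm of `n` is the sum of `log q` over its unitary prime power divisors. -/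
theorem log_le_sum_unitary {n : ℕ} (hn : 0 < n) :
    Real.log n ≤ ∑ q ∈ n.divisors, if IsPrimePow q ∧ q.Coprime (n / q) then Real.log q else 0 := by
  rw [← Finset.sum_filter]
  have h1 : Real.log n = ∑ p ∈ n.primeFactors, Real.log ((p ^ n.factorization p : ℕ) : ℝ) := by
    conv_lhs => rw [← Nat.prod_factorization_pow_eq_self hn.ne']
    rw [Finsupp.prod, Nat.cast_prod, Real.log_prod]
    · rfl
    · intro p hp
      have := (Nat.prime_of_mem_primeFactors hp).pos
      positivity
  rw [h1]
  rw [← Finset.sum_image (f := fun q : ℕ => Real.log q) (g := fun p => p ^ n.factorization p)]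
  · refine Finset.sum_le_sum_of_subset_of_nonneg ?_ fun q _ _ => Real.log_natCast_nonneg q
    intro q hq
    obtain ⟨p, hp, rfl⟩ := Finset.mem_image.1 hq
    have hpp := Nat.prime_of_mem_primeFactors hp
    have hpn := Nat.dvd_of_mem_primeFactors hp
    rw [Finset.mem_filter, Nat.mem_divisors]
    refine ⟨⟨Nat.ordProj_dvd n p, hn.ne'⟩, ?_, ?_⟩
    · exact hpp.isPrimePow.pow (hpp.factorization_pos_of_dvd hn.ne' hpn).ne'
    · exact Nat.Coprime.pow_left _ (Nat.coprime_ordCompl hpp hn.ne')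
  · intro p hp p' hp' h
    have hpp := Nat.prime_of_mem_primeFactors hp
    have hpp' := Nat.prime_of_mem_primeFactors hp'
    have hpn := Nat.dvd_of_mem_primeFactors hp
    have h0 := (hpp.factorization_pos_of_dvd hn.ne' hpn).ne'
    have : p ∣ p' ^ n.factorization p' := by
      rw [show p' ^ n.factorization p' = p ^ n.factorization p from h.symm]
      exact dvd_pow_self p h0
    exact (Nat.prime_dvd_prime_iff_eq hpp hpp').1 (hpp.dvd_of_dvd_pow this)

open scoped Classical in
/-- Sums of two squares up to `X`. -/
def SX (X : ℕ) : Finset ℕ := (Finset.Ioc 0 X).filter (· ∈ sumTwoSq)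

open scoped Classical in
theorem mem_SX {X n : ℕ} : n ∈ SX X ↔ n ≤ X ∧ n ∈ sumTwoSq := by
  rw [SX, Finset.mem_filter, Finset.mem_Ioc]
  exact ⟨fun h => ⟨h.1.2, h.2⟩, fun h => ⟨⟨sumTwoSq_pos h.2, h.1⟩, h.2⟩⟩

open scoped Classical in
theorem exists_weighted_upper : ∃ C : ℝ, 0 < C ∧ ∀ w : ℕ → ℝ, (∀ n, 0 ≤ w n) →
    (∀ n m, 0 < n → m ∣ n → w n ≤ w m) → ∀ X : ℕ,
      (∑ n ∈ SX X, w n) * Real.log X ≤ C * X * ∑ m ∈ SX X, w m / m := by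
  obtain ⟨C, hC0, hC⟩ := exists_sum_log_primePow_le
  refine ⟨C + 1, by positivity, fun w hw hwd X => ?_⟩
  rcases Nat.eq_zero_or_pos X with rfl | hX
  · simp
  have hX' : (0 : ℝ) < X := by exact_mod_cast hX
  have h1 : ∑ n ∈ SX X, w n * Real.log n ≤ C * X * ∑ m ∈ SX X, w m / m := by
    set F : ℕ → ℕ → ℝ := fun q m => if q * m ∈ sumTwoSq then
      w (q * m) * (if IsPrimePow q ∧ q.Coprime m then Real.log q else 0) else 0 with hF
    calc ∑ n ∈ SX X, w n * Real.log n ≤ ∑ n ∈ Finset.Ioc 0 X, ∑ q ∈ n.divisors, F q (n / q) := by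
          rw [SX, Finset.sum_filter]
          refine Finset.sum_le_sum fun n hn => ?_
          have hn0 := (Finset.mem_Ioc.1 hn).1
          have e : ∑ q ∈ n.divisors, F q (n / q) = if n ∈ sumTwoSq then w n *
              ∑ q ∈ n.divisors, (if IsPrimePow q ∧ q.Coprime (n / q) then Real.log q else 0)
              else 0 := by
            split_ifs with hS
            · rw [Finset.mul_sum]
              refine Finset.sum_congr rfl fun q hq => ?_
              rw [hF]
              simp only [Nat.mul_div_cancel' (Nat.dvd_of_mem_divisors hq), if_pos hS]
            · refine Finset.sum_eq_zero fun q hq => ?_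
              rw [hF]
              simp only [Nat.mul_div_cancel' (Nat.dvd_of_mem_divisors hq), if_neg hS]
          rw [e]
          split_ifs
          · exact mul_le_mul_of_nonneg_left (log_le_sum_unitary hn0) (hw n)
          · exact le_rfl
      _ = ∑ q ∈ Finset.Ioc 0 X, ∑ m ∈ Finset.Ioc 0 (X / q), F q m := sum_Ioc_sum_divisors F X
      _ ≤ ∑ q ∈ Finset.Ioc 0 X, ∑ m ∈ Finset.Ioc 0 (X / q),
            (if m ∈ sumTwoSq then w m * (if IsPrimePow q then Real.log q else 0) else 0) := by
          refine Finset.sum_le_sum fun q hq => Finset.sum_le_sum fun m hm => ?_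
          have hq0 := (Finset.mem_Ioc.1 hq).1
          have hm0 := (Finset.mem_Ioc.1 hm).1
          have hl := Real.log_natCast_nonneg q
          have hwm := hw m
          rw [hF]
          by_cases hS : q * m ∈ sumTwoSq ∧ IsPrimePow q ∧ q.Coprime m
          · simp only [if_pos hS.1, if_pos hS.2, if_pos hS.2.1,
              if_pos (sumTwoSq_of_mul_coprime hS.1 hS.2.2)]
            exact mul_le_mul_of_nonneg_right (hwd _ _ (Nat.mul_pos hq0 hm0) (Dvd.intro_left _ rfl)) hl
          · have : (if q * m ∈ sumTwoSq then
                w (q * m) * (if IsPrimePow q ∧ q.Coprime m then Real.log q else 0) else 0) = 0 := by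
              by_cases a : q * m ∈ sumTwoSq
              · rw [if_pos a, if_neg (fun b => hS ⟨a, b⟩), mul_zero]
              · rw [if_neg a]
            simp only [this]
            split_ifs <;> positivity
      _ = ∑ q ∈ Finset.Ioc 0 X, ∑ m ∈ Finset.Ioc 0 (X / q),
            (if m ∈ sumTwoSq then w m * (if IsPrimePow q then Real.log q else 0) else 0) := rfl
      _ = ∑ m ∈ Finset.Ioc 0 X, ∑ q ∈ Finset.Ioc 0 (X / m),
            (if m ∈ sumTwoSq then w m * (if IsPrimePow q then Real.log q else 0) else 0) := by
          refine Finset.sum_comm' fun q m => ?_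
          simp only [Finset.mem_Ioc]
          constructor
          · rintro ⟨⟨a, b⟩, c, d⟩
            have := (Nat.le_div_iff_mul_le a).1 d
            exact ⟨⟨a, (Nat.le_div_iff_mul_le c).2 (by rwa [mul_comm])⟩, c, d.trans (Nat.div_le_self _ _)⟩
          · rintro ⟨⟨a, b⟩, c, d⟩
            have := (Nat.le_div_iff_mul_le c).1 b
            exact ⟨⟨a, b.trans (Nat.div_le_self _ _)⟩, c, (Nat.le_div_iff_mul_le a).2 (by rwa [mul_comm])⟩
      _ ≤ ∑ m ∈ Finset.Ioc 0 X, (if m ∈ sumTwoSq then C * X * (w m / m) else 0) := by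
          refine Finset.sum_le_sum fun m hm => ?_
          split_ifs with hS
          · have hm0 : (0 : ℝ) < m := by exact_mod_cast (Finset.mem_Ioc.1 hm).1
            rw [← Finset.mul_sum, ← Finset.sum_filter]
            calc w m * _ ≤ w m * (C * (X / m : ℕ)) := mul_le_mul_of_nonneg_left (hC _) (hw m)
              _ ≤ w m * (C * (X / m)) := by
                  have := hw m
                  gcongr
                  exact Nat.cast_div_le
              _ = _ := by ring
          · simp
      _ = _ := by rw [SX, Finset.sum_filter, Finset.mul_sum]; simp only [mul_ite, mul_zero]
  have h2 : ∀ n ∈ SX X, w n * Real.log X ≤ w n * Real.log n + X * (w n / n) := by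
    intro n hn
    obtain ⟨hnX, hnS⟩ := mem_SX.1 hn
    have hn0 : (0 : ℝ) < n := by exact_mod_cast sumTwoSq_pos hnS
    have h3 : Real.log X ≤ Real.log n + X / n := by
      have := Real.log_le_sub_one_of_pos (div_pos hX' hn0)
      rw [Real.log_div hX'.ne' hn0.ne'] at this
      linarith
    calc _ ≤ w n * (Real.log n + X / n) := mul_le_mul_of_nonneg_left h3 (hw n)
      _ = _ := by ring
  calc _ = ∑ n ∈ SX X, w n * Real.log X := Finset.sum_mul _ _ _
    _ ≤ ∑ n ∈ SX X, (w n * Real.log n + X * (w n / n)) := Finset.sum_le_sum h2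
    _ = ∑ n ∈ SX X, w n * Real.log n + X * ∑ n ∈ SX X, w n / n := by
        rw [Finset.sum_add_distrib, Finset.mul_sum]
    _ ≤ _ := by linarith

/-- The logarithmic sum over sums of two squares up to `X`. -/
def HX (X : ℕ) : ℝ := ∑ m ∈ SX X, 1 / (m : ℝ)

theorem SX_mono {X Y : ℕ} (h : X ≤ Y) : SX X ⊆ SX Y := fun n hn => by
  rw [mem_SX] at *
  exact ⟨hn.1.trans h, hn.2⟩

theorem HX_mono {X Y : ℕ} (h : X ≤ Y) : HX X ≤ HX Y :=
  Finset.sum_le_sum_of_subset_of_nonneg (SX_mono h) fun _ _ _ => by positivity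

theorem HX_nonneg (X : ℕ) : 0 ≤ HX X := Finset.sum_nonneg fun _ _ => by positivity

theorem one_le_HX {X : ℕ} (h : 0 < X) : 1 ≤ HX X := by
  have : (1 : ℕ) ∈ SX X := mem_SX.2 ⟨h, one_mem_sumTwoSq⟩
  have := Finset.single_le_sum (f := fun m : ℕ => 1 / (m : ℝ)) (fun _ _ => by positivity) this
  simpa [HX] using this

open scoped Classical in
theorem card_SX_le (X : ℕ) : (SX X).card ≤ X := by
  rw [SX]
  exact (Finset.card_filter_le _ _).trans (by simp)

open scoped Classical in
theorem exists_log_lower : ∃ c : ℝ, 0 < c ∧ ∃ K0 : ℕ, 0 < K0 ∧ ∀ X : ℕ,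
    c * X * HX (X / K0) ≤ (SX X).card * Real.log X := by
  obtain ⟨c, hc, K0, hK0, h⟩ := exists_theta_one_ge
  refine ⟨c / 2, by positivity, K0, hK0, fun X => ?_⟩
  set F : ℕ → ℕ → ℝ := fun p m => if m ∈ sumTwoSq ∧ p.Prime ∧ p % 4 = 1 then Real.log p else 0
    with hF
  have hF0 : ∀ p m, 0 ≤ F p m := fun p m => by
    rw [hF]; dsimp only; split_ifs
    · exact Real.log_natCast_nonneg p
    · exact le_rfl
  have h1 : ∑ n ∈ Finset.Ioc 0 X, ∑ p ∈ n.divisors, F p (n / p) ≤ (SX X).card * Real.log X := by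
    have e : ((SX X).card : ℝ) * Real.log X = ∑ n ∈ SX X, Real.log X := by simp
    rw [e, SX, Finset.sum_filter]
    refine Finset.sum_le_sum fun n hn => ?_
    obtain ⟨hn0, hnX⟩ := Finset.mem_Ioc.1 hn
    split_ifs with hS
    · calc ∑ p ∈ n.divisors, F p (n / p) ≤ ∑ p ∈ n.divisors, if p.Prime then Real.log p else 0 := by
            refine Finset.sum_le_sum fun p _ => ?_
            rw [hF]
            dsimp only
            have := Real.log_natCast_nonneg p
            split_ifs with a b b
            · exact le_rfl
            · exact absurd a.2.1 b
            · exact this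
            · exact le_rfl
        _ = ∑ p ∈ n.primeFactors, Real.log p := by
            rw [← Finset.sum_filter]
            congr 1
            ext p
            simp only [Finset.mem_filter, Nat.mem_divisors, Nat.mem_primeFactors]
            tauto
        _ = Real.log ((∏ p ∈ n.primeFactors, p : ℕ) : ℝ) := by
            rw [Nat.cast_prod, Real.log_prod]
            intro p hp
            have := (Nat.prime_of_mem_primeFactors hp).pos
            positivity
        _ ≤ Real.log X := by
            have h2 : 0 < ∏ p ∈ n.primeFactors, p :=
              Finset.prod_pos fun p hp => (Nat.prime_of_mem_primeFactors hp).pos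
            have h3 := (Nat.le_of_dvd hn0 (Nat.prod_primeFactors_dvd n)).trans hnX
            exact Real.log_le_log (by exact_mod_cast h2) (by exact_mod_cast h3)
    · refine le_of_eq (Finset.sum_eq_zero fun p hp => ?_)
      rw [hF]
      dsimp only
      refine if_neg fun hh => hS ?_
      have := sumTwoSq_mul_mem hh.1 (prime_one_mem_sumTwoSq hh.2.1 hh.2.2)
      rwa [Nat.div_mul_cancel (Nat.dvd_of_mem_divisors hp)] at this
  refine le_trans ?_ h1
  rw [sum_Ioc_sum_divisors F X]
  have h2 : ∑ p ∈ Finset.Ioc 0 X, ∑ m ∈ Finset.Ioc 0 (X / p), F p m =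
      ∑ m ∈ Finset.Ioc 0 X, ∑ p ∈ Finset.Ioc 0 (X / m), F p m := by
    refine Finset.sum_comm' fun q m => ?_
    simp only [Finset.mem_Ioc]
    constructor
    · rintro ⟨⟨a, b⟩, c, d⟩
      have := (Nat.le_div_iff_mul_le a).1 d
      exact ⟨⟨a, (Nat.le_div_iff_mul_le c).2 (by rwa [mul_comm])⟩, c, d.trans (Nat.div_le_self _ _)⟩
    · rintro ⟨⟨a, b⟩, c, d⟩
      have := (Nat.le_div_iff_mul_le c).1 b
      exact ⟨⟨a, b.trans (Nat.div_le_self _ _)⟩, c, (Nat.le_div_iff_mul_le a).2 (by rwa [mul_comm])⟩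
  rw [h2, HX, Finset.mul_sum]
  calc ∑ m ∈ SX (X / K0), c / 2 * X * (1 / (m : ℝ))
      ≤ ∑ m ∈ SX (X / K0), ∑ p ∈ Finset.Ioc 0 (X / m), F p m := by
        refine Finset.sum_le_sum fun m hm => ?_
        obtain ⟨hmX, hmS⟩ := mem_SX.1 hm
        have hm0 := sumTwoSq_pos hmS
        have hm0' : (0 : ℝ) < m := by exact_mod_cast hm0
        have h3 : m * K0 ≤ X := (Nat.le_div_iff_mul_le hK0).1 hmX
        have h4 : K0 ≤ X / m := (Nat.le_div_iff_mul_le hm0).2 (by rwa [mul_comm])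
        have h5 := h _ h4
        have h6 : ∑ p ∈ Finset.Ioc 0 (X / m), F p m = ∑ p ∈ primesOne 0 (X / m), Real.log p := by
          rw [primesOne, Finset.sum_filter]
          refine Finset.sum_congr rfl fun p _ => ?_
          rw [hF]
          simp only [hmS, true_and]
        rw [h6]
        refine le_trans ?_ h5
        have h7 : X ≤ 2 * m * (X / m) := by
          have : 1 ≤ X / m := by omega
          have h5 : X < m * (X / m + 1) := by
            have := Nat.lt_div_mul_add hm0 (a := X)
            nlinarith
          nlinarith
        have h8 : (X : ℝ) ≤ 2 * m * (X / m : ℕ) := by exact_mod_cast h7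
        rw [mul_one_div, div_le_iff₀ hm0']
        nlinarith
    _ ≤ _ := by
        refine Finset.sum_le_sum_of_subset_of_nonneg ?_ fun m _ _ => Finset.sum_nonneg fun p _ => hF0 p m
        intro m hm
        obtain ⟨hmX, hmS⟩ := mem_SX.1 hm
        exact Finset.mem_Ioc.2 ⟨sumTwoSq_pos hmS, hmX.trans (Nat.div_le_self _ _)⟩

theorem exists_HX_step : ∃ C : ℝ, 0 < C ∧ ∃ i0 : ℕ, ∀ i, i0 ≤ i →
    HX (2 ^ (i + 1)) ≤ Real.exp (C / (i + 1)) * HX (2 ^ i) := by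
  obtain ⟨C, hC, h⟩ := exists_weighted_upper
  have hl2 : 0 < Real.log 2 := Real.log_pos one_lt_two
  set D := 2 * C / Real.log 2 with hD
  have hD0 : 0 < D := by positivity
  obtain ⟨i0, hi0⟩ := exists_nat_gt (2 * D)
  refine ⟨2 * D, by positivity, i0, fun i hi => ?_⟩
  have hi' : (i0 : ℝ) ≤ i := by exact_mod_cast hi
  have hip : (0 : ℝ) < i + 1 := by positivity
  have h1 := h (fun _ => 1) (fun _ => zero_le_one) (fun _ _ _ _ => le_rfl) (2 ^ (i + 1))
  have h2 : HX (2 ^ (i + 1)) - HX (2 ^ i) ≤ (SX (2 ^ (i + 1))).card / 2 ^ i := by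
    have e : HX (2 ^ (i + 1)) - HX (2 ^ i) = ∑ m ∈ SX (2 ^ (i + 1)) \ SX (2 ^ i), 1 / (m : ℝ) := by
      rw [HX, HX, ← Finset.sum_sdiff (SX_mono (Nat.pow_le_pow_right two_pos (Nat.le_succ i)))]
      ring
    rw [e]
    calc _ ≤ ∑ m ∈ SX (2 ^ (i + 1)) \ SX (2 ^ i), 1 / (2 : ℝ) ^ i := by
          refine Finset.sum_le_sum fun m hm => ?_
          rw [Finset.mem_sdiff, mem_SX, mem_SX] at hm
          have : 2 ^ i < m := by
            by_contra hh
            exact hm.2 ⟨not_lt.1 hh, hm.1.2⟩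
          have : (2 : ℝ) ^ i ≤ m := by exact_mod_cast this.le
          exact one_div_le_one_div_of_le (by positivity) this
      _ = ((SX (2 ^ (i + 1)) \ SX (2 ^ i)).card : ℝ) / 2 ^ i := by simp [div_eq_mul_inv]
      _ ≤ _ := by
          gcongr
          exact Finset.sdiff_subset
  simp only [Finset.sum_const, nsmul_eq_mul, mul_one] at h1
  rw [show ∑ m ∈ SX (2 ^ (i + 1)), 1 / (m : ℝ) = HX (2 ^ (i + 1)) from rfl] at h1
  push_cast at h1
  rw [Real.log_pow] at h1
  push_cast at h1
  have h3 : HX (2 ^ (i + 1)) - HX (2 ^ i) ≤ D / (i + 1) * HX (2 ^ (i + 1)) := by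
    refine h2.trans ?_
    rw [div_le_iff₀ (by positivity), hD]
    have e : 2 * C / Real.log 2 / (i + 1) * HX (2 ^ (i + 1)) * 2 ^ i =
        (C * 2 ^ (i + 1) * HX (2 ^ (i + 1))) / ((i + 1) * Real.log 2) := by
      field_simp; ring
    rw [e, le_div_iff₀ (by positivity)]
    exact h1
  have hH0 := HX_nonneg (2 ^ i)
  set x := D / (i + 1 : ℝ) with hx
  have hx0 : 0 ≤ x := by positivity
  have hx1 : x ≤ 1 / 2 := by
    rw [hx, div_le_iff₀ hip]; linarith
  have h4 : HX (2 ^ (i + 1)) * (1 - x) ≤ HX (2 ^ i) := by linarith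
  have h5 : HX (2 ^ (i + 1)) ≤ (1 + 2 * x) * HX (2 ^ i) := by
    have h6 : 1 ≤ (1 - x) * (1 + 2 * x) := by nlinarith
    have := HX_nonneg (2 ^ (i + 1))
    calc HX (2 ^ (i + 1)) ≤ HX (2 ^ (i + 1)) * ((1 - x) * (1 + 2 * x)) := le_mul_of_one_le_right this h6
      _ = (HX (2 ^ (i + 1)) * (1 - x)) * (1 + 2 * x) := by ring
      _ ≤ HX (2 ^ i) * (1 + 2 * x) := by gcongr
      _ = _ := by ring
  refine h5.trans ?_
  gcongr
  have := Real.add_one_le_exp (2 * D / (i + 1))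
  have e : 2 * D / (i + 1 : ℝ) = 2 * x := by rw [hx]; ring
  rw [e] at this ⊢
  linarith

theorem exists_HX_sq_le (K0 : ℕ) (hK0 : 0 < K0) : ∃ C : ℝ, 0 < C ∧ ∃ X0 : ℕ, ∀ X, X0 ≤ X →
    HX (X ^ 2) ≤ C * HX (X / K0) := by
  obtain ⟨C, hC, i0, h⟩ := exists_HX_step
  have hit : ∀ i, i0 ≤ i → ∀ k : ℕ, HX (2 ^ (i + k)) ≤ Real.exp (k * (C / (i + 1))) * HX (2 ^ i) := by
    intro i hi k
    induction k with
    | zero => simp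
    | succ k ih =>
      have h1 := h (i + k) (by omega)
      have hH := HX_nonneg (2 ^ i)
      calc HX (2 ^ (i + (k + 1))) ≤ Real.exp (C / ((i + k : ℕ) + 1)) * HX (2 ^ (i + k)) := h1
        _ ≤ Real.exp (C / (i + 1)) * (Real.exp (k * (C / (i + 1))) * HX (2 ^ i)) := by
            have := HX_nonneg (2 ^ (i + k))
            gcongr
            linarith [(Nat.cast_nonneg k : (0 : ℝ) ≤ k)]
        _ = _ := by
            rw [← mul_assoc, ← Real.exp_add]
            push_cast
            ring_nf
  set t := 2 * K0 + 2 with ht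
  refine ⟨Real.exp (t * C + C), Real.exp_pos _, K0 * 2 ^ i0, fun X hX => ?_⟩
  have hX2 : 2 ^ i0 ≤ X / K0 := (Nat.le_div_iff_mul_le hK0).2 (by rwa [mul_comm])
  have hXK : X / K0 ≠ 0 := by have := Nat.pos_of_ne_zero (pow_ne_zero i0 (two_ne_zero' ℕ)); omega
  set i := Nat.log 2 (X / K0) with hi
  have hi0 : i0 ≤ i := Nat.le_log_of_pow_le (by norm_num) hX2
  have h1 : 2 ^ i ≤ X / K0 := Nat.pow_log_le_self 2 hXK
  have h2 : X / K0 < 2 ^ (i + 1) := Nat.lt_pow_succ_log_self (by norm_num) _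
  have h3 : X ^ 2 ≤ 2 ^ (i + (i + t)) := by
    have h4 : X < 2 ^ (i + 1) * K0 := (Nat.div_lt_iff_lt_mul hK0).1 h2
    have h5 : K0 ≤ 2 ^ K0 := Nat.lt_two_pow_self.le
    calc X ^ 2 ≤ (2 ^ (i + 1) * 2 ^ K0) ^ 2 := by
          gcongr
          exact h4.le.trans (Nat.mul_le_mul_left _ h5)
      _ = _ := by rw [ht]; ring
  have h6 := HX_mono h1
  have hH := HX_nonneg (2 ^ i)
  calc HX (X ^ 2) ≤ HX (2 ^ (i + (i + t))) := HX_mono h3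
    _ ≤ Real.exp ((i + t : ℕ) * (C / (i + 1))) * HX (2 ^ i) := hit i hi0 _
    _ ≤ Real.exp (t * C + C) * HX (X / K0) := by
        gcongr
        rw [mul_div_assoc', div_le_iff₀ (by positivity)]
        push_cast
        have : (0 : ℝ) ≤ i := by positivity
        have : (0 : ℝ) ≤ t := by positivity
        nlinarith [mul_nonneg (mul_nonneg this ‹(0 : ℝ) ≤ i›) hC.le]

theorem exists_card_SX_ge : ∃ c : ℝ, 0 < c ∧ ∃ X0 : ℕ, ∀ X, X0 ≤ X →
    c * X ≤ (SX X).card * Real.log X := by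
  obtain ⟨c, hc, K0, hK0, h⟩ := exists_log_lower
  refine ⟨c, hc, K0, fun X hX => ?_⟩
  have := one_le_HX (Nat.div_pos hX hK0)
  calc c * X ≤ c * X * HX (X / K0) := le_mul_of_one_le_right (by positivity) this
    _ ≤ _ := h X

/-- Weighted counts of sums of two squares, relative to the unweighted one. -/
theorem exists_weighted_le : ∃ C : ℝ, 0 < C ∧ ∃ X0 : ℕ, ∀ X, X0 ≤ X → ∀ w : ℕ → ℝ, (∀ n, 0 ≤ w n) →
    (∀ n m, 0 < n → m ∣ n → w n ≤ w m) →
      (∑ n ∈ SX X, w n) * HX (X ^ 2) ≤ C * (SX X).card * ∑ m ∈ SX X, w m / m := by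
  obtain ⟨C, hC, h⟩ := exists_weighted_upper
  obtain ⟨c, hc, K0, hK0, h'⟩ := exists_log_lower
  obtain ⟨C', hC', X0, h''⟩ := exists_HX_sq_le K0 hK0
  refine ⟨C * C' / c, by positivity, X0 + 2, fun X hX w hw hwd => ?_⟩
  have h1 := h w hw hwd X
  have h2 := h' X
  have h3 := h'' X (by omega)
  have hX1 : (1 : ℝ) < X := by exact_mod_cast (by omega : 1 < X)
  have hl : 0 < Real.log X := Real.log_pos hX1
  have hw0 : 0 ≤ ∑ n ∈ SX X, w n := Finset.sum_nonneg fun n _ => hw n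
  have hw1 : 0 ≤ ∑ m ∈ SX X, w m / m := Finset.sum_nonneg fun n _ => div_nonneg (hw n) (by positivity)
  have hH := HX_nonneg (X / K0)
  refine le_of_mul_le_mul_right (a := Real.log X) ?_ hl
  calc (∑ n ∈ SX X, w n) * HX (X ^ 2) * Real.log X
      = ((∑ n ∈ SX X, w n) * Real.log X) * HX (X ^ 2) := by ring
    _ ≤ (C * X * ∑ m ∈ SX X, w m / m) * (C' * HX (X / K0)) := by
        have := HX_nonneg (X ^ 2)
        gcongr
    _ = (C * C' / c) * (∑ m ∈ SX X, w m / m) * (c * X * HX (X / K0)) := by field_simp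
    _ ≤ (C * C' / c) * (∑ m ∈ SX X, w m / m) * ((SX X).card * Real.log X) := by gcongr
    _ = _ := by ring

theorem exists_card_SX_div_le : ∃ C : ℝ, 0 < C ∧ ∃ X0 : ℕ, ∀ X, X0 ≤ X → ∀ d : ℕ, 0 < d →
    ((SX (X / d)).card : ℝ) ≤ C * (Real.log (2 * d) / d) * (SX X).card := by
  obtain ⟨C, hC, h⟩ := exists_weighted_upper
  obtain ⟨c, hc, K0, hK0, h'⟩ := exists_log_lower
  obtain ⟨C', hC', X0, h''⟩ := exists_HX_sq_le K0 hK0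
  obtain ⟨c2, hc2, X2, h2⟩ := exists_card_SX_ge
  have hl2 : 1 / 2 < Real.log 2 := by linarith [Real.log_two_gt_d9]
  refine ⟨max (8 * C * C' / c) (2 / c2), by positivity, X0 + X2 + 16, fun X hX d hd => ?_⟩
  have hd' : (0 : ℝ) < d := by exact_mod_cast hd
  have hd1 : (1 : ℝ) ≤ d := by exact_mod_cast hd
  have hX16 : (16 : ℝ) ≤ X := by exact_mod_cast (by omega : 16 ≤ X)
  have hl : 0 < Real.log X := Real.log_pos (by linarith)
  have hB : (0 : ℝ) ≤ (SX X).card := by positivity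
  have hld : 0 ≤ Real.log d := Real.log_nonneg hd1
  have hl2d : Real.log (2 * d) = Real.log 2 + Real.log d := Real.log_mul (by norm_num) hd'.ne'
  rcases Nat.lt_or_ge (d ^ 2) X with hdX | hdX
  · have hY : 0 < X / d := Nat.div_pos (by nlinarith) hd
    have hY' : (0 : ℝ) < (X / d : ℕ) := by exact_mod_cast hY
    have h1 := h (fun _ => 1) (fun _ => zero_le_one) (fun _ _ _ _ => le_rfl) (X / d)
    simp only [Finset.sum_const, nsmul_eq_mul, mul_one] at h1
    rw [show ∑ m ∈ SX (X / d), 1 / (m : ℝ) = HX (X / d) from rfl] at h1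
    have h3 : Real.log X ≤ 4 * Real.log (X / d : ℕ) := by
      have h4 : X ≤ (X / d + 1) ^ 2 := by
        have h5 : X < d * (X / d + 1) := by
          have := Nat.lt_div_mul_add hd (a := X)
          nlinarith
        have h6 : d ≤ X / d := (Nat.le_div_iff_mul_le hd).2 (by nlinarith)
        nlinarith
      have h5 : X / d ≥ 3 := by
        by_contra hh
        have : X / d + 1 ≤ 3 := by omega
        have : (X / d + 1) ^ 2 ≤ 3 ^ 2 := Nat.pow_le_pow_left this 2
        omega
      have h6 : X ≤ (X / d) ^ 4 := by
        refine h4.trans ?_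
        calc (X / d + 1) ^ 2 ≤ ((X / d) ^ 2) ^ 2 := Nat.pow_le_pow_left (by nlinarith) 2
          _ = _ := by ring
      have := Real.log_le_log (by linarith) (by exact_mod_cast h6 : (X : ℝ) ≤ ((X / d : ℕ) : ℝ) ^ 4)
      rwa [Real.log_pow] at this
    have h4 : HX (X / d) ≤ C' * HX (X / K0) :=
      (HX_mono ((Nat.div_le_self X d).trans (by nlinarith))).trans (h'' X (by omega))
    have hH := HX_nonneg (X / K0)
    have h5 : ((SX (X / d)).card : ℝ) * Real.log X ≤ (4 * C * C' / c / d) * (SX X).card * Real.log X := by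
      calc ((SX (X / d)).card : ℝ) * Real.log X ≤ ((SX (X / d)).card : ℝ) * (4 * Real.log (X / d : ℕ)) := by
            gcongr
        _ = 4 * (((SX (X / d)).card : ℝ) * Real.log (X / d : ℕ)) := by ring
        _ ≤ 4 * (C * (X / d : ℕ) * HX (X / d)) := by gcongr
        _ ≤ 4 * (C * (X / d) * (C' * HX (X / K0))) := by
            have := HX_nonneg (X / d)
            gcongr
            exact Nat.cast_div_le
        _ = (4 * C * C' / c / d) * (c * X * HX (X / K0)) := by field_simp
        _ ≤ (4 * C * C' / c / d) * ((SX X).card * Real.log X) :=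
            mul_le_mul_of_nonneg_left (h' X) (by positivity)
        _ = _ := by ring
    refine (le_of_mul_le_mul_right h5 hl).trans ?_
    gcongr
    calc 4 * C * C' / c / d = 8 * C * C' / c * ((1 / 2) / d) := by ring
      _ ≤ max (8 * C * C' / c) (2 / c2) * (Real.log (2 * d) / d) := by
          gcongr
          · exact le_max_left _ _
          · linarith
  · have h1 := h2 X (by omega)
    have h3 : Real.log X ≤ 2 * Real.log d := by
      have := Real.log_le_log (by linarith) (by exact_mod_cast hdX : (X : ℝ) ≤ (d : ℝ) ^ 2)
      rwa [Real.log_pow] at this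
    calc ((SX (X / d)).card : ℝ) ≤ (X / d : ℕ) := by exact_mod_cast card_SX_le _
      _ ≤ X / d := Nat.cast_div_le
      _ = (1 / (c2 * d)) * (c2 * X) := by field_simp
      _ ≤ (1 / (c2 * d)) * ((SX X).card * Real.log X) := by gcongr
      _ ≤ (1 / (c2 * d)) * ((SX X).card * (2 * Real.log (2 * d))) := by
          gcongr
          linarith
      _ = 2 / c2 * (Real.log (2 * d) / d) * (SX X).card := by field_simp
      _ ≤ _ := by
          have : 0 ≤ Real.log (2 * d) := by linarith
          gcongr
          exact le_max_right _ _

/-- A lattice point as a Gaussian integer. -/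
def toG (v : ℤ × ℤ) : GaussianInt := ⟨v.1, v.2⟩

theorem toG_injective : Function.Injective toG := fun v w h => by
  have h1 := congrArg Zsqrtd.re h
  have h2 := congrArg Zsqrtd.im h
  exact Prod.ext h1 h2

theorem norm_toG (v : ℤ × ℤ) : (toG v).norm = v.1 ^ 2 + v.2 ^ 2 := by
  simp [toG, Zsqrtd.norm_def]; ring

theorem toG_sum {ι : Type*} (s : Finset ι) (v : ι → ℤ × ℤ) :
    toG (∑ i ∈ s, v i) = ∑ i ∈ s, toG (v i) := by
  classical
  induction s using Finset.induction_on with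
  | empty => rfl
  | insert a s ha ih => rw [Finset.sum_insert ha, Finset.sum_insert ha, ← ih]; rfl

theorem toG_eq_zero {v : ℤ × ℤ} : toG v = 0 ↔ v = 0 :=
  ⟨fun h => toG_injective h, fun h => by rw [h]; rfl⟩

open Classical in
/-- The Gaussian integers of norm `n`. -/
def gpts (n : ℕ) : Finset GaussianInt := (latticePts n).image toG

theorem mem_gpts {n : ℕ} {z : GaussianInt} : z ∈ gpts n ↔ z.norm = n := by
  classical
  simp only [gpts, Finset.mem_image, mem_latticePts]
  constructor
  · rintro ⟨v, hv, rfl⟩; rw [norm_toG, hv]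
  · intro h
    refine ⟨(z.re, z.im), ?_, rfl⟩
    rw [← h]; exact (norm_toG (z.re, z.im)).symm

theorem card_gpts (n : ℕ) : (gpts n).card = (latticePts n).card := by
  classical
  exact Finset.card_image_of_injective _ toG_injective

theorem exists_norm_eq_prime {p : ℕ} (hp : p.Prime) (h : p % 4 ≠ 3) :
    ∃ ϖ : GaussianInt, ϖ.norm = p := by
  have := Fact.mk hp
  obtain ⟨a, b, hab⟩ := Nat.Prime.sq_add_sq (p := p) h
  refine ⟨⟨a, b⟩, ?_⟩
  rw [Zsqrtd.norm_def, ← hab]; push_cast; ring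

theorem prime_of_norm_prime {p : ℕ} (hp : p.Prime) {ϖ : GaussianInt} (h : ϖ.norm = p) :
    Prime ϖ := by
  refine Irreducible.prime ⟨fun hu => ?_, fun a b hab => ?_⟩
  · rw [Zsqrtd.isUnit_iff_norm_isUnit, h] at hu
    exact (Nat.prime_iff_prime_int.mp hp).not_isUnit hu
  · have h1 : a.norm * b.norm = (p : ℤ) := by rw [← Zsqrtd.norm_mul, ← hab, h]
    have h2 : Irreducible (p : ℤ) := (Nat.prime_iff_prime_int.mp hp).irreducible
    rcases h2.isUnit_or_isUnit h1.symm with h3 | h3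
    · exact Or.inl (Zsqrtd.isUnit_iff_norm_isUnit _ |>.mpr h3)
    · exact Or.inr (Zsqrtd.isUnit_iff_norm_isUnit _ |>.mpr h3)

theorem gnorm_star (z : GaussianInt) : (star z).norm = z.norm := Zsqrtd.norm_conj z

theorem exists_factor_step {p k : ℕ} (hp : p.Prime) {ϖ z : GaussianInt} (h : ϖ.norm = p)
    (hz : z.norm = (p * k : ℕ)) : ∃ g : GaussianInt, g.norm = k ∧ (z = ϖ * g ∨ z = star ϖ * g) := by
  have hpr := prime_of_norm_prime hp h
  have h1 : ϖ ∣ z * star z := by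
    rw [← Zsqrtd.norm_eq_mul_conj, hz]
    refine ⟨star ϖ * k, ?_⟩
    rw [← mul_assoc, ← Zsqrtd.norm_eq_mul_conj, h]; push_cast; ring
  have hp0 : (p : ℤ) ≠ 0 := by exact_mod_cast hp.ne_zero
  rcases hpr.dvd_or_dvd h1 with h2 | h2
  · obtain ⟨g, rfl⟩ := h2
    refine ⟨g, ?_, Or.inl rfl⟩
    rw [Zsqrtd.norm_mul, h] at hz
    push_cast at hz
    exact mul_left_cancel₀ hp0 hz
  · obtain ⟨g, hg⟩ := h2
    have h3 : z = star ϖ * star g := by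
      rw [← star_star z, hg, star_mul, mul_comm]
    refine ⟨star g, ?_, Or.inr h3⟩
    rw [h3, Zsqrtd.norm_mul, gnorm_star ϖ, h] at hz
    push_cast at hz
    exact mul_left_cancel₀ hp0 hz

theorem exists_factor_pow {p : ℕ} (hp : p.Prime) {ϖ : GaussianInt} (h : ϖ.norm = p) (e m : ℕ) :
    ∀ {z : GaussianInt}, z.norm = (p ^ e * m : ℕ) →
      ∃ a ≤ e, ∃ u : GaussianInt, u.norm = m ∧ z = ϖ ^ a * star ϖ ^ (e - a) * u := by
  induction e with
  | zero => intro z hz; exact ⟨0, le_rfl, z, by simpa using hz, by simp⟩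
  | succ e ih =>
    intro z hz
    have h1 : z.norm = (p * (p ^ e * m) : ℕ) := by rw [hz]; congr 1; ring
    obtain ⟨g, hg, h2⟩ := exists_factor_step hp h h1
    obtain ⟨a, ha, u, hu, rfl⟩ := ih hg
    rcases h2 with h2 | h2
    · refine ⟨a + 1, by omega, u, hu, ?_⟩
      rw [h2, show e + 1 - (a + 1) = e - a by omega]; ring
    · refine ⟨a, by omega, u, hu, ?_⟩
      rw [h2, show e + 1 - a = (e - a) + 1 by omega]; ring

theorem not_dvd_star {p : ℕ} (hp : p.Prime) (hp1 : p % 4 = 1) {ϖ : GaussianInt}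
    (h : ϖ.norm = p) : ¬ ϖ ∣ star ϖ := by
  intro hd
  have h1 : ϖ ∣ ((2 * ϖ.re : ℤ) : GaussianInt) := by
    have : ((2 * ϖ.re : ℤ) : GaussianInt) = ϖ + star ϖ := by
      ext <;> simp [two_mul]
    rw [this]; exact dvd_add dvd_rfl hd
  obtain ⟨g, hg⟩ := h1
  have h2 := congrArg Zsqrtd.norm hg
  rw [Zsqrtd.norm_mul, Zsqrtd.norm_intCast, h] at h2
  have hpi := Nat.prime_iff_prime_int.mp hp
  have h3 : (p : ℤ) ∣ 2 * ϖ.re := by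
    rcases hpi.dvd_or_dvd (Dvd.intro _ h2.symm) with h | h <;> exact h
  have h4 : (p : ℤ) ∣ ϖ.re := by
    rcases hpi.dvd_or_dvd h3 with h | h
    · have := Int.le_of_dvd (by norm_num) h
      have := hp.two_le
      have : p = 2 := by omega
      omega
    · exact h
  have h5 : ϖ.re * ϖ.re + ϖ.im * ϖ.im = p := by
    rw [← h, Zsqrtd.norm_def]; ring
  have h6 : (p : ℤ) ∣ ϖ.im := by
    have : (p : ℤ) ∣ ϖ.im * ϖ.im := by
      rw [show ϖ.im * ϖ.im = p - ϖ.re * ϖ.re by linarith]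
      exact dvd_sub dvd_rfl (h4.mul_left _)
    rcases hpi.dvd_or_dvd this with h | h <;> exact h
  obtain ⟨x, hx⟩ := h4
  obtain ⟨y, hy⟩ := h6
  rw [hx, hy] at h5
  have h7 : (p : ℤ) * (p * (x * x + y * y)) = p * 1 := by linarith
  have h8 := mul_left_cancel₀ (by exact_mod_cast hp.ne_zero) h7
  have : (p : ℤ) ∣ 1 := Dvd.intro _ h8
  exact hpi.not_isUnit (isUnit_of_dvd_one this)

theorem two_mul_card_gpts_le {p m : ℕ} (hp : p.Prime) (hp1 : p % 4 = 1) (hm : ¬ p ∣ m) :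
    2 * (gpts m).card ≤ (gpts (p * m)).card := by
  classical
  obtain ⟨ϖ, h⟩ := exists_norm_eq_prime hp (by omega)
  have hpr := prime_of_norm_prime hp h
  have hinj : ∀ w : GaussianInt, w ≠ 0 → Function.Injective fun g : GaussianInt => w * g :=
    fun w hw a b hab => mul_left_cancel₀ hw hab
  have hs0 : star ϖ ≠ 0 := by simpa using hpr.ne_zero
  have h1 : ((gpts m).image fun g => ϖ * g) ∪ ((gpts m).image fun g => star ϖ * g) ⊆
      gpts (p * m) := by
    intro z hz
    rw [Finset.mem_union, Finset.mem_image, Finset.mem_image] at hz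
    rw [mem_gpts]
    rcases hz with ⟨g, hg, rfl⟩ | ⟨g, hg, rfl⟩
    · rw [Zsqrtd.norm_mul, h, mem_gpts.mp hg]; push_cast; ring
    · rw [Zsqrtd.norm_mul, gnorm_star, h, mem_gpts.mp hg]; push_cast; ring
  have h2 : Disjoint ((gpts m).image fun g => ϖ * g) ((gpts m).image fun g => star ϖ * g) := by
    rw [Finset.disjoint_left]
    intro z hz hz'
    obtain ⟨g, hg, rfl⟩ := Finset.mem_image.mp hz
    obtain ⟨g', hg', hgg⟩ := Finset.mem_image.mp hz'
    have h3 : ϖ ∣ star ϖ * g' := ⟨g, hgg⟩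
    rcases hpr.dvd_or_dvd h3 with h4 | ⟨u, hu⟩
    · exact not_dvd_star hp hp1 h h4
    · have h5 := mem_gpts.mp hg'
      rw [hu, Zsqrtd.norm_mul, h] at h5
      exact hm (by exact_mod_cast Dvd.intro _ h5)
  calc 2 * (gpts m).card = (((gpts m).image fun g => ϖ * g) ∪
        ((gpts m).image fun g => star ϖ * g)).card := by
        rw [Finset.card_union_of_disjoint h2, Finset.card_image_of_injective _ (hinj _ hpr.ne_zero),
          Finset.card_image_of_injective _ (hinj _ hs0)]; ring
    _ ≤ _ := Finset.card_le_card h1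

theorem card_gpts_prod (s : Finset ℕ) (hs : ∀ p ∈ s, p.Prime ∧ p % 4 = 1) (m : ℕ)
    (hm : ∀ p ∈ s, ¬ p ∣ m) :
    2 ^ s.card * (gpts m).card ≤ (gpts ((∏ p ∈ s, p) * m)).card ∧
      ∀ z ∈ gpts ((∏ p ∈ s, p) * m), ∃ g ∈ gpts m, g ∣ z := by
  classical
  induction s using Finset.induction_on with
  | empty => simp only [Finset.card_empty, Finset.prod_empty, one_mul, pow_zero]
             exact ⟨le_rfl, fun z hz => ⟨z, hz, dvd_rfl⟩⟩
  | insert q s hq ih =>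
    obtain ⟨h1, h2⟩ := ih (fun p hp => hs p (Finset.mem_insert_of_mem hp))
      (fun p hp => hm p (Finset.mem_insert_of_mem hp))
    obtain ⟨hqp, hq1⟩ := hs q (Finset.mem_insert_self _ _)
    have hqn : ¬ q ∣ (∏ p ∈ s, p) * m := by
      rw [hqp.dvd_mul, hqp.prime.dvd_finsetProd_iff]
      rintro (⟨p, hp, h⟩ | h)
      · have := (Nat.prime_dvd_prime_iff_eq hqp (hs p (Finset.mem_insert_of_mem hp)).1).mp h
        exact hq (this ▸ hp)
      · exact hm q (Finset.mem_insert_self _ _) h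
    rw [Finset.prod_insert hq, Finset.card_insert_of_notMem hq, mul_assoc]
    constructor
    · calc 2 ^ (s.card + 1) * (gpts m).card = 2 * (2 ^ s.card * (gpts m).card) := by ring
        _ ≤ 2 * _ := Nat.mul_le_mul_left _ h1
        _ ≤ _ := two_mul_card_gpts_le hqp hq1 hqn
    · intro z hz
      obtain ⟨ϖ, h⟩ := exists_norm_eq_prime hqp (by omega)
      obtain ⟨g, hg, h3⟩ := exists_factor_step hqp h (mem_gpts.mp hz)
      obtain ⟨g', hg', hd⟩ := h2 g (mem_gpts.mpr hg)
      refine ⟨g', hg', hd.trans ?_⟩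
      rcases h3 with rfl | rfl <;> exact dvd_mul_left _ _

theorem sepProp_of_primes {m h Y : ℕ} (s : Finset ℕ) (hs : ∀ p ∈ s, p.Prime ∧ p % 4 = 1)
    (hm : ∀ p ∈ s, ¬ p ∣ m) (hm0 : (gpts m).Nonempty) (hc : h + 8 ≤ s.card)
    (hY : ∏ p ∈ s, p ≤ Y) : SepProp ((∏ p ∈ s, p) * m) (2 ^ h) Y := by
  classical
  intro G hG hcard
  obtain ⟨h1, h2⟩ := card_gpts_prod s hs m hm
  choose! φ hφ hφd using h2
  have hmaps : ∀ v ∈ G, φ (toG v) ∈ gpts m := fun v hv =>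
    hφ _ (Finset.mem_image_of_mem _ (hG hv))
  have h3 : (gpts m).card * 2 ^ h ≤ G.card := by
    rw [← card_gpts] at hcard
    have h4 : 2 ^ (h + 8) * (gpts m).card ≤ 2 ^ s.card * (gpts m).card :=
      Nat.mul_le_mul_right _ (Nat.pow_le_pow_right (by norm_num) hc)
    rw [pow_add] at h4
    nlinarith
  obtain ⟨g, hg, h5⟩ := Finset.exists_le_card_fiber_of_mul_le_card_of_maps_to hmaps hm0 h3
  obtain ⟨T, hT, hTc⟩ := Finset.exists_subset_card_eq h5
  refine ⟨T, hT.trans (Finset.filter_subset _ _), hTc, fun z hz z' hz' hne => ?_⟩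
  have hd : ∀ v ∈ T, g ∣ toG v := fun v hv => by
    have := Finset.mem_filter.mp (hT hv)
    rw [← this.2]
    exact hφd _ (Finset.mem_image_of_mem _ (hG this.1))
  have hd2 : g ∣ toG (z - z') := by
    have : toG (z - z') = toG z - toG z' := rfl
    rw [this]; exact dvd_sub (hd z hz) (hd z' hz')
  obtain ⟨u, hu⟩ := hd2
  have hn := congrArg Zsqrtd.norm hu
  rw [norm_toG, Zsqrtd.norm_mul, mem_gpts.mp hg] at hn
  have hu0 : 0 < u.norm := by
    rw [GaussianInt.norm_pos]
    rintro rfl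
    rw [mul_zero, toG_eq_zero, sub_eq_zero] at hu
    exact hne hu
  simp only [Prod.fst_sub, Prod.snd_sub] at hn
  rw [hn]
  push_cast
  have hY' : (∏ p ∈ s, (p : ℤ)) ≤ Y := by
    have h6 : ((∏ p ∈ s, p : ℕ) : ℤ) ≤ (Y : ℤ) := Int.ofNat_le.mpr hY
    rwa [Nat.cast_prod] at h6
  have hm' : (0 : ℤ) ≤ m := by positivity
  calc (∏ p ∈ s, (p : ℤ)) * m ≤ Y * m := by gcongr
    _ = m * 1 * Y := by ring
    _ ≤ m * u.norm * Y := by gcongr; omega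

theorem dvd_of_dvd_norm {p : ℕ} (hp : p.Prime) (hp3 : p % 4 = 3) {z : GaussianInt}
    (h : (p : ℤ) ∣ z.norm) : (p : GaussianInt) ∣ z := by
  have := Fact.mk hp
  have hpr := GaussianInt.prime_of_nat_prime_of_mod_four_eq_three p hp3
  have h1 : (p : GaussianInt) ∣ z * star z := by
    rw [← Zsqrtd.norm_eq_mul_conj]
    obtain ⟨k, hk⟩ := h
    rw [hk]; push_cast; exact dvd_mul_right _ _
  rcases hpr.dvd_or_dvd h1 with h2 | ⟨g, hg⟩
  · exact h2
  · refine ⟨star g, ?_⟩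
    rw [← star_star z, hg, star_mul, mul_comm]; simp

theorem card_gpts_pow_mul_le {p m : ℕ} (hp : p.Prime) (hm : ¬ p ∣ m) (e : ℕ) :
    (gpts (p ^ e * m)).card ≤ (e + 1) * (gpts m).card := by
  classical
  by_cases h3 : p % 4 = 3
  · suffices h : (gpts (p ^ e * m)).card ≤ (gpts m).card by nlinarith
    induction e using Nat.twoStepInduction with
    | zero => simp
    | one =>
      suffices h0 : gpts (p ^ 1 * m) = ∅ by rw [h0]; simp
      rw [Finset.eq_empty_iff_forall_notMem]
      intro z hz
      rw [mem_gpts, pow_one] at hz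
      obtain ⟨g, rfl⟩ := dvd_of_dvd_norm hp h3 (z := z) (by rw [hz]; push_cast; exact dvd_mul_right _ _)
      rw [Zsqrtd.norm_mul, Zsqrtd.norm_natCast, mul_assoc] at hz
      push_cast at hz
      have := mul_left_cancel₀ (by exact_mod_cast hp.ne_zero) hz
      exact hm (by exact_mod_cast Dvd.intro _ this)
    | more e ih _ =>
      refine le_trans ?_ ih
      refine (Finset.card_le_card (t := (gpts (p ^ e * m)).image fun g => (p : GaussianInt) * g)
        ?_).trans Finset.card_image_le
      intro z hz
      rw [mem_gpts] at hz
      obtain ⟨g, rfl⟩ := dvd_of_dvd_norm hp h3 (z := z)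
        (by rw [hz, show p ^ (e + 2) * m = p * (p ^ (e + 1) * m) by ring]; push_cast; exact dvd_mul_right _ _)
      refine Finset.mem_image.mpr ⟨g, ?_, rfl⟩
      rw [mem_gpts]
      rw [Zsqrtd.norm_mul, Zsqrtd.norm_natCast] at hz
      push_cast at hz ⊢
      have hp0 : ((p : ℤ) * p) ≠ 0 := by simpa using hp.ne_zero
      refine mul_left_cancel₀ hp0 (hz.trans ?_)
      ring
  · obtain ⟨ϖ, h⟩ := exists_norm_eq_prime hp h3
    refine (Finset.card_le_card (t := (Finset.range (e + 1) ×ˢ gpts m).image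
      fun x => ϖ ^ x.1 * star ϖ ^ (e - x.1) * x.2) ?_).trans (Finset.card_image_le.trans ?_)
    · intro z hz
      obtain ⟨a, ha, u, hu, rfl⟩ := exists_factor_pow hp h e m (mem_gpts.mp hz)
      exact Finset.mem_image.mpr ⟨(a, u), by simp [mem_gpts, hu]; omega, rfl⟩
    · rw [Finset.card_product, Finset.card_range]

theorem card_gpts_le {n : ℕ} (hn : 0 < n) : (gpts n).card ≤ 4 * n.divisors.card := by
  induction n using Nat.recOnPrimePow with
  | zero => omega
  | one => rw [card_gpts]; decide
  | prime_pow_mul a p n hp hpa hn0 ih =>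
    have ha : 0 < a := Nat.pos_of_mul_pos_left hn
    have hc : (p ^ n).Coprime a := Nat.Coprime.pow_left _ ((Nat.Prime.coprime_iff_not_dvd hp).mpr hpa)
    rw [hc.card_divisors_mul, Nat.divisors_prime_pow hp, Finset.card_map, Finset.card_range]
    calc (gpts (p ^ n * a)).card ≤ (n + 1) * (gpts a).card := card_gpts_pow_mul_le hp hpa n
      _ ≤ (n + 1) * (4 * a.divisors.card) := Nat.mul_le_mul_left _ (ih ha)
      _ = _ := by ring

theorem prod_mem_sumTwoSq (s : Finset ℕ) (hs : ∀ p ∈ s, p.Prime ∧ p % 4 = 1) :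
    ∏ p ∈ s, p ∈ sumTwoSq := by
  classical
  induction s using Finset.induction_on with
  | empty => exact one_mem_sumTwoSq
  | insert q s hq ih =>
    rw [Finset.prod_insert hq]
    have h1 := hs q (Finset.mem_insert_self _ _)
    exact sumTwoSq_mul_mem (prime_one_mem_sumTwoSq h1.1 h1.2)
      (ih fun p hp => hs p (Finset.mem_insert_of_mem hp))

theorem gpts_nonempty {n : ℕ} (h : n ∈ sumTwoSq) : (gpts n).Nonempty := by
  obtain ⟨-, a, b, hab⟩ := h
  exact ⟨⟨a, b⟩, mem_gpts.mpr (by rw [Zsqrtd.norm_def, hab]; ring)⟩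

open Classical in
/-- The number of primes of `T` dividing `n`. -/
def omegaT (T : Finset ℕ) (n : ℕ) : ℕ := (T.filter (· ∣ n)).card

theorem sepProp_of_omegaT {lam h z Y : ℕ} (hlam : lam ∈ sumTwoSq) (T : Finset ℕ)
    (hT : ∀ p ∈ T, p.Prime ∧ p % 4 = 1) (hz : ∀ p ∈ T, p ≤ z) (hsq : ∀ p ∈ T, ¬ p ^ 2 ∣ lam)
    (hω : h + 8 ≤ omegaT T lam) (hY : z ^ (h + 8) ≤ Y) : SepProp lam (2 ^ h) Y := by
  classical
  obtain ⟨s, hs, hc⟩ := Finset.exists_subset_card_eq hω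
  have hsT : ∀ p ∈ s, p ∈ T := fun p hp => (Finset.mem_filter.mp (hs hp)).1
  have hsd : ∀ p ∈ s, p ∣ lam := fun p hp => (Finset.mem_filter.mp (hs hp)).2
  have hd : ∏ p ∈ s, p ∣ lam :=
    Finset.prod_primes_dvd _ (fun p hp => (hT p (hsT p hp)).1.prime) hsd
  have hprod := prod_mem_sumTwoSq s fun p hp => hT p (hsT p hp)
  have hm := sumTwoSq_div_mem hlam hprod hd
  have h1 := sepProp_of_primes (m := lam / ∏ p ∈ s, p) (h := h) (Y := Y) s
    (fun p hp => hT p (hsT p hp)) (fun p hp hpm => ?_) (gpts_nonempty hm) hc.ge ?_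
  · rwa [Nat.mul_div_cancel' hd] at h1
  · apply hsq p (hsT p hp)
    rw [pow_two]
    obtain ⟨k, hk⟩ := hpm
    have h2 := Nat.mul_div_cancel' hd
    rw [hk] at h2
    rw [← h2]
    exact mul_dvd_mul (Finset.dvd_prod_of_mem _ hp) (dvd_mul_right _ _)
  · refine le_trans ?_ hY
    rw [← hc]
    exact Finset.prod_le_pow_card _ _ _ fun p hp => hz p (hsT p hp)

open Classical in
theorem exists_sq_dvd_le : ∀ ε : ℝ, 0 < ε → ∃ z0 X0 : ℕ, ∀ X, X0 ≤ X → ∀ z, z0 ≤ z →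
    (((SX X).filter fun n => ∃ p, z < p ∧ p ^ 2 ∣ n).card : ℝ) ≤ ε * (SX X).card := by
  intro ε hε
  obtain ⟨C, hC, X0, hX⟩ := exists_card_SX_div_le
  have hsum : Summable fun p : ℕ => C * (8 * (1 / (p : ℝ) ^ (3 / 2 : ℝ))) :=
    ((Real.summable_one_div_nat_rpow.mpr (by norm_num)).mul_left _).mul_left _
  have ht := tendsto_sum_nat_add fun p : ℕ => C * (8 * (1 / (p : ℝ) ^ (3 / 2 : ℝ)))
  have hev := (ht.eventually (ge_mem_nhds hε)).exists_forall_of_atTop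
  obtain ⟨z0, hz0⟩ := hev
  refine ⟨z0, X0, fun X hXX z hz => ?_⟩
  have hterm : ∀ p : ℕ, 0 < p → C * (Real.log (2 * (p ^ 2 : ℕ)) / (p ^ 2 : ℕ)) ≤
      C * (8 * (1 / (p : ℝ) ^ (3 / 2 : ℝ))) := by
    intro p hp
    have hp' : (0 : ℝ) < p := by exact_mod_cast hp
    have h1 : Real.log (2 * (p ^ 2 : ℕ)) ≤ 8 * (p : ℝ) ^ (1 / 2 : ℝ) := by
      have h2 : Real.log ((p : ℝ) ^ (1 / 2 : ℝ)) ≤ (p : ℝ) ^ (1 / 2 : ℝ) - 1 :=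
        Real.log_le_sub_one_of_pos (by positivity)
      rw [Real.log_rpow hp'] at h2
      push_cast
      rw [Real.log_mul (by norm_num) (by positivity), Real.log_pow]
      have := Real.log_two_lt_d9
      push_cast
      have := Real.rpow_pos_of_pos hp' (1 / 2 : ℝ)
      linarith
    have h3 : (p : ℝ) ^ (3 / 2 : ℝ) * (p : ℝ) ^ (1 / 2 : ℝ) = (p ^ 2 : ℕ) := by
      rw [← Real.rpow_add hp']; norm_num
    refine mul_le_mul_of_nonneg_left ?_ hC.le
    rw [mul_one_div, div_le_div_iff₀ (by positivity) (by positivity)]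
    calc _ ≤ 8 * (p : ℝ) ^ (1 / 2 : ℝ) * (p : ℝ) ^ (3 / 2 : ℝ) := by gcongr
      _ = 8 * ((p : ℝ) ^ (3 / 2 : ℝ) * (p : ℝ) ^ (1 / 2 : ℝ)) := by ring
      _ = _ := by rw [h3]
  have hsub : ((SX X).filter fun n => ∃ p, z < p ∧ p ^ 2 ∣ n) ⊆
      (Finset.Ioc z X).biUnion fun p => (SX (X / p ^ 2)).image fun k => p ^ 2 * k := by
    intro n hn
    obtain ⟨hn1, p, hp, k, rfl⟩ := Finset.mem_filter.mp hn
    obtain ⟨hle, hS⟩ := mem_SX.mp hn1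
    have hp0 : 0 < p := by omega
    have hk0 : 0 < k := Nat.pos_of_mul_pos_left (sumTwoSq_pos hS)
    rw [Finset.mem_biUnion]
    refine ⟨p, Finset.mem_Ioc.mpr ⟨hp, ?_⟩, Finset.mem_image.mpr ⟨k, mem_SX.mpr ⟨?_, ?_⟩, rfl⟩⟩
    · nlinarith
    · rw [Nat.le_div_iff_mul_le (by positivity)]; linarith
    · have := sumTwoSq_div_mem hS (sq_mem_sumTwoSq hp0) (dvd_mul_right _ _)
      rwa [Nat.mul_div_cancel_left _ (by positivity)] at this
  calc (((SX X).filter fun n => ∃ p, z < p ∧ p ^ 2 ∣ n).card : ℝ)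
      ≤ ∑ p ∈ Finset.Ioc z X, ((SX (X / p ^ 2)).card : ℝ) := by
        have h1 := (Finset.card_le_card hsub).trans Finset.card_biUnion_le
        have h2 : ∑ p ∈ Finset.Ioc z X, ((SX (X / p ^ 2)).image fun k => p ^ 2 * k).card ≤
            ∑ p ∈ Finset.Ioc z X, (SX (X / p ^ 2)).card :=
          Finset.sum_le_sum fun p _ => Finset.card_image_le
        exact_mod_cast h1.trans h2
    _ ≤ ∑ p ∈ Finset.Ioc z X, C * (8 * (1 / (p : ℝ) ^ (3 / 2 : ℝ))) * (SX X).card := by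
        refine Finset.sum_le_sum fun p hp => ?_
        have hp0 : 0 < p := by have := Finset.mem_Ioc.mp hp; omega
        exact (hX X hXX (p ^ 2) (by positivity)).trans
          (mul_le_mul_of_nonneg_right (hterm p hp0) (by positivity))
    _ = (∑ p ∈ Finset.Ioc z X, C * (8 * (1 / (p : ℝ) ^ (3 / 2 : ℝ)))) * (SX X).card := by
        rw [Finset.sum_mul]
    _ ≤ ε * (SX X).card := by
        refine mul_le_mul_of_nonneg_right ?_ (by positivity)
        refine le_trans ?_ (hz0 z hz)
        have hs2 := (summable_nat_add_iff (f := fun p : ℕ => C * (8 * (1 / (p : ℝ) ^ (3 / 2 : ℝ)))) z).mpr hsum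
        have h4 : ∑ p ∈ Finset.Ioc z X, C * (8 * (1 / (p : ℝ) ^ (3 / 2 : ℝ))) ≤
            ∑ k ∈ Finset.range (X + 1), C * (8 * (1 / ((k + z : ℕ) : ℝ) ^ (3 / 2 : ℝ))) := by
          rw [← Finset.sum_image (f := fun p : ℕ => C * (8 * (1 / (p : ℝ) ^ (3 / 2 : ℝ))))
            (s := Finset.range (X + 1)) (g := fun k => k + z) (fun a _ b _ h => by simpa using h)]
          refine Finset.sum_le_sum_of_subset_of_nonneg (fun p hp => ?_) fun _ _ _ => by positivity
          have := Finset.mem_Ioc.mp hp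
          exact Finset.mem_image.mpr ⟨p - z, Finset.mem_range.mpr (by omega), by omega⟩
        exact h4.trans (hs2.sum_le_tsum _ fun _ _ => by positivity)

theorem sum_weight_mul_le (T : Finset ℕ) (hT : ∀ p ∈ T, p.Prime ∧ p % 4 = 1) {z r X : ℕ}
    (hz : ∀ p ∈ T, p ≤ z) (hz1 : 0 < z) (hX : z ^ r ≤ X) :
    (∑ m ∈ SX X, (1 / 2 : ℝ) ^ omegaT T m / m) *
      (∑ s ∈ T.powerset.filter (fun s => s.card ≤ r), (1 / 2 : ℝ) ^ s.card / ∏ p ∈ s, (p : ℝ)) ≤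
      HX (X ^ 2) := by
  classical
  have h1 : ∀ s ∈ T.powerset.filter (fun s => s.card ≤ r),
      (∑ m ∈ SX X, (1 / 2 : ℝ) ^ omegaT T m / m) * ((1 / 2 : ℝ) ^ s.card / ∏ p ∈ s, (p : ℝ)) ≤
      ∑ k ∈ SX (X ^ 2), if s ⊆ T.filter (· ∣ k) then (1 / 2 : ℝ) ^ omegaT T k / k else 0 := by
    intro s hs
    obtain ⟨hsT, hsr⟩ := Finset.mem_filter.mp hs
    rw [Finset.mem_powerset] at hsT
    have hsp : ∀ p ∈ s, p.Prime ∧ p % 4 = 1 := fun p hp => hT p (hsT hp)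
    have hP0 : 0 < ∏ p ∈ s, p := Finset.prod_pos fun p hp => (hsp p hp).1.pos
    have hPX : ∏ p ∈ s, p ≤ X := by
      refine (Finset.prod_le_pow_card s _ z fun p hp => hz p (hsT hp)).trans (le_trans ?_ hX)
      exact Nat.pow_le_pow_right hz1 hsr
    rw [← Finset.sum_filter, Finset.sum_mul]
    set P := ∏ p ∈ s, p with hP
    have hPc : ∏ p ∈ s, (p : ℝ) = (P : ℝ) := by rw [hP]; push_cast; rfl
    rw [hPc]
    calc ∑ m ∈ SX X, (1 / 2 : ℝ) ^ omegaT T m / m * ((1 / 2 : ℝ) ^ s.card / P)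
        ≤ ∑ m ∈ SX X, (1 / 2 : ℝ) ^ omegaT T (m * P) / ((m * P : ℕ) : ℝ) := by
          refine Finset.sum_le_sum fun m hm => ?_
          rw [div_mul_div_comm, ← pow_add]
          push_cast
          refine div_le_div_of_nonneg_right ?_ (by positivity)
          refine pow_le_pow_of_le_one (by norm_num) (by norm_num) ?_
          unfold omegaT
          refine le_trans (Finset.card_le_card ?_) (Finset.card_union_le _ _)
          intro p hp
          obtain ⟨hpT, hpd⟩ := Finset.mem_filter.mp hp
          have hpp := (hT p hpT).1
          rcases hpp.dvd_mul.mp hpd with h | h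
          · exact Finset.mem_union_left _ (Finset.mem_filter.mpr ⟨hpT, h⟩)
          · refine Finset.mem_union_right _ ?_
            obtain ⟨q, hq, hpq⟩ := (hpp.prime.dvd_finsetProd_iff _).mp h
            rwa [(Nat.prime_dvd_prime_iff_eq hpp (hsp q hq).1).mp hpq]
      _ = ∑ k ∈ (SX X).image (fun m => m * P), (1 / 2 : ℝ) ^ omegaT T k / (k : ℝ) := by
          rw [Finset.sum_image]
          intro a _ b _ h
          exact Nat.eq_of_mul_eq_mul_right hP0 h
      _ ≤ _ := by
          refine Finset.sum_le_sum_of_subset_of_nonneg (fun k hk => ?_) fun _ _ _ => by positivity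
          obtain ⟨m, hm, rfl⟩ := Finset.mem_image.mp hk
          obtain ⟨hmX, hmS⟩ := mem_SX.mp hm
          refine Finset.mem_filter.mpr ⟨mem_SX.mpr ⟨?_, ?_⟩, fun p hp => ?_⟩
          · rw [pow_two]; exact Nat.mul_le_mul hmX hPX
          · exact sumTwoSq_mul_mem hmS (prod_mem_sumTwoSq s hsp)
          · exact Finset.mem_filter.mpr ⟨hsT hp, (Finset.dvd_prod_of_mem _ hp).mul_left _⟩
  rw [Finset.mul_sum]
  refine (Finset.sum_le_sum h1).trans ?_
  rw [Finset.sum_comm]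
  refine Finset.sum_le_sum fun k _ => ?_
  rw [← Finset.sum_filter]
  calc ∑ s ∈ (T.powerset.filter (fun s => s.card ≤ r)).filter (fun s => s ⊆ T.filter (· ∣ k)),
        (1 / 2 : ℝ) ^ omegaT T k / k
      ≤ ∑ s ∈ (T.filter (· ∣ k)).powerset, (1 / 2 : ℝ) ^ omegaT T k / k := by
        refine Finset.sum_le_sum_of_subset_of_nonneg (fun s hs => ?_) fun _ _ _ => by positivity
        exact Finset.mem_powerset.mpr (Finset.mem_filter.mp hs).2
    _ = 1 / k := by
        rw [Finset.sum_const, Finset.card_powerset, nsmul_eq_mul]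
        unfold omegaT
        push_cast
        rw [← mul_div_assoc, ← mul_pow]; norm_num

theorem exp_half_le {x : ℝ} (hx : 0 ≤ x) (hx1 : x ≤ 1) : Real.exp (x / 2) ≤ 1 + x := by
  have h := Real.abs_exp_sub_one_sub_id_le (x := x / 2) (by rw [abs_of_nonneg] <;> linarith)
  have := (abs_le.mp h).2
  nlinarith

theorem exp_le_sum_weight (T : Finset ℕ) (hT : ∀ p ∈ T, 0 < p) {z r : ℕ} (hz1 : 0 < z)
    (hz : ∀ p ∈ T, p ≤ z) (hr : 6 * z ≤ 2 ^ r) :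
    Real.exp (∑ p ∈ T, 1 / (p : ℝ) / 4) / 2 ≤
      ∑ s ∈ T.powerset.filter (fun s => s.card ≤ r), (1 / 2 : ℝ) ^ s.card / ∏ p ∈ s, (p : ℝ) := by
  classical
  have hp1 : ∀ p ∈ T, 1 / (p : ℝ) ≤ 1 := fun p hp => by
    rw [div_le_one (by exact_mod_cast hT p hp)]; exact_mod_cast hT p hp
  have h1 : Real.exp (∑ p ∈ T, 1 / (p : ℝ) / 4) ≤ ∏ p ∈ T, (1 + 1 / 2 / (p : ℝ)) := by
    rw [Real.exp_sum]
    refine Finset.prod_le_prod (fun _ _ => (Real.exp_pos _).le) fun p hp => ?_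
    have := exp_half_le (x := 1 / 2 / (p : ℝ)) (by positivity) (by
      have := hp1 p hp
      rw [div_div, mul_comm, ← div_div]; linarith)
    refine le_trans (le_of_eq ?_) this
    congr 1; ring
  have h2 : ∏ p ∈ T, (1 + 1 / 2 / (p : ℝ)) =
      ∑ s ∈ T.powerset, (1 / 2 : ℝ) ^ s.card / ∏ p ∈ s, (p : ℝ) := by
    rw [Finset.prod_one_add]
    refine Finset.sum_congr rfl fun s _ => ?_
    rw [Finset.prod_div_distrib, Finset.prod_const]
  have h3 : ∑ s ∈ T.powerset.filter (fun s => ¬ s.card ≤ r), (1 / 2 : ℝ) ^ s.card /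
      ∏ p ∈ s, (p : ℝ) ≤ 1 / 2 := by
    calc ∑ s ∈ T.powerset.filter (fun s => ¬ s.card ≤ r), (1 / 2 : ℝ) ^ s.card /
        ∏ p ∈ s, (p : ℝ)
        ≤ ∑ s ∈ T.powerset.filter (fun s => ¬ s.card ≤ r), (1 / 2 : ℝ) ^ r *
            ∏ p ∈ s, (1 / (p : ℝ)) := by
          refine Finset.sum_le_sum fun s hs => ?_
          have := (Finset.mem_filter.mp hs).2
          rw [Finset.prod_div_distrib, Finset.prod_const_one, mul_one_div]
          refine div_le_div_of_nonneg_right ?_ (by positivity)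
          exact pow_le_pow_of_le_one (by norm_num) (by norm_num) (by omega)
      _ ≤ ∑ s ∈ T.powerset, (1 / 2 : ℝ) ^ r * ∏ p ∈ s, (1 / (p : ℝ)) :=
          Finset.sum_le_sum_of_subset_of_nonneg (Finset.filter_subset _ _) fun _ _ _ => by positivity
      _ = (1 / 2 : ℝ) ^ r * ∏ p ∈ T, (1 + 1 / (p : ℝ)) := by
          rw [← Finset.mul_sum, Finset.prod_one_add]
      _ ≤ (1 / 2 : ℝ) ^ r * Real.exp (1 + Real.log z) := by
          refine mul_le_mul_of_nonneg_left ?_ (by positivity)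
          calc ∏ p ∈ T, (1 + 1 / (p : ℝ)) ≤ ∏ p ∈ T, Real.exp (1 / (p : ℝ)) :=
                Finset.prod_le_prod (fun _ _ => by positivity) fun p _ => by
                  rw [add_comm]; exact Real.add_one_le_exp _
            _ = Real.exp (∑ p ∈ T, 1 / (p : ℝ)) := (Real.exp_sum _ _).symm
            _ ≤ _ := by
              refine Real.exp_le_exp.mpr (le_trans ?_ (harmonic_le_one_add_log z))
              rw [harmonic_eq_sum_Icc]
              push_cast
              refine (Finset.sum_le_sum_of_subset_of_nonneg (t := Finset.Icc 1 z)
                (fun p hp => Finset.mem_Icc.mpr ⟨hT p hp, hz p hp⟩)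
                fun _ _ _ => by positivity).trans (le_of_eq ?_)
              exact Finset.sum_congr rfl fun _ _ => one_div _
      _ ≤ 1 / 2 := by
          rw [Real.exp_add, Real.exp_log (by exact_mod_cast hz1), one_div_pow, one_div_mul_eq_div,
            div_le_iff₀ (by positivity)]
          have h6 : (6 : ℝ) * z ≤ 2 ^ r := by exact_mod_cast hr
          have := Real.exp_one_lt_d9
          have hz' : (0 : ℝ) < z := by exact_mod_cast hz1
          nlinarith
  have h4 := Finset.sum_filter_add_sum_filter_not T.powerset (fun s => s.card ≤ r)
    (fun s => (1 / 2 : ℝ) ^ s.card / ∏ p ∈ s, (p : ℝ))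
  have h5 : 1 ≤ Real.exp (∑ p ∈ T, 1 / (p : ℝ) / 4) :=
    Real.one_le_exp (Finset.sum_nonneg fun _ _ => by positivity)
  rw [← h2] at h4
  linarith

open Classical in
theorem exists_card_omegaT_lt_le : ∃ C : ℝ, 0 < C ∧ ∃ X0 : ℕ, ∀ X, X0 ≤ X →
    ∀ T : Finset ℕ, (∀ p ∈ T, p.Prime ∧ p % 4 = 1) → ∀ z r h : ℕ, 0 < z → (∀ p ∈ T, p ≤ z) →
      6 * z ≤ 2 ^ r → z ^ r ≤ X →
      (((SX X).filter fun n => omegaT T n < h).card : ℝ) ≤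
        C * 2 ^ h * Real.exp (-∑ p ∈ T, 1 / (p : ℝ) / 4) * (SX X).card := by
  obtain ⟨C, hC, X0, hX0⟩ := exists_weighted_le
  refine ⟨2 * C, by positivity, X0 + 1, fun X hX T hT z r h hz1 hz hr hzr => ?_⟩
  have h1 := hX0 X (by omega) (fun n => (1 / 2 : ℝ) ^ omegaT T n) (fun _ => by positivity)
    (fun n m _ hmn => pow_le_pow_of_le_one (by norm_num) (by norm_num)
      (Finset.card_le_card fun p hp => by
        rw [Finset.mem_filter] at hp ⊢; exact ⟨hp.1, hp.2.trans hmn⟩))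
  have h2 := sum_weight_mul_le T hT hz hz1 hzr
  have h3 := exp_le_sum_weight T (fun p hp => (hT p hp).1.pos) hz1 hz hr
  set V := ∑ s ∈ T.powerset.filter (fun s => s.card ≤ r), (1 / 2 : ℝ) ^ s.card / ∏ p ∈ s, (p : ℝ)
  set W := ∑ m ∈ SX X, (1 / 2 : ℝ) ^ omegaT T m / m
  set U := ∑ n ∈ SX X, (1 / 2 : ℝ) ^ omegaT T n
  have hH : 0 < HX (X ^ 2) := lt_of_lt_of_le one_pos (one_le_HX (pow_pos (by omega) 2))
  set E := Real.exp (∑ p ∈ T, 1 / (p : ℝ) / 4) with hE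
  have hEpos : 0 < E := Real.exp_pos _
  have hV : 0 < V := by linarith [half_pos hEpos]
  have hW : W * V ≤ HX (X ^ 2) := h2
  have h4 : U * V ≤ C * (SX X).card := by
    have h5 : U * V * HX (X ^ 2) ≤ C * (SX X).card * HX (X ^ 2) := by
      calc U * V * HX (X ^ 2) = (U * HX (X ^ 2)) * V := by ring
        _ ≤ (C * (SX X).card * W) * V := by gcongr
        _ = C * (SX X).card * (W * V) := by ring
        _ ≤ _ := by gcongr
    exact le_of_mul_le_mul_right h5 hH
  have hU0 : 0 ≤ U := Finset.sum_nonneg fun _ _ => by positivity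
  have h6 : U * E ≤ 2 * C * (SX X).card := by
    have : U * (E / 2) ≤ U * V := by gcongr
    linarith
  have h7 : (((SX X).filter fun n => omegaT T n < h).card : ℝ) ≤ 2 ^ h * U := by
    rw [Finset.card_eq_sum_ones, Nat.cast_sum, Finset.mul_sum]
    refine (Finset.sum_le_sum fun n hn => ?_).trans (Finset.sum_le_sum_of_subset_of_nonneg
      (Finset.filter_subset _ _) fun _ _ _ => by positivity)
    have hn2 := (Finset.mem_filter.mp hn).2
    rw [one_div_pow, mul_one_div, Nat.cast_one, le_div_iff₀ (by positivity), one_mul]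
    exact pow_le_pow_right₀ (by norm_num) hn2.le
  rw [Real.exp_neg, ← hE]
  calc (((SX X).filter fun n => omegaT T n < h).card : ℝ) ≤ 2 ^ h * U := h7
    _ ≤ 2 ^ h * (2 * C * (SX X).card * E⁻¹) := by
        gcongr
        rwa [← div_eq_mul_inv, le_div_iff₀ hEpos]
    _ = _ := by ring

theorem le_sum_primesOne {A : ℕ} (hA : 2 ≤ A) {c : ℝ} (hc : 0 < c) {J : ℕ}
    (h : ∀ j, J ≤ j → c / (j + 1) ≤ ∑ p ∈ primesOne (A ^ j) (A ^ (j + 1)), 1 / (p : ℝ))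
    {m n : ℕ} (hm : J ≤ m) (hmn : m ≤ n) :
    c * Real.log ((n + 1) / (m + 1)) ≤ ∑ p ∈ primesOne (A ^ m) (A ^ n), 1 / (p : ℝ) := by
  classical
  induction n, hmn using Nat.le_induction with
  | base => rw [div_self (by positivity)]; simpa using Finset.sum_nonneg fun _ _ => by positivity
  | succ n hmn ih =>
    have h1 := h n (hm.trans hmn)
    have hle : A ^ m ≤ A ^ n := Nat.pow_le_pow_right (by omega) hmn
    have hle2 : A ^ n ≤ A ^ (n + 1) := Nat.pow_le_pow_right (by omega) (by omega)
    have hd : Disjoint (primesOne (A ^ m) (A ^ n)) (primesOne (A ^ n) (A ^ (n + 1))) := by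
      rw [Finset.disjoint_left]
      intro p hp hp'
      have h2 := (mem_primesOne.mp hp).1
      have h3 := (mem_primesOne.mp hp').1
      omega
    have hsub : primesOne (A ^ m) (A ^ n) ∪ primesOne (A ^ n) (A ^ (n + 1)) ⊆
        primesOne (A ^ m) (A ^ (n + 1)) := by
      intro p hp
      rw [Finset.mem_union, mem_primesOne, mem_primesOne] at hp
      rw [mem_primesOne]
      rcases hp with hp | hp <;> exact ⟨⟨by omega, by omega⟩, hp.2⟩
    have h4 := Finset.sum_le_sum_of_subset_of_nonneg (f := fun p : ℕ => 1 / (p : ℝ)) hsub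
      fun _ _ _ => by positivity
    rw [Finset.sum_union hd] at h4
    refine le_trans ?_ h4
    have h5 : Real.log (((n + 1 : ℕ) + 1) / (m + 1)) ≤
        Real.log ((n + 1) / (m + 1)) + 1 / (n + 1) := by
      have h6 : (((n + 1 : ℕ) : ℝ) + 1) / (m + 1) = ((n + 1) / (m + 1)) * (1 + 1 / (n + 1)) := by
        push_cast; field_simp
      rw [h6, Real.log_mul (by positivity) (by positivity)]
      have := Real.log_le_sub_one_of_pos (x := 1 + 1 / ((n : ℝ) + 1)) (by positivity)
      linarith
    calc c * Real.log (((n + 1 : ℕ) + 1) / (m + 1))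
        ≤ c * (Real.log ((n + 1) / (m + 1)) + 1 / (n + 1)) := by gcongr
      _ = c * Real.log ((n + 1) / (m + 1)) + c / (n + 1) := by ring
      _ ≤ _ := add_le_add ih h1

open Classical in
theorem exists_sepProp : ∃ A C C2 : ℕ, 2 ≤ A ∧ ∀ ε : ℝ, 0 < ε → ∃ h1, ∀ h0, h1 ≤ h0 → ∃ X0 : ℕ,
    ∀ X, X0 ≤ X → (((SX X).filter fun n : ℕ => ∃ h, h0 ≤ h ∧ (2 : ℝ) ^ (C2 * h) ≤ Real.log (n : ℝ) ∧
      ¬ SepProp n (2 ^ h) (A ^ ((h + 8) * 2 ^ (C * h)))).card : ℝ) ≤ ε * (SX X).card := by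
  obtain ⟨A, hA, c, hc, J, hJ⟩ := exists_sum_inv_ge
  obtain ⟨C0, hC0, X1, hX1⟩ := exists_card_omegaT_lt_le
  obtain ⟨C', hC'⟩ := exists_nat_ge (12 / c)
  rw [div_le_iff₀ hc] at hC'
  refine ⟨A, C' + 1, 2 * (C' + 1) + 2 * A + 3, hA, fun ε hε => ?_⟩
  obtain ⟨z0, X2, hz0⟩ := exists_sq_dvd_le (ε / 2) (by positivity)
  obtain ⟨h2, hh2⟩ := exists_pow_lt_of_lt_one (show 0 < ε / (1024 * C0) by positivity)
    (show (1 / 4 : ℝ) < 1 by norm_num)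
  refine ⟨J + z0 + h2 + 1, fun h0 hh0 => ⟨X1 + X2 + 1, fun X hX => ?_⟩⟩
  set z := A ^ h0 with hz
  have hzz : z0 ≤ z := by have := Nat.lt_pow_self (n := h0) (show 1 < A by omega); omega
  set Jh : ℕ → ℕ := fun h => (h0 + 1) * 2 ^ (C' * h) with hJh
  set T : ℕ → Finset ℕ := fun h => primesOne (A ^ h0) (A ^ Jh h) with hT
  have hTp : ∀ h, ∀ p ∈ T h, p.Prime ∧ p % 4 = 1 := fun h p hp => (mem_primesOne.mp hp).2
  have hTz : ∀ h, ∀ p ∈ T h, p ≤ A ^ Jh h := fun h p hp => (mem_primesOne.mp hp).1.2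
  have hJle : ∀ h, h0 ≤ h → Jh h ≤ 2 ^ ((C' + 1) * h) := by
    intro h hh
    rw [add_mul, one_mul, pow_add, mul_comm (2 ^ (C' * h))]
    refine Nat.mul_le_mul_right _ (le_trans ?_ (Nat.pow_le_pow_right (by norm_num) hh))
    exact Nat.lt_two_pow_self
  have hcount : ∀ h, h0 ≤ h → (2 : ℝ) ^ ((2 * (C' + 1) + 2 * A + 3) * h) ≤ Real.log X →
      (((SX X).filter fun n : ℕ => omegaT (T h) n < h + 8).card : ℝ) ≤
        256 * C0 * (1 / 4) ^ h * (SX X).card := by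
    intro h hh hlog
    have hA0 : 0 < A := by omega
    have h3 := hX1 X (by omega) (T h) (hTp h) (A ^ Jh h) (A * Jh h + 3) (h + 8) (by positivity)
      (hTz h) ?_ ?_
    · refine h3.trans (mul_le_mul_of_nonneg_right ?_ (by positivity))
      have h4 := le_sum_primesOne hA hc hJ (m := h0) (n := Jh h) (by omega)
        (by have : 0 < 2 ^ (C' * h) := by positivity
            simp only [hJh]; nlinarith)
      have h5 : Real.log ((2 : ℝ) ^ (C' * h)) ≤ Real.log ((Jh h + 1) / (h0 + 1)) := by
        refine Real.log_le_log (by positivity) ?_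
        rw [le_div_iff₀ (by positivity)]
        simp only [hJh]; push_cast
        linarith
      rw [Real.log_pow] at h5
      have hl2 : 0 < Real.log 2 := Real.log_pos (by norm_num)
      have h6 : 3 * h * Real.log 2 ≤ ∑ p ∈ T h, 1 / (p : ℝ) / 4 := by
        rw [← Finset.sum_div, le_div_iff₀ (by norm_num)]
        refine le_trans ?_ h4
        refine le_trans ?_ (mul_le_mul_of_nonneg_left h5 hc.le)
        push_cast
        have : 0 ≤ h * Real.log 2 := by positivity
        nlinarith
      have h7 : Real.exp (-∑ p ∈ T h, 1 / (p : ℝ) / 4) ≤ (1 / 8) ^ h := by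
        calc Real.exp (-∑ p ∈ T h, 1 / (p : ℝ) / 4) ≤ Real.exp (h * (-(3 * Real.log 2))) :=
              Real.exp_le_exp.mpr (by linarith)
          _ = (1 / 8) ^ h := by
              rw [Real.exp_nat_mul, Real.exp_neg, mul_comm, Real.exp_mul, Real.exp_log (by norm_num)]
              norm_num
      calc C0 * 2 ^ (h + 8) * Real.exp (-∑ p ∈ T h, 1 / (p : ℝ) / 4)
          ≤ C0 * 2 ^ (h + 8) * (1 / 8) ^ h := by gcongr
        _ = 256 * C0 * (2 * (1 / 8)) ^ h := by rw [mul_pow, pow_add]; ring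
        _ = _ := by norm_num
    · rw [pow_add, pow_mul 2 A]
      have : A ^ Jh h ≤ (2 ^ A) ^ Jh h := Nat.pow_le_pow_left Nat.lt_two_pow_self.le _
      calc 6 * A ^ Jh h ≤ 6 * (2 ^ A) ^ Jh h := Nat.mul_le_mul_left _ this
        _ ≤ (2 ^ A) ^ Jh h * 2 ^ 3 := by linarith [Nat.zero_le ((2 ^ A) ^ Jh h)]
    · rw [← pow_mul]
      have hX0 : (0 : ℝ) < X := by exact_mod_cast (by omega : 0 < X)
      have h4 : ((A ^ (Jh h * (A * Jh h + 3)) : ℕ) : ℝ) ≤ X := by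
        rw [← Real.log_le_log_iff (by positivity) hX0]
        refine le_trans ?_ hlog
        push_cast
        rw [Real.log_pow]
        have h5 : Real.log A ≤ A := (Real.log_le_self (by positivity))
        have h6 : ((Jh h : ℕ) : ℝ) ≤ 2 ^ ((C' + 1) * h) := by exact_mod_cast hJle h hh
        have h7 : (1 : ℝ) ≤ 2 ^ ((C' + 1) * h) := one_le_pow₀ (by norm_num)
        have h8 : (A : ℝ) ≤ 2 ^ A := by exact_mod_cast Nat.lt_two_pow_self.le
        have hh1 : 1 ≤ h := by omega
        have h9 : (A + 3 : ℝ) * A ≤ 2 ^ ((2 * A + 3) * h) := by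
          calc (A + 3 : ℝ) * A ≤ 2 ^ (A + 3) * 2 ^ A := by
                have : ((A + 3 : ℕ) : ℝ) ≤ 2 ^ (A + 3) := by
                  exact_mod_cast Nat.lt_two_pow_self.le
                push_cast at this
                gcongr
            _ = 2 ^ (2 * A + 3) := by rw [← pow_add]; congr 1; omega
            _ ≤ _ := pow_le_pow_right₀ (by norm_num) (Nat.le_mul_of_pos_right _ hh1)
        set Q : ℝ := 2 ^ ((C' + 1) * h)
        push_cast
        calc (Jh h : ℝ) * (A * Jh h + 3) * Real.log A ≤ Q * (A * Q + 3 * Q) * A := by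
              gcongr
              linarith
          _ = Q * Q * ((A + 3) * A) := by ring
          _ ≤ Q * Q * 2 ^ ((2 * A + 3) * h) := by gcongr
          _ = _ := by simp only [Q]; rw [← pow_add, ← pow_add]; congr 1; ring
      exact_mod_cast h4
  have hsub : ((SX X).filter fun n : ℕ => ∃ h, h0 ≤ h ∧
      (2 : ℝ) ^ ((2 * (C' + 1) + 2 * A + 3) * h) ≤ Real.log (n : ℝ) ∧
      ¬ SepProp n (2 ^ h) (A ^ ((h + 8) * 2 ^ ((C' + 1) * h)))) ⊆
      ((SX X).filter fun n : ℕ => ∃ p, z < p ∧ p ^ 2 ∣ n) ∪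
      ((Finset.Ico h0 X).filter fun h =>
        (2 : ℝ) ^ ((2 * (C' + 1) + 2 * A + 3) * h) ≤ Real.log X).biUnion
          fun h => (SX X).filter fun n : ℕ => omegaT (T h) n < h + 8 := by
    intro n hn
    obtain ⟨hnX, h, hh, hlog, hS⟩ := Finset.mem_filter.mp hn
    obtain ⟨hle, hnS⟩ := mem_SX.mp hnX
    rw [Finset.mem_union]
    by_contra hcon
    push Not at hcon
    obtain ⟨hc1, hc2⟩ := hcon
    have hn0 : (0 : ℝ) < n := by exact_mod_cast sumTwoSq_pos hnS
    have hX0 : (0 : ℝ) < X := by exact_mod_cast (by omega : 0 < X)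
    have hlogX : (2 : ℝ) ^ ((2 * (C' + 1) + 2 * A + 3) * h) ≤ Real.log X :=
      hlog.trans (Real.log_le_log hn0 (by exact_mod_cast hle))
    have hhX : h < X := by
      have h3 : (h : ℝ) < X := by
        calc (h : ℝ) < 2 ^ h := by exact_mod_cast Nat.lt_two_pow_self
          _ ≤ (2 : ℝ) ^ ((2 * (C' + 1) + 2 * A + 3) * h) :=
              pow_le_pow_right₀ (by norm_num) (Nat.le_mul_of_pos_left _ (by omega))
          _ ≤ Real.log X := hlogX
          _ ≤ X := Real.log_le_self hX0.le
      exact_mod_cast h3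
    apply hS
    refine sepProp_of_omegaT (z := A ^ Jh h) hnS (T h) (hTp h) (hTz h) (fun p hp hpn => ?_) ?_ ?_
    · exact hc1 (Finset.mem_filter.mpr ⟨hnX, p, (mem_primesOne.mp hp).1.1, hpn⟩)
    · by_contra hlt
      exact hc2 (Finset.mem_biUnion.mpr ⟨h, Finset.mem_filter.mpr
        ⟨Finset.mem_Ico.mpr ⟨hh, hhX⟩, hlogX⟩, Finset.mem_filter.mpr ⟨hnX, by omega⟩⟩)
    · rw [← pow_mul, mul_comm (h + 8)]
      exact Nat.pow_le_pow_right (by omega) (Nat.mul_le_mul_right _ (hJle h hh))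
  have h3 := (Finset.card_le_card hsub).trans ((Finset.card_union_le _ _).trans
    (Nat.add_le_add_left Finset.card_biUnion_le _))
  calc _ ≤ (((SX X).filter fun n : ℕ => ∃ p, z < p ∧ p ^ 2 ∣ n).card : ℝ) +
        ∑ h ∈ (Finset.Ico h0 X).filter fun h =>
        (2 : ℝ) ^ ((2 * (C' + 1) + 2 * A + 3) * h) ≤ Real.log X,
          (((SX X).filter fun n : ℕ => omegaT (T h) n < h + 8).card : ℝ) := by exact_mod_cast h3
    _ ≤ ε / 2 * (SX X).card + ∑ h ∈ Finset.Ico h0 X, 256 * C0 * (1 / 4) ^ h * (SX X).card := by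
        refine add_le_add (hz0 X (by omega) z hzz) ?_
        refine (Finset.sum_le_sum fun h hh => ?_).trans (Finset.sum_le_sum_of_subset_of_nonneg
          (Finset.filter_subset _ _) fun _ _ _ => by positivity)
        obtain ⟨hh1, hh2⟩ := Finset.mem_filter.mp hh
        exact hcount h (Finset.mem_Ico.mp hh1).1 hh2
    _ = (ε / 2 + 256 * C0 * ∑ h ∈ Finset.Ico h0 X, (1 / 4 : ℝ) ^ h) * (SX X).card := by
        rw [← Finset.sum_mul, ← Finset.mul_sum]; ring
    _ ≤ (ε / 2 + ε / 2) * (SX X).card := by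
        refine mul_le_mul_of_nonneg_right (add_le_add le_rfl ?_) (by positivity)
        have h4 : ∑ h ∈ Finset.Ico h0 X, (1 / 4 : ℝ) ^ h ≤ (1 / 4) ^ h0 / (1 - 1 / 4) :=
          geom_sum_Ico_le_of_lt_one (by norm_num) (by norm_num)
        have h5 : (1 / 4 : ℝ) ^ h0 ≤ (1 / 4) ^ h2 :=
          pow_le_pow_of_le_one (by norm_num) (by norm_num) (by omega)
        have h6 : (1 / 4 : ℝ) ^ h0 / (1 - 1 / 4) ≤ 2 * (ε / (1024 * C0)) := by
          rw [div_le_iff₀ (by norm_num)]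
          have : 0 < ε / (1024 * C0) := by positivity
          linarith
        calc 256 * C0 * ∑ h ∈ Finset.Ico h0 X, (1 / 4 : ℝ) ^ h
            ≤ 256 * C0 * (2 * (ε / (1024 * C0))) := by
              gcongr
              exact h4.trans h6
          _ = ε / 2 := by field_simp; ring
    _ = _ := by ring

section primitive
variable {ι : Type} [Fintype ι]

open Classical in
/-- The primitive minimal vanishing sums in the Gaussian integers of norm `d`. -/
def primSet (b : Finset ι) (d : ℕ) : Finset (ι → ℤ × ℤ) :=
  (relSet (latticePts d) b).filter fun w => ∀ g : GaussianInt, (∀ i ∈ b, g ∣ toG (w i)) → IsUnit g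

theorem mem_latticePts_iff_norm {n : ℕ} {v : ℤ × ℤ} : v ∈ latticePts n ↔ (toG v).norm = n := by
  rw [norm_toG, mem_latticePts]

theorem ZeroMin.of_mul {ι : Type} {v w : ι → ℤ × ℤ} {b : Finset ι} {δ : GaussianInt} (hδ : δ ≠ 0)
    (h : ∀ i ∈ b, toG (v i) = δ * toG (w i)) (hv : ZeroMin v b) : ZeroMin w b := by
  have key : ∀ t ⊆ b, (∑ i ∈ t, v i = 0 ↔ ∑ i ∈ t, w i = 0) := by
    intro t ht
    rw [← toG_eq_zero, ← toG_eq_zero, toG_sum, toG_sum,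
      Finset.sum_congr rfl fun i hi => h i (ht hi), ← Finset.mul_sum, mul_eq_zero]
    simp [hδ]
  exact ⟨hv.1, (key b subset_rfl).mp hv.2.1, fun t ht hne htn =>
    fun h0 => hv.2.2 t ht hne htn ((key t ht).mpr h0)⟩

theorem exists_gcd_family {ι : Type} (b : Finset ι) (z : ι → GaussianInt) :
    ∃ δ : GaussianInt, (∀ i ∈ b, δ ∣ z i) ∧ ∀ g, (∀ i ∈ b, g ∣ z i) → g ∣ δ := by
  obtain ⟨δ, hδ⟩ := (IsPrincipalIdealRing.principal (Ideal.span (z '' (b : Set ι)))).principal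
  refine ⟨δ, fun i hi => ?_, fun g hg => ?_⟩
  · rw [← Ideal.mem_span_singleton, ← Ideal.submodule_span_eq, ← hδ]
    exact Ideal.subset_span ⟨i, hi, rfl⟩
  · have h1 : δ ∈ Ideal.span (z '' (b : Set ι)) := by
      rw [hδ]; exact Submodule.mem_span_singleton_self δ
    have h2 : Ideal.span (z '' (b : Set ι)) ≤ Ideal.span {g} := by
      rw [Ideal.span_le]
      rintro _ ⟨i, hi, rfl⟩
      exact Ideal.mem_span_singleton.mpr (hg i hi)
    exact Ideal.mem_span_singleton.mp (h2 h1)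

theorem exists_primitive {lam : ℕ} (hlam : 0 < lam) {b : Finset ι} {v : ι → ℤ × ℤ}
    (hv : v ∈ relSet (latticePts lam) b) :
    ∃ d ∈ lam.divisors, ∃ w ∈ primSet b d, ∃ δ : GaussianInt, ∀ i ∈ b, toG (v i) = δ * toG (w i) := by
  classical
  obtain ⟨h1, h2, h3⟩ := mem_relSet.mp hv
  obtain ⟨δ, hδ, hmax⟩ := exists_gcd_family b fun i => toG (v i)
  choose! c hc using hδ
  obtain ⟨i0, hi0⟩ := h3.1
  have hnorm : ∀ i ∈ b, δ.norm * (c i).norm = lam := fun i hi => by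
    rw [← Zsqrtd.norm_mul, ← hc i hi]; exact mem_latticePts_iff_norm.mp (h1 i hi)
  have hlam' : (lam : ℤ) ≠ 0 := by exact_mod_cast hlam.ne'
  have hδ0 : δ ≠ 0 := by
    rintro rfl
    have := hnorm i0 hi0
    simp at this
    omega
  have hδn : δ.norm ≠ 0 := fun h => hδ0 (GaussianInt.norm_eq_zero.mp h)
  have hdn : ((c i0).norm.toNat : ℤ) = (c i0).norm := Int.toNat_of_nonneg (GaussianInt.norm_nonneg _)
  have heq : ∀ i ∈ b, (c i).norm = (c i0).norm := fun i hi =>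
    mul_left_cancel₀ hδn ((hnorm i hi).trans (hnorm i0 hi0).symm)
  set w : ι → ℤ × ℤ := fun i => if i ∈ b then ((c i).re, (c i).im) else 0 with hw
  have hwc : ∀ i ∈ b, toG (w i) = c i := fun i hi => by simp only [hw, hi, if_true]; rfl
  have hvw : ∀ i ∈ b, toG (v i) = δ * toG (w i) := fun i hi => by rw [hwc i hi]; exact hc i hi
  refine ⟨(c i0).norm.toNat, ?_, w, ?_, δ, hvw⟩
  · rw [Nat.mem_divisors]
    refine ⟨?_, hlam.ne'⟩
    rw [← Int.natCast_dvd_natCast, hdn]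
    exact Dvd.intro_left _ (hnorm i0 hi0)
  · refine Finset.mem_filter.mpr ⟨mem_relSet.mpr ⟨fun i hi => ?_, fun i hi => by simp [hw, hi],
      h3.of_mul hδ0 hvw⟩, fun g hg => ?_⟩
    · rw [mem_latticePts_iff_norm, hwc i hi, hdn, heq i hi]
    · have h4 : δ * g ∣ δ := hmax _ fun i hi => by
        rw [hvw i hi]; exact mul_dvd_mul_left _ (hg i hi)
      obtain ⟨k, hk⟩ := h4
      have h5 : δ * (g * k) = δ * 1 := by rw [mul_one, ← mul_assoc, ← hk]
      exact IsUnit.of_mul_eq_one _ (mul_left_cancel₀ hδ0 h5)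

open Classical in
theorem card_relSet_filter_le {lam : ℕ} (hlam : 0 < lam) (b : Finset ι) {i : ι} (hi : i ∈ b)
    (ξ : ℤ × ℤ) : ((relSet (latticePts lam) b).filter fun v => v i = ξ).card ≤
      ∑ d ∈ lam.divisors, (primSet b d).card := by
  have h0 : ∀ v ∈ (relSet (latticePts lam) b).filter fun v => v i = ξ,
      ∃ x : (_ : ℕ) × (ι → ℤ × ℤ), x ∈ lam.divisors.sigma (fun d => primSet b d) ∧
        ∃ δ : GaussianInt, ∀ j ∈ b, toG (v j) = δ * toG (x.2 j) := by
    intro v hv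
    obtain ⟨d, hd, w, hw, δ, h⟩ := exists_primitive hlam (Finset.mem_filter.mp hv).1
    exact ⟨⟨d, w⟩, Finset.mem_sigma.mpr ⟨hd, hw⟩, δ, h⟩
  choose! F hF hδ using h0
  rw [← Finset.card_sigma]
  refine Finset.card_le_card_of_injOn F hF fun v hv v' hv' hFF => ?_
  obtain ⟨δ, h1⟩ := hδ v hv
  obtain ⟨δ', h1'⟩ := hδ v' hv'
  rw [Finset.mem_coe, Finset.mem_filter] at hv hv'
  obtain ⟨h2, h3, -⟩ := mem_relSet.mp hv.1
  obtain ⟨-, h3', -⟩ := mem_relSet.mp hv'.1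
  rw [← hFF] at h1'
  have h4 : δ = δ' := by
    have h5 := h1 i hi
    have h5' := h1' i hi
    rw [hv.2] at h5
    rw [hv'.2, h5] at h5'
    refine mul_right_cancel₀ (fun h0 => ?_) h5'
    rw [h0, mul_zero] at h5
    have := mem_latticePts_iff_norm.mp (h2 i hi)
    rw [hv.2, h5] at this
    simp at this
    omega
  funext j
  by_cases hj : j ∈ b
  · apply toG_injective
    rw [h1 j hj, h1' j hj, h4]
  · rw [h3 j hj, h3' j hj]

theorem mem_sumTwoSq_of_primSet {b : Finset ι} {d : ℕ} (hd : 0 < d) (h : (primSet b d).Nonempty) :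
    d ∈ sumTwoSq := by
  classical
  obtain ⟨w, hw⟩ := h
  obtain ⟨h1, -, h3⟩ := mem_relSet.mp (Finset.mem_filter.mp hw).1
  obtain ⟨i, hi⟩ := h3.1
  exact ⟨hd, (w i).1, (w i).2, (mem_latticePts.mp (h1 i hi)).symm⟩

theorem primSet_eq_empty {p k : ℕ} (hp : p.Prime) (hp1 : p % 4 ≠ 1) (b : Finset ι) :
    primSet b (p * k) = ∅ := by
  classical
  rw [Finset.eq_empty_iff_forall_notMem]
  intro w hw
  obtain ⟨hw1, hw2⟩ := Finset.mem_filter.mp hw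
  obtain ⟨h1, -, h3⟩ := mem_relSet.mp hw1
  have hn : ∀ i ∈ b, (toG (w i)).norm = (p * k : ℕ) := fun i hi =>
    mem_latticePts_iff_norm.mp (h1 i hi)
  by_cases h : p % 4 = 3
  · have hu := hw2 p fun i hi => dvd_of_dvd_norm hp h
      (by rw [hn i hi]; push_cast; exact dvd_mul_right _ _)
    have := Fact.mk hp
    exact (GaussianInt.prime_of_nat_prime_of_mod_four_eq_three p h).not_isUnit hu
  · have hp2 : p = 2 := by
      rcases hp.eq_two_or_odd with h2 | h2
      · exact h2
      · omega
    have hϖ : (⟨1, 1⟩ : GaussianInt).norm = p := by rw [hp2]; rfl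
    refine (prime_of_norm_prime hp hϖ).not_isUnit (hw2 _ fun i hi => ?_)
    obtain ⟨g, -, hg | hg⟩ := exists_factor_step hp hϖ (hn i hi)
    · rw [hg]; exact dvd_mul_right _ _
    · rw [hg]
      have : (star ⟨1, 1⟩ : GaussianInt) = ⟨1, 1⟩ * ⟨0, -1⟩ := rfl
      rw [this, mul_assoc]; exact dvd_mul_right _ _

end primitive

open Classical in
/-- A Gaussian integer of norm `p`, when there is one. -/
def gprime (p : ℕ) : GaussianInt := if h : ∃ ϖ : GaussianInt, ϖ.norm = p then h.choose else 0

theorem norm_gprime {p : ℕ} (hp : p.Prime) (h : p % 4 = 1) : (gprime p).norm = p := by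
  have h1 := exists_norm_eq_prime hp (by omega : p % 4 ≠ 3)
  rw [gprime, dif_pos h1]; exact h1.choose_spec

/-- The quotient of a Gaussian prime over `p` and its conjugate. -/
def gratio (p : ℕ) : ℂ := (gprime p : ℂ) / ((star (gprime p) : GaussianInt) : ℂ)

theorem gprime_ne_zero {p : ℕ} (hp : p.Prime) (h : p % 4 = 1) : gprime p ≠ 0 :=
  (prime_of_norm_prime hp (norm_gprime hp h)).ne_zero

theorem gratio_injOn : Set.InjOn gratio {p | p.Prime ∧ p % 4 = 1} := by
  rintro p ⟨hp, hp1⟩ q ⟨hq, hq1⟩ h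
  have hp0 : ((star (gprime p) : GaussianInt) : ℂ) ≠ 0 := by
    rw [Ne, GaussianInt.toComplex_eq_zero]; simpa using gprime_ne_zero hp hp1
  have hq0 : ((star (gprime q) : GaussianInt) : ℂ) ≠ 0 := by
    rw [Ne, GaussianInt.toComplex_eq_zero]; simpa using gprime_ne_zero hq hq1
  have h1 : gprime p * star (gprime q) = gprime q * star (gprime p) := by
    unfold gratio at h
    rw [div_eq_div_iff hp0 hq0, ← GaussianInt.toComplex_mul, ← GaussianInt.toComplex_mul] at h
    exact GaussianInt.toComplex_inj.mp h
  have hpr := prime_of_norm_prime hp (norm_gprime hp hp1)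
  rcases hpr.dvd_or_dvd (Dvd.intro _ h1) with ⟨k, hk⟩ | h2
  · have h3 := norm_gprime hq hq1
    rw [hk, Zsqrtd.norm_mul, norm_gprime hp hp1] at h3
    have h4 : p ∣ q := by exact_mod_cast Dvd.intro _ h3
    exact (Nat.prime_dvd_prime_iff_eq hp hq).mp h4
  · exact absurd h2 (not_dvd_star hp hp1 (norm_gprime hp hp1))

section count
variable {ι : Type} [Fintype ι]

/-- The polynomial whose roots govern the vanishing of `∑ u_j ϖ^{a_j} ϖ̄^{e - a_j}`. -/
def relPoly (b : Finset ι) (a : ι → ℕ) (u : ι → GaussianInt) : Polynomial ℂ :=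
  ∑ j ∈ b, Polynomial.C (u j : ℂ) * Polynomial.X ^ a j

theorem natDegree_relPoly_le {ι : Type} {b : Finset ι} {a : ι → ℕ} {u : ι → GaussianInt} {e : ℕ}
    (h : ∀ j ∈ b, a j ≤ e) : (relPoly b a u).natDegree ≤ e :=
  Polynomial.natDegree_sum_le_of_forall_le _ _ fun j hj =>
    (Polynomial.natDegree_C_mul_X_pow_le _ _).trans (h j hj)

open Classical in
theorem exists_of_mem_primSet {p e l : ℕ} (hp : p.Prime) (hp1 : p % 4 = 1) (he : 0 < e)
    {b : Finset ι} {w : ι → ℤ × ℤ} (hw : w ∈ primSet b (p ^ e * l)) :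
    ∃ a ∈ Fintype.piFinset fun _ : ι => Finset.range (e + 1),
      ∃ u ∈ Fintype.piFinset fun j : ι => if j ∈ b then gpts l else {0},
        (∀ j ∈ b, toG (w j) = gprime p ^ a j * star (gprime p) ^ (e - a j) * u j) ∧
        relPoly b a u ≠ 0 ∧ (relPoly b a u).IsRoot (gratio p) := by
  obtain ⟨hw1, hw2⟩ := Finset.mem_filter.mp hw
  obtain ⟨h1, -, h3⟩ := mem_relSet.mp hw1
  have hϖ := norm_gprime hp hp1
  have h4 : ∀ j, ∃ a ≤ e, ∃ u : GaussianInt, j ∈ b →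
      u.norm = l ∧ toG (w j) = gprime p ^ a * star (gprime p) ^ (e - a) * u := by
    intro j
    by_cases hj : j ∈ b
    · obtain ⟨a, ha, u, hu⟩ := exists_factor_pow hp hϖ e l (mem_latticePts_iff_norm.mp (h1 j hj))
      exact ⟨a, ha, u, fun _ => hu⟩
    · exact ⟨0, by omega, 0, fun h => absurd h hj⟩
  choose a ha u0 hu0 using h4
  set u : ι → GaussianInt := fun j => if j ∈ b then u0 j else 0 with hu
  have hub : ∀ j ∈ b, u j = u0 j := fun j hj => by simp [hu, hj]
  have hwu : ∀ j ∈ b, toG (w j) = gprime p ^ a j * star (gprime p) ^ (e - a j) * u j :=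
    fun j hj => by rw [hub j hj]; exact (hu0 j hj).2
  have hs0 : ((star (gprime p) : GaussianInt) : ℂ) ≠ 0 := by
    rw [Ne, GaussianInt.toComplex_eq_zero]; simpa using gprime_ne_zero hp hp1
  refine ⟨a, ?_, u, ?_, hwu, fun h0 => ?_, ?_⟩
  · simpa [Fintype.mem_piFinset, Nat.lt_succ_iff] using ha
  · rw [Fintype.mem_piFinset]
    intro j
    by_cases hj : j ∈ b
    · simp only [hj, if_true, mem_gpts, hub j hj]; exact (hu0 j hj).1
    · simp [hj, hu]
  · obtain ⟨j0, hj0⟩ := h3.1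
    have hc := congrArg (fun P => Polynomial.coeff P (a j0)) h0
    simp only [relPoly, Polynomial.finsetSum_coeff, Polynomial.coeff_C_mul_X_pow,
      Polynomial.coeff_zero] at hc
    rw [← Finset.sum_filter] at hc
    have hc2 : ∑ j ∈ b.filter (fun j => a j0 = a j), u j = 0 := by
      rw [← GaussianInt.toComplex_eq_zero, map_sum]; exact hc
    have hcw : ∑ j ∈ b.filter (fun j => a j0 = a j), w j = 0 := by
      rw [← toG_eq_zero, toG_sum]
      calc ∑ j ∈ b.filter (fun j => a j0 = a j), toG (w j)
          = ∑ j ∈ b.filter (fun j => a j0 = a j),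
              gprime p ^ a j0 * star (gprime p) ^ (e - a j0) * u j :=
            Finset.sum_congr rfl fun j hj => by
              obtain ⟨hj1, hj2⟩ := Finset.mem_filter.mp hj
              rw [hwu j hj1, ← hj2]
        _ = 0 := by rw [← Finset.mul_sum, hc2, mul_zero]
    have hall : b.filter (fun j => a j0 = a j) = b := by
      by_contra hne
      exact h3.2.2 _ (Finset.filter_subset _ _) hne
        ⟨j0, Finset.mem_filter.mpr ⟨hj0, rfl⟩⟩ hcw
    have hunit := hw2 (gprime p ^ a j0 * star (gprime p) ^ (e - a j0)) fun j hj => by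
      rw [← hall] at hj
      obtain ⟨hj1, hj2⟩ := Finset.mem_filter.mp hj
      rw [hwu j hj1, ← hj2]; exact dvd_mul_right _ _
    rw [Zsqrtd.isUnit_iff_norm_isUnit, Zsqrtd.norm_mul] at hunit
    have hnp : ∀ (z : GaussianInt) (k : ℕ), (z ^ k).norm = z.norm ^ k := fun z k =>
      map_pow Zsqrtd.normMonoidHom z k
    rw [hnp, hnp, gnorm_star, hϖ, ← pow_add, show a j0 + (e - a j0) = e by have := ha j0; omega,
      isUnit_pow_iff he.ne'] at hunit
    exact (Nat.prime_iff_prime_int.mp hp).not_isUnit hunit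
  · have hz : ∑ j ∈ b, gprime p ^ a j * star (gprime p) ^ (e - a j) * u j = 0 := by
      rw [← Finset.sum_congr rfl hwu, ← toG_sum, h3.2.1]; rfl
    have hz2 := congrArg GaussianInt.toComplex hz
    rw [map_sum, map_zero] at hz2
    simp only [relPoly, Polynomial.IsRoot.def, Polynomial.eval_finsetSum, Polynomial.eval_mul,
      Polynomial.eval_C, Polynomial.eval_pow, Polynomial.eval_X]
    refine mul_left_cancel₀ (pow_ne_zero e hs0) ?_
    rw [mul_zero, ← hz2, Finset.mul_sum]
    refine Finset.sum_congr rfl fun j _ => ?_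
    rw [map_mul, map_mul, map_pow, map_pow, gratio, div_pow]
    have : ((star (gprime p) : GaussianInt) : ℂ) ^ e =
        ((star (gprime p) : GaussianInt) : ℂ) ^ a j * ((star (gprime p) : GaussianInt) : ℂ) ^ (e - a j) := by
      rw [← pow_add]; congr 1; have := ha j; omega
    rw [this]
    field_simp

open Classical in
theorem sum_card_primSet_le {e l t : ℕ} (he : 0 < e) (ht : 0 < t) (hl : (gpts l).card ≤ t)
    (b : Finset ι) (P : Finset ℕ) (hP : ∀ p ∈ P, p.Prime) :
    ∑ p ∈ P, (primSet b (p ^ e * l)).card ≤ e * ((e + 1) ^ Fintype.card ι * t ^ Fintype.card ι) := by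
  set P1 := P.filter fun p => p % 4 = 1 with hP1
  have hPP : ∀ p ∈ P1, p.Prime ∧ p % 4 = 1 := fun p hp =>
    ⟨hP p (Finset.mem_filter.mp hp).1, (Finset.mem_filter.mp hp).2⟩
  have h1 : ∑ p ∈ P, (primSet b (p ^ e * l)).card = ∑ p ∈ P1, (primSet b (p ^ e * l)).card := by
    rw [hP1, Finset.sum_filter]
    refine Finset.sum_congr rfl fun p hp => ?_
    by_cases h : p % 4 = 1
    · simp [h]
    · obtain ⟨k, rfl⟩ : ∃ k, e = k + 1 := ⟨e - 1, by omega⟩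
      rw [if_neg h, pow_succ', mul_assoc, primSet_eq_empty (hP p hp) h]; rfl
  rw [h1, ← Finset.card_sigma]
  set U := (Fintype.piFinset fun _ : ι => Finset.range (e + 1)) ×ˢ
    (Fintype.piFinset fun j : ι => if j ∈ b then gpts l else {0}) with hU
  have h0 : ∀ x ∈ P1.sigma (fun p => primSet b (p ^ e * l)), ∃ y ∈ U,
      (∀ j ∈ b, toG (x.2 j) =
        gprime x.1 ^ y.1 j * star (gprime x.1) ^ (e - y.1 j) * y.2 j) ∧
        relPoly b y.1 y.2 ≠ 0 ∧ (relPoly b y.1 y.2).IsRoot (gratio x.1) := by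
    rintro ⟨p, w⟩ hx
    obtain ⟨hp, hw⟩ := Finset.mem_sigma.mp hx
    obtain ⟨a, ha, u, hu, h⟩ := exists_of_mem_primSet (hPP p hp).1 (hPP p hp).2 he hw
    exact ⟨(a, u), Finset.mem_product.mpr ⟨ha, hu⟩, h⟩
  choose! Y hYU hY using h0
  have hfib : ∀ y ∈ U, ((P1.sigma (fun p => primSet b (p ^ e * l))).filter fun x => Y x = y).card ≤
      e := by
    intro y hy
    have hdeg : (relPoly b y.1 y.2).natDegree ≤ e := natDegree_relPoly_le fun j _ => by
      have := Fintype.mem_piFinset.mp (Finset.mem_product.mp hy).1 j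
      exact Nat.lt_succ_iff.mp (Finset.mem_range.mp this)
    refine le_trans ?_ (((Polynomial.card_roots' _).trans hdeg).trans' (Multiset.toFinset_card_le _))
    refine Finset.card_le_card_of_injOn (fun x => gratio x.1) ?_ ?_
    · intro x hx
      obtain ⟨hx1, rfl⟩ := Finset.mem_filter.mp hx
      obtain ⟨-, h2, h3⟩ := hY x hx1
      rw [Finset.mem_coe, Multiset.mem_toFinset, Polynomial.mem_roots h2]; exact h3
    · rintro ⟨p, w⟩ hx ⟨p', w'⟩ hx' hr
      obtain ⟨hx1, rfl⟩ := Finset.mem_filter.mp hx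
      obtain ⟨hx1', hyy⟩ := Finset.mem_filter.mp hx'
      obtain ⟨hp, hw⟩ := Finset.mem_sigma.mp hx1
      obtain ⟨hp', hw'⟩ := Finset.mem_sigma.mp hx1'
      have hpp : p = p' := gratio_injOn (hPP p hp) (hPP p' hp') hr
      subst hpp
      congr 1
      funext j
      by_cases hj : j ∈ b
      · apply toG_injective
        have e1 := (hY _ hx1).1 j hj
        have e2 := (hY _ hx1').1 j hj
        rw [hyy] at e2
        exact e1.trans e2.symm
      · have e1 := (mem_relSet.mp (Finset.mem_filter.mp hw).1).2.1 j hj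
        have e2 := (mem_relSet.mp (Finset.mem_filter.mp hw').1).2.1 j hj
        simp only at e1 e2
        rw [e1, e2]
  refine (Finset.card_le_mul_card_image_of_maps_to hYU e hfib).trans (Nat.mul_le_mul_left _ ?_)
  rw [hU, Finset.card_product, Fintype.card_piFinset, Fintype.card_piFinset]
  refine Nat.mul_le_mul ?_ ?_
  · simp
  · refine (Finset.prod_le_pow_card _ _ t fun j _ => ?_).trans (by simp)
    split_ifs
    · exact hl
    · simpa using Nat.succ_le_of_lt ht

end count

theorem sum_primesBelow_inv_le {y z : ℕ} (hy : 0 < y) (hz : 1 < z) :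
    ∑ p ∈ Nat.primesBelow y, (1 : ℝ) / p ≤ z + (Real.log y + 6) / Real.log z := by
  have hlz : 0 < Real.log z := Real.log_pos (by exact_mod_cast hz)
  have h1 := sum_vonMangoldt_div_le hy
  calc ∑ p ∈ Nat.primesBelow y, (1 : ℝ) / p
      ≤ ∑ p ∈ Nat.primesBelow y, ((if p < z then 1 else 0) +
          (ArithmeticFunction.vonMangoldt p / p) / Real.log z) := by
        refine Finset.sum_le_sum fun p hp => ?_
        have hpp := Nat.prime_of_mem_primesBelow hp
        rw [ArithmeticFunction.vonMangoldt_apply_prime hpp]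
        have hp1 : (1 : ℝ) ≤ p := by exact_mod_cast hpp.one_lt.le
        have hlp : 0 ≤ Real.log p := Real.log_nonneg hp1
        split_ifs with h
        · have : (1 : ℝ) / p ≤ 1 := by rw [div_le_one (by linarith)]; exact hp1
          have : 0 ≤ Real.log p / p / Real.log z := by positivity
          linarith
        · rw [zero_add, le_div_iff₀ hlz, div_mul_eq_mul_div, one_mul]
          have hzp : (z : ℝ) ≤ p := by exact_mod_cast not_lt.mp h
          have := Real.log_le_log (by exact_mod_cast (by omega : 0 < z)) hzp
          gcongr
    _ = ∑ p ∈ Nat.primesBelow y, (if p < z then (1 : ℝ) else 0) +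
          (∑ p ∈ Nat.primesBelow y, ArithmeticFunction.vonMangoldt p / p) / Real.log z := by
        rw [Finset.sum_add_distrib, Finset.sum_div]
    _ ≤ z + (Real.log y + 6) / Real.log z := by
        gcongr
        · rw [Finset.sum_boole]
          have : ((Nat.primesBelow y).filter fun p => p < z).card ≤ (Finset.range z).card :=
            Finset.card_le_card fun p hp => Finset.mem_range.mpr (Finset.mem_filter.mp hp).2
          rw [Finset.card_range] at this
          exact_mod_cast this
        · refine le_trans (Finset.sum_le_sum_of_subset_of_nonneg ?_ ?_) h1
          · intro p hp
            exact Finset.mem_Ioc.mpr ⟨(Nat.prime_of_mem_primesBelow hp).pos,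
              (Nat.lt_of_mem_primesBelow hp).le⟩
          · intro n _ _
            exact div_nonneg ArithmeticFunction.vonMangoldt_nonneg (Nat.cast_nonneg _)

theorem exists_sum_smooth_le (m : ℕ) : ∃ K : ℝ, 0 < K ∧ ∀ (i : ℕ) (T : Finset ℕ),
    (∀ l ∈ T, l ∈ Nat.smoothNumbers (2 ^ (i + 1))) →
    ∑ l ∈ T, ((l.divisors.card : ℝ) ^ m / l) ≤ K * Real.exp ((i + 1) / 4) := by
  set C : ℝ := ∑' k : ℕ, ((k : ℝ) + 2) ^ m * (1 / 2) ^ k with hC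
  have hsumC : Summable fun k : ℕ => ((k : ℝ) + 2) ^ m * (1 / 2 : ℝ) ^ k := by
    have h := (summable_nat_add_iff 2).mpr (summable_pow_mul_geometric_of_norm_lt_one (R := ℝ) m
      (r := 1 / 2) (by norm_num))
    refine (h.mul_left 4).congr fun k => ?_
    push_cast
    rw [pow_add]; ring
  have hC0 : 0 ≤ C := tsum_nonneg fun k => by positivity
  set f : ℕ → ℝ := fun l => (l.divisors.card : ℝ) ^ m / l with hf
  have hf0 : ∀ l, 0 ≤ f l := fun l => by positivity
  have hf1 : f 1 = 1 := by simp [hf]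
  have hmul : ∀ {a b : ℕ}, a.Coprime b → f (a * b) = f a * f b := by
    intro a b hab
    simp only [hf]
    rw [hab.card_divisors_mul]
    push_cast
    rw [mul_pow, mul_div_mul_comm]
  have hfp : ∀ {p : ℕ}, p.Prime → ∀ k : ℕ, f (p ^ k) = ((k : ℝ) + 1) ^ m / (p : ℝ) ^ k := by
    intro p hp k
    simp only [hf]
    rw [Nat.divisors_prime_pow hp, Finset.card_map, Finset.card_range]
    push_cast; rfl
  have hterm : ∀ {p : ℕ}, p.Prime → ∀ k : ℕ, f (p ^ (k + 1)) ≤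
      (1 / p) * (((k : ℝ) + 2) ^ m * (1 / 2) ^ k) := by
    intro p hp k
    rw [hfp hp]
    have hp2 : (2 : ℝ) ≤ p := by exact_mod_cast hp.two_le
    have : (1 / (p : ℝ)) ^ k ≤ (1 / 2) ^ k := by gcongr
    calc _ = (1 / (p : ℝ)) * (((k : ℝ) + 2) ^ m * (1 / p) ^ k) := by
          push_cast; rw [one_div_pow, pow_succ]; ring
      _ ≤ _ := by gcongr
  have hsum1 : ∀ {p : ℕ}, p.Prime → Summable fun k => f (p ^ (k + 1)) := fun hp =>
    Summable.of_nonneg_of_le (fun k => hf0 _) (hterm hp) (hsumC.mul_left _)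
  have hsum : ∀ {p : ℕ}, p.Prime → Summable fun k => f (p ^ k) := fun hp =>
    (summable_nat_add_iff 1).mp (hsum1 hp)
  have hts : ∀ {p : ℕ}, p.Prime → ∑' k, f (p ^ k) ≤ Real.exp (C * (1 / p)) := by
    intro p hp
    rw [(hsum hp).tsum_eq_zero_add, pow_zero, hf1]
    have : ∑' k, f (p ^ (k + 1)) ≤ (1 / p) * C := by
      rw [hC, ← tsum_mul_left]
      exact (hsum1 hp).tsum_le_tsum (hterm hp) (hsumC.mul_left _)
    have := Real.add_one_le_exp (C * (1 / (p : ℝ)))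
    linarith
  obtain ⟨z, hz⟩ := exists_nat_gt (Real.exp (4 * C + 1))
  have hz1 : 1 < z := by
    have : (1 : ℝ) < z := (Real.one_lt_exp_iff.mpr (by linarith)).trans hz
    exact_mod_cast this
  have hlz : 4 * C + 1 ≤ Real.log z := by
    rw [← Real.log_exp (4 * C + 1)]
    exact Real.log_le_log (Real.exp_pos _) hz.le
  refine ⟨Real.exp (C * z + 6 * C), Real.exp_pos _, fun i T hT => ?_⟩
  obtain ⟨hs1, hs2⟩ := EulerProduct.summable_and_hasSum_smoothNumbers_prod_primesBelow_tsum hf1 hmul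
    (fun hp => (hsum hp).norm) (2 ^ (i + 1))
  have hle : ∑ l ∈ T, f l ≤ ∏ p ∈ Nat.primesBelow (2 ^ (i + 1)), ∑' k, f (p ^ k) := by
    rw [← hs2.tsum_eq]
    have := Summable.sum_le_tsum (f := fun x : Nat.smoothNumbers (2 ^ (i + 1)) => f x) (T.attach.image fun l => ⟨l.1, hT l.1 l.2⟩)
      (fun l _ => hf0 l) hs2.summable
    refine le_trans (le_of_eq ?_) this
    rw [Finset.sum_image]
    · exact (Finset.sum_attach T f).symm
    · intro a _ b _ hab
      exact Subtype.ext (Subtype.mk.inj hab)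
  refine hle.trans ((Finset.prod_le_prod (fun p _ => tsum_nonneg fun k => hf0 _)
    fun p hp => hts (Nat.prime_of_mem_primesBelow hp)).trans ?_)
  rw [← Real.exp_sum, ← Real.exp_add, ← Finset.mul_sum]
  refine Real.exp_le_exp.mpr ?_
  have h1 := sum_primesBelow_inv_le (y := 2 ^ (i + 1)) (by positivity) hz1
  have hl2 : Real.log ((2 ^ (i + 1) : ℕ) : ℝ) ≤ i + 1 := by
    push_cast
    rw [Real.log_pow]
    push_cast
    have : Real.log 2 ≤ 1 := by linarith [Real.log_two_lt_d9]
    nlinarith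
  have hlz0 : 0 < Real.log z := by linarith
  have h2 : C * ((Real.log ((2 ^ (i + 1) : ℕ) : ℝ) + 6) / Real.log z) ≤ 6 * C + (i + 1) / 4 := by
    rw [← mul_div_assoc, div_le_iff₀ hlz0]
    have hi : (0 : ℝ) ≤ (i : ℝ) + 1 := by positivity
    have a1 : C * (Real.log ((2 ^ (i + 1) : ℕ) : ℝ) + 6) ≤ C * ((i + 1) + 6) := by gcongr
    have a2 : (6 * C + (i + 1) / 4) * (4 * C + 1) ≤ (6 * C + (i + 1) / 4) * Real.log z := by gcongr
    nlinarith [mul_nonneg hC0 hC0]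
  have h3 := mul_le_mul_of_nonneg_left h1 hC0
  rw [mul_add] at h3
  linarith

theorem log_le_card_divisors_mul {y : ℕ} (hy : 0 < y) :
    ∀ l : ℕ, l ≠ 0 → (∀ p, p.Prime → p ∣ l → p ≤ y) →
      Real.log l ≤ l.divisors.card * Real.log y := by
  have hly : 0 ≤ Real.log y := Real.log_nonneg (by exact_mod_cast hy)
  intro l
  induction l using induction_on_primes with
  | zero => intro h; exact absurd rfl h
  | one => intro _ _; simpa using hly
  | prime_mul p a hp ih =>
    intro h0 h
    have ha : a ≠ 0 := right_ne_zero_of_mul h0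
    have hpy := h p hp (dvd_mul_right p a)
    have h1 := ih ha fun q hq hqa => h q hq (dvd_mul_of_dvd_right hqa p)
    have h2 : a.divisors.card + 1 ≤ (p * a).divisors.card := by
      have : p * a ∉ a.divisors := fun hmem => by
        have := Nat.divisor_le hmem
        have := hp.two_le
        have : 0 < a := Nat.pos_of_ne_zero ha
        nlinarith
      rw [← Finset.card_insert_of_notMem this]
      refine Finset.card_le_card (Finset.insert_subset ?_ ?_)
      · exact Nat.mem_divisors_self _ h0
      · exact Nat.divisors_subset_of_dvd h0 (dvd_mul_left a p)
    have h3 : (a.divisors.card : ℝ) + 1 ≤ (p * a).divisors.card := by exact_mod_cast h2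
    have h4 : Real.log p ≤ Real.log y :=
      Real.log_le_log (by exact_mod_cast hp.pos) (by exact_mod_cast hpy)
    push_cast
    rw [Real.log_mul (by exact_mod_cast hp.ne_zero) (by exact_mod_cast ha)]
    nlinarith

section total
variable {ι : Type} [Fintype ι]

theorem exists_prime_mul_smooth {d : ℕ} (hd : 1 < d) : ∃ i l p : ℕ, p.Prime ∧ 2 ^ i ≤ p ∧
    p < 2 ^ (i + 1) ∧ l ∈ Nat.smoothNumbers (2 ^ (i + 1)) ∧ d = p * l := by
  have hne : d.primeFactors.Nonempty := Nat.nonempty_primeFactors.mpr hd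
  set p := d.primeFactors.max' hne with hp
  have hmem : p ∈ d.primeFactors := Finset.max'_mem _ _
  obtain ⟨hpp, ⟨l, hl⟩, hd0⟩ := Nat.mem_primeFactors.mp hmem
  have hlt : p < 2 ^ (Nat.log 2 p + 1) := Nat.lt_pow_succ_log_self (by norm_num) p
  refine ⟨Nat.log 2 p, l, p, hpp, Nat.pow_log_le_self 2 hpp.ne_zero, hlt, ?_, hl⟩
  rw [Nat.mem_smoothNumbers']
  intro q hq hql
  refine lt_of_le_of_lt ?_ hlt
  exact Finset.le_max' _ _ (Nat.mem_primeFactors.mpr ⟨hq, hl ▸ dvd_mul_of_dvd_right hql p, hd0⟩)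

theorem sum_primSet_block_le (b : Finset ι) {i l : ℕ} (hl : l ∈ Nat.smoothNumbers (2 ^ (i + 1)))
    (P : Finset ℕ) (hP : ∀ p ∈ P, p.Prime ∧ 2 ^ i ≤ p ∧ p < 2 ^ (i + 1)) :
    ∑ p ∈ P, ((primSet b (p * l)).card * (Real.log (2 * (p * l : ℕ)) / (p * l : ℕ)) : ℝ) ≤
      2 * 8 ^ Fintype.card ι * ((i + 2) * (1 / 2) ^ i) *
        ((l.divisors.card : ℝ) ^ (Fintype.card ι + 1) / l) := by
  set n := Fintype.card ι with hn
  have hl0 : l ≠ 0 := Nat.ne_zero_of_mem_smoothNumbers hl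
  have hlpos : (0 : ℝ) < l := by exact_mod_cast Nat.pos_of_ne_zero hl0
  set t := l.divisors.card with ht
  have ht0 : 0 < t := Finset.card_pos.mpr ⟨1, Nat.one_mem_divisors.mpr hl0⟩
  have ht1 : (1 : ℝ) ≤ t := by exact_mod_cast ht0
  have hl2 : Real.log 2 ≤ 1 := by linarith [Real.log_two_lt_d9]
  have hl20 : 0 ≤ Real.log 2 := Real.log_nonneg (by norm_num)
  have hi2 : Real.log ((2 ^ (i + 1) : ℕ) : ℝ) ≤ i + 1 := by
    push_cast
    rw [Real.log_pow]
    push_cast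
    nlinarith
  have hlogl : Real.log l ≤ t * (i + 1) := by
    refine (log_le_card_divisors_mul (y := 2 ^ (i + 1)) (by positivity) l hl0
      fun p hp hpl => ((Nat.mem_smoothNumbers'.mp hl) p hp hpl).le).trans ?_
    gcongr
  have hterm : ∀ p ∈ P, ((primSet b (p * l)).card * (Real.log (2 * (p * l : ℕ)) / (p * l : ℕ)) : ℝ) ≤
      (primSet b (p ^ 1 * l)).card * (2 * (i + 2) * t * (1 / 2) ^ i / l) := by
    intro p hp
    obtain ⟨hpp, hp1, hp2⟩ := hP p hp
    have hp0 : (0 : ℝ) < p := by exact_mod_cast hpp.pos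
    rw [pow_one]
    refine mul_le_mul_of_nonneg_left ?_ (Nat.cast_nonneg _)
    have hlp : Real.log p ≤ i + 1 :=
      (Real.log_le_log hp0 (by exact_mod_cast hp2.le)).trans hi2
    have hlog : Real.log (2 * (p * l : ℕ)) ≤ 2 * (i + 2) * t := by
      push_cast
      rw [Real.log_mul (by norm_num) (by positivity), Real.log_mul hp0.ne' hlpos.ne']
      have : (0 : ℝ) ≤ i := Nat.cast_nonneg i
      nlinarith
    have hpi : (2 : ℝ) ^ i ≤ p := by exact_mod_cast hp1
    have hinv : 1 / (p : ℝ) ≤ (1 / 2) ^ i := by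
      rw [one_div_pow]
      exact one_div_le_one_div_of_le (by positivity) hpi
    calc Real.log (2 * (p * l : ℕ)) / (p * l : ℕ) ≤ (2 * (i + 2) * t) / (p * l : ℕ) := by gcongr
      _ = 2 * (i + 2) * t * (1 / p) / l := by push_cast; field_simp
      _ ≤ _ := by gcongr
  have hcard := sum_card_primSet_le (e := 1) (t := 4 * t) one_pos (by omega)
    ((card_gpts_le (Nat.pos_of_ne_zero hl0)).trans le_rfl) b P fun p hp => (hP p hp).1
  have hcard' : ∑ p ∈ P, ((primSet b (p ^ 1 * l)).card : ℝ) ≤ 8 ^ n * t ^ n := by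
    calc ∑ p ∈ P, ((primSet b (p ^ 1 * l)).card : ℝ) ≤
        ((1 * ((1 + 1) ^ n * (4 * t) ^ n) : ℕ) : ℝ) := by exact_mod_cast hcard
      _ = _ := by
        push_cast
        rw [← mul_pow, ← mul_pow, one_mul, ← mul_assoc]; norm_num
  calc _ ≤ ∑ p ∈ P, ((primSet b (p ^ 1 * l)).card : ℝ) * (2 * (i + 2) * t * (1 / 2) ^ i / l) :=
        Finset.sum_le_sum hterm
    _ ≤ 8 ^ n * t ^ n * (2 * (i + 2) * t * (1 / 2) ^ i / l) := by
        rw [← Finset.sum_mul]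
        gcongr
    _ = _ := by rw [pow_succ (t : ℝ)]; ring

open Classical in
theorem exists_sum_primSet_le (b : Finset ι) : ∃ K : ℝ, ∀ X : ℕ,
    ∑ d ∈ Finset.Ioc 0 X, ((primSet b d).card * (Real.log (2 * d) / d) : ℝ) ≤ K := by
  obtain ⟨K, hK, hKs⟩ := exists_sum_smooth_le (Fintype.card ι + 1)
  set c : ℝ := 2 * 8 ^ Fintype.card ι with hc
  have hc0 : 0 ≤ c := by positivity
  have hsum : Summable fun i : ℕ => ((i : ℝ) + 2) * (2 / 3) ^ i := by
    have h1 := summable_pow_mul_geometric_of_norm_lt_one (R := ℝ) 1 (r := 2 / 3) (by norm_num)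
    have h2 := summable_geometric_of_lt_one (r := (2 / 3 : ℝ)) (by norm_num) (by norm_num)
    refine (h1.add (h2.mul_left 2)).congr fun i => by ring
  have he : Real.exp (1 / 4) ≤ 4 / 3 := by
    have := Real.exp_bound' (x := 1 / 4) (by norm_num) (by norm_num) (n := 3) (by norm_num)
    refine this.trans ?_
    norm_num [Finset.sum_range_succ, Nat.factorial]
  refine ⟨(primSet b 1).card * (Real.log 2) +
    ∑' i : ℕ, c * K * (4 / 3) * (((i : ℝ) + 2) * (2 / 3) ^ i), fun X => ?_⟩
  have hF0 : ∀ d : ℕ, 0 ≤ ((primSet b d).card * (Real.log (2 * d) / d) : ℝ) := by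
    intro d
    have : 0 ≤ Real.log (2 * d) := by
      have := Real.log_natCast_nonneg (2 * d)
      push_cast at this; exact this
    positivity
  set F : ℕ → ℝ := fun d => ((primSet b d).card * (Real.log (2 * d) / d) : ℝ) with hF
  set Z : ℕ → Finset ℕ := fun i => (Finset.Icc 1 X).filter fun l => l ∈ Nat.smoothNumbers (2 ^ (i + 1))
    with hZ
  set P : ℕ → Finset ℕ := fun i =>
    (Finset.range (2 ^ (i + 1))).filter fun p => p.Prime ∧ 2 ^ i ≤ p with hP
  have hP' : ∀ i, ∀ p ∈ P i, p.Prime ∧ 2 ^ i ≤ p ∧ p < 2 ^ (i + 1) := by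
    intro i p hp
    obtain ⟨h1, h2, h3⟩ := Finset.mem_filter.mp hp
    exact ⟨h2, h3, Finset.mem_range.mp h1⟩
  have hsub : Finset.Ioc 0 X ⊆ {1} ∪ ((Finset.range X).sigma fun i => (Z i) ×ˢ (P i)).image
      fun x => x.2.2 * x.2.1 := by
    intro d hd
    obtain ⟨hd0, hdX⟩ := Finset.mem_Ioc.mp hd
    rcases Nat.lt_or_ge 1 d with h1 | h1
    · obtain ⟨i, l, p, hp, hp1, hp2, hl, rfl⟩ := exists_prime_mul_smooth h1
      have hl0 := Nat.ne_zero_of_mem_smoothNumbers hl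
      refine Finset.mem_union_right _ (Finset.mem_image.mpr ⟨⟨i, l, p⟩, ?_, rfl⟩)
      refine Finset.mem_sigma.mpr ⟨Finset.mem_range.mpr ?_, Finset.mem_product.mpr
        ⟨Finset.mem_filter.mpr ⟨Finset.mem_Icc.mpr ⟨Nat.pos_of_ne_zero hl0, ?_⟩, hl⟩,
          Finset.mem_filter.mpr ⟨Finset.mem_range.mpr hp2, hp, hp1⟩⟩⟩
      · calc i < 2 ^ i := Nat.lt_two_pow_self
          _ ≤ p := hp1
          _ ≤ p * l := Nat.le_mul_of_pos_right _ (Nat.pos_of_ne_zero hl0)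
          _ ≤ X := hdX
      · exact (Nat.le_mul_of_pos_left _ hp.pos).trans hdX
    · refine Finset.mem_union_left _ (Finset.mem_singleton.mpr (by omega))
  calc ∑ d ∈ Finset.Ioc 0 X, F d ≤ ∑ d ∈ {1} ∪ ((Finset.range X).sigma fun i => (Z i) ×ˢ (P i)).image
        (fun x => x.2.2 * x.2.1), F d :=
        Finset.sum_le_sum_of_subset_of_nonneg hsub fun d _ _ => hF0 d
    _ ≤ ∑ d ∈ {1}, F d + ∑ d ∈ ((Finset.range X).sigma fun i => (Z i) ×ˢ (P i)).image
        (fun x => x.2.2 * x.2.1), F d := by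
        rw [← Finset.sum_union_inter]
        have : 0 ≤ ∑ d ∈ {1} ∩ ((Finset.range X).sigma fun i => (Z i) ×ˢ (P i)).image
          (fun x => x.2.2 * x.2.1), F d := Finset.sum_nonneg fun d _ => hF0 d
        linarith
    _ ≤ F 1 + ∑ x ∈ (Finset.range X).sigma fun i => (Z i) ×ˢ (P i), F (x.2.2 * x.2.1) := by
        rw [Finset.sum_singleton]
        gcongr
        exact Finset.sum_image_le_of_nonneg fun d _ => hF0 d
    _ ≤ (primSet b 1).card * (Real.log 2) +
        ∑ i ∈ Finset.range X, c * K * (4 / 3) * (((i : ℝ) + 2) * (2 / 3) ^ i) := by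
        rw [Finset.sum_sigma]
        gcongr with i hi
        · simp [hF]
        · rw [Finset.sum_product]
          calc _ ≤ ∑ l ∈ Z i, c * ((i + 2) * (1 / 2) ^ i) *
                ((l.divisors.card : ℝ) ^ (Fintype.card ι + 1) / l) :=
                Finset.sum_le_sum fun l hl =>
                  sum_primSet_block_le b (Finset.mem_filter.mp hl).2 (P i) (hP' i)
            _ ≤ c * ((i + 2) * (1 / 2) ^ i) * (K * Real.exp ((i + 1) / 4)) := by
                rw [← Finset.mul_sum]
                gcongr
                exact hKs i (Z i) fun l hl => (Finset.mem_filter.mp hl).2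
            _ ≤ c * ((i + 2) * (1 / 2) ^ i) * (K * (4 / 3) ^ (i + 1)) := by
                have : Real.exp (((i : ℝ) + 1) / 4) = Real.exp (1 / 4) ^ (i + 1) := by
                  rw [← Real.exp_nat_mul]; push_cast; ring_nf
                rw [this]
                gcongr
            _ = _ := by
                rw [show (2 / 3 : ℝ) = (1 / 2) * (4 / 3) by norm_num, mul_pow, pow_succ]; ring
    _ ≤ _ := by
        gcongr
        exact (hsum.mul_left _).sum_le_tsum _ fun i _ => by positivity

end total

section relations
variable {ι : Type} [Fintype ι]

open Classical in
theorem sum_SX_sum_divisors_le (b : Finset ι) (X : ℕ) :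
    ∑ n ∈ SX X, ∑ d ∈ n.divisors, (primSet b d).card ≤
      ∑ d ∈ Finset.Ioc 0 X, (primSet b d).card * (SX (X / d)).card := by
  have h1 : ∀ n ∈ SX X, ∑ d ∈ n.divisors, (primSet b d).card =
      ∑ d ∈ Finset.Ioc 0 X, if d ∣ n then (primSet b d).card else 0 := by
    intro n hn
    obtain ⟨hnX, hnS⟩ := mem_SX.mp hn
    rw [← Finset.sum_filter]
    refine Finset.sum_congr ?_ fun _ _ => rfl
    ext d
    rw [Nat.mem_divisors, Finset.mem_filter, Finset.mem_Ioc]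
    have hn0 := sumTwoSq_pos hnS
    exact ⟨fun h => ⟨⟨Nat.pos_of_dvd_of_pos h.1 hn0, (Nat.le_of_dvd hn0 h.1).trans hnX⟩, h.1⟩,
      fun h => ⟨h.2, hn0.ne'⟩⟩
  rw [Finset.sum_congr rfl h1, Finset.sum_comm]
  refine Finset.sum_le_sum fun d hd => ?_
  have hd0 := (Finset.mem_Ioc.mp hd).1
  rw [← Finset.sum_filter, Finset.sum_const, smul_eq_mul, mul_comm]
  rcases Finset.eq_empty_or_nonempty (primSet b d) with h | h
  · simp [h]
  refine Nat.mul_le_mul_left _ ?_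
  have hdS := mem_sumTwoSq_of_primSet hd0 h
  refine Finset.card_le_card_of_injOn (fun n => n / d) ?_ ?_
  · intro n hn
    obtain ⟨hn1, hn2⟩ := Finset.mem_filter.mp hn
    obtain ⟨hnX, hnS⟩ := mem_SX.mp hn1
    exact mem_SX.mpr ⟨Nat.div_le_div_right hnX, sumTwoSq_div_mem hnS hdS hn2⟩
  · intro n hn m hm hnm
    have h1 := (Finset.mem_filter.mp hn).2
    have h2 := (Finset.mem_filter.mp hm).2
    exact Nat.div_left_inj h1 h2 |>.mp hnm

open Classical in
theorem exists_relBound (ι : Type) [Fintype ι] {ε : ℝ} (hε : 0 < ε) : ∃ D X0 : ℕ, ∀ X, X0 ≤ X →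
    (((SX X).filter fun n => ¬ RelBound ι (latticePts n) D).card : ℝ) ≤ ε * (SX X).card := by
  obtain ⟨C, hC, X0, hX0⟩ := exists_card_SX_div_le
  choose K hK using fun b : Finset ι => exists_sum_primSet_le b
  set M : ℝ := ∑ b : Finset ι, C * K b with hM
  obtain ⟨D, hD⟩ := exists_nat_gt (M / ε)
  refine ⟨D, X0, fun X hX => ?_⟩
  have hsum : ∑ n ∈ SX X, ∑ b : Finset ι, ∑ d ∈ n.divisors, ((primSet b d).card : ℝ) ≤
      M * (SX X).card := by
    rw [Finset.sum_comm, hM, Finset.sum_mul]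
    refine Finset.sum_le_sum fun b _ => ?_
    calc ∑ n ∈ SX X, ∑ d ∈ n.divisors, ((primSet b d).card : ℝ)
        ≤ ∑ d ∈ Finset.Ioc 0 X, ((primSet b d).card : ℝ) * (SX (X / d)).card := by
          exact_mod_cast sum_SX_sum_divisors_le b X
      _ ≤ ∑ d ∈ Finset.Ioc 0 X, C * (SX X).card *
            ((primSet b d).card * (Real.log (2 * d) / d)) := by
          refine Finset.sum_le_sum fun d hd => ?_
          have := hX0 X hX d (Finset.mem_Ioc.mp hd).1
          have := mul_le_mul_of_nonneg_left this (Nat.cast_nonneg (α := ℝ) (primSet b d).card)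
          linarith
      _ ≤ C * (SX X).card * K b := by
          rw [← Finset.mul_sum]
          exact mul_le_mul_of_nonneg_left (hK b X) (by positivity)
      _ = _ := by ring
  have hbad : ∑ n ∈ (SX X).filter (fun n => ¬ RelBound ι (latticePts n) D), (D : ℝ) ≤
      M * (SX X).card := by
    have hmono : ∑ n ∈ (SX X).filter (fun n => ¬ RelBound ι (latticePts n) D),
        ∑ b : Finset ι, ∑ d ∈ n.divisors, ((primSet b d).card : ℝ) ≤
        ∑ n ∈ SX X, ∑ b : Finset ι, ∑ d ∈ n.divisors, ((primSet b d).card : ℝ) :=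
      Finset.sum_le_sum_of_subset_of_nonneg (Finset.filter_subset _ _) fun n _ _ =>
        Finset.sum_nonneg fun _ _ => Finset.sum_nonneg fun _ _ => Nat.cast_nonneg _
    refine (Finset.sum_le_sum fun n hn => ?_).trans (hmono.trans hsum)
    obtain ⟨hn1, hn2⟩ := Finset.mem_filter.mp hn
    have hn0 := sumTwoSq_pos (mem_SX.mp hn1).2
    rw [RelBound] at hn2
    push Not at hn2
    obtain ⟨b, i, hi, ξ, h⟩ := hn2
    have h1 := card_relSet_filter_le hn0 b hi ξ
    have h2 : (D : ℝ) ≤ ∑ d ∈ n.divisors, ((primSet b d).card : ℝ) := by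
      exact_mod_cast h.le.trans h1
    exact h2.trans (Finset.single_le_sum
      (f := fun b : Finset ι => ∑ d ∈ n.divisors, ((primSet b d).card : ℝ))
      (fun _ _ => Finset.sum_nonneg fun _ _ => Nat.cast_nonneg _) (Finset.mem_univ b))
  rw [Finset.sum_const, nsmul_eq_mul] at hbad
  rw [div_lt_iff₀ hε] at hD
  have h0 : (0 : ℝ) ≤ (SX X).card := Nat.cast_nonneg _
  rcases Nat.eq_zero_or_pos D with hD0 | hD0
  · subst hD0
    have hlt : M < 0 := by simpa using hD
    have : ((SX X).card : ℝ) = 0 := by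
      by_contra hne
      have : (0 : ℝ) < (SX X).card := lt_of_le_of_ne h0 (Ne.symm hne)
      nlinarith
    have h2 : (SX X).card = 0 := by exact_mod_cast this
    have h3 := Finset.card_filter_le (SX X) fun n => ¬ RelBound ι (latticePts n) 0
    rw [h2] at h3
    rw [Nat.le_zero.mp h3, this]; simp
  · have hDp : (0 : ℝ) < D := by exact_mod_cast hD0
    refine le_of_mul_le_mul_right (hbad.trans ?_) hDp
    nlinarith

theorem RelBound.mono {ι : Type} [Fintype ι] {A : Finset (ℤ × ℤ)} {D D' : ℕ} (hD : D ≤ D')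
    (h : RelBound ι A D) : RelBound ι A D' := fun b i hi ξ => (h b i hi ξ).trans hD

open Classical in
theorem card_filter_not_and_le (s : Finset ℕ) (P Q T : ℕ → Prop)
    (h : ∀ n ∈ s, P n → Q n → T n) :
    ((s.filter fun n => ¬ T n).card : ℝ) ≤
      (s.filter fun n => ¬ P n).card + (s.filter fun n => ¬ Q n).card := by
  have : (s.filter fun n => ¬ T n) ⊆ (s.filter fun n => ¬ P n) ∪ (s.filter fun n => ¬ Q n) := by
    intro n hn
    obtain ⟨h1, h2⟩ := Finset.mem_filter.mp hn
    simp only [Finset.mem_union, Finset.mem_filter]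
    by_contra hc
    push Not at hc
    exact h2 (h n h1 (hc.1 h1) (hc.2 h1))
  exact_mod_cast (Finset.card_le_card this).trans (Finset.card_union_le _ _)

/-- The set where `P` fails has upper density at most `ε` in the sums of two squares. -/
def FailsRarely (ε : ℝ) (P : ℕ → Prop) : Prop :=
  open Classical in ∃ X0 : ℕ, ∀ X, X0 ≤ X →
    (((SX X).filter fun n => ¬ P n).card : ℝ) ≤ ε * (SX X).card

theorem FailsRarely.imp {ε₁ ε₂ : ℝ} {P Q T : ℕ → Prop} (hP : FailsRarely ε₁ P)
    (hQ : FailsRarely ε₂ Q) (h : ∀ n ∈ sumTwoSq, P n → Q n → T n) : FailsRarely (ε₁ + ε₂) T := by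
  classical
  obtain ⟨X1, h1⟩ := hP
  obtain ⟨X2, h2⟩ := hQ
  refine ⟨max X1 X2, fun X hX => ?_⟩
  have := card_filter_not_and_le (SX X) P Q T fun n hn => h n (mem_SX.mp hn).2
  have a1 := h1 X ((le_max_left _ _).trans hX)
  have a2 := h2 X ((le_max_right _ _).trans hX)
  rw [add_mul]
  convert this.trans (add_le_add a1 a2) using 2

theorem FailsRarely.and {ε₁ ε₂ : ℝ} {P Q : ℕ → Prop} (hP : FailsRarely ε₁ P)
    (hQ : FailsRarely ε₂ Q) : FailsRarely (ε₁ + ε₂) fun n => P n ∧ Q n :=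
  hP.imp hQ fun _ _ h1 h2 => ⟨h1, h2⟩

theorem exists_relBound_fin (J : ℕ) : ∀ ε : ℝ, 0 < ε → ∃ D : ℕ,
    FailsRarely ε fun n => ∀ j < J, RelBound (Fin j) (latticePts n) D := by
  induction J with
  | zero => exact fun ε hε => ⟨0, 0, fun X _ => by simp; positivity⟩
  | succ J ih =>
    intro ε hε
    obtain ⟨D1, h1⟩ := ih (ε / 2) (half_pos hε)
    obtain ⟨D2, h2⟩ := exists_relBound (Fin J) (half_pos hε)
    refine ⟨max D1 D2, ?_⟩
    rw [← add_halves ε]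
    refine h1.imp (Q := fun n => RelBound (Fin J) (latticePts n) D2) h2 fun n _ a1 a2 j hj => ?_
    rcases Nat.lt_succ_iff_lt_or_eq.mp hj with h | rfl
    · exact (a1 j h).mono (le_max_left _ _)
    · exact a2.mono (le_max_right _ _)

theorem exists_sqrt_le_card_SX {ε : ℝ} (hε : 0 < ε) : ∃ X0 : ℕ, ∀ X, X0 ≤ X →
    Real.sqrt X ≤ ε * (SX X).card := by
  obtain ⟨c, hc, X1, h1⟩ := exists_card_SX_ge
  have h2 := ((isLittleO_log_rpow_atTop (r := 1 / 2) (by norm_num)).comp_tendsto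
    tendsto_natCast_atTop_atTop).bound (mul_pos hε hc)
  obtain ⟨X2, h2⟩ := eventually_atTop.mp h2
  refine ⟨max X1 (max X2 2), fun X hX => ?_⟩
  have a1 := h1 X ((le_max_left _ _).trans hX)
  have a2 := h2 X ((le_max_left _ _).trans ((le_max_right _ _).trans hX))
  have hX2 : 2 ≤ X := (le_max_right _ _).trans ((le_max_right _ _).trans hX)
  have hX0 : (1 : ℝ) < X := by exact_mod_cast hX2
  have hl : 0 < Real.log X := Real.log_pos hX0
  simp only [Function.comp, Real.norm_eq_abs] at a2
  rw [abs_of_pos hl, abs_of_nonneg (by positivity), ← Real.sqrt_eq_rpow] at a2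
  have hs : 0 < Real.sqrt X := Real.sqrt_pos.mpr (by linarith)
  have hss : Real.sqrt X * Real.sqrt X = X := Real.mul_self_sqrt (by linarith)
  have h0 : (0 : ℝ) ≤ (SX X).card := Nat.cast_nonneg _
  have h3 : c * (Real.sqrt X * Real.sqrt X) ≤ (SX X).card * (ε * c * Real.sqrt X) := by
    rw [hss]
    exact a1.trans (mul_le_mul_of_nonneg_left a2 h0)
  have h4 : (c * Real.sqrt X) * Real.sqrt X ≤ (c * Real.sqrt X) * (ε * (SX X).card) := by linarith
  exact le_of_mul_le_mul_left h4 (by positivity)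

theorem failsRarely_of_subset {ε : ℝ} {P : ℕ → Prop} (X0 : ℕ) (h : ∀ X, X0 ≤ X → ∀ B ⊆ SX X,
    (∀ n ∈ B, ¬ P n) → (B.card : ℝ) ≤ ε * (SX X).card) : FailsRarely ε P := by
  classical
  exact ⟨X0, fun X hX => h X hX _ (Finset.filter_subset _ _) fun n hn => (Finset.mem_filter.mp hn).2⟩

theorem failsRarely_ge (M : ℕ) {ε : ℝ} (hε : 0 < ε) : FailsRarely ε fun n => M ≤ n := by
  obtain ⟨X0, h0⟩ := exists_sqrt_le_card_SX hε
  refine failsRarely_of_subset (max X0 (M ^ 2)) fun X hX B _ hB => ?_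
  refine le_trans ?_ (h0 X ((le_max_left _ _).trans hX))
  have h1 : B.card ≤ M := (Finset.card_le_card (t := Finset.range M)
    fun n hn => Finset.mem_range.mpr (not_le.mp (hB n hn))).trans (Finset.card_range M).le
  refine le_trans (Nat.cast_le.mpr h1) ?_
  refine Real.le_sqrt_of_sq_le ?_
  exact_mod_cast (le_max_right _ _).trans hX

theorem sum_card_latticePts_le {X : ℕ} (hX : 0 < X) :
    ∑ n ∈ SX X, (latticePts n).card ≤ 9 * X := by
  rw [← Finset.card_sigma]
  set s : ℤ := ((Nat.sqrt X : ℕ) : ℤ) with hs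
  have h1 : ((SX X).sigma latticePts).card ≤ ((Finset.Icc (-s) s) ×ˢ (Finset.Icc (-s) s)).card := by
    refine Finset.card_le_card_of_injOn (fun x => x.2) ?_ ?_
    · rintro ⟨n, ξ⟩ hx
      obtain ⟨hn, hξ⟩ := Finset.mem_sigma.mp hx
      have h2 := mem_latticePts.mp hξ
      have h3 : (n : ℤ) ≤ X := by exact_mod_cast (mem_SX.mp hn).1
      have key : ∀ z : ℤ, z ^ 2 ≤ X → z ∈ Finset.Icc (-s) s := by
        intro z hz
        rw [Finset.mem_Icc, ← abs_le, Int.abs_eq_natAbs]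
        have : z.natAbs ≤ Nat.sqrt X := by
          rw [Nat.le_sqrt, ← pow_two]
          zify
          rwa [sq_abs]
        exact Int.ofNat_le.mpr this
      exact Finset.mem_product.mpr ⟨key _ (by nlinarith [sq_nonneg ξ.2]),
        key _ (by nlinarith [sq_nonneg ξ.1])⟩
    · rintro ⟨n, ξ⟩ hx ⟨m, η⟩ hy h
      obtain rfl : ξ = η := h
      have h2 := mem_latticePts.mp (Finset.mem_sigma.mp hx).2
      have h3 := mem_latticePts.mp (Finset.mem_sigma.mp hy).2
      obtain rfl : n = m := by exact_mod_cast h2.symm.trans h3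
      rfl
  refine h1.trans ?_
  rw [Finset.card_product, Int.card_Icc]
  have h2 : (s + 1 - -s).toNat = 2 * Nat.sqrt X + 1 := by omega
  rw [h2]
  have h3 := Nat.sqrt_le X
  have h4 : 1 ≤ Nat.sqrt X := Nat.sqrt_pos.mpr hX
  nlinarith

theorem failsRarely_card_latticePts_le {ε : ℝ} (hε : 0 < ε) :
    FailsRarely ε fun n => ((latticePts n).card : ℝ) ≤ Real.log n ^ 4 := by
  classical
  obtain ⟨c, hc, X1, h1⟩ := exists_card_SX_ge
  obtain ⟨X2, h2⟩ := exists_sqrt_le_card_SX (half_pos hε)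
  have h3 : Tendsto (fun X : ℕ => Real.log X) atTop atTop :=
    Real.tendsto_log_atTop.comp tendsto_natCast_atTop_atTop
  obtain ⟨X3, h3⟩ := eventually_atTop.mp (h3.eventually_ge_atTop (1 + 144 / c * (2 / ε)))
  refine ⟨max (max X1 X2) (max X3 1), fun X hX => ?_⟩
  have a1 := h1 X ((le_max_left _ _).trans ((le_max_left _ _).trans hX))
  have a2 := h2 X ((le_max_right _ _).trans ((le_max_left _ _).trans hX))
  have a3 := h3 X ((le_max_left _ _).trans ((le_max_right _ _).trans hX))
  have hX0 : 0 < X := (le_max_right _ _).trans ((le_max_right _ _).trans hX)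
  have hpos : 0 < 144 / c * (2 / ε) := by positivity
  set g := Real.log X with hg
  have hg1 : 1 ≤ g := by linarith
  set B := (SX X).filter fun n => ¬ ((latticePts n).card : ℝ) ≤ Real.log n ^ 4 with hB
  set B1 := B.filter fun n : ℕ => Real.sqrt X < n with hB1
  have hB2 : ((B.filter fun n : ℕ => ¬ Real.sqrt X < n).card : ℝ) ≤ Real.sqrt X := by
    have : (B.filter fun n : ℕ => ¬ Real.sqrt X < n).card ≤ (Finset.Ioc 0 (Nat.floor (Real.sqrt X))).card := by
      refine Finset.card_le_card fun n hn => ?_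
      obtain ⟨hn1, hn2⟩ := Finset.mem_filter.mp hn
      exact Finset.mem_Ioc.mpr ⟨sumTwoSq_pos (mem_SX.mp (Finset.mem_filter.mp hn1).1).2,
        Nat.le_floor (not_lt.mp hn2)⟩
    rw [Nat.card_Ioc, Nat.sub_zero] at this
    exact le_trans (by exact_mod_cast this) (Nat.floor_le (Real.sqrt_nonneg _))
  have hB3 : (B1.card : ℝ) * (g / 2) ^ 4 ≤ 9 * X := by
    have h4 : ∑ n ∈ B1, (g / 2) ^ 4 ≤ ∑ n ∈ SX X, ((latticePts n).card : ℝ) := by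
      have hmono : ∑ n ∈ B1, ((latticePts n).card : ℝ) ≤ ∑ n ∈ SX X, ((latticePts n).card : ℝ) :=
        Finset.sum_le_sum_of_subset_of_nonneg
          ((Finset.filter_subset _ _).trans (Finset.filter_subset _ _)) fun n _ _ => Nat.cast_nonneg _
      refine (Finset.sum_le_sum fun n hn => ?_).trans hmono
      obtain ⟨hn1, hn2⟩ := Finset.mem_filter.mp hn
      refine le_trans ?_ (not_le.mp (Finset.mem_filter.mp hn1).2).le
      have : g / 2 ≤ Real.log n := by
        rw [hg, ← Real.log_sqrt (Nat.cast_nonneg _)]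
        exact Real.log_le_log (Real.sqrt_pos.mpr (by exact_mod_cast hX0)) hn2.le
      gcongr
    rw [Finset.sum_const, nsmul_eq_mul] at h4
    refine h4.trans ?_
    exact_mod_cast sum_card_latticePts_le hX0
  have hcard : (B.card : ℝ) = B1.card + (B.filter fun n : ℕ => ¬ Real.sqrt X < n).card := by
    exact_mod_cast (Finset.card_filter_add_card_filter_not (s := B) fun n : ℕ => Real.sqrt X < n).symm
  have h0 : (0 : ℝ) ≤ (SX X).card := Nat.cast_nonneg _
  have h5 : (B1.card : ℝ) ≤ ε / 2 * (SX X).card := by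
    have e1 : (B1.card : ℝ) * g ^ 4 * c ≤ 144 * ((SX X).card * g) := by
      have : c * (9 * X) ≤ 9 * ((SX X).card * g) := by linarith
      have := mul_le_mul_of_nonneg_left hB3 hc.le
      nlinarith
    have e2 : 144 ≤ ε / 2 * c * g := by
      have : 144 / c * (2 / ε) ≤ g := by linarith
      calc (144 : ℝ) = ε / 2 * c * (144 / c * (2 / ε)) := by field_simp
        _ ≤ _ := by gcongr
    have e3 : g ≤ g ^ 3 := le_self_pow₀ hg1 (by norm_num)
    have e4 : 144 * ((SX X).card * g) ≤ ε / 2 * (SX X).card * (g ^ 4 * c) := by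
      calc 144 * ((SX X).card * g) ≤ ε / 2 * c * g * ((SX X).card * g) := by gcongr
        _ ≤ ε / 2 * c * g ^ 3 * ((SX X).card * g) := by gcongr
        _ = _ := by ring
    have e5 : (0 : ℝ) < g ^ 4 * c := by positivity
    refine le_of_mul_le_mul_right (a := g ^ 4 * c) ?_ e5
    linarith
  rw [hcard]
  linarith

theorem densityOne_of_failsRarely {P : ℕ → Prop} (h : ∀ ε : ℝ, 0 < ε → FailsRarely ε P) :
    DensityOne {n | n ∈ sumTwoSq ∧ P n} := by
  classical
  refine ⟨fun n hn => hn.1, ?_⟩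
  have e1 : ∀ X : ℕ, Nat.card {n : ℕ | n ∈ {n | n ∈ sumTwoSq ∧ P n} ∧ n ≤ X} =
      ((SX X).filter P).card := by
    intro X
    refine Nat.subtype_card _ fun n => ?_
    simp only [Finset.mem_filter, mem_SX, Set.mem_ofPred_eq]
    tauto
  have e2 : ∀ X : ℕ, Nat.card {n : ℕ | n ∈ sumTwoSq ∧ n ≤ X} = (SX X).card := by
    intro X
    refine Nat.subtype_card _ fun n => ?_
    simp only [mem_SX, Set.mem_ofPred_eq]
    tauto
  simp only [e1, e2]
  rw [Metric.tendsto_atTop]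
  intro ε hε
  obtain ⟨X0, hX0⟩ := h (ε / 2) (half_pos hε)
  obtain ⟨X1, hX1⟩ := exists_sqrt_le_card_SX one_pos
  refine ⟨max X0 (max X1 1), fun X hX => ?_⟩
  have a0 := hX0 X ((le_max_left _ _).trans hX)
  have a1 := hX1 X ((le_max_left _ _).trans ((le_max_right _ _).trans hX))
  have hX2 : 1 ≤ X := (le_max_right _ _).trans ((le_max_right _ _).trans hX)
  have hpos : (0 : ℝ) < (SX X).card := by
    have : 0 < Real.sqrt X := Real.sqrt_pos.mpr (by exact_mod_cast hX2)
    linarith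
  have hc : (((SX X).filter P).card : ℝ) + ((SX X).filter fun n => ¬ P n).card = (SX X).card := by
    exact_mod_cast Finset.card_filter_add_card_filter_not (s := SX X) P
  have h0 : (0 : ℝ) ≤ ((SX X).filter fun n => ¬ P n).card := Nat.cast_nonneg _
  rw [Real.dist_eq, div_sub_one hpos.ne', abs_div, abs_of_pos hpos, div_lt_iff₀ hpos, abs_lt]
  constructor <;> nlinarith

end relations

section assembly

theorem exists_scale_exponent {A : ℕ} (hA : 2 ≤ A) (C : ℕ) : ∃ C' : ℕ, 0 < C' ∧ ∀ h : ℕ, 1 ≤ h →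
    (40 * (2 ^ h : ℕ) * (A ^ ((h + 8) * 2 ^ (C * h)) : ℕ) : ℝ) ^ (2 ^ h) ≤
      Real.exp ((2 : ℝ) ^ (C' * h)) := by
  refine ⟨C + 2 + 18 * A, by omega, fun h hh => ?_⟩
  have hA1 : (1 : ℝ) ≤ A := by exact_mod_cast (by omega : 1 ≤ A)
  have hA0 : (0 : ℝ) < A := by linarith
  set x : ℝ := 40 * (2 ^ h : ℕ) * (A ^ ((h + 8) * 2 ^ (C * h)) : ℕ) with hx
  have hx0 : 0 < x := by positivity
  have hl2 : Real.log 2 ≤ 1 := by linarith [Real.log_two_lt_d9]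
  have hl40 : Real.log 40 ≤ 5 := by
    have h1 : Real.log 40 ≤ Real.log (2 ^ 6) := Real.log_le_log (by norm_num) (by norm_num)
    rw [Real.log_pow] at h1
    push_cast at h1
    linarith [Real.log_two_lt_d9]
  have hlA : Real.log A ≤ A := (Real.log_le_sub_one_of_pos hA0).trans (by linarith)
  set q : ℝ := 2 ^ (C * h) with hq
  have hq1 : 1 ≤ q := one_le_pow₀ (by norm_num)
  have hh0 : (0 : ℝ) ≤ h := Nat.cast_nonneg h
  have hlog : Real.log x ≤ 2 * ((h + 8) * q * A) := by
    have e1 : Real.log x = Real.log 40 + h * Real.log 2 + (h + 8) * q * Real.log A := by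
      rw [hx, Real.log_mul (by positivity) (by positivity), Real.log_mul (by positivity)
        (by positivity)]
      push_cast
      rw [Real.log_pow, Real.log_pow]
      push_cast
      rfl
    have e2 : (h : ℝ) * Real.log 2 ≤ h * 1 := by gcongr
    have e3 : ((h : ℝ) + 8) * q * Real.log A ≤ (h + 8) * q * A := by gcongr
    have e4 : ((h : ℝ) + 8) * 1 * 1 ≤ (h + 8) * q * A := by gcongr
    linarith
  have hh2 : (h : ℝ) + 8 ≤ 9 * 2 ^ h := by
    have a1 : (h : ℝ) ≤ 2 ^ h := by exact_mod_cast Nat.lt_two_pow_self.le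
    have a2 : (1 : ℝ) ≤ 2 ^ h := one_le_pow₀ (by norm_num)
    linarith
  have hA2 : 18 * (A : ℝ) ≤ 2 ^ (18 * A * h) := by
    have a1 : 18 * A ≤ 2 ^ (18 * A) := Nat.lt_two_pow_self.le
    have a2 : 2 ^ (18 * A) ≤ 2 ^ (18 * A * h) :=
      Nat.pow_le_pow_right (by norm_num) (Nat.le_mul_of_pos_right _ hh)
    exact_mod_cast a1.trans a2
  rw [← Real.exp_log hx0, ← Real.exp_nat_mul]
  refine Real.exp_le_exp.mpr ?_
  push_cast
  calc (2 : ℝ) ^ h * Real.log x ≤ 2 ^ h * (2 * ((9 * 2 ^ h) * q * A)) := by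
        gcongr
        refine hlog.trans ?_
        gcongr
    _ = 2 ^ h * 2 ^ h * q * (18 * A) := by ring
    _ ≤ 2 ^ h * 2 ^ h * q * 2 ^ (18 * A * h) := by gcongr
    _ = _ := by rw [hq, ← pow_add, ← pow_add, ← pow_add]; congr 1; ring

theorem card_pow_lt_exp {N lam : ℕ} (hl : 0 < lam) (hlog : 6 ≤ Real.log lam)
    (hN : (N : ℝ) ≤ Real.log lam ^ 4) {l : ℕ} (h : Real.log lam ^ 6 < l) :
    (40 * N * lam : ℝ) ^ N < Real.exp l := by
  set x := Real.log lam with hx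
  have hl0 : (0 : ℝ) < lam := by exact_mod_cast hl
  rcases Nat.eq_zero_or_pos N with rfl | hN0
  · rw [pow_zero]
    refine Real.one_lt_exp_iff.mpr (lt_of_le_of_lt ?_ h)
    positivity
  have hNp : (0 : ℝ) < N := by exact_mod_cast hN0
  have hl40 : Real.log 40 ≤ 5 := by
    have h1 : Real.log 40 ≤ Real.log (2 ^ 6) := Real.log_le_log (by norm_num) (by norm_num)
    rw [Real.log_pow] at h1
    push_cast at h1
    linarith [Real.log_two_lt_d9]
  have hlN : Real.log N ≤ 4 * (x - 1) := by
    have h1 := Real.log_le_log hNp hN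
    rw [Real.log_pow] at h1
    have h2 := Real.log_le_sub_one_of_pos (x := x) (by linarith)
    push_cast at h1
    linarith
  rw [← Real.exp_log (show (0 : ℝ) < 40 * N * lam by positivity), ← Real.exp_nat_mul]
  refine Real.exp_lt_exp.mpr (lt_of_le_of_lt ?_ h)
  rw [Real.log_mul (by positivity) hl0.ne', Real.log_mul (by norm_num) hNp.ne']
  have h3 : Real.log 40 + Real.log N + x ≤ x ^ 2 := by nlinarith
  calc (N : ℝ) * (Real.log 40 + Real.log N + x) ≤ N * x ^ 2 := by gcongr
    _ ≤ x ^ 4 * x ^ 2 := by gcongr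
    _ = x ^ 6 := by ring

theorem pow_mul_measureReal_smallSet_le {A C C2 C' : ℕ} (hA : 2 ≤ A) (hC'0 : 0 < C')
    (hC' : ∀ h : ℕ, 1 ≤ h → (40 * (2 ^ h : ℕ) * (A ^ ((h + 8) * 2 ^ (C * h)) : ℕ) : ℝ) ^ (2 ^ h) ≤
      Real.exp ((2 : ℝ) ^ (C' * h))) {R : ℝ} (hR : 1 < R) (m : ℕ) {E k : ℕ}
    (hE : E = C' + 6 * C2 + 1) (hk : k = E * m + 1) {D h0 : ℕ} (hh0 : 1 ≤ h0)
    (hD : (4 * (D : ℝ) ^ 2) ^ k ≤ 2 ^ h0) {lam : ℕ} (hl : 0 < lam)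
    (hrel : RelBound (Fin (2 * k) × Bool) (latticePts lam) D)
    (hsep : ∀ h, h0 ≤ h → (2 : ℝ) ^ (C2 * h) ≤ Real.log lam →
      SepProp lam (2 ^ h) (A ^ ((h + 8) * 2 ^ (C * h))))
    (hlog0 : (2 : ℝ) ^ (C2 * h0) ≤ Real.log lam)
    (hN : ((latticePts lam).card : ℝ) ≤ Real.log lam ^ 4) (hlog : 6 ≤ Real.log lam)
    {a : ℤ × ℤ → ℂ} {f : E2 → ℝ} (h : IsEigenfunction lam a f) (hf : IsFlat lam a)
    {l : ℕ} (hll : 2 ^ (C' * h0) ≤ l) :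
    ((l : ℝ) + 1) ^ m * μT.real (smallSet lam R f l) ≤ 2 ^ (E * m) * chaosConst (2 * k) := by
  classical
  rcases lt_or_ge (Real.log lam ^ 6) l with hbig | hsmall
  · rw [smallSet_eq_empty hl hR h (card_pow_lt_exp hl hlog hN hbig)]
    simp only [measureReal_empty, mul_zero]
    positivity
  have hl0 : l ≠ 0 := by
    have : 0 < 2 ^ (C' * h0) := by positivity
    omega
  set h1 := Nat.log 2 l / C' with hh1
  have e1 : 2 ^ (C' * h1) ≤ l :=
    (Nat.pow_le_pow_right (by norm_num) (Nat.mul_div_le _ _)).trans (Nat.pow_log_le_self 2 hl0)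
  have e2 : l + 1 ≤ 2 ^ (C' * (h1 + 1)) := by
    have := Nat.lt_pow_succ_log_self (b := 2) (by norm_num) l
    exact this.trans_le (Nat.pow_le_pow_right (by norm_num) (Nat.lt_mul_div_succ _ hC'0))
  have e3 : h0 ≤ h1 := by
    rw [hh1, Nat.le_div_iff_mul_le hC'0, mul_comm]
    exact Nat.le_log_of_pow_le (by norm_num) hll
  set P : ℕ → Prop := fun h => (2 : ℝ) ^ (C2 * h) ≤ Real.log lam with hP
  set g := Nat.findGreatest P h1 with hg
  have hPg : P g := Nat.findGreatest_spec (P := P) e3 hlog0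
  have hg0 : h0 ≤ g := Nat.le_findGreatest (P := P) e3 hlog0
  have hg1 : g ≤ h1 := Nat.findGreatest_le h1
  have hlE : (l : ℝ) + 1 ≤ 2 ^ (E * (g + 1)) := by
    rcases hg1.eq_or_lt with heq | hlt
    · rw [heq]
      have : 2 ^ (C' * (h1 + 1)) ≤ 2 ^ (E * (h1 + 1)) :=
        Nat.pow_le_pow_right (by norm_num) (Nat.mul_le_mul_right _ (by omega))
      exact_mod_cast e2.trans this
    · have hnP : ¬ P (g + 1) := Nat.findGreatest_is_greatest (Nat.lt_succ_self g) hlt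
      have hlt' : Real.log lam ≤ 2 ^ (C2 * (g + 1)) := (not_le.mp hnP).le
      have b1 : (l : ℝ) ≤ 2 ^ (6 * C2 * (g + 1)) := by
        refine hsmall.trans ?_
        calc Real.log lam ^ 6 ≤ (2 ^ (C2 * (g + 1))) ^ 6 := by gcongr
          _ = _ := by rw [← pow_mul]; congr 1; ring
      have b2 : (1 : ℝ) ≤ 2 ^ (6 * C2 * (g + 1)) := one_le_pow₀ (by norm_num)
      calc (l : ℝ) + 1 ≤ 2 ^ (6 * C2 * (g + 1) + 1) := by rw [pow_succ]; linarith
        _ ≤ _ := by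
          refine pow_le_pow_right₀ (by norm_num) ?_
          rw [hE]
          nlinarith [Nat.zero_le (C' * (g + 1)), Nat.zero_le g]
  have hμ := measureReal_smallSet_le hl hR hrel (n := 2 ^ g) (Y := A ^ ((g + 8) * 2 ^ (C * g)))
    (by positivity) (by positivity) (hsep g hg0 hPg) h hf (l := l)
    ((hC' g (hh0.trans hg0)).trans (Real.exp_le_exp.mpr (by
      have : 2 ^ (C' * g) ≤ l := (Nat.pow_le_pow_right (by norm_num)
        (Nat.mul_le_mul_left _ hg1)).trans e1
      exact_mod_cast this)))
  push_cast at hμ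
  have hDg : (4 * (D : ℝ) ^ 2) ^ k ≤ 2 ^ g := hD.trans (pow_le_pow_right₀ (by norm_num) hg0)
  have hc0 : (0 : ℝ) ≤ chaosConst (2 * k) := Nat.cast_nonneg _
  calc ((l : ℝ) + 1) ^ m * μT.real (smallSet lam R f l)
      ≤ (2 ^ (E * (g + 1))) ^ m * (chaosConst (2 * k) * (4 * (D : ℝ) ^ 2 / 2 ^ g) ^ k) := by
        gcongr
    _ ≤ (2 ^ (E * (g + 1))) ^ m * (chaosConst (2 * k) * (2 ^ g / (2 ^ g) ^ k)) := by
        rw [div_pow]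
        gcongr
    _ = _ := by
        have : ((2 : ℝ) ^ (E * (g + 1))) ^ m * (2 ^ g / (2 ^ g) ^ k) = 2 ^ (E * m) := by
          rw [← mul_div_assoc, div_eq_iff (by positivity), ← pow_mul, ← pow_mul, ← pow_add,
            ← pow_add, hk]
          congr 1; ring
        rw [← this]; ring

theorem summable_pow_mul_exp_neg (p : ℕ) :
    Summable fun l : ℕ => ((l : ℝ) + 1) ^ p * Real.exp (-(l : ℝ)) := by
  have h := (summable_nat_add_iff 1).mpr (Real.summable_pow_mul_exp_neg_nat_mul p one_pos)
  refine (h.mul_left (Real.exp 1)).congr fun l => ?_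
  push_cast
  rw [show -(1 : ℝ) * ((l : ℝ) + 1) = -(l : ℝ) - 1 by ring, Real.exp_sub]
  field_simp

theorem failsRarely_tsum_le {R : ℝ} (hR : 1 < R) (p : ℕ) : ∃ K : ℝ≥0, ∀ ε : ℝ, 0 < ε →
    FailsRarely ε fun lam => ∀ (a : ℤ × ℤ → ℂ) (f : E2 → ℝ), IsEigenfunction lam a f →
      IsFlat lam a → ∑' l : ℕ, ((l : ℝ≥0∞) + 1) ^ p * μT (smallSet lam R f l) ≤ K := by
  obtain ⟨A, C, C2, hA, hsep⟩ := exists_sepProp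
  obtain ⟨C', hC'0, hC'⟩ := exists_scale_exponent hA C
  obtain ⟨E, hE⟩ : ∃ E, E = C' + 6 * C2 + 1 := ⟨_, rfl⟩
  obtain ⟨k, hk⟩ : ∃ k, k = E * (p + 2) + 1 := ⟨_, rfl⟩
  set Kc : ℝ := 2 ^ (E * (p + 2)) * chaosConst (2 * k) with hKc
  have hKc0 : 0 ≤ Kc := by positivity
  set g : ℕ → ℝ := fun l => 12 * (((l : ℝ) + 1) ^ p * Real.exp (-(l : ℝ))) +
    Kc * (1 / ((l : ℝ) + 1) ^ 2) with hg
  have hg0 : ∀ l, 0 ≤ g l := fun l => by positivity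
  have hgs : Summable g := by
    refine ((summable_pow_mul_exp_neg p).mul_left 12).add (Summable.mul_left Kc ?_)
    have := (summable_nat_add_iff 1).mpr (Real.summable_one_div_nat_pow.mpr one_lt_two)
    exact this.congr fun l => by push_cast; rfl
  refine ⟨Real.toNNReal (∑' l, g l), fun ε hε => ?_⟩
  have hε4 : 0 < ε / 4 := by positivity
  obtain ⟨D, X1, hX1⟩ := exists_relBound (Fin (2 * k) × Bool) hε4
  obtain ⟨h1, hh1⟩ := hsep (ε / 4) hε4
  obtain ⟨hD, hhD⟩ := exists_nat_gt ((4 * (D : ℝ) ^ 2) ^ k)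
  set h0 := max (max h1 1) hD with hh0
  obtain ⟨X2, hX2⟩ := hh1 h0 ((le_max_left _ _).trans (le_max_left _ _))
  have hsepR : FailsRarely (ε / 4) fun n => ∀ h, h0 ≤ h → (2 : ℝ) ^ (C2 * h) ≤ Real.log n →
      SepProp n (2 ^ h) (A ^ ((h + 8) * 2 ^ (C * h))) := by
    refine failsRarely_of_subset X2 fun X hX B hBs hB => ?_
    classical
    refine le_trans (Nat.cast_le.mpr (Finset.card_le_card fun n hn => ?_)) (hX2 X hX)
    refine Finset.mem_filter.mpr ⟨hBs hn, ?_⟩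
    have := hB n hn
    push Not at this
    exact this
  obtain ⟨J, hJ⟩ := exists_small_ball (2 ^ (C' * h0))
  obtain ⟨D', hD'⟩ := exists_relBound_fin (J + 1) (ε / 8) (by positivity)
  obtain ⟨N0, hN0⟩ := hJ D'
  set h2 := max h0 N0 with hh2
  have hcardR := failsRarely_card_latticePts_le (ε := ε / 16) (by positivity)
  obtain ⟨M, hM⟩ := eventually_atTop.mp ((Real.tendsto_log_atTop.comp
    (tendsto_natCast_atTop_atTop (R := ℝ))).eventually_ge_atTop (max 6 ((2 : ℝ) ^ (C2 * h2))))
  have hlargeR := failsRarely_ge M (ε := ε / 16) (by positivity)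
  have hrelR : FailsRarely (ε / 4) fun n => RelBound (Fin (2 * k) × Bool) (latticePts n) D :=
    ⟨X1, hX1⟩
  have hsum : ε = ε / 4 + (ε / 4 + (ε / 8 + (ε / 16 + ε / 16))) + ε / 4 := by ring
  rw [hsum]
  refine (hrelR.and (hsepR.and (hD'.and (hcardR.and hlargeR)))).imp (Q := fun _ => True) ?_ ?_
  · exact failsRarely_of_subset 0 fun X _ B _ hB => by
      have : B = ∅ := Finset.eq_empty_of_forall_notMem fun n hn => hB n hn trivial
      rw [this, Finset.card_empty, Nat.cast_zero]
      exact mul_nonneg hε4.le (Nat.cast_nonneg _)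
  rintro lam hlam ⟨hrel, hsp, hrel', hcard, hMl⟩ - a f h hf
  have hl := sumTwoSq_pos hlam
  have hlogM : max 6 ((2 : ℝ) ^ (C2 * h2)) ≤ Real.log lam := hM lam hMl
  have hlog6 : 6 ≤ Real.log lam := (le_max_left _ _).trans hlogM
  have hlog2 : (2 : ℝ) ^ (C2 * h2) ≤ Real.log lam := (le_max_right _ _).trans hlogM
  have hlog0 : (2 : ℝ) ^ (C2 * h0) ≤ Real.log lam := le_trans
    (pow_le_pow_right₀ (by norm_num) (Nat.mul_le_mul_left _ (le_max_left _ _))) hlog2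
  have hNN : N0 ≤ (latticePts lam).card := by
    obtain ⟨T, hT, hTc, -⟩ := hsp h2 (le_max_left _ _) hlog2 (latticePts lam) subset_rfl (by omega)
    calc N0 ≤ h2 := le_max_right _ _
      _ ≤ 2 ^ h2 := Nat.lt_two_pow_self.le
      _ = T.card := hTc.symm
      _ ≤ _ := Finset.card_le_card hT
  have hDh : (4 * (D : ℝ) ^ 2) ^ k ≤ 2 ^ h0 := by
    refine hhD.le.trans ?_
    have : hD ≤ 2 ^ h0 := (le_max_right _ _).trans Nat.lt_two_pow_self.le
    exact_mod_cast this
  have hpt : ∀ l : ℕ, ((l : ℝ) + 1) ^ p * μT.real (smallSet lam R f l) ≤ g l := by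
    intro l
    rcases le_total l (2 ^ (C' * h0)) with hle | hge
    · have h3 := hN0 lam hl hNN (fun j hj => hrel' j (by omega)) R a f h hf l hle
      have h4 : 0 ≤ Kc * (1 / ((l : ℝ) + 1) ^ 2) := by positivity
      calc _ ≤ ((l : ℝ) + 1) ^ p * (12 * Real.exp (-(l : ℝ))) := by gcongr
        _ ≤ _ := by simp only [hg]; linarith
    · have h3 := pow_mul_measureReal_smallSet_le hA hC'0 hC' hR (p + 2) hE hk
        ((le_max_right _ _).trans (le_max_left _ _)) hDh hl hrel hsp hlog0 hcard hlog6 h hf hge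
      have h4 : 0 ≤ 12 * (((l : ℝ) + 1) ^ p * Real.exp (-(l : ℝ))) := by positivity
      have h5 : ((l : ℝ) + 1) ^ p * μT.real (smallSet lam R f l) ≤ Kc * (1 / ((l : ℝ) + 1) ^ 2) := by
        rw [mul_one_div, le_div_iff₀ (by positivity)]
        refine le_trans (le_of_eq ?_) h3
        ring
      simp only [hg]; linarith
  calc ∑' l : ℕ, ((l : ℝ≥0∞) + 1) ^ p * μT (smallSet lam R f l)
      ≤ ∑' l : ℕ, ENNReal.ofReal (g l) := by
        refine ENNReal.tsum_le_tsum fun l => ?_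
        refine le_trans (le_of_eq ?_) (ENNReal.ofReal_le_ofReal (hpt l))
        rw [ENNReal.ofReal_mul (by positivity), ENNReal.ofReal_pow (by positivity),
          ENNReal.ofReal_add (by positivity) zero_le_one, ENNReal.ofReal_natCast, ENNReal.ofReal_one,
          ofReal_measureReal]
    _ = _ := by rw [← ENNReal.ofReal_tsum_of_nonneg hg0 hgs]; rfl

end assembly

/-- Proposition: integrability of the nodal length: all moments of
`L(F_x)` over `𝕋²` are bounded, uniformly along a density one subsequence. -/
theorem nodal_length_moments (R : ℝ) (hR : 1 < R) (p : ℕ) (hp : 1 ≤ p) :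
    ∃ S' : Set ℕ, DensityOne S' ∧ ∃ C : ℝ, 0 < C ∧
      ∀ lam ∈ S', ∀ (a : ℤ × ℤ → ℂ) (f : E2 → ℝ),
        IsEigenfunction lam a f → IsFlat lam a →
        ∫⁻ x in Tdom, (LF lam R f x) ^ p ≤ ENNReal.ofReal C := by
  obtain ⟨K, hK⟩ := failsRarely_tsum_le hR p
  obtain ⟨C, hC, hle⟩ := lintegral_LF_pow_le hR hp K
  exact ⟨_, densityOne_of_failsRarely hK, C, hC, fun lam hlam =>
    hle lam (sumTwoSq_pos hlam.1) hlam.2⟩
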